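/- Assume R is unmixed of dimension d ≥ 2. Then R is generalized Cohen-Macaulay if and only if the set Ξ_1(R) = { e_1(q :_R m, R) : q a C-parameter ideal of R } is finite. -/

import Mathlib

/-! Preliminary definitions: lengths, dimensions, (C-)systems of parameters, Hilbert
coefficients, irreducible multiplicities, local cohomology invariants, stable values,
unmixedness, the unmixed component, and the g-invariant. -/

open CategoryTheory CategoryTheory.Limits Opposite IsLocalRing

universe u

noncomputable section

section Definitions

variable (R : Type u) [CommRing R]

/-- The length of an `R`-module, defined as the Krull dimension of its submodule lattice. -/
def moduleLength (M : Type u) [AddCommGroup M] [Module R M] : WithBot ℕ∞ :=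
  Order.krullDim (Submodule R M)

/-- The Krull dimension of an `R`-module `M`, i.e. `dim (R / Ann M)`. -/
def moduleDim (M : Type u) [AddCommGroup M] [Module R M] : WithBot ℕ∞ :=
  ringKrullDim (R ⧸ Module.annihilator R M)

/-- The colon submodule `(N :_M I) = {x : M | I • x ⊆ N}`. -/
def modColon {M : Type u} [AddCommGroup M] [Module R M] (N : Submodule R M) (I : Ideal R) :
    Submodule R M where
  carrier := {x | ∀ r ∈ I, r • x ∈ N}
  add_mem' := by
    intro a b ha hb r hr
    simpa [smul_add] using N.add_mem (ha r hr) (hb r hr)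
  zero_mem' := by
    intro r hr
    simpa using N.zero_mem
  smul_mem' := by
    intro c a ha r hr
    rw [smul_comm]
    exact N.smul_mem c (ha r hr)

/-- `x : Fin s → R` is a system of parameters of the module `M`:
`s = dim M`, the `x i` are nonunits, and `M/(x)M` has finite length. -/
def IsSOP (M : Type u) [AddCommGroup M] [Module R M] {s : ℕ} (x : Fin s → R) : Prop :=
  moduleDim R M = (s : WithBot ℕ∞) ∧ (∀ i, x i ∈ nonunits R) ∧
    IsFiniteLength R (M ⧸ (Ideal.span (Set.range x) • (⊤ : Submodule R M)))

/-- The ideal `b(M)`: the intersection, over all systems of parameters `x` of `M` and all `i`,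
of `Ann_R ((0) :_{M/(x_1,...,x_{i-1})M} x_i)`. -/
def bIdeal (M : Type u) [AddCommGroup M] [Module R M] : Ideal R :=
  ⨅ (s : ℕ) (x : Fin s → R) (_ : IsSOP R M x) (i : Fin s),
    (Submodule.torsionBy R
      (M ⧸ (Ideal.span (x '' {j | j < i}) • (⊤ : Submodule R M))) (x i)).annihilator

/-- `x` is a C-system of parameters of `M`: a system of parameters such that
`x i ∈ b(M/(x_{i+1},...,x_s)M)^3` for every `i` (for `i = s` the quotient is `M` itself). -/
def IsCSOP (M : Type u) [AddCommGroup M] [Module R M] {s : ℕ} (x : Fin s → R) : Prop :=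
  IsSOP R M x ∧ ∀ i : Fin s,
    x i ∈ (bIdeal R (M ⧸ (Ideal.span (x '' {j | i < j}) • (⊤ : Submodule R M)))) ^ 3

/-- A parameter ideal of `R`. -/
def IsParamIdeal (q : Ideal R) : Prop :=
  ∃ (s : ℕ) (x : Fin s → R), IsSOP R R x ∧ q = Ideal.span (Set.range x)

/-- A C-parameter ideal of `R`: an ideal generated by a C-system of parameters of `R`. -/
def IsCParamIdeal (q : Ideal R) : Prop :=
  ∃ (s : ℕ) (x : Fin s → R), IsCSOP R R x ∧ q = Ideal.span (Set.range x)

/-- A C-parameter ideal of a module `M`. -/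
def IsCParamIdealMod (M : Type u) [AddCommGroup M] [Module R M] (q : Ideal R) : Prop :=
  ∃ (s : ℕ) (x : Fin s → R), IsCSOP R M x ∧ q = Ideal.span (Set.range x)

/-- `e` is the family of Hilbert coefficients of `M` (of dimension `s`) with respect to `I`:
`ℓ(M/I^{n+1}M) = ∑_{i=0}^{s} (-1)^i (e i) binom(n+s-i, s-i)` for all large `n`. -/
def IsHilbCoeffMod (I : Ideal R) (M : Type u) [AddCommGroup M] [Module R M] (s : ℕ)
    (e : ℕ → ℤ) : Prop :=
  ∃ N : ℕ, ∀ n ≥ N, ∃ L : ℕ,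
    moduleLength R (M ⧸ (I ^ (n + 1) • (⊤ : Submodule R M))) = (L : WithBot ℕ∞) ∧
    (L : ℤ) = ∑ i ∈ Finset.range (s + 1),
      (-1) ^ i * e i * ((n + s - i).choose (s - i) : ℤ)

/-- `e` is the family of Hilbert coefficients of `R` (of dimension `d`) with respect to `I`;
`e 1` is the Chern number of `I`. -/
def IsHilbCoeff (I : Ideal R) (d : ℕ) (e : ℕ → ℤ) : Prop :=
  IsHilbCoeffMod R I R d e

variable [IsLocalRing R]

/-- The colon ideal `(q :_R m)`. -/
def colonIdeal (q : Ideal R) : Ideal R :=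
  modColon R q (maximalIdeal R)

/-- The index of reducibility `ir_M(q) = ℓ((qM :_M m)/qM)`. -/
def irMod (M : Type u) [AddCommGroup M] [Module R M] (q : Ideal R) : WithBot ℕ∞ :=
  moduleLength R
    ↥(Submodule.map (q • (⊤ : Submodule R M)).mkQ
      (modColon R (q • (⊤ : Submodule R M)) (maximalIdeal R)))

/-- `NN` is the stable value `𝒩(M)` of `M`: the common index of reducibility of all
C-parameter ideals of `M`. -/
def IsStableValueMod (M : Type u) [AddCommGroup M] [Module R M] (NN : ℕ) : Prop :=
  ∀ q : Ideal R, IsCParamIdealMod R M q → irMod R M q = (NN : WithBot ℕ∞)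

/-- `NN` is the stable value `𝒩(R)` of `R`. -/
def IsStableValue (NN : ℕ) : Prop :=
  ∀ q : Ideal R, IsCParamIdeal R q → irMod R R q = (NN : WithBot ℕ∞)

/-- `f` is the family of coefficients of the polynomial giving the index of reducibility,
`ir_M(I^{n+1}) = ℓ((I^{n+1}M :_M m)/I^{n+1}M) = ∑_{i=0}^{s-1} (-1)^i (f i) binom(n+s-1-i, s-1-i)`
for all large `n`; `f 0` is the irreducible multiplicity of `M` with respect to `I`. -/
def IsIrrCoeffMod (I : Ideal R) (M : Type u) [AddCommGroup M] [Module R M] (s : ℕ)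
    (f : ℕ → ℤ) : Prop :=
  ∃ N : ℕ, ∀ n ≥ N, ∃ L : ℕ,
    irMod R M (I ^ (n + 1)) = (L : WithBot ℕ∞) ∧
    (L : ℤ) = ∑ i ∈ Finset.range s,
      (-1) ^ i * f i * ((n + s - 1 - i).choose (s - 1 - i) : ℤ)

/-- Ring version of `IsIrrCoeffMod`. -/
def IsIrrCoeff (I : Ideal R) (d : ℕ) (f : ℕ → ℤ) : Prop :=
  IsIrrCoeffMod R I R d f

/-- The local cohomology module `H^i_m(M)`. -/
def Hmod (M : Type u) [AddCommGroup M] [Module R M] (i : ℕ) : ModuleCat.{u} R :=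
  (localCohomology (maximalIdeal R) i).obj (ModuleCat.of R M)

/-- `r_i(M) = ℓ((0) :_{H^i_m(M)} m)`, the length of the socle of `H^i_m(M)`. -/
def rLengthMod (M : Type u) [AddCommGroup M] [Module R M] (i : ℕ) : WithBot ℕ∞ :=
  moduleLength R ↥(Submodule.torsionBySet R ↥(Hmod R M i) ((maximalIdeal R : Ideal R) : Set R))

/-- `r_i(R)`. -/
def rLength (i : ℕ) : WithBot ℕ∞ := rLengthMod R R i

/-- `M` is a Cohen-Macaulay `R`-module: `H^i_m(M) = 0` for all `i < dim M`. -/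
def IsCMMod (M : Type u) [AddCommGroup M] [Module R M] : Prop :=
  ∀ i : ℕ, (i : WithBot ℕ∞) < moduleDim R M → Subsingleton ↥(Hmod R M i)

/-- `R` is a Cohen-Macaulay local ring: `H^i_m(R) = 0` for all `i < dim R`. -/
def IsCMLocal : Prop :=
  ∀ i : ℕ, (i : WithBot ℕ∞) < ringKrullDim R → Subsingleton ↥(Hmod R R i)

/-- `R` is a generalized Cohen-Macaulay local ring:
`H^i_m(R)` has finite length for all `i < dim R`. -/
def IsGeneralizedCM : Prop :=
  ∀ i : ℕ, (i : WithBot ℕ∞) < ringKrullDim R → IsFiniteLength R ↥(Hmod R R i)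

/-- `R` is a Gorenstein local ring: Cohen-Macaulay of type `r_d(R) = 1`, `d = dim R`. -/
def IsGorensteinLocal : Prop :=
  IsCMLocal R ∧ ∀ d : ℕ, ringKrullDim R = (d : WithBot ℕ∞) → rLength R d = (1 : WithBot ℕ∞)

/-- `R` is unmixed: `dim R̂/p = dim R̂` for every associated prime `p` of the
`m`-adic completion `R̂` of `R`. -/
def IsUnmixedRing : Prop :=
  ∀ p ∈ associatedPrimes (AdicCompletion (maximalIdeal R) R) (AdicCompletion (maximalIdeal R) R),
    ringKrullDim ((AdicCompletion (maximalIdeal R) R) ⧸ p) =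
      ringKrullDim (AdicCompletion (maximalIdeal R) R)

/-- `M` is unmixed: `dim R̂/p = dim M̂` for every associated prime `p` of the
`m`-adic completion `M̂` of `M`, viewed over `R̂`. -/
def IsUnmixedMod (M : Type u) [AddCommGroup M] [Module R M] : Prop :=
  ∀ p ∈ associatedPrimes (AdicCompletion (maximalIdeal R) R) (AdicCompletion (maximalIdeal R) M),
    ringKrullDim ((AdicCompletion (maximalIdeal R) R) ⧸ p) =
      moduleDim (AdicCompletion (maximalIdeal R) R) (AdicCompletion (maximalIdeal R) M)

/-- `H^0_m(M)`, described as the submodule of elements killed by a power of `m`. -/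
def H0Sub (M : Type u) [AddCommGroup M] [Module R M] : Submodule R M :=
  ⨆ n : ℕ, Submodule.torsionBySet R M (((maximalIdeal R) ^ n : Ideal R) : Set R)

/-- The unmixed component `u = U_R(0)` of `R`: the largest ideal of dimension `< dim R`. -/
def unmixedComponent : Ideal R := sSup {J : Ideal R | moduleDim R ↥J < ringKrullDim R}

end Definitions

section CMImage

/-- `R` is a homomorphic image of a Cohen-Macaulay (Noetherian) local ring. -/
def IsHomImageOfCM (R : Type u) [CommRing R] : Prop :=
  ∃ (A : Type u) (_ : CommRing A) (_ : IsLocalRing A) (_ : IsNoetherianRing A),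
    IsCMLocal A ∧ ∃ f : A →+* R, Function.Surjective f

end CMImage

section GInvariant

variable (R : Type u) [CommRing R] [IsLocalRing R] [IsNoetherianRing R]

/-- The canonical homomorphism from `Ext^p(R/q, R)` (the term of the directed system indexed by
the ideal `q` with `J ≤ rad q`) into the local cohomology module `H^p_J(R)`, given by the
structure of `H^p_J(R)` as an inductive limit. -/
def canonicalToLocalCohomology (J q : Ideal R) (h : J ≤ q.radical) (p : ℕ) :
    ((localCohomology.diagram (localCohomology.selfLERadicalDiagram J) p).obj
        (op (⟨q, h⟩ : localCohomology.SelfLERadical J))).obj (ModuleCat.of R R) ⟶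
      (localCohomology J p).obj (ModuleCat.of R R) :=
  haveI := localCohomology.hasColimitDiagram.{u, u} (localCohomology.selfLERadicalDiagram J) p
  (colimit.ι (localCohomology.diagram (localCohomology.selfLERadicalDiagram J) p)
      (op (⟨q, h⟩ : localCohomology.SelfLERadical J))).app (ModuleCat.of R R) ≫
    (localCohomology.isoSelfLERadical J p).hom.app (ModuleCat.of R R)

/-- A map of `R`-modules is surjective on socles. -/
def SurjectiveOnSocles {A B : ModuleCat.{u} R} (φ : A ⟶ B) : Prop :=
  ∀ y ∈ Submodule.torsionBySet R ↥B ((maximalIdeal R : Ideal R) : Set R),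
    ∃ z ∈ Submodule.torsionBySet R ↥A ((maximalIdeal R : Ideal R) : Set R), φ z = y

/-- The defining property of the g-invariant: for every system of parameters `x` of `R`
contained in `m^(n₀)` and every `p`, the canonical homomorphism into the local cohomology
module `H^p_m(R)` is surjective on the socles. -/
def GProperty (n₀ : ℕ) : Prop :=
  ∀ (s : ℕ) (x : Fin s → R), IsSOP R R x → (∀ i, x i ∈ maximalIdeal R ^ n₀) →
    ∀ (h : maximalIdeal R ≤ (Ideal.span (Set.range x)).radical) (p : ℕ),
      SurjectiveOnSocles R
        (canonicalToLocalCohomology R (maximalIdeal R) (Ideal.span (Set.range x)) h p)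

/-- The g-invariant `g(R)`: the least `n₀` satisfying `GProperty`. -/
def gInvariant : ℕ := sInf {n₀ : ℕ | GProperty R n₀}

end GInvariant

end

namespace LocCoh

set_option linter.unusedSectionVars false

section OpComplex
variable {R : Type u} [CommRing R] (K : ChainComplex (ModuleCat.{u} R)ᵒᵖ ℕ) (n : ℕ)

/-- `Rep K n` is the submodule of pairs `(f, h)` where `f` is a cocycle representing the class `h`. -/
noncomputable def Rep : Submodule R ((K.X n).unop × (K.homology n).unop) :=
  LinearMap.range ((K.pOpcycles n).unop.hom.prod (K.homologyι n).unop.hom)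

variable {K n}

theorem mem_rep {f : (K.X n).unop} {h : (K.homology n).unop} :
    (f, h) ∈ Rep K n ↔ ∃ z : (K.opcycles n).unop,
      (K.pOpcycles n).unop.hom z = f ∧ (K.homologyι n).unop.hom z = h := by
  simp [Rep, LinearMap.mem_range, Prod.ext_iff]

theorem rep_add {f f' : (K.X n).unop} {h h' : (K.homology n).unop} (H : (f, h) ∈ Rep K n)
    (H' : (f', h') ∈ Rep K n) : (f + f', h + h') ∈ Rep K n :=
  Submodule.add_mem _ H H'

theorem rep_smul (r : R) {f : (K.X n).unop} {h : (K.homology n).unop} (H : (f, h) ∈ Rep K n) :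
    (r • f, r • h) ∈ Rep K n :=
  Submodule.smul_mem _ r H

theorem rep_congr {f f' : (K.X n).unop} {h h' : (K.homology n).unop} (H : (f, h) ∈ Rep K n)
    (hf : f = f') (hh : h = h') : (f', h') ∈ Rep K n :=
  hf ▸ hh ▸ H

theorem rep_surj (h : (K.homology n).unop) : ∃ f, (f, h) ∈ Rep K n := by
  have : Function.Surjective (K.homologyι n).unop.hom :=
    (ModuleCat.epi_iff_surjective _).1 inferInstance
  obtain ⟨z, rfl⟩ := this h
  exact ⟨_, mem_rep.2 ⟨z, rfl, rfl⟩⟩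

theorem pOpcycles_inj : Function.Injective (K.pOpcycles n).unop.hom :=
  (ModuleCat.mono_iff_injective _).1 inferInstance

theorem rep_unique {f : (K.X n).unop} {h h' : (K.homology n).unop} (H : (f, h) ∈ Rep K n)
    (H' : (f, h') ∈ Rep K n) : h = h' := by
  obtain ⟨z, hz, rfl⟩ := mem_rep.1 H
  obtain ⟨z', hz', rfl⟩ := mem_rep.1 H'
  rw [pOpcycles_inj (hz.trans hz'.symm)]

theorem rep_cocycle {f : (K.X n).unop} :
    (∃ h, (f, h) ∈ Rep K n) ↔ (K.d (n + 1) n).unop.hom f = 0 := by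
  have hex : (ShortComplex.mk (K.pOpcycles n).unop (K.d (n+1) n).unop
    (by rw [← unop_comp, K.d_pOpcycles]; rfl)).Exact := by
    have := ShortComplex.exact_of_g_is_cokernel
      (ShortComplex.mk (K.d (n+1) n) (K.pOpcycles n) (K.d_pOpcycles _ _))
      (K.opcyclesIsCokernel (n+1) n (by simp))
    exact this.unop
  constructor
  · rintro ⟨h, H⟩
    obtain ⟨z, rfl, rfl⟩ := mem_rep.1 H
    exact congrArg (fun t => t.unop.hom z) (K.d_pOpcycles (n+1) n)
  · intro hf
    obtain ⟨z, hz⟩ := (ShortComplex.moduleCat_exact_iff _).1 hex f hf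
    exact ⟨_, mem_rep.2 ⟨z, hz, rfl⟩⟩

theorem rep_zero {f : (K.X (n+1)).unop} :
    (f, 0) ∈ Rep K (n+1) ↔ ∃ g, (K.d (n + 1) n).unop.hom g = f := by
  have hex : (ShortComplex.mk (K.fromOpcycles (n+1) n).unop (K.homologyι (n+1)).unop
    (by rw [← unop_comp, K.homologyι_comp_fromOpcycles]; rfl)).Exact := by
    have := ShortComplex.exact_of_f_is_kernel
      (ShortComplex.mk (K.homologyι (n+1)) (K.fromOpcycles (n+1) n)
        (K.homologyι_comp_fromOpcycles _ _))
      (K.homologyIsKernel (n+1) n (by simp))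
    exact this.unop
  have hc : ∀ g, (K.d (n + 1) n).unop.hom g
      = (K.pOpcycles (n+1)).unop.hom ((K.fromOpcycles (n+1) n).unop.hom g) := by
    intro g
    rw [← K.p_fromOpcycles (n+1) n]
    rfl
  constructor
  · intro H
    obtain ⟨z, rfl, hz⟩ := mem_rep.1 H
    obtain ⟨g, hg⟩ := (ShortComplex.moduleCat_exact_iff _).1 hex z hz
    exact ⟨g, by rw [hc]; exact congrArg _ hg⟩
  · rintro ⟨g, rfl⟩
    refine mem_rep.2 ⟨(K.fromOpcycles (n+1) n).unop.hom g, (hc g).symm, ?_⟩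
    exact congrArg (fun t => t.unop.hom g) (K.homologyι_comp_fromOpcycles (n+1) n)

theorem rep_map {L : ChainComplex (ModuleCat.{u} R)ᵒᵖ ℕ} (φ : K ⟶ L) {f : (L.X n).unop}
    {h : (L.homology n).unop} (H : (f, h) ∈ Rep L n) :
    ((φ.f n).unop.hom f, (HomologicalComplex.homologyMap φ n).unop.hom h) ∈ Rep K n := by
  obtain ⟨z, rfl, rfl⟩ := mem_rep.1 H
  refine mem_rep.2 ⟨(HomologicalComplex.opcyclesMap φ n).unop.hom z, ?_, ?_⟩
  · have := congrArg (fun t => t.unop.hom z) (HomologicalComplex.p_opcyclesMap φ n)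
    exact this
  · have := congrArg (fun t => t.unop.hom z) (HomologicalComplex.homologyι_naturality φ n)
    exact this.symm

theorem rep_inj_zero {f : (K.X 0).unop} (H : (f, 0) ∈ Rep K 0) : f = 0 := by
  obtain ⟨z, rfl, hz⟩ := mem_rep.1 H
  have : IsIso (K.homologyι 0) := by
    apply K.isIso_homologyι 0 0 (by simp)
    apply K.shape; simp
  have hi : Function.Injective (K.homologyι 0).unop.hom :=
    (ModuleCat.mono_iff_injective _).1 inferInstance
  rw [hi (hz.trans (map_zero _).symm), map_zero]

end OpComplex

theorem iso_inv_comp_of_eq {C : Type*} [Category* C] {A B A' B' : C} {i : A ≅ A'} {j : B ≅ B'}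
    {a : A ⟶ B} {m : A' ⟶ B'} (h : a = i.hom ≫ m ≫ j.inv) : i.inv ≫ a = m ≫ j.inv := by
  rw [h, Iso.inv_hom_id_assoc]

section Comparison
variable {R : Type u} [CommRing R]

/-- The contravariant Hom functor into `Y`. -/
noncomputable abbrev homTo (Y : ModuleCat.{u} R) : ModuleCat.{u} R ⥤ (ModuleCat.{u} R)ᵒᵖ :=
  ((linearYoneda R (ModuleCat.{u} R)).obj Y).rightOp

/-- The `Ext` module used in the definition of local cohomology. -/
noncomputable abbrev ExtM (X Y : ModuleCat.{u} R) (n : ℕ) : ModuleCat.{u} R :=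
  ((Ext R (ModuleCat.{u} R) n).obj (op X)).obj Y

variable {X Y : ModuleCat.{u} R} (P : ProjectiveResolution X) (n : ℕ)

/-- The complex `Hom(P, Y)`. -/
noncomputable abbrev homCx (Y : ModuleCat.{u} R) : ChainComplex (ModuleCat.{u} R)ᵒᵖ ℕ :=
  ((homTo Y).mapHomologicalComplex _).obj P.complex

/-- The class of a cocycle in a projective resolution. -/
def Cmp (f : P.complex.X n ⟶ Y) (e : ExtM X Y n) : Prop :=
  ((f, (P.isoLeftDerivedObj (homTo Y) n).inv.unop.hom e) :
    ((homCx P Y).X n).unop × ((homCx P Y).homology n).unop) ∈ Rep (homCx P Y) n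

variable {P n}

theorem iso_inv_inj : Function.Injective (P.isoLeftDerivedObj (homTo Y) n).inv.unop.hom :=
  (ModuleCat.mono_iff_injective _).1 inferInstance

theorem iso_inv_surj : Function.Surjective (P.isoLeftDerivedObj (homTo Y) n).inv.unop.hom :=
  (ModuleCat.epi_iff_surjective _).1 inferInstance

theorem cmp_surj (e : ExtM X Y n) : ∃ f : P.complex.X n ⟶ Y, Cmp P n f e :=
  rep_surj (K := homCx P Y) _

theorem cmp_unique {f : P.complex.X n ⟶ Y} {e e' : ExtM X Y n} (h : Cmp P n f e)
    (h' : Cmp P n f e') : e = e' :=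
  iso_inv_inj (rep_unique h h')

theorem cmp_cocycle {f : P.complex.X n ⟶ Y} :
    (∃ e, Cmp P n f e) ↔ P.complex.d (n + 1) n ≫ f = 0 := by
  refine Iff.trans ?_ (rep_cocycle (K := homCx P Y) (n := n) (f := f))
  constructor
  · rintro ⟨e, he⟩; exact ⟨_, he⟩
  · rintro ⟨h, hh⟩
    obtain ⟨e, rfl⟩ := iso_inv_surj h
    exact ⟨e, hh⟩

theorem cmp_add {f f' : P.complex.X n ⟶ Y} {e e' : ExtM X Y n} (h : Cmp P n f e)
    (h' : Cmp P n f' e') : Cmp P n (f + f') (e + e') :=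
  rep_congr (K := homCx P Y) (rep_add h h') rfl (map_add _ _ _).symm

theorem cmp_smul (r : R) {f : P.complex.X n ⟶ Y} {e : ExtM X Y n} (h : Cmp P n f e) :
    Cmp P n (r • f) (r • e) :=
  rep_congr (K := homCx P Y) (rep_smul r h) rfl (map_smul _ _ _).symm

theorem cmp_zero_succ {f : P.complex.X (n+1) ⟶ Y} :
    Cmp P (n+1) f 0 ↔ ∃ g, P.complex.d (n + 1) n ≫ g = f := by
  refine Iff.trans ?_ (rep_zero (K := homCx P Y) (n := n) (f := f))
  exact ⟨fun h => rep_congr (K := homCx P Y) h rfl (map_zero _),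
    fun h => rep_congr (K := homCx P Y) h rfl (map_zero _).symm⟩

theorem cmp_zero_zero {f : P.complex.X 0 ⟶ Y} (h : Cmp P 0 f 0) : f = 0 :=
  rep_inj_zero (K := homCx P Y) (rep_congr (K := homCx P Y) h rfl (map_zero _))

theorem cmp_map_right {Y' : ModuleCat.{u} R} (g : Y ⟶ Y') {f : P.complex.X n ⟶ Y}
    {e : ExtM X Y n} (h : Cmp P n f e) :
    Cmp P n (f ≫ g) ((((Ext R (ModuleCat.{u} R) n).obj (op X)).map g).hom e) := by
  let α : homTo Y' ⟶ homTo Y := NatTrans.rightOp ((linearYoneda R (ModuleCat.{u} R)).map g)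
  have key := rep_map (n := n) ((NatTrans.mapHomologicalComplex α _).app P.complex) h
  have h2 := P.leftDerived_app_eq α n
  have h3' := iso_inv_comp_of_eq h2
  have h4 := congrArg (fun t => t.unop.hom e) h3'
  exact rep_congr (K := homCx P Y') key rfl h4.symm

theorem cmp_map_left {X' : ModuleCat.{u} R} {P' : ProjectiveResolution X'} {g : X' ⟶ X}
    (φ : ProjectiveResolution.Hom P' P g) {f : P.complex.X n ⟶ Y}
    {e : ExtM X Y n} (h : Cmp P n f e) :
    Cmp P' n (φ.hom.f n ≫ f) ((((Ext R (ModuleCat.{u} R) n).map g.op).app Y).hom e) := by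
  have key := rep_map (n := n) (((homTo Y).mapHomologicalComplex _).map φ.hom) h
  have h3 := ProjectiveResolution.isoLeftDerivedObj_inv_naturality g P' P φ.hom
    φ.hom_f_zero_comp_π_f_zero (homTo Y) n
  have h4 := congrArg (fun t => t.unop.hom e) h3
  exact rep_congr (K := homCx P' Y) key rfl h4.symm

end Comparison

section Abel
variable {R : Type u} [CommRing R]

open CochainComplex HomComplex in
theorem extMk_zero_inj {X Y : ModuleCat.{u} R} (P : ProjectiveResolution X)
    (f : P.complex.X 0 ⟶ Y) (hf : P.complex.d 1 0 ≫ f = 0)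
    (h : P.extMk f 1 rfl hf = (0 : Abelian.Ext.{u} X Y 0)) : f = 0 := by
  rw [← P.extEquivCohomologyClass.apply_eq_iff_eq, P.extEquivCohomologyClass_extMk,
    P.extEquivCohomologyClass_zero, CohomologyClass.mk_eq_zero_iff,
    Cocycle.toSingleMk_mem_coboundaries_iff _ _ _ _ _ 1 (by lia)] at h
  obtain ⟨g, hg⟩ := h
  have hz : IsZero (P.cochainComplex.X 1) := by
    apply P.complex.isZero_extend_X
    intro i hi
    simp at hi
    lia
  rw [hz.eq_of_src g 0, comp_zero] at hg
  have := hg.symm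
  rwa [← cancel_epi (P.cochainComplexXIso (-(0:ℕ)) 0 rfl).hom, comp_zero]

/-- The graph of the comparison of the two versions of `Ext`. -/
def Gr {X Y : ModuleCat.{u} R} (P : ProjectiveResolution X) {n : ℕ}
    (α : Abelian.Ext.{u} X Y n) (e : ExtM X Y n) : Prop :=
  ∃ f, ∃ hf : P.complex.d (n + 1) n ≫ f = 0, P.extMk f (n + 1) rfl hf = α ∧ Cmp P n f e

variable {X Y : ModuleCat.{u} R} {P : ProjectiveResolution X} {n : ℕ}

theorem gr_left (α : Abelian.Ext.{u} X Y n) : ∃ e, Gr P α e := by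
  obtain ⟨f, hf, rfl⟩ := P.extMk_surjective α (n+1) rfl
  obtain ⟨e, he⟩ := cmp_cocycle.2 hf
  exact ⟨e, f, hf, rfl, he⟩

theorem gr_right (e : ExtM X Y n) : ∃ α, Gr P α e := by
  obtain ⟨f, hf⟩ := cmp_surj (P := P) e
  exact ⟨_, f, cmp_cocycle.1 ⟨_, hf⟩, rfl, hf⟩

theorem gr_add {α β : Abelian.Ext.{u} X Y n} {e e' : ExtM X Y n} (h : Gr P α e)
    (h' : Gr P β e') : Gr P (α + β) (e + e') := by
  obtain ⟨f, hf, rfl, h1⟩ := h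
  obtain ⟨f', hf', rfl, h1'⟩ := h'
  exact ⟨f + f', by simp [hf, hf'], (P.add_extMk _ _ _ _ _ _).symm, cmp_add h1 h1'⟩

theorem gr_map_right {Y' : ModuleCat.{u} R} (g : Y ⟶ Y') {α : Abelian.Ext.{u} X Y n}
    {e : ExtM X Y n} (h : Gr P α e) :
    Gr P (α.comp (Abelian.Ext.mk₀ g) (add_zero n))
      ((((Ext R (ModuleCat.{u} R) n).obj (op X)).map g).hom e) := by
  obtain ⟨f, hf, rfl, h1⟩ := h
  refine ⟨f ≫ g, by rw [← Category.assoc, hf, zero_comp], ?_, cmp_map_right g h1⟩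
  rw [P.extMk_comp_mk₀]

theorem gr_map_left {X' : ModuleCat.{u} R} {P' : ProjectiveResolution X'} {g : X' ⟶ X}
    (φ : ProjectiveResolution.Hom P' P g) {α : Abelian.Ext.{u} X Y n}
    {e : ExtM X Y n} (h : Gr P α e) :
    Gr P' ((Abelian.Ext.mk₀ g).comp α (zero_add n))
      ((((Ext R (ModuleCat.{u} R) n).map g.op).app Y).hom e) := by
  obtain ⟨f, hf, rfl, h1⟩ := h
  have hd : P'.complex.d (n+1) n ≫ φ.hom.f n ≫ f = 0 := by
    rw [← φ.hom.comm_assoc, hf, comp_zero]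
  exact ⟨φ.hom.f n ≫ f, hd, (P.mk₀_comp_extMk f (n+1) rfl hf φ).symm, cmp_map_left φ h1⟩

theorem gr_smul (r : R) {α : Abelian.Ext.{u} X Y n} {e : ExtM X Y n} (h : Gr P α e) :
    Gr P (r • α) (r • e) := by
  obtain ⟨f, hf, rfl, h1⟩ := h
  refine ⟨r • f, by rw [Linear.comp_smul, hf, smul_zero], ?_, cmp_smul r h1⟩
  rw [Abelian.Ext.smul_eq_comp_mk₀, P.extMk_comp_mk₀]
  congr 1

theorem gr_zero_iff {α : Abelian.Ext.{u} X Y n} {e : ExtM X Y n} (h : Gr P α e) :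
    α = 0 ↔ e = 0 := by
  obtain ⟨f, hf, rfl, h1⟩ := h
  cases n with
  | zero =>
    constructor
    · intro h
      have := extMk_zero_inj P f hf h
      subst this
      have h2 := cmp_smul (0 : R) h1
      rw [zero_smul, zero_smul] at h2
      exact cmp_unique h1 h2
    · rintro rfl
      have := cmp_zero_zero h1
      subst this
      exact P.extMk_zero _ _
  | succ n =>
    rw [P.extMk_eq_zero_iff f (n+2) rfl hf n rfl, ← cmp_zero_succ (P := P)]
    constructor
    · intro h; exact cmp_unique h1 h
    · rintro rfl; exact h1

theorem gr_unique_right {α : Abelian.Ext.{u} X Y n} {e e' : ExtM X Y n} (h : Gr P α e)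
    (h' : Gr P α e') : e = e' := by
  have := gr_add h (gr_smul (-1 : R) h')
  have := (gr_zero_iff this).1 (by simp)
  simpa [← sub_eq_add_neg, sub_eq_zero] using this

/-- The comparison map from the derived-category `Ext` to the left-derived-functor `Ext`. -/
noncomputable def cmpExt (X Y : ModuleCat.{u} R) (n : ℕ) :
    Abelian.Ext.{u} X Y n →ₗ[R] ExtM X Y n where
  toFun α := (gr_left (P := projectiveResolution X) α).choose
  map_add' α β := gr_unique_right (gr_left _).choose_spec
    (gr_add (gr_left α).choose_spec (gr_left β).choose_spec)
  map_smul' r α := gr_unique_right (gr_left _).choose_spec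
    (gr_smul r (gr_left α).choose_spec)

theorem gr_cmpExt (α : Abelian.Ext.{u} X Y n) :
    Gr (projectiveResolution X) α (cmpExt X Y n α) := (gr_left _).choose_spec

theorem cmpExt_zero_iff (α : Abelian.Ext.{u} X Y n) : cmpExt X Y n α = 0 ↔ α = 0 :=
  (gr_zero_iff (gr_cmpExt α)).symm

theorem cmpExt_surj : Function.Surjective (cmpExt X Y n) := by
  intro e
  obtain ⟨α, h⟩ := gr_right (P := projectiveResolution X) e
  exact ⟨α, gr_unique_right (gr_cmpExt α) h⟩

theorem cmpExt_map_right {Y' : ModuleCat.{u} R} (g : Y ⟶ Y') (α : Abelian.Ext.{u} X Y n) :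
    cmpExt X Y' n (α.comp (Abelian.Ext.mk₀ g) (add_zero n)) =
      (((Ext R (ModuleCat.{u} R) n).obj (op X)).map g).hom (cmpExt X Y n α) :=
  gr_unique_right (gr_cmpExt _) (gr_map_right g (gr_cmpExt α))

theorem cmpExt_map_left {X' : ModuleCat.{u} R} (g : X' ⟶ X) (α : Abelian.Ext.{u} X Y n) :
    cmpExt X' Y n ((Abelian.Ext.mk₀ g).comp α (zero_add n)) =
      (((Ext R (ModuleCat.{u} R) n).map g.op).app Y).hom (cmpExt X Y n α) := by
  let φ : ProjectiveResolution.Hom (projectiveResolution X') (projectiveResolution X) g :=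
    { hom := ProjectiveResolution.lift g _ _
      hom_f_zero_comp_π_f_zero := by
        have := congrArg (fun t => t.f 0) (ProjectiveResolution.lift_commutes g
          (projectiveResolution X') (projectiveResolution X))
        exact this }
  exact gr_unique_right (gr_cmpExt _) (gr_map_left φ (gr_cmpExt α))

end Abel

section Col
variable {R : Type u} [CommRing R] (J : Ideal R)

/-- The projection `R ⧸ J ^ t' → R ⧸ J ^ t` for `t ≤ t'`. -/
noncomputable def powProj {t t' : ℕ} (h : t ≤ t') :
    ModuleCat.of R (R ⧸ J ^ t') ⟶ ModuleCat.of R (R ⧸ J ^ t) :=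
  ModuleCat.ofHom (Submodule.mapQ _ _ LinearMap.id (Ideal.pow_le_pow_right h))

/-- The canonical map from the `t`-th term of the direct system to local cohomology. -/
noncomputable def stageLC (M : ModuleCat.{u} R) (i t : ℕ) :
    ExtM (ModuleCat.of R (R ⧸ J ^ t)) M i →ₗ[R] (localCohomology J i).obj M :=
  ((colimit.ι (localCohomology.diagram (localCohomology.idealPowersDiagram J) i)
    (op (op t))).app M).hom

/-- The map from `Ext` to local cohomology. -/
noncomputable def toLC (M : ModuleCat.{u} R) (i t : ℕ) :
    Abelian.Ext.{u} (ModuleCat.of R (R ⧸ J ^ t)) M i →ₗ[R] (localCohomology J i).obj M :=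
  (stageLC J M i t).comp (cmpExt (ModuleCat.of R (R ⧸ J ^ t)) M i)

variable {J} {M : ModuleCat.{u} R} {i : ℕ}

theorem stageLC_surj (x : (localCohomology J i).obj M) : ∃ t e, stageLC J M i t e = x := by
  let F := localCohomology.diagram (localCohomology.idealPowersDiagram J) i
  have hc := isColimitOfPreserves ((evaluation (ModuleCat.{u} R) (ModuleCat.{u} R)).obj M)
    (colimit.isColimit F)
  have : PreservesFilteredColimitsOfSize.{0, 0} (forget (ModuleCat.{u} R)) :=
    preservesFilteredColimitsOfSize_shrink.{0, u, 0, u} _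
  obtain ⟨j, y, hy⟩ := Concrete.isColimit_exists_rep _ hc x
  exact ⟨unop (unop j), y, hy⟩

theorem stageLC_eq_zero {t : ℕ} {e : ExtM (ModuleCat.of R (R ⧸ J ^ t)) M i}
    (h : stageLC J M i t e = 0) :
    ∃ (t' : ℕ) (h : t ≤ t'),
      (((Ext R (ModuleCat.{u} R) i).map (powProj J h).op).app M).hom e = 0 := by
  let F := localCohomology.diagram (localCohomology.idealPowersDiagram J) i
  have hc := isColimitOfPreserves ((evaluation (ModuleCat.{u} R) (ModuleCat.{u} R)).obj M)
    (colimit.isColimit F)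
  have : PreservesFilteredColimitsOfSize.{0, 0} (forget (ModuleCat.{u} R)) :=
    preservesFilteredColimitsOfSize_shrink.{0, u, 0, u} _
  let e' : ↑((F ⋙ (evaluation (ModuleCat.{u} R) (ModuleCat.{u} R)).obj M).obj (op (op t))) := e
  have h0 : ((((evaluation (ModuleCat.{u} R) (ModuleCat.{u} R)).obj M).mapCocone
      (colimit.cocone F)).ι.app (op (op t))).hom e' =
    ((((evaluation (ModuleCat.{u} R) (ModuleCat.{u} R)).obj M).mapCocone
      (colimit.cocone F)).ι.app (op (op t))).hom 0 := by
    rw [map_zero]; exact h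
  obtain ⟨k, f, g, hfg⟩ := Concrete.isColimit_exists_of_rep_eq _ hc _ _ h0
  have hk : t ≤ unop (unop k) := leOfHom f.unop.unop
  refine ⟨unop (unop k), hk, ?_⟩
  exact hfg.trans (map_zero ((F ⋙ (evaluation (ModuleCat.{u} R) (ModuleCat.{u} R)).obj M).map g).hom)

theorem stageLC_trans {t t' : ℕ} (h : t ≤ t') (e : ExtM (ModuleCat.of R (R ⧸ J ^ t)) M i) :
    stageLC J M i t' ((((Ext R (ModuleCat.{u} R) i).map (powProj J h).op).app M).hom e) =
      stageLC J M i t e := by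
  let F := localCohomology.diagram (localCohomology.idealPowersDiagram J) i
  have := colimit.w F (homOfLE h).op.op
  exact congrArg (fun f => (f.app M).hom e) this

theorem stageLC_map {M' : ModuleCat.{u} R} (g : M ⟶ M') {t : ℕ}
    (e : ExtM (ModuleCat.of R (R ⧸ J ^ t)) M i) :
    ((localCohomology J i).map g).hom (stageLC J M i t e) =
      stageLC J M' i t ((((Ext R (ModuleCat.{u} R) i).obj _).map g).hom e) := by
  let F := localCohomology.diagram (localCohomology.idealPowersDiagram J) i
  have := (colimit.ι F (op (op t))).naturality g
  exact (congrArg (fun f => f.hom e) this).symm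

theorem toLC_surj (x : (localCohomology J i).obj M) : ∃ t α, toLC J M i t α = x := by
  obtain ⟨t, e, rfl⟩ := stageLC_surj x
  obtain ⟨α, rfl⟩ := cmpExt_surj e
  exact ⟨t, α, rfl⟩

theorem toLC_trans {t t' : ℕ} (h : t ≤ t')
    (α : Abelian.Ext.{u} (ModuleCat.of R (R ⧸ J ^ t)) M i) :
    toLC J M i t' ((Abelian.Ext.mk₀ (powProj J h)).comp α (zero_add i)) = toLC J M i t α := by
  simp only [toLC, LinearMap.comp_apply]
  rw [cmpExt_map_left, stageLC_trans]

theorem toLC_eq_zero {t : ℕ} {α : Abelian.Ext.{u} (ModuleCat.of R (R ⧸ J ^ t)) M i}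
    (h : toLC J M i t α = 0) :
    ∃ (t' : ℕ) (h : t ≤ t'), (Abelian.Ext.mk₀ (powProj J h)).comp α (zero_add i) = 0 := by
  obtain ⟨t', h', h0⟩ := stageLC_eq_zero h
  exact ⟨t', h', by rw [← cmpExt_zero_iff, cmpExt_map_left, h0]⟩

theorem toLC_map {M' : ModuleCat.{u} R} (g : M ⟶ M') {t : ℕ}
    (α : Abelian.Ext.{u} (ModuleCat.of R (R ⧸ J ^ t)) M i) :
    ((localCohomology J i).map g).hom (toLC J M i t α) =
      toLC J M' i t (α.comp (Abelian.Ext.mk₀ g) (add_zero i)) := by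
  simp only [toLC, LinearMap.comp_apply]
  rw [cmpExt_map_right, stageLC_map]

end Col

section Van
variable {R : Type u} [CommRing R]

theorem ext_comp_eq_zero_of_kerSES {F L F' L' : Type u} [AddCommGroup F] [Module R F]
    [AddCommGroup L] [Module R L] [AddCommGroup F'] [Module R F'] [AddCommGroup L'] [Module R L']
    {f : F →ₗ[R] L} (hf : Function.Surjective f) {f' : F' →ₗ[R] L'}
    (hf' : Function.Surjective f') (g : F' →ₗ[R] F) (h : L' →ₗ[R] L)
    (comm : ∀ x, h (f' x) = f (g x)) {K : ModuleCat.{u} R} {i : ℕ}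
    (β : Abelian.Ext.{u} (ModuleCat.of R (LinearMap.ker f)) K i) (W : Submodule R (LinearMap.ker f))
    (hβ : (Abelian.Ext.mk₀ (ModuleCat.ofHom W.subtype)).comp β (zero_add i) = 0)
    (hW : ∀ x, f' x = 0 → ∃ w ∈ W, (w : F) = g x) :
    (Abelian.Ext.mk₀ (ModuleCat.ofHom h)).comp
      ((LinearMap.shortExact_shortComplexKer hf).extClass.comp β (add_comm 1 i)) (zero_add _) = 0 := by
  let τ₁ : LinearMap.ker f' →ₗ[R] LinearMap.ker f := g.restrict (by
    intro x hx
    rw [LinearMap.mem_ker] at *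
    rw [← comm, hx, map_zero])
  let φ : f'.shortComplexKer ⟶ f.shortComplexKer :=
    { τ₁ := ModuleCat.ofHom τ₁
      τ₂ := ModuleCat.ofHom g
      τ₃ := ModuleCat.ofHom h
      comm₁₂ := rfl
      comm₂₃ := by
        ext x
        exact (comm x).symm }
  have hnat := ShortComplex.ShortExact.extClass_naturality
    (LinearMap.shortExact_shortComplexKer hf') (LinearMap.shortExact_shortComplexKer hf) φ
  let σ : LinearMap.ker f' →ₗ[R] W := τ₁.codRestrict W (by
    intro x
    obtain ⟨w, hw, e⟩ := hW x.1 x.2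
    have : τ₁ x = w := Subtype.ext e.symm
    rw [this]; exact hw)
  have hτ : φ.τ₁ = ModuleCat.ofHom σ ≫ ModuleCat.ofHom W.subtype := rfl
  have h1 : (Abelian.Ext.mk₀ φ.τ₁).comp β (zero_add i) = 0 := by
    rw [hτ, ← Abelian.Ext.mk₀_comp_mk₀_assoc, hβ, Abelian.Ext.comp_zero]
  have h2 : (Abelian.Ext.mk₀ φ.τ₃).comp
      ((LinearMap.shortExact_shortComplexKer hf).extClass.comp β (add_comm 1 i)) (zero_add _) = 0 := by
    rw [← Abelian.Ext.comp_assoc _ _ _ (zero_add 1) _ (by lia), ← hnat,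
      Abelian.Ext.comp_assoc_of_second_deg_zero, h1, Abelian.Ext.comp_zero]
  exact h2

variable [IsNoetherianRing R] (J : Ideal R)

theorem exists_ext_restrict_eq_zero {K : Type u} [AddCommGroup K] [Module R K] {N : ℕ}
    (hK : ∀ a ∈ J ^ N, ∀ k : K, a • k = 0) (i : ℕ) :
    ∀ (L : Type u) [AddCommGroup L] [Module R L] [Module.Finite R L]
      (α : Abelian.Ext.{u} (ModuleCat.of R L) (ModuleCat.of R K) i),
      ∃ u : ℕ, (Abelian.Ext.mk₀ (ModuleCat.ofHom (J ^ u • (⊤ : Submodule R L)).subtype)).comp α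
        (zero_add i) = 0 := by
  induction i with
  | zero =>
    intro L _ _ _ α
    obtain ⟨f, rfl⟩ : ∃ f, α = Abelian.Ext.mk₀ f := ⟨_, (Abelian.Ext.mk₀_homEquiv₀_apply α).symm⟩
    refine ⟨N, ?_⟩
    rw [Abelian.Ext.mk₀_comp_mk₀]
    have : ModuleCat.ofHom (J ^ N • (⊤ : Submodule R L)).subtype ≫ f = 0 := by
      ext x
      obtain ⟨x, hx⟩ := x
      change f.hom x = 0
      refine Submodule.smul_induction_on hx ?_ ?_
      · intro a ha y _
        rw [map_smul]; exact hK a ha _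
      · intro x y hx hy
        rw [map_add, hx, hy, add_zero]
    rw [this, Abelian.Ext.mk₀_zero]
  | succ i ih =>
    intro L _ _ _ α
    obtain ⟨F, _, _, _, _, f, hf⟩ := Module.exists_finite_presentation R L
    obtain ⟨β, rfl⟩ := precomp_extClass_surjective_of_projective_X₂ (ModuleCat.of R K)
      (LinearMap.shortExact_shortComplexKer hf) i α
    obtain ⟨u, hu⟩ := ih (LinearMap.ker f) β
    obtain ⟨k, hk⟩ := Ideal.exists_pow_inf_eq_pow_smul J (LinearMap.ker f)
    refine ⟨u + k, ?_⟩
    let G : Submodule R F := J ^ (u + k) • ⊤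
    have hG : ∀ x ∈ G, f x ∈ J ^ (u + k) • (⊤ : Submodule R L) := by
      intro x hx
      have : f x ∈ G.map f := ⟨x, hx, rfl⟩
      rw [Submodule.map_smul''] at this
      exact Submodule.smul_mono le_rfl le_top this
    let f' : G →ₗ[R] (J ^ (u + k) • (⊤ : Submodule R L) : Submodule R L) := f.restrict hG
    have hf' : Function.Surjective f' := by
      rintro ⟨y, hy⟩
      have : (J ^ (u + k) • (⊤ : Submodule R L) : Submodule R L) = G.map f := by
        rw [Submodule.map_smul'', Submodule.map_top, LinearMap.range_eq_top.2 hf]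
      rw [this] at hy
      obtain ⟨x, hx, rfl⟩ := hy
      exact ⟨⟨x, hx⟩, rfl⟩
    refine ext_comp_eq_zero_of_kerSES hf hf' G.subtype (Submodule.subtype _) (fun x => rfl) β _ hu ?_
    intro x hx
    have hx0 : f x.1 = 0 := congrArg Subtype.val hx
    have : x.1 ∈ J ^ (u + k) • (⊤ : Submodule R F) ⊓ LinearMap.ker f := ⟨x.2, hx0⟩
    rw [hk (u + k) (by omega), Nat.add_sub_cancel] at this
    have h3 : x.1 ∈ J ^ u • LinearMap.ker f := Submodule.smul_mono le_rfl inf_le_right this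
    have h4 : (J ^ u • (⊤ : Submodule R (LinearMap.ker f))).map (LinearMap.ker f).subtype =
        J ^ u • LinearMap.ker f := by
      rw [Submodule.map_smul'', Submodule.map_top, Submodule.range_subtype]
    rw [← h4] at h3
    exact h3

theorem subsingleton_localCohomology_of_torsion {K : Type u} [AddCommGroup K] [Module R K] {N : ℕ}
    (hK : ∀ a ∈ J ^ N, ∀ k : K, a • k = 0) (i : ℕ) (x : (localCohomology J (i + 1)).obj
      (ModuleCat.of R K)) : x = 0 := by
  obtain ⟨t, α, rfl⟩ := toLC_surj x
  have hf : Function.Surjective (J ^ t).mkQ := Submodule.mkQ_surjective _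
  obtain ⟨β, rfl⟩ := precomp_extClass_surjective_of_projective_X₂ (ModuleCat.of R K)
      (LinearMap.shortExact_shortComplexKer hf) i α
  obtain ⟨u, hu⟩ := exists_ext_restrict_eq_zero J hK i (LinearMap.ker (J ^ t).mkQ) β
  rw [← toLC_trans (Nat.le_add_left t u)]
  rw [← map_zero (toLC J (ModuleCat.of R K) (i + 1) (u + t))]
  congr 1
  refine ext_comp_eq_zero_of_kerSES hf (f' := (J ^ (u + t)).mkQ) (Submodule.mkQ_surjective _)
    LinearMap.id _ (fun x => rfl) β _ hu ?_
  intro x hx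
  have hx0 : x ∈ J ^ (u + t) := Ideal.Quotient.eq_zero_iff_mem.1 hx
  have h4 : (J ^ u • (⊤ : Submodule R (LinearMap.ker (J ^ t).mkQ))).map
      (LinearMap.ker (J ^ t).mkQ).subtype = J ^ u • J ^ t := by
    rw [Submodule.map_smul'', Submodule.map_top, Submodule.range_subtype, Submodule.ker_mkQ]
  rw [pow_add] at hx0
  change x ∈ J ^ u • J ^ t at hx0
  rw [← h4] at hx0
  exact hx0

end Van

section LES
variable {R : Type u} [CommRing R] {J : Ideal R}

theorem exists_toLC_lift {M : ModuleCat.{u} R} {i : ℕ} {Z : Type*} [AddCommGroup Z] [Module R Z]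
    (φ : ∀ t, Abelian.Ext.{u} (ModuleCat.of R (R ⧸ J ^ t)) M i →ₗ[R] Z)
    (hφ : ∀ t t' (h : t ≤ t') α,
      φ t' ((Abelian.Ext.mk₀ (powProj J h)).comp α (zero_add i)) = φ t α) :
    ∃ Φ : (localCohomology J i).obj M →ₗ[R] Z, ∀ t α, Φ (toLC J M i t α) = φ t α := by
  have key0 : ∀ t α, toLC J M i t α = 0 → φ t α = 0 := by
    intro t α h
    obtain ⟨t', h', h0⟩ := toLC_eq_zero h
    rw [← hφ t t' h', h0, map_zero]
  have key : ∀ t α t' α', toLC J M i t α = toLC J M i t' α' → φ t α = φ t' α' := by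
    intro t α t' α' h
    rw [← toLC_trans (le_max_left t t'), ← toLC_trans (le_max_right t t'), ← sub_eq_zero,
      ← map_sub] at h
    have := key0 _ _ h
    rwa [map_sub, sub_eq_zero, hφ, hφ] at this
  choose s r hr using fun x : (localCohomology J i).obj M => toLC_surj x
  refine ⟨{ toFun := fun x => φ (s x) (r x), map_add' := ?_, map_smul' := ?_ }, ?_⟩
  · intro x y
    rw [← hφ _ _ (le_max_left (s x) (s y)), ← hφ _ _ (le_max_right (s x) (s y)), ← map_add]
    apply key
    rw [hr, map_add, toLC_trans, toLC_trans, hr, hr]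
  · intro a x
    rw [RingHom.id_apply, ← map_smul]
    apply key
    rw [hr, map_smul, hr]
  · intro t α
    exact key _ _ _ _ (hr _)

variable (J) in
/-- Local cohomology of a module. -/
abbrev LCo (M : Type u) [AddCommGroup M] [Module R M] (i : ℕ) : Type u :=
  (localCohomology J i).obj (ModuleCat.of R M)

variable {M N P : Type u} [AddCommGroup M] [Module R M] [AddCommGroup N] [Module R N]
  [AddCommGroup P] [Module R P] {i : ℕ}

variable (J) in
/-- The map induced on local cohomology. -/
noncomputable def lcMap (g : M →ₗ[R] N) (i : ℕ) : LCo J M i →ₗ[R] LCo J N i :=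
  ((localCohomology J i).map (ModuleCat.ofHom g)).hom

theorem lcMap_toLC (g : M →ₗ[R] N) (t : ℕ) (α) :
    lcMap J g i (toLC J _ i t α) = toLC J (ModuleCat.of R N) i t
      (α.comp (Abelian.Ext.mk₀ (ModuleCat.ofHom g)) (add_zero i)) := toLC_map _ _

theorem lcMap_comp (f : M →ₗ[R] N) (g : N →ₗ[R] P) (x : LCo J M i) :
    lcMap J (g ∘ₗ f) i x = lcMap J g i (lcMap J f i x) := by
  have := (localCohomology J i).map_comp (ModuleCat.ofHom f) (ModuleCat.ofHom g)
  exact congrArg (fun f => f.hom x) this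

theorem lcMap_smul_id (a : R) (x : LCo J M i) : lcMap J (a • (LinearMap.id : M →ₗ[R] M)) i x = a • x := by
  obtain ⟨t, α, rfl⟩ := toLC_surj x
  rw [lcMap_toLC, ← map_smul, Abelian.Ext.smul_eq_comp_mk₀]
  rfl

theorem exists_pow_smul_lc_eq_zero (x : LCo J M i) : ∃ t, ∀ a ∈ J ^ t, a • x = 0 := by
  obtain ⟨t, α, rfl⟩ := toLC_surj x
  refine ⟨t, fun a ha => ?_⟩
  have h0 : a • 𝟙 (ModuleCat.of R (R ⧸ J ^ t)) = 0 := by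
    ext
    change a • (Submodule.Quotient.mk (1 : R) : R ⧸ J ^ t) = 0
    exact (Submodule.Quotient.mk_eq_zero _).2 (Ideal.mul_mem_right _ _ ha)
  have : a • α = (a • Abelian.Ext.mk₀ (𝟙 _)).comp α (zero_add i) := by
    rw [Abelian.Ext.smul_comp, Abelian.Ext.mk₀_id_comp]
  rw [← map_smul, this, ← Abelian.Ext.mk₀_smul, h0, Abelian.Ext.mk₀_zero, Abelian.Ext.zero_comp,
    map_zero]

theorem exists_lcDelta {f : M →ₗ[R] N} {g : N →ₗ[R] P} (hf : Function.Injective f)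
    (hg : Function.Surjective g) (hfg : Function.Exact f g) (i : ℕ) :
    ∃ δ : LCo J P i →ₗ[R] LCo J M (i + 1),
      (∀ x, δ x = 0 ↔ ∃ y, lcMap J g i y = x) ∧ (∀ x, lcMap J f (i + 1) x = 0 ↔ ∃ y, δ y = x) ∧
      (∀ j x, lcMap J g j x = 0 ↔ ∃ y, lcMap J f j y = x) := by
  have hgf : g ∘ₗ f = 0 := by
    ext x; exact hfg.apply_apply_eq_zero x
  let S := ModuleCat.shortComplexOfCompEqZero f g hgf
  have hS : S.ShortExact := ModuleCat.shortComplex_shortExact S hfg hf hg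
  obtain ⟨δ, hδ⟩ := exists_toLC_lift (J := J) (M := ModuleCat.of R P) (i := i)
    (Z := LCo J M (i + 1))
    (fun t => (toLC J (ModuleCat.of R M) (i + 1) t).comp
      (hS.extClass.postcompOfLinear R (ModuleCat.of R (R ⧸ J ^ t)) rfl))
    (by
      intro t t' h α
      change toLC J (ModuleCat.of R M) (i + 1) t' (Abelian.Ext.comp _ hS.extClass rfl) =
        toLC J (ModuleCat.of R M) (i + 1) t (Abelian.Ext.comp α hS.extClass rfl)
      rw [← toLC_trans h, Abelian.Ext.comp_assoc _ _ _ (zero_add i) rfl (by lia)])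
  have hδ' : ∀ t α, δ (toLC J (ModuleCat.of R P) i t α) =
    toLC J (ModuleCat.of R M) (i + 1) t (Abelian.Ext.comp α hS.extClass rfl) := hδ
  have e1 : Abelian.Ext.mk₀ (ModuleCat.ofHom g) = Abelian.Ext.mk₀ S.g := rfl
  have e2 : Abelian.Ext.mk₀ (ModuleCat.ofHom f) = Abelian.Ext.mk₀ S.f := rfl
  refine ⟨δ, ?_, ?_, ?_⟩
  · intro x
    constructor
    · intro hx
      obtain ⟨t, α, rfl⟩ := toLC_surj x
      rw [hδ'] at hx
      obtain ⟨t', h', h0⟩ := toLC_eq_zero hx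
      rw [← Abelian.Ext.comp_assoc _ _ _ (zero_add i) rfl (by lia)] at h0
      obtain ⟨y, hy⟩ := Abelian.Ext.covariant_sequence_exact₃ _ hS _ rfl h0
      exact ⟨toLC J (ModuleCat.of R N) i t' y, by rw [lcMap_toLC, ← toLC_trans h', ← hy]⟩
    · rintro ⟨y, rfl⟩
      obtain ⟨t, α, rfl⟩ := toLC_surj y
      rw [lcMap_toLC, hδ', Abelian.Ext.comp_assoc _ _ _ (add_zero i) (zero_add 1) (by lia), e1,
        hS.comp_extClass, Abelian.Ext.comp_zero, map_zero]
  · intro x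
    constructor
    · intro hx
      obtain ⟨t, α, rfl⟩ := toLC_surj x
      rw [lcMap_toLC] at hx
      obtain ⟨t', h', h0⟩ := toLC_eq_zero hx
      rw [← Abelian.Ext.comp_assoc _ _ _ (zero_add _) (add_zero _) (by lia)] at h0
      obtain ⟨y, hy⟩ := Abelian.Ext.covariant_sequence_exact₁ _ hS _ h0 rfl
      exact ⟨toLC J (ModuleCat.of R P) i t' y, by rw [hδ', hy, toLC_trans]⟩
    · rintro ⟨y, rfl⟩
      obtain ⟨t, α, rfl⟩ := toLC_surj y
      rw [hδ', lcMap_toLC, Abelian.Ext.comp_assoc _ _ _ rfl (add_zero 1) (by lia), e2,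
        hS.extClass_comp, Abelian.Ext.comp_zero, map_zero]
  · intro j x
    constructor
    · intro hx
      obtain ⟨t, α, rfl⟩ := toLC_surj x
      rw [lcMap_toLC] at hx
      obtain ⟨t', h', h0⟩ := toLC_eq_zero hx
      rw [← Abelian.Ext.comp_assoc _ _ _ (zero_add _) (add_zero _) (by lia)] at h0
      obtain ⟨y, hy⟩ := Abelian.Ext.covariant_sequence_exact₂ _ hS _ h0
      refine ⟨toLC J (ModuleCat.of R M) j t' y, ?_⟩
      rw [← toLC_trans h', ← hy, lcMap_toLC]
    · rintro ⟨y, rfl⟩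
      rw [← lcMap_comp, hgf]
      have := lcMap_smul_id (J := J) (i := j) (M := M) (0 : R) y
      have h2 : (0 : M →ₗ[R] P) = (0 : M →ₗ[R] P) ∘ₗ ((0 : R) • (LinearMap.id : M →ₗ[R] M)) := by
        simp
      rw [h2, lcMap_comp, this, zero_smul, map_zero]

theorem exists_eq_mk₀_ofHom {t : ℕ} (α : Abelian.Ext.{u} (ModuleCat.of R (R ⧸ J ^ t))
    (ModuleCat.of R M) 0) :
    ∃ f : (R ⧸ J ^ t) →ₗ[R] M, α = Abelian.Ext.mk₀ (ModuleCat.ofHom f) :=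
  ⟨(Abelian.Ext.homEquiv₀ α).hom, (Abelian.Ext.mk₀_homEquiv₀_apply α).symm⟩

theorem exists_lcGamma (J : Ideal R) (M : Type u) [AddCommGroup M] [Module R M] :
    ∃ γ : LCo J M 0 →ₗ[R] M, ∀ t (f : (R ⧸ J ^ t) →ₗ[R] M),
      γ (toLC J _ 0 t (Abelian.Ext.mk₀ (ModuleCat.ofHom f))) = f (Submodule.Quotient.mk 1) := by
  let ev : ∀ t, Abelian.Ext.{u} (ModuleCat.of R (R ⧸ J ^ t)) (ModuleCat.of R M) 0 →ₗ[R] M :=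
    fun t => (LinearMap.applyₗ (Submodule.Quotient.mk (p := J ^ t) (1 : R))).comp
      (((ModuleCat.homLinearEquiv (R := R) (S := R) (M := ModuleCat.of R (R ⧸ J ^ t))
        (N := ModuleCat.of R M)).toLinearMap).comp
        (Abelian.Ext.linearEquiv₀ (R := R)).toLinearMap)
  have hev : ∀ t (f : (R ⧸ J ^ t) →ₗ[R] M), ev t (Abelian.Ext.mk₀ (ModuleCat.ofHom f)) =
      f (Submodule.Quotient.mk 1) := by
    intro t f
    have : (Abelian.Ext.linearEquiv₀ (R := R) (Abelian.Ext.mk₀ (ModuleCat.ofHom f))) =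
      ModuleCat.ofHom f := by
      apply (Abelian.Ext.linearEquiv₀ (R := R)).symm.injective
      rw [LinearEquiv.symm_apply_apply]; rfl
    change ((Abelian.Ext.linearEquiv₀ (R := R) (Abelian.Ext.mk₀ (ModuleCat.ofHom f)))).hom _ = _
    rw [this]; rfl
  obtain ⟨γ, hγ⟩ := exists_toLC_lift ev (by
    intro t t' h α
    obtain ⟨f, rfl⟩ := exists_eq_mk₀_ofHom α
    rw [Abelian.Ext.mk₀_comp_mk₀, hev]
    exact hev t' (f ∘ₗ Submodule.mapQ _ _ LinearMap.id (Ideal.pow_le_pow_right h)))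
  exact ⟨γ, fun t f => by rw [hγ, hev]⟩

variable (J M) in
/-- The comparison of `H⁰` with the torsion submodule. -/
noncomputable def lcGamma : LCo J M 0 →ₗ[R] M := (exists_lcGamma J M).choose

theorem lcGamma_toLC (t : ℕ) (f : (R ⧸ J ^ t) →ₗ[R] M) :
    lcGamma J M (toLC J _ 0 t (Abelian.Ext.mk₀ (ModuleCat.ofHom f))) = f (Submodule.Quotient.mk 1) :=
  (exists_lcGamma J M).choose_spec t f

theorem lcGamma_injective : Function.Injective (lcGamma J M) := by
  rw [injective_iff_map_eq_zero]
  intro x hx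
  obtain ⟨t, α, rfl⟩ := toLC_surj x
  obtain ⟨f, rfl⟩ := exists_eq_mk₀_ofHom α
  rw [lcGamma_toLC] at hx
  have : f = 0 := by
    ext
    exact hx
  rw [this, ModuleCat.ofHom_zero, Abelian.Ext.mk₀_zero, map_zero]

theorem exists_lcGamma_eq_iff (m : M) :
    (∃ x, lcGamma J M x = m) ↔ ∃ t, ∀ a ∈ J ^ t, a • m = 0 := by
  constructor
  · rintro ⟨x, rfl⟩
    obtain ⟨t, ht⟩ := exists_pow_smul_lc_eq_zero x
    exact ⟨t, fun a ha => by rw [← map_smul, ht a ha, map_zero]⟩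
  · rintro ⟨t, ht⟩
    let f : (R ⧸ J ^ t) →ₗ[R] M := (J ^ t).liftQ (LinearMap.toSpanSingleton R M m)
      (fun a ha => ht a ha)
    refine ⟨toLC J _ 0 t (Abelian.Ext.mk₀ (ModuleCat.ofHom f)), ?_⟩
    rw [lcGamma_toLC]
    change (1 : R) • m = m
    exact one_smul _ _

end LES

section LESx
variable {R : Type u} [CommRing R] [IsNoetherianRing R] {J : Ideal R}
variable {M : Type u} [AddCommGroup M] [Module R M]

theorem lcMap_bijective_of_torsion_ker {N : Type u} [AddCommGroup N] [Module R N] {f : M →ₗ[R] N}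
    (hf : Function.Surjective f) {n : ℕ} (hn : ∀ a ∈ J ^ n, ∀ m, f m = 0 → a • m = 0) (i : ℕ) :
    Function.Bijective (lcMap J f (i + 1)) := by
  have hn' : ∀ a ∈ J ^ n, ∀ k : LinearMap.ker f, a • k = 0 := fun a ha k =>
    Subtype.ext (hn a ha k.1 k.2)
  have hex : Function.Exact (LinearMap.ker f).subtype f := LinearMap.exact_subtype_ker_map f
  obtain ⟨δ, h1, h2, h3⟩ := exists_lcDelta (J := J) (Submodule.injective_subtype _) hf hex (i + 1)
  constructor
  · rw [injective_iff_map_eq_zero]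
    intro x hx
    obtain ⟨y, rfl⟩ := (h3 _ _).1 hx
    rw [subsingleton_localCohomology_of_torsion J hn' i y, map_zero]
  · intro x
    exact (h1 x).1 (subsingleton_localCohomology_of_torsion J hn' _ _)

/-- The long exact sequence of multiplication by `x` when `0 :_M x` is torsion. -/
theorem exists_lcDelta_smul (x : R) {n : ℕ} (hn : ∀ a ∈ J ^ n, ∀ m : M, x • m = 0 → a • m = 0)
    {C : Type u} [AddCommGroup C] [Module R C] {π : M →ₗ[R] C} (hπ : Function.Surjective π)
    (hx : ∀ m, π m = 0 ↔ ∃ m', x • m' = m) (i : ℕ) :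
    ∃ δ : LCo J C i →ₗ[R] LCo J M (i + 1),
      (∀ y, δ y = 0 ↔ ∃ z, lcMap J π i z = y) ∧ (∀ y, x • y = 0 ↔ ∃ z, δ z = y) := by
  let μ : M →ₗ[R] M := x • LinearMap.id
  have hμr : Function.Surjective μ.rangeRestrict := μ.surjective_rangeRestrict
  have hb := lcMap_bijective_of_torsion_ker (J := J) hμr (n := n) (by
    intro a ha m hm
    exact hn a ha m (congrArg Subtype.val hm)) i
  have hex : Function.Exact (LinearMap.range μ).subtype π := by
    intro m
    rw [hx]
    simp only [Submodule.coe_subtype, Subtype.range_coe_subtype, SetLike.setOfPred_mem_eq]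
    exact Iff.rfl
  obtain ⟨δ, h1, h2, h3⟩ := exists_lcDelta (J := J) (Submodule.injective_subtype _) hπ hex i
  let e := LinearEquiv.ofBijective _ hb
  have hcomp : ∀ y, lcMap J (LinearMap.range μ).subtype (i + 1) (e y) = x • y := by
    intro y
    rw [← lcMap_smul_id]
    exact (lcMap_comp _ _ _).symm
  refine ⟨e.symm.toLinearMap ∘ₗ δ, ?_, ?_⟩
  · intro y
    rw [← h1, LinearMap.comp_apply, LinearEquiv.coe_coe, LinearEquiv.map_eq_zero_iff]
  · intro y
    rw [← hcomp, h2]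
    simp only [LinearMap.comp_apply, LinearEquiv.coe_coe, LinearEquiv.symm_apply_eq]

end LESx

section FilterRegular
variable {R : Type u} [CommRing R] [IsNoetherianRing R]

theorem exists_eq_colon_of_isAssociatedPrime {M : Type u} [AddCommGroup M] [Module R M] {P : Ideal R}
    (hP : IsAssociatedPrime P M) : ∃ v : M, v ≠ 0 ∧ ∀ a, a ∈ P ↔ a • v = 0 := by
  obtain ⟨h1, v, rfl⟩ := isAssociatedPrime_iff.1 hP
  refine ⟨v, ?_, fun a => by simp [Submodule.mem_colon_singleton]⟩
  rintro rfl
  exact h1.ne_top (by simp)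

variable [IsLocalRing R]

theorem exists_pow_smul_eq_zero_of_associatedPrimes {M : Type u} [AddCommGroup M] [Module R M]
    (v : M) (h : ∀ P, IsAssociatedPrime P M → (∀ a : R, a • v = 0 → a ∈ P) → P = maximalIdeal R) :
    ∃ t, ∀ a ∈ maximalIdeal R ^ t, a • v = 0 := by
  have h1 : maximalIdeal R ≤ ((⊥ : Submodule R M).colon {v}).radical := by
    rw [← Ideal.sInf_minimalPrimes]
    refine le_sInf fun P hP => ?_
    obtain ⟨w, hw⟩ := Submodule.exists_eq_colon_of_mem_minimalPrimes hP
    rw [h P (isAssociatedPrime_iff.2 ⟨hP.1.1, w, hw⟩) fun a ha => hP.1.2 (by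
      simpa [Submodule.mem_colon_singleton] using ha)]
  obtain ⟨t, ht⟩ := Ideal.exists_pow_le_of_le_radical_of_fg h1 (IsNoetherian.noetherian _)
  exact ⟨t, fun a ha => by simpa [Submodule.mem_colon_singleton] using ht ha⟩

theorem exists_pow_smul_of_avoids {M : Type u} [AddCommGroup M] [Module R M] {x : R}
    (hx : ∀ P, IsAssociatedPrime P M → x ∈ P → P = maximalIdeal R) {v : M} (hv : x • v = 0) :
    ∃ t, ∀ a ∈ maximalIdeal R ^ t, a • v = 0 :=
  exists_pow_smul_eq_zero_of_associatedPrimes v fun P hP h => hx P hP (h x hv)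

/-- If each element of a finite submodule is torsion then the torsion is uniformly bounded. -/
theorem exists_pow_smul_uniform {M : Type u} [AddCommGroup M] [Module R M] [Module.Finite R M]
    {J : Ideal R} (N : Submodule R M) (h : ∀ v ∈ N, ∃ t, ∀ a ∈ J ^ t, a • v = 0) :
    ∃ t, ∀ a ∈ J ^ t, ∀ v ∈ N, a • v = 0 := by
  obtain ⟨S, hS⟩ := IsNoetherian.noetherian N
  have hSN : ∀ v ∈ S, v ∈ N := fun v hv => hS ▸ Submodule.subset_span hv
  choose! t ht using fun v (hv : v ∈ S) => h v (hSN v hv)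
  refine ⟨S.sup t, fun a ha v hv => ?_⟩
  rw [← hS] at hv
  induction hv using Submodule.span_induction with
  | mem y hy => exact ht y hy a (Ideal.pow_le_pow_right (Finset.le_sup hy) ha)
  | zero => simp
  | add y z _ _ h1 h2 => rw [smul_add, h1, h2, add_zero]
  | smul b y _ h1 => rw [smul_comm, h1, smul_zero]

theorem exists_mem_avoiding {M : Type u} [AddCommGroup M] [Module R M] [Module.Finite R M] :
    ∃ x ∈ maximalIdeal R, ∀ P, IsAssociatedPrime P M → x ∈ P → P = maximalIdeal R := by
  have hfin := associatedPrimes.finite R M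
  by_contra! hcon
  have h1 : (maximalIdeal R : Set R) ⊆
      ⋃ P ∈ (associatedPrimes R M \ {maximalIdeal R} : Set (Ideal R)), (P : Set R) := by
    intro x hx
    obtain ⟨P, hP, hxP, hne⟩ := hcon x hx
    simp only [Set.mem_iUnion]
    exact ⟨P, ⟨hP, hne⟩, hxP⟩
  have h2 := (Ideal.subset_union_prime_finite (R := R) (hfin.subset Set.sdiff_subset)
    (f := fun P => P) (maximalIdeal R) (maximalIdeal R)
    (fun P hP _ _ => IsAssociatedPrime.isPrime hP.1)).1 h1
  obtain ⟨P, hP, hle⟩ := h2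
  exact hP.2 (((maximalIdeal.isMaximal R).eq_of_le hP.1.isPrime.ne_top hle).symm)

theorem succ_le_ringKrullDim_quotient {P P' : Ideal R} (hP : P.IsPrime) {x : R} (hle : P ≤ P') (hx : x ∈ P') (hxP : x ∉ P) {k : ℕ}
    (hk : (k : WithBot ℕ∞) ≤ ringKrullDim (R ⧸ P')) :
    ((k + 1 : ℕ) : WithBot ℕ∞) ≤ ringKrullDim (R ⧸ P) := by
  have h := ringKrullDim_succ_le_of_surjective (Ideal.Quotient.factor hle)
    (Ideal.Quotient.factor_surjective hle) (r := Ideal.Quotient.mk P x)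
    (mem_nonZeroDivisors_of_ne_zero (by rwa [Ne, Ideal.Quotient.eq_zero_iff_mem]))
    (by simpa [Ideal.Quotient.eq_zero_iff_mem] using hx)
  refine le_trans ?_ h
  push_cast
  gcongr

theorem one_le_ringKrullDim_quotient {P : Ideal R} (hP : P.IsPrime) (h : P ≠ maximalIdeal R) :
    ((1 : ℕ) : WithBot ℕ∞) ≤ ringKrullDim (R ⧸ P) := by
  have hle := le_maximalIdeal hP.ne_top
  obtain ⟨x, hx, hxP⟩ := SetLike.exists_of_lt (lt_of_le_of_ne hle h)
  refine succ_le_ringKrullDim_quotient (k := 0) hP hle hx hxP ?_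
  exact_mod_cast ringKrullDim_nonneg_of_nontrivial

end FilterRegular

open scoped Pointwise

section LCKilled
variable {R : Type u} [CommRing R] [IsNoetherianRing R]

theorem lc_killed_quotient {J : Ideal R} {M C : Type u} [AddCommGroup M] [Module R M] [AddCommGroup C]
    [Module R C] (x : R) {n : ℕ} (hn : ∀ a ∈ J ^ n, ∀ m : M, x • m = 0 → a • m = 0)
    {π : M →ₗ[R] C} (hπ : Function.Surjective π) (hx : ∀ m, π m = 0 ↔ ∃ m', x • m' = m)
    {i s t : ℕ} (hs : ∀ a ∈ J ^ s, ∀ y : LCo J M i, a • y = 0)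
    (ht : ∀ a ∈ J ^ t, ∀ y : LCo J M (i + 1), a • y = 0) :
    ∀ a ∈ J ^ (s + t), ∀ y : LCo J C i, a • y = 0 := by
  obtain ⟨δ, h1, -⟩ := exists_lcDelta_smul x hn hπ hx i
  intro a ha y
  rw [pow_add] at ha
  induction ha using Submodule.mul_induction_on' with
  | mem_mul_mem b hb c hc =>
    obtain ⟨z, hz⟩ := (h1 (c • y)).1 (by rw [map_smul, ht c hc])
    rw [mul_smul, ← hz, ← map_smul, hs b hb, map_zero]
  | add b _ c _ hb hc => rw [add_smul, hb, hc, add_zero]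

omit [IsNoetherianRing R] in
theorem torsion_killed_of_lc_zero {J : Ideal R} {M : Type u} [AddCommGroup M] [Module R M] {t : ℕ}
    (ht : ∀ a ∈ J ^ t, ∀ y : LCo J M 0, a • y = 0) {v : M} {s : ℕ} (hv : ∀ a ∈ J ^ s, a • v = 0) :
    ∀ a ∈ J ^ t, a • v = 0 := by
  obtain ⟨w, rfl⟩ := (exists_lcGamma_eq_iff (J := J) v).2 ⟨s, hv⟩
  intro a ha
  rw [← map_smul, ht a ha, map_zero]

variable [IsLocalRing R]

/-- The first `k` local cohomology modules are killed by powers of the maximal ideal. -/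
def LCKilled (M : Type u) [AddCommGroup M] [Module R M] (k : ℕ) : Prop :=
  ∀ i < k, ∃ t, ∀ a ∈ maximalIdeal R ^ t, ∀ y : LCo (maximalIdeal R) M i, a • y = 0

theorem LCKilled.quotient {M C : Type u} [AddCommGroup M] [Module R M] [AddCommGroup C]
    [Module R C] {k : ℕ} (h : LCKilled (R := R) M (k + 1)) (x : R) {n : ℕ}
    (hn : ∀ a ∈ maximalIdeal R ^ n, ∀ m : M, x • m = 0 → a • m = 0)
    {π : M →ₗ[R] C} (hπ : Function.Surjective π) (hx : ∀ m, π m = 0 ↔ ∃ m', x • m' = m) :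
    LCKilled (R := R) C k := by
  intro i hi
  obtain ⟨s, hs⟩ := h i (by lia)
  obtain ⟨t, ht⟩ := h (i + 1) (by lia)
  exact ⟨s + t, lc_killed_quotient x hn hπ hx hs ht⟩

omit [IsNoetherianRing R] [IsLocalRing R] in
theorem mkQ_smul_top_eq_zero_iff {M : Type u} [AddCommGroup M] [Module R M] (x : R) (m : M) :
    (x • (⊤ : Submodule R M)).mkQ m = 0 ↔ ∃ m', x • m' = m := by
  rw [Submodule.mkQ_apply, Submodule.Quotient.mk_eq_zero, Submodule.mem_smul_pointwise_iff_exists]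
  simp

theorem le_ringKrullDim_of_LCKilled (k : ℕ) : ∀ (M : Type u) [AddCommGroup M] [Module R M]
    [Module.Finite R M], LCKilled (R := R) M k → ∀ P, IsAssociatedPrime P M → P ≠ maximalIdeal R →
    (k : WithBot ℕ∞) ≤ ringKrullDim (R ⧸ P) := by
  induction k with
  | zero =>
    intro M _ _ _ _ P hP _
    have := hP.isPrime
    exact_mod_cast ringKrullDim_nonneg_of_nontrivial
  | succ k ih =>
    intro M _ _ _ hM P hP hne
    have hPp := hP.isPrime
    rcases Nat.eq_zero_or_pos k with rfl | hk
    · exact one_le_ringKrullDim_quotient hPp hne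
    obtain ⟨v, hv0, hv⟩ := exists_eq_colon_of_isAssociatedPrime hP
    obtain ⟨x, hxm, hx⟩ := exists_mem_avoiding (R := R) (M := M)
    have hxP : x ∉ P := fun h => hne (hx P hP h)
    obtain ⟨s, hs⟩ := hM 0 (by lia)
    obtain ⟨t, ht⟩ := hM 1 (by lia)
    have hxn : ∀ n, ∀ a ∈ maximalIdeal R ^ s, ∀ w : M, x ^ n • w = 0 → a • w = 0 := by
      intro n a ha w hw
      obtain ⟨r, hr⟩ := exists_pow_smul_of_avoids (x := x ^ n)
        (fun Q hQ h => hx Q hQ (hQ.isPrime.mem_of_pow_mem n h)) hw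
      exact torsion_killed_of_lc_zero hs hr a ha
    let π := fun n : ℕ => (x ^ n • (⊤ : Submodule R M)).mkQ
    have hπ : ∀ n, Function.Surjective (π n) := fun n => Submodule.mkQ_surjective _
    have hπ0 : ∀ n m, π n m = 0 ↔ ∃ m', x ^ n • m' = m := fun n m => mkQ_smul_top_eq_zero_iff _ m
    by_cases hc : ∀ n, ∃ r, ∀ a ∈ maximalIdeal R ^ r, a • π n v = 0
    · exfalso
      let N := Submodule.torsionBySet R M P
      have h1 : ∀ n, ∀ a ∈ maximalIdeal R ^ (s + t), a • v ∈ maximalIdeal R ^ n • N := by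
        intro n a ha
        obtain ⟨r, hr⟩ := hc (n + s)
        have h2 := torsion_killed_of_lc_zero (lc_killed_quotient (x ^ (n + s)) (hxn (n + s))
          (hπ (n + s)) (hπ0 (n + s)) hs ht) hr a ha
        rw [← map_smul, hπ0] at h2
        obtain ⟨w, hw⟩ := h2
        rw [← hw, pow_add, mul_smul]
        refine Submodule.smul_mem_smul (Ideal.pow_mem_pow hxm n) ?_
        rw [Submodule.mem_torsionBySet_iff]
        rintro ⟨p, hp⟩
        have h3 : x ^ (n + s) • p • w = 0 := by
          rw [smul_comm, hw, smul_comm, (hv p).1 hp, smul_zero]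
        rw [smul_comm]
        exact hxn _ _ (Ideal.pow_mem_pow hxm s) _ h3
      have h2 : ∀ a ∈ maximalIdeal R ^ (s + t), a ∈ P := by
        intro a ha
        have h3 : (⟨a • v, Submodule.mem_torsionBySet_iff _ _ |>.2 fun p => by
            rw [smul_comm, (hv p.1).1 p.2, smul_zero]⟩ : N) ∈
            (⨅ n : ℕ, maximalIdeal R ^ n • (⊤ : Submodule R N)) := by
          refine Submodule.mem_iInf _ |>.2 fun n => ?_
          have h4 := h1 n a ha
          have h5 : maximalIdeal R ^ n • N =
              (maximalIdeal R ^ n • (⊤ : Submodule R N)).map N.subtype := by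
            rw [Submodule.map_smul'', Submodule.map_top, Submodule.range_subtype]
          rw [h5] at h4
          obtain ⟨w, hw, hw'⟩ := h4
          exact (Subtype.ext hw' : w = ⟨a • v, _⟩) ▸ hw
        rw [Ideal.iInf_pow_smul_eq_bot_of_isLocalRing _ (maximalIdeal.isMaximal R).ne_top] at h3
        exact (hv a).2 (congrArg Subtype.val ((Submodule.mem_bot R).1 h3))
      exact hne (((maximalIdeal.isMaximal R).eq_of_le hPp.ne_top
        (hPp.le_of_pow_le h2)).symm)
    · push Not at hc
      obtain ⟨n, hc⟩ := hc
      have hnn := hM.quotient (x ^ n) (hxn n) (hπ n) (hπ0 n)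
      obtain ⟨P', hP', h1, h2⟩ : ∃ P', IsAssociatedPrime P' (M ⧸ (x ^ n • (⊤ : Submodule R M))) ∧
          (∀ a : R, a • π n v = 0 → a ∈ P') ∧ P' ≠ maximalIdeal R := by
        by_contra! hcon
        obtain ⟨r, hr⟩ := exists_pow_smul_eq_zero_of_associatedPrimes (π n v) hcon
        obtain ⟨a, ha, h⟩ := hc r
        exact h (hr a ha)
      have hle : P ≤ P' := fun a ha => h1 a (by rw [← map_smul, (hv a).1 ha, map_zero])
      have hxP' : x ∈ P' := hP'.isPrime.mem_of_pow_mem n (h1 _ (by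
        rw [← map_smul, hπ0]; exact ⟨v, rfl⟩))
      exact succ_le_ringKrullDim_quotient hPp hle hxP' hxP (ih _ hnn P' hP' h2)

end LCKilled

section Par
variable {R : Type u} [CommRing R]

theorem smul_mem_smul_top_iff {M : Type u} [AddCommGroup M] [Module R M] {x : R} {v : M} :
    v ∈ x • (⊤ : Submodule R M) ↔ ∃ w, x • w = v := by
  rw [Submodule.mem_smul_pointwise_iff_exists]; simp

theorem annihilator_sup_span_le_annihilator_quotSMulTop (x : R) (M : Type u) [AddCommGroup M]
    [Module R M] :
    Module.annihilator R M ⊔ Ideal.span {x} ≤ Module.annihilator R (QuotSMulTop x M) := by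
  refine sup_le (LinearMap.annihilator_le_of_surjective _ (Submodule.mkQ_surjective _)) ?_
  rw [Ideal.span_singleton_le_iff_mem, Module.mem_annihilator]
  intro m
  obtain ⟨m, rfl⟩ := Submodule.mkQ_surjective _ m
  rw [← map_smul, mkQ_smul_top_eq_zero_iff]
  exact ⟨m, rfl⟩

theorem annihilator_quotSMulTop_le_radical (x : R) (M : Type u) [AddCommGroup M]
    [Module R M] [Module.Finite R M] :
    Module.annihilator R (QuotSMulTop x M) ≤ (Module.annihilator R M ⊔ Ideal.span {x}).radical := by
  intro a ha
  obtain ⟨p, hp, -, hc, h⟩ := LinearMap.exists_monic_and_natDegree_eq_and_coeff_mem_pow_and_aeval_eq_zero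
    R (a • LinearMap.id : M →ₗ[R] M) (Ideal.span {x}) (by
      rintro _ ⟨m, rfl⟩
      rw [Module.mem_annihilator] at ha
      have := ha (Submodule.Quotient.mk m)
      rw [← Submodule.Quotient.mk_smul, Submodule.Quotient.mk_eq_zero] at this
      rwa [Submodule.ideal_span_singleton_smul])
  refine ⟨p.natDegree, ?_⟩
  have h1 : p.eval a ∈ Module.annihilator R M := by
    rw [Module.mem_annihilator]
    intro m
    have h2 : (a • LinearMap.id : M →ₗ[R] M) = algebraMap R (Module.End R M) a := by
      ext; simp [Algebra.algebraMap_eq_smul_one]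
    rw [h2, Polynomial.aeval_algebraMap_apply] at h
    have := congrArg (fun f : Module.End R M => f m) h
    simpa using this
  have h2 : a ^ p.natDegree = p.eval a - ∑ i ∈ Finset.range p.natDegree, p.coeff i * a ^ i := by
    rw [Polynomial.eval_eq_sum_range, Finset.sum_range_succ, hp.coeff_natDegree]; ring
  rw [h2]
  refine Ideal.sub_mem _ (Ideal.mem_sup_left h1) (Ideal.mem_sup_right (Ideal.sum_mem _ fun i hi => ?_))
  refine Ideal.mul_mem_right _ _ (Ideal.pow_le_self ?_ (hc i))
  have := Finset.mem_range.1 hi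
  lia

variable [IsLocalRing R]

/-- `xs` is a list of elements of the maximal ideal generating a primary ideal modulo the
annihilator of `M`. -/
def Par (xs : List R) (M : Type u) [AddCommGroup M] [Module R M] : Prop :=
  (∀ x ∈ xs, x ∈ maximalIdeal R) ∧
    ∃ n, maximalIdeal R ^ n ≤ Module.annihilator R M ⊔ Ideal.ofList xs

variable {M : Type u} [AddCommGroup M] [Module R M]

theorem Par.tail {x : R} {xs : List R} (h : Par (x :: xs) M) : Par xs (QuotSMulTop x M) := by
  obtain ⟨h1, n, hn⟩ := h
  refine ⟨fun y hy => h1 y (List.mem_cons_of_mem _ hy), n, hn.trans ?_⟩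
  rw [Ideal.ofList_cons, ← sup_assoc]
  exact sup_le_sup_right (annihilator_sup_span_le_annihilator_quotSMulTop x M) _

variable [IsNoetherianRing R]

theorem exists_pow_le_of_le_radical {I J : Ideal R} {n : ℕ} (h : J ^ n ≤ I.radical) :
    ∃ k, J ^ k ≤ I := by
  obtain ⟨k, hk⟩ := Ideal.exists_pow_le_of_le_radical_of_fg h (IsNoetherian.noetherian _)
  exact ⟨n * k, by rwa [pow_mul]⟩

theorem Par.cons [Module.Finite R M] {x : R} {xs : List R} (hx : x ∈ maximalIdeal R)
    (h : Par xs (QuotSMulTop x M)) : Par (x :: xs) M := by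
  obtain ⟨h1, n, hn⟩ := h
  refine ⟨List.forall_mem_cons.2 ⟨hx, h1⟩, exists_pow_le_of_le_radical (n := n) (hn.trans ?_)⟩
  rw [Ideal.ofList_cons, ← sup_assoc]
  refine sup_le ((annihilator_quotSMulTop_le_radical x M).trans (Ideal.radical_mono le_sup_left))
    (le_sup_right.trans Ideal.le_radical)

theorem Par.pow_head {x : R} {xs : List R} (h : Par (x :: xs) M) {k : ℕ} (hk : k ≠ 0) :
    Par (x ^ k :: xs) M := by
  obtain ⟨h1, n, hn⟩ := h
  refine ⟨?_, exists_pow_le_of_le_radical (n := n) (hn.trans ?_)⟩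
  · intro y hy
    rcases List.mem_cons.1 hy with rfl | hy
    · exact Ideal.pow_mem_of_mem _ (h1 x (by simp)) k (Nat.pos_of_ne_zero hk)
    · exact h1 y (by simp [hy])
  · rw [Ideal.ofList_cons, Ideal.ofList_cons]
    refine sup_le (le_sup_left.trans Ideal.le_radical) (sup_le ?_ ?_)
    · rw [Ideal.span_singleton_le_iff_mem]
      exact ⟨k, Ideal.mem_sup_right (Ideal.mem_sup_left (Ideal.mem_span_singleton_self _))⟩
    · exact (le_sup_right.trans le_sup_right).trans Ideal.le_radical

theorem ringKrullDim_quotient_le_of_pow_le {P : Ideal R} (hP : P.IsPrime) {xs : List R}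
    (hxs : ∀ x ∈ xs, x ∈ maximalIdeal R) {n : ℕ} (hn : maximalIdeal R ^ n ≤ P ⊔ Ideal.ofList xs) :
    ringKrullDim (R ⧸ P) ≤ xs.length := by
  let f := Ideal.Quotient.mk P
  have hf : Function.Surjective f := Ideal.Quotient.mk_surjective
  have : IsLocalRing (R ⧸ P) := .of_surjective' f hf
  have hmax : (maximalIdeal R).map f = maximalIdeal (R ⧸ P) :=
    IsLocalRing.map_maximalIdeal_of_surjective f hf
  have h1 : maximalIdeal (R ⧸ P) ^ n ≤ Ideal.ofList (xs.map f) := by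
    rw [← hmax, ← Ideal.map_pow, ← Ideal.map_ofList]
    refine (Ideal.map_mono hn).trans ?_
    rw [Ideal.map_sup, Ideal.map_quotient_self, bot_sup_eq]
  have h2 : Ideal.ofList (xs.map f) ≤ maximalIdeal (R ⧸ P) := by
    rw [← Ideal.map_ofList, ← hmax]
    exact Ideal.map_mono (Ideal.span_le.2 hxs)
  have h3 : maximalIdeal (R ⧸ P) ∈ (Ideal.ofList (xs.map f)).minimalPrimes :=
    ⟨⟨inferInstance, h2⟩, fun Q hQ _ => hQ.1.le_of_pow_le (h1.trans hQ.2)⟩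
  rw [← IsLocalRing.maximalIdeal_height_eq_ringKrullDim]
  have h4 := Ideal.height_le_card_of_mem_minimalPrimes_span
    (List.finite_toSet (xs.map f)) h3
  refine (WithBot.coe_le_coe.2 h4).trans ?_
  have h5 : {x | x ∈ xs.map f}.ncard ≤ xs.length := by
    classical
    rw [← List.coe_toFinset, Set.ncard_coe_finset]
    simpa using List.toFinset_card_le (xs.map f)
  exact_mod_cast h5

theorem Par.eq_maximalIdeal_of_mem {x : R} {xs : List R} (h : Par (x :: xs) M) [Module.Finite R M]
    (hM : LCKilled (R := R) M (xs.length + 1)) {P : Ideal R} (hP : IsAssociatedPrime P M)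
    (hx : x ∈ P) : P = maximalIdeal R := by
  by_contra hne
  have h1 := le_ringKrullDim_of_LCKilled _ M hM P hP hne
  obtain ⟨h2, n, hn⟩ := h
  have h3 : maximalIdeal R ^ n ≤ P ⊔ Ideal.ofList xs := by
    have h4 : Module.annihilator R M ⊔ Ideal.span {x} ≤ P :=
      sup_le (Submodule.annihilator_top (R := R) (M := M) ▸ IsAssociatedPrime.annihilator_le hP) ((Ideal.span_singleton_le_iff_mem P).2 hx)
    rw [Ideal.ofList_cons, ← sup_assoc] at hn
    exact hn.trans (sup_le_sup_right h4 _)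
  have h4 := h1.trans (ringKrullDim_quotient_le_of_pow_le hP.isPrime
    (fun y hy => h2 y (List.mem_cons_of_mem _ hy)) h3)
  norm_cast at h4
  lia

theorem isWeaklyRegular_of_lc_eq_zero (xs : List R) : ∀ (M : Type u) [AddCommGroup M] [Module R M]
    [Module.Finite R M], (∀ i < xs.length, ∀ y : LCo (maximalIdeal R) M i, y = 0) → Par xs M →
    RingTheory.Sequence.IsWeaklyRegular M xs := by
  induction xs with
  | nil => intros; exact .nil _ _
  | cons x xs ih =>
    intro M _ _ _ hM hpar
    have hk : LCKilled (R := R) M (xs.length + 1) := fun i hi => ⟨0, fun a _ y => by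
      rw [hM i (by simpa using hi) y, smul_zero]⟩
    have h0 : ∀ a ∈ maximalIdeal R ^ 0, ∀ v : M, x • v = 0 → a • v = 0 := by
      intro a ha v hv
      obtain ⟨t, ht⟩ := exists_pow_smul_of_avoids (fun P hP h => hpar.eq_maximalIdeal_of_mem hk hP h) hv
      refine torsion_killed_of_lc_zero (J := maximalIdeal R) (t := 0) ?_ ht a ha
      intro a _ y
      rw [hM 0 (by simp) y, smul_zero]
    refine .cons ?_ (ih _ ?_ hpar.tail)
    · rw [isSMulRegular_iff_right_eq_zero_of_smul]
      intro v hv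
      simpa using h0 1 (by simp) v hv
    · intro i hi y
      have := lc_killed_quotient (J := maximalIdeal R) x h0 (Submodule.mkQ_surjective _) (mkQ_smul_top_eq_zero_iff x)
        (i := i) (s := 0) (t := 0)
        (fun a _ y => by rw [hM i (by simp; lia) y, smul_zero])
        (fun a _ y => by rw [hM (i + 1) (by simpa using hi) y, smul_zero]) 1 (by simp) y
      simpa using this

end Par

section ColonKilled
variable {R : Type u} [CommRing R]

/-- The ideal `𝔞` kills all colon modules `((x₁,…,xᵢ)M : xᵢ₊₁) / (x₁,…,xᵢ)M`. -/
def ColonKilled (𝔞 : Ideal R) : List R → ∀ (M : Type u) [AddCommGroup M] [Module R M], Prop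
  | [], _, _, _ => True
  | x :: xs, M, _, _ => (∀ a ∈ 𝔞, ∀ v : M, x • v = 0 → a • v = 0) ∧
      ColonKilled 𝔞 xs (QuotSMulTop x M)

variable [IsNoetherianRing R] [IsLocalRing R]

theorem isFiniteLength_of_pow_smul_eq_zero {M : Type u} [AddCommGroup M] [Module R M]
    [Module.Finite R M] {t : ℕ} (ht : ∀ a ∈ maximalIdeal R ^ t, ∀ v : M, a • v = 0) :
    IsFiniteLength R M := by
  rw [isFiniteLength_iff_isNoetherian_isArtinian]
  refine ⟨inferInstance, ?_⟩
  let I := maximalIdeal R ^ t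
  have hI : Module.IsTorsionBySet R M (I : Set R) := fun v a => ht a.1 a.2 v
  let _ := hI.module
  have hA : IsArtinianRing (R ⧸ I) := by
    rw [isArtinianRing_iff_isNoetherianRing_krullDimLE_zero]
    refine ⟨inferInstance, Ring.KrullDimLE.mk₀ fun P hP => ?_⟩
    have hc : Function.Surjective (Ideal.Quotient.mk I) := Ideal.Quotient.mk_surjective
    have h2 : maximalIdeal R ≤ P.comap (Ideal.Quotient.mk I) := by
      refine (hP.comap (Ideal.Quotient.mk I)).le_of_pow_le (n := t) fun a ha => ?_
      rw [Ideal.mem_comap, Ideal.Quotient.eq_zero_iff_mem.2 ha]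
      exact P.zero_mem
    have h3 : (P.comap (Ideal.Quotient.mk I)).IsMaximal := by
      rw [← (maximalIdeal.isMaximal R).eq_of_le (hP.comap _).ne_top h2]
      infer_instance
    rw [← Ideal.map_comap_of_surjective _ hc P]
    refine Ideal.IsMaximal.map_of_surjective_of_ker_le hc ?_
    rw [Ideal.mk_ker]
    intro a ha
    rw [Ideal.mem_comap, Ideal.Quotient.eq_zero_iff_mem.2 ha]
    exact P.zero_mem
  have : IsScalarTower R (R ⧸ I) M := hI.isScalarTower
  have : Module.Finite (R ⧸ I) M := Module.Finite.of_restrictScalars_finite R _ _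
  have : IsArtinian (R ⧸ I) M := inferInstance
  exact isArtinian_of_surjective_algebraMap (R := R ⧸ I) Ideal.Quotient.mk_surjective

theorem lc_finite_of_colonKilled {t : ℕ} (i : ℕ) : ∀ (k : ℕ) (M : Type u) [AddCommGroup M] [Module R M]
    [Module.Finite R M], (∃ xs : List R, xs.length = k ∧ Par xs M) →
    (∀ xs : List R, xs.length = k → Par xs M → ColonKilled (maximalIdeal R ^ t) xs M) → i < k →
    (∀ a ∈ maximalIdeal R ^ t, ∀ y : LCo (maximalIdeal R) M i, a • y = 0) ∧
      IsFiniteLength R (LCo (maximalIdeal R) M i) := by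
  induction i with
  | zero =>
    rintro k M _ _ _ ⟨xs, rfl, hxs⟩ hM hk
    obtain ⟨x, xs, rfl⟩ := List.exists_cons_of_length_pos hk
    have h1 : ∀ a ∈ maximalIdeal R ^ t, ∀ y : LCo (maximalIdeal R) M 0, a • y = 0 := by
      intro a ha y
      obtain ⟨s, hs⟩ := exists_pow_smul_lc_eq_zero y
      have h2 := (hM (x ^ (s + 1) :: xs) rfl (hxs.pow_head (by simp))).1 a ha (lcGamma _ M y) (by
        rw [← map_smul, pow_succ, mul_comm, mul_smul, hs _ (Ideal.pow_mem_pow (hxs.1 x (by simp)) s), smul_zero, map_zero])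
      exact lcGamma_injective (by rw [map_smul, h2, map_zero])
    refine ⟨h1, ?_⟩
    have : Module.Finite R (LCo (maximalIdeal R) M 0) :=
      Module.Finite.of_injective (lcGamma _ M) (lcGamma_injective)
    exact isFiniteLength_of_pow_smul_eq_zero h1
  | succ i ih =>
    rintro k M _ _ _ ⟨xs, rfl, hxs⟩ hM hk
    obtain ⟨x, xs, rfl⟩ := List.exists_cons_of_length_pos (Nat.zero_lt_of_lt hk)
    have key : ∀ s, ∃ δ : LCo (maximalIdeal R) (QuotSMulTop (x ^ (s + 1)) M) i →ₗ[R]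
        LCo (maximalIdeal R) M (i + 1), ∀ y, x ^ (s + 1) • y = 0 ↔ ∃ z, δ z = y := by
      intro s
      have hs := hM (x ^ (s + 1) :: xs) rfl (hxs.pow_head (by simp))
      obtain ⟨δ, -, h⟩ := exists_lcDelta_smul (J := maximalIdeal R) (x ^ (s + 1)) hs.1
        (Submodule.mkQ_surjective _) (mkQ_smul_top_eq_zero_iff _) i
      exact ⟨δ, h⟩
    have IH : ∀ s, _ := fun s => ih xs.length (QuotSMulTop (x ^ (s + 1)) M)
      ⟨xs, rfl, (hxs.pow_head (by simp)).tail⟩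
      (fun ys hys hp => (hM (x ^ (s + 1) :: ys) (by simp [hys])
        (hp.cons (Ideal.pow_mem_of_mem _ (hxs.1 x (by simp)) _ (by simp)))).2)
      (by simpa using hk)
    have h1 : ∀ a ∈ maximalIdeal R ^ t, ∀ y : LCo (maximalIdeal R) M (i + 1), a • y = 0 := by
      intro a ha y
      obtain ⟨s, hs⟩ := exists_pow_smul_lc_eq_zero y
      obtain ⟨δ, h⟩ := key s
      obtain ⟨z, rfl⟩ := (h y).1 (by
        rw [pow_succ, mul_comm, mul_smul, hs _ (Ideal.pow_mem_pow (hxs.1 x (by simp)) s), smul_zero])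
      rw [← map_smul, (IH s).1 a ha, map_zero]
    refine ⟨h1, ?_⟩
    obtain ⟨δ, h⟩ := key t
    have hδ : Function.Surjective δ := fun y => (h y).1 (by
      rw [pow_succ, mul_comm, mul_smul, h1 _ (Ideal.pow_mem_pow (hxs.1 x (by simp)) t), smul_zero])
    exact (IH t).2.of_surjective hδ

end ColonKilled

section Mult
variable {R : Type u} [CommRing R]

/-- The length of a module as a natural number. -/
noncomputable def len (R : Type u) [CommRing R] (X : Type u) [AddCommGroup X] [Module R X] : ℕ :=
  (Module.length R X).toNat

theorem len_coe {X : Type u} [AddCommGroup X] [Module R X] (h : IsFiniteLength R X) :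
    (len R X : ℕ∞) = Module.length R X :=
  ENat.natCast_toNat (Module.length_ne_top_iff.2 h)

theorem len_add {X Y Z : Type u} [AddCommGroup X] [Module R X] [AddCommGroup Y] [Module R Y]
    [AddCommGroup Z] [Module R Z] {f : X →ₗ[R] Y} {g : Y →ₗ[R] Z} (hf : Function.Injective f)
    (hg : Function.Surjective g) (hfg : Function.Exact f g) (hY : IsFiniteLength R Y) :
    len R Y = len R X + len R Z := by
  have h := Module.length_eq_add_of_exact f g hf hg hfg
  rw [← len_coe hY, ← len_coe (hY.of_injective hf), ← len_coe (hY.of_surjective hg)] at h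
  exact_mod_cast h

theorem len_le_of_injective {X Y : Type u} [AddCommGroup X] [Module R X] [AddCommGroup Y]
    [Module R Y] {f : X →ₗ[R] Y} (hf : Function.Injective f) (hY : IsFiniteLength R Y) :
    len R X ≤ len R Y :=
  ENat.toNat_le_toNat (Module.length_le_of_injective f hf) (Module.length_ne_top_iff.2 hY)

theorem len_le_of_surjective {X Y : Type u} [AddCommGroup X] [Module R X] [AddCommGroup Y]
    [Module R Y] {f : X →ₗ[R] Y} (hf : Function.Surjective f) (hX : IsFiniteLength R X) :
    len R Y ≤ len R X :=
  ENat.toNat_le_toNat (Module.length_le_of_surjective f hf) (Module.length_ne_top_iff.2 hX)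

theorem len_congr {X Y : Type u} [AddCommGroup X] [Module R X] [AddCommGroup Y]
    [Module R Y] (e : X ≃ₗ[R] Y) : len R X = len R Y := by
  rw [len, len, e.length_eq]

/-- The multiplicity symbol `e(x₁, …, xₙ; X)`. -/
noncomputable def mult : List R → ∀ (X : Type u) [AddCommGroup X] [Module R X], ℤ
  | [], X, _, _ => len R X
  | x :: xs, X, _, _ => mult xs (QuotSMulTop x X) - mult xs (Submodule.torsionBy R X x)

variable [IsLocalRing R]

theorem Par.of_surjective {xs : List R} {X Y : Type u} [AddCommGroup X] [Module R X]
    [AddCommGroup Y] [Module R Y] (h : Par xs X) (f : X →ₗ[R] Y) (hf : Function.Surjective f) :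
    Par xs Y :=
  ⟨h.1, h.2.imp fun _ hn => hn.trans (sup_le_sup_right (f.annihilator_le_of_surjective hf) _)⟩

theorem Par.of_injective {xs : List R} {X Y : Type u} [AddCommGroup X] [Module R X]
    [AddCommGroup Y] [Module R Y] (h : Par xs Y) (f : X →ₗ[R] Y) (hf : Function.Injective f) :
    Par xs X :=
  ⟨h.1, h.2.imp fun _ hn => hn.trans (sup_le_sup_right (f.annihilator_le_of_injective hf) _)⟩

theorem Par.torsionBy {x : R} {xs : List R} {X : Type u} [AddCommGroup X] [Module R X]
    (h : Par (x :: xs) X) : Par xs (Submodule.torsionBy R X x) := by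
  obtain ⟨h1, n, hn⟩ := h
  refine ⟨fun y hy => h1 y (List.mem_cons_of_mem _ hy), n, hn.trans ?_⟩
  rw [Ideal.ofList_cons, ← sup_assoc]
  refine sup_le_sup_right (sup_le (LinearMap.annihilator_le_of_injective _
    (Submodule.subtype_injective _)) ?_) _
  rw [Ideal.span_singleton_le_iff_mem, Module.mem_annihilator]
  exact fun m => Subtype.ext m.2

variable [IsNoetherianRing R]

theorem Par.isFiniteLength {X : Type u} [AddCommGroup X] [Module R X] [Module.Finite R X]
    (h : Par ([] : List R) X) : IsFiniteLength R X := by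
  obtain ⟨-, n, hn⟩ := h
  rw [Ideal.ofList_nil, sup_bot_eq] at hn
  exact isFiniteLength_of_pow_smul_eq_zero fun a ha v => Module.mem_annihilator.1 (hn ha) v

theorem six_term {φ : ∀ (X : Type u) [AddCommGroup X] [Module R X], ℤ} {xs : List R}
    (hφ : ∀ (X Y Z : Type u) [AddCommGroup X] [Module R X] [AddCommGroup Y] [Module R Y]
      [Module.Finite R Y] [AddCommGroup Z] [Module R Z] (f : X →ₗ[R] Y) (g : Y →ₗ[R] Z),
      Function.Injective f → Function.Surjective g → Function.Exact f g → Par xs Y →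
      φ Y = φ X + φ Z)
    {A₁ A₂ A₃ B₁ B₂ B₃ : Type u} [AddCommGroup A₁] [Module R A₁] [AddCommGroup A₂] [Module R A₂]
    [AddCommGroup A₃] [Module R A₃] [AddCommGroup B₁] [Module R B₁] [AddCommGroup B₂]
    [Module R B₂] [AddCommGroup B₃] [Module R B₃]
    [Module.Finite R A₂] [Module.Finite R A₃] [Module.Finite R B₁] [Module.Finite R B₂]
    (a₁ : A₁ →ₗ[R] A₂) (a₂ : A₂ →ₗ[R] A₃) (δ : A₃ →ₗ[R] B₁) (b₁ : B₁ →ₗ[R] B₂)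
    (b₂ : B₂ →ₗ[R] B₃) (h₁ : Function.Injective a₁) (h₂ : Function.Exact a₁ a₂)
    (h₃ : Function.Exact a₂ δ) (h₄ : Function.Exact δ b₁) (h₅ : Function.Exact b₁ b₂)
    (h₆ : Function.Surjective b₂) (hA₂ : Par xs A₂) (hA₃ : Par xs A₃) (hB₁ : Par xs B₁)
    (hB₂ : Par xs B₂) : φ B₂ - φ A₂ = (φ B₁ - φ A₁) + (φ B₃ - φ A₃) := by
  have key : ∀ {X Y Z : Type u} [AddCommGroup X] [Module R X] [AddCommGroup Y] [Module R Y]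
      [Module.Finite R Y] [AddCommGroup Z] [Module R Z] (f : X →ₗ[R] Y) (g : Y →ₗ[R] Z),
      Function.Exact f g → Par xs Y → φ Y = φ (LinearMap.range f) + φ (LinearMap.range g) := by
    intro X Y Z _ _ _ _ _ _ _ f g hfg hY
    refine hφ _ _ _ (LinearMap.range f).subtype g.rangeRestrict (Submodule.subtype_injective _)
      g.surjective_rangeRestrict ?_ hY
    intro y
    rw [← Subtype.val_inj, LinearMap.codRestrict_apply, ZeroMemClass.coe_zero, hfg y]
    simp
  have e1 := hφ _ _ _ a₁ a₂.rangeRestrict h₁ a₂.surjective_rangeRestrict (fun y => by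
    rw [← Subtype.val_inj, LinearMap.codRestrict_apply, ZeroMemClass.coe_zero, h₂ y]) hA₂
  have e2 := key a₂ δ h₃ hA₃
  have e3 := key δ b₁ h₄ hB₁
  have e4 := hφ _ _ _ (LinearMap.range b₁).subtype b₂ (Submodule.subtype_injective _) h₆
    (fun y => by rw [h₅ y]; simp) hB₂
  lia

theorem mult_add (xs : List R) : ∀ (X Y Z : Type u) [AddCommGroup X] [Module R X] [AddCommGroup Y]
    [Module R Y] [Module.Finite R Y] [AddCommGroup Z] [Module R Z] (f : X →ₗ[R] Y)
    (g : Y →ₗ[R] Z), Function.Injective f → Function.Surjective g → Function.Exact f g →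
    Par xs Y → mult xs Y = mult xs X + mult xs Z := by
  induction xs with
  | nil =>
    intro X Y Z _ _ _ _ _ _ _ f g hf hg hfg hY
    rw [mult, mult, mult, len_add hf hg hfg hY.isFiniteLength]
    push_cast; rfl
  | cons x xs ih =>
    intro X Y Z _ _ _ _ _ _ _ f g hf hg hfg hY
    have : Module.Finite R X := .of_injective f hf
    have : Module.Finite R Z := .of_surjective g hg
    rw [mult, mult, mult]
    let t {X Y : Type u} [AddCommGroup X] [Module R X] [AddCommGroup Y] [Module R Y]
        (f : X →ₗ[R] Y) : Submodule.torsionBy R X x →ₗ[R] Submodule.torsionBy R Y x :=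
      f.restrict fun v hv => by
        rw [Submodule.mem_torsionBy_iff] at hv ⊢; rw [← map_smul, hv, map_zero]
    have hl {X Y : Type u} [AddCommGroup X] [Module R X] [AddCommGroup Y] [Module R Y]
        (f : X →ₗ[R] Y) : f ∘ₗ (LinearMap.lsmul R X x) = (LinearMap.lsmul R Y x) ∘ₗ f := by
      ext; simp
    have hτ (X : Type u) [AddCommGroup X] [Module R X] : Function.Exact
        (Submodule.torsionBy R X x).subtype (LinearMap.lsmul R X x) := by
      intro v; simp
    have hπ (X : Type u) [AddCommGroup X] [Module R X] : Function.Exact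
        (LinearMap.lsmul R X x) (x • (⊤ : Submodule R X)).mkQ := by
      intro v; rw [mkQ_smul_top_eq_zero_iff]; rfl
    have hgf : ∀ v, g (f v) = 0 := hfg.apply_apply_eq_zero
    refine six_term ih (t f) (t g) (SnakeLemma.δ' (LinearMap.lsmul R X x) (LinearMap.lsmul R Y x)
      (LinearMap.lsmul R Z x) f g hfg f g hfg (hl f) (hl g)
      (Submodule.torsionBy R Z x).subtype (hτ Z) (x • (⊤ : Submodule R X)).mkQ (hπ X) hg hf)
      (QuotSMulTop.map x f) (QuotSMulTop.map x g) ?_ ?_ ?_ ?_ ?_ ?_ hY.torsionBy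
      (hY.of_surjective g hg).torsionBy (hY.of_injective f hf).tail hY.tail
    · intro a b h
      exact Subtype.ext (hf (congrArg Subtype.val h))
    · intro v
      constructor
      · intro h
        obtain ⟨w, hw⟩ := (hfg v.1).1 (congrArg Subtype.val h)
        refine ⟨⟨w, ?_⟩, Subtype.ext hw⟩
        have := v.2
        rw [Submodule.mem_torsionBy_iff] at this ⊢
        apply hf
        rw [map_smul, hw, this, map_zero]
      · rintro ⟨w, rfl⟩
        exact Subtype.ext (hgf _)
    · exact SnakeLemma.exact_δ'_right _ _ _ _ _ _ _ _ _ _ _ _ (hτ Y) _ _ _ _ _ _ (t g) rfl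
        (Submodule.subtype_injective _)
    · exact SnakeLemma.exact_δ'_left _ _ _ _ _ _ _ _ _ _ _ _ _ _ _ _ (hπ Y) _ _
        (QuotSMulTop.map x f) (by ext; rfl) (Submodule.mkQ_surjective _)
    · exact QuotSMulTop.map_exact x hfg hg
    · exact QuotSMulTop.map_surjective x hg

end Mult

section Mult2
variable {R : Type u} [CommRing R]

theorem exists_prime_le_ringKrullDim {I : Ideal R} {k : ℕ}
    (h : (k : WithBot ℕ∞) ≤ ringKrullDim (R ⧸ I)) :
    ∃ P : Ideal R, P.IsPrime ∧ I ≤ P ∧ (k : WithBot ℕ∞) ≤ ringKrullDim (R ⧸ P) := by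
  rw [ringKrullDim_quotient, Order.le_krullDim_iff] at h
  obtain ⟨p, hp⟩ := h
  refine ⟨p.head.1.asIdeal, p.head.1.2, p.head.2, ?_⟩
  rw [ringKrullDim_quotient, Order.le_krullDim_iff]
  refine ⟨⟨p.length, fun i => ⟨(p i).1, ?_⟩, fun i => p.step i⟩, hp⟩
  exact p.head_le i

theorem mult_subsingleton (xs : List R) : ∀ (X : Type u) [AddCommGroup X] [Module R X]
    [Subsingleton X], mult xs X = 0 := by
  induction xs with
  | nil => intro X _ _ _; rw [mult, len, Module.length_eq_zero]; rfl
  | cons x xs ih =>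
    intro X _ _ _
    have : Subsingleton (QuotSMulTop x X) := Quotient.instSubsingletonQuotient _
    rw [mult, ih, ih, sub_zero]

/-- The isomorphism `X / xX ≃ X` when `x` kills `X`. -/
noncomputable def quotEquivOfSmulZero {x : R} {X : Type u} [AddCommGroup X] [Module R X]
    (h : ∀ v : X, x • v = 0) : QuotSMulTop x X ≃ₗ[R] X :=
  Submodule.quotEquivOfEqBot _ (by
    rw [eq_bot_iff]; intro v hv
    obtain ⟨w, rfl⟩ := smul_mem_smul_top_iff.1 hv
    exact h w)

/-- The isomorphism `0 :_X x ≃ X` when `x` kills `X`. -/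
noncomputable def torsionEquivOfSmulZero {x : R} {X : Type u} [AddCommGroup X] [Module R X]
    (h : ∀ v : X, x • v = 0) : Submodule.torsionBy R X x ≃ₗ[R] X :=
  LinearEquiv.ofTop _ (by rw [eq_top_iff]; intro v _; exact h v)

variable [IsLocalRing R] [IsNoetherianRing R]

theorem mult_congr {xs : List R} {X Y : Type u} [AddCommGroup X] [Module R X] [AddCommGroup Y]
    [Module R Y] [Module.Finite R Y] (e : X ≃ₗ[R] Y) (h : Par xs Y) : mult xs X = mult xs Y := by
  have := mult_add xs X Y PUnit.{u + 1} e.toLinearMap 0 e.injective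
    (Function.surjective_to_subsingleton _) ((e.toLinearMap.exact_zero_iff_surjective _).2 e.surjective) h
  rw [this, mult_subsingleton xs PUnit, add_zero]

theorem mult_eq_zero_of_smul (xs : List R) : ∀ (X : Type u) [AddCommGroup X] [Module R X]
    [Module.Finite R X] (y : R), y ∈ xs → (∀ v : X, y • v = 0) → Par xs X → mult xs X = 0 := by
  induction xs with
  | nil => intro X _ _ _ y hy; simp at hy
  | cons x xs ih =>
    intro X _ _ _ y hy h hX
    rcases List.mem_cons.1 hy with rfl | hy
    · have hX' : Par xs X := hX.torsionBy.of_surjective (torsionEquivOfSmulZero h).toLinearMap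
        (torsionEquivOfSmulZero h).surjective
      rw [mult, mult_congr (quotEquivOfSmulZero h) hX', mult_congr (torsionEquivOfSmulZero h) hX',
        sub_self]
    · rw [mult, ih _ y hy ?_ hX.tail, ih _ y hy ?_ hX.torsionBy, sub_zero]
      · exact fun v => Subtype.ext (h _)
      · intro v
        obtain ⟨w, rfl⟩ := Submodule.mkQ_surjective _ v
        rw [← map_smul, h, map_zero]

theorem mult_eq_sub_of_submodule {xs : List R} {X : Type u} [AddCommGroup X] [Module R X]
    [Module.Finite R X] (N : Submodule R X) (h : Par xs X) :
    mult xs X = mult xs N + mult xs (X ⧸ N) :=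
  mult_add xs N X (X ⧸ N) N.subtype N.mkQ (Submodule.subtype_injective _)
    (Submodule.mkQ_surjective _) (LinearMap.exact_subtype_mkQ N) h

theorem mult_eq_zero_of_pow_smul {xs : List R} (k : ℕ) : ∀ (X : Type u) [AddCommGroup X] [Module R X]
    [Module.Finite R X] (y : R), y ∈ xs → (∀ v : X, y ^ k • v = 0) → Par xs X → mult xs X = 0 := by
  induction k with
  | zero =>
    intro X _ _ _ y _ h _
    have : Subsingleton X := subsingleton_of_forall_eq 0 fun v => by simpa using h v
    exact mult_subsingleton xs X
  | succ k ih =>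
    intro X _ _ _ y hy h hX
    let N : Submodule R X := y • ⊤
    rw [mult_eq_sub_of_submodule N hX, ih N y hy ?_ (hX.of_injective _ N.subtype_injective),
      mult_eq_zero_of_smul xs (X ⧸ N) y hy ?_ (hX.of_surjective _ N.mkQ_surjective), add_zero]
    · intro v
      obtain ⟨w, rfl⟩ := N.mkQ_surjective v
      rw [← map_smul, Submodule.mkQ_apply, Submodule.Quotient.mk_eq_zero]
      exact smul_mem_smul_top_iff.2 ⟨w, rfl⟩
    · rintro ⟨v, hv⟩
      obtain ⟨w, rfl⟩ := smul_mem_smul_top_iff.1 hv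
      apply Subtype.ext
      change y ^ k • y • w = 0
      rw [smul_smul, ← pow_succ, h]

theorem torsionBy_quotient_prime {P : Ideal R} (hP : P.IsPrime) {x : R} (hx : x ∉ P) :
    Subsingleton (Submodule.torsionBy R (R ⧸ P) x) := by
  refine subsingleton_of_forall_eq 0 fun ⟨v, hv⟩ => Subtype.ext ?_
  obtain ⟨v, rfl⟩ := Ideal.Quotient.mk_surjective v
  rw [Submodule.mem_torsionBy_iff] at hv
  change Ideal.Quotient.mk P (x * v) = 0 at hv
  rw [Ideal.Quotient.eq_zero_iff_mem] at hv
  exact Ideal.Quotient.eq_zero_iff_mem.2 ((hP.mem_or_mem hv).resolve_left hx)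

theorem smul_quotient_of_mem {P : Ideal R} {x : R} (hx : x ∈ P) (v : R ⧸ P) : x • v = 0 := by
  obtain ⟨v, rfl⟩ := Ideal.Quotient.mk_surjective v
  exact Ideal.Quotient.eq_zero_iff_mem.2 (P.mul_mem_right v hx)

theorem mult_nonneg (xs : List R) : ∀ (X : Type u) [AddCommGroup X] [Module R X]
    [Module.Finite R X], Par xs X → 0 ≤ mult xs X := by
  induction xs with
  | nil => intro X _ _ _ _; rw [mult]; positivity
  | cons x xs ih =>
    intro X _ _ hfin
    induction hfin using IsNoetherianRing.induction_on_isQuotientEquivQuotientPrime R with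
    | subsingleton N => intro _; rw [mult_subsingleton]
    | quotient N p f =>
      intro h
      have h' := h.of_surjective f.toLinearMap f.surjective
      rw [mult_congr f h']
      by_cases hx : x ∈ p.1
      · rw [mult_eq_zero_of_smul _ _ x (by simp) (smul_quotient_of_mem hx) h']
      · have := torsionBy_quotient_prime p.2 hx
        rw [mult, mult_subsingleton xs (Submodule.torsionBy R (R ⧸ p.1) x), sub_zero]
        exact ih _ h'.tail
    | exact N₁ N₂ N₃ f g hf hg hfg h₁ h₃ =>
      intro h
      rw [mult_add _ _ _ _ f g hf hg hfg h]
      exact add_nonneg (h₁ (h.of_injective f hf)) (h₃ (h.of_surjective g hg))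

theorem mult_le_of_injective {xs : List R} {X Y : Type u} [AddCommGroup X] [Module R X]
    [AddCommGroup Y] [Module R Y] [Module.Finite R Y] (f : X →ₗ[R] Y) (hf : Function.Injective f)
    (h : Par xs Y) : mult xs X ≤ mult xs Y := by
  rw [mult_add xs X Y (Y ⧸ LinearMap.range f) f (LinearMap.range f).mkQ hf
    (Submodule.mkQ_surjective _) (LinearMap.exact_map_mkQ_range f) h]
  have := mult_nonneg xs _ (h.of_surjective _ (LinearMap.range f).mkQ_surjective)
  lia

theorem mult_le_of_surjective {xs : List R} {X Y : Type u} [AddCommGroup X] [Module R X]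
    [AddCommGroup Y] [Module R Y] [Module.Finite R X] (f : X →ₗ[R] Y)
    (hf : Function.Surjective f) (h : Par xs X) : mult xs Y ≤ mult xs X := by
  rw [mult_add xs (LinearMap.ker f) X Y (LinearMap.ker f).subtype f (Submodule.subtype_injective _)
    hf (LinearMap.exact_subtype_ker_map f) h]
  have := mult_nonneg xs _ (h.of_injective _ (LinearMap.ker f).subtype_injective)
  lia

theorem ringKrullDim_quotient_le_add_one (I : Ideal R) {x : R} (hx : x ∈ maximalIdeal R) :
    ringKrullDim (R ⧸ I) ≤ ringKrullDim (R ⧸ (I ⊔ Ideal.span {x})) + 1 := by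
  rcases subsingleton_or_nontrivial (R ⧸ I) with h | h
  · rw [ringKrullDim_eq_bot_of_subsingleton]; exact bot_le
  have : IsLocalRing (R ⧸ I) := .of_surjective' _ Ideal.Quotient.mk_surjective
  have h1 := ringKrullDim_le_ringKrullDim_quotient_add_card {Ideal.Quotient.mk I x} (by
    rw [Finset.coe_singleton, Set.singleton_subset_iff, SetLike.mem_coe,
      IsLocalRing.ringJacobson_eq_maximalIdeal,
      ← IsLocalRing.map_maximalIdeal_of_surjective _ Ideal.Quotient.mk_surjective]
    exact Ideal.mem_map_of_mem _ hx)
  rw [Finset.coe_singleton, Finset.card_singleton, Nat.cast_one] at h1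
  refine h1.trans_eq ?_
  rw [← ringKrullDim_eq_of_ringEquiv (DoubleQuot.quotQuotEquivQuotSup I (Ideal.span {x})),
    Ideal.map_span, Set.image_singleton]

theorem one_le_mult (xs : List R) : ∀ (X : Type u) [AddCommGroup X] [Module R X]
    [Module.Finite R X], Par xs X → ∀ P : Ideal R, P.IsPrime → Module.annihilator R X ≤ P →
    (xs.length : WithBot ℕ∞) ≤ ringKrullDim (R ⧸ P) → 1 ≤ mult xs X := by
  induction xs with
  | nil =>
    intro X _ _ _ h P hP hle _
    have hX : Nontrivial X := by
      by_contra hn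
      rw [not_nontrivial_iff_subsingleton] at hn
      rw [Module.annihilator_eq_top_iff.2 hn, top_le_iff] at hle
      exact hP.ne_top hle
    have := len_coe h.isFiniteLength
    have h1 : 0 < Module.length R X := Module.length_pos
    rw [← this] at h1
    rw [mult]
    have : 0 < len R X := by exact_mod_cast h1
    lia
  | cons x xs ih =>
    intro X _ _ _ h P hP hle hdim
    obtain ⟨P₀, hP₀, hP₀P⟩ := Ideal.exists_minimalPrimes_le hle
    have hass := Module.associatedPrimes.minimalPrimes_annihilator_subset_associatedPrimes R X hP₀
    have hp₀ : P₀.IsPrime := hP₀.1.1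
    obtain ⟨f, hf⟩ := ((isAssociatedPrime_iff_exists_injective_linearMap _ X).1 hass).2
    refine le_trans ?_ (mult_le_of_injective f hf h)
    have h0 := h.of_injective f hf
    have hdim0 : ((xs.length + 1 : ℕ) : WithBot ℕ∞) ≤ ringKrullDim (R ⧸ P₀) := by
      refine le_trans ?_ (ringKrullDim_le_of_surjective (Ideal.Quotient.factor hP₀P)
        (Ideal.Quotient.factor_surjective hP₀P))
      simpa using hdim
    have hx : x ∉ P₀ := by
      intro hx
      have h1 : Par xs (R ⧸ P₀) := h0.torsionBy.of_surjective
        (torsionEquivOfSmulZero (smul_quotient_of_mem hx)).toLinearMap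
        (torsionEquivOfSmulZero (smul_quotient_of_mem hx)).surjective
      obtain ⟨h2, n, hn⟩ := h1
      rw [Ideal.annihilator_quotient] at hn
      have h3 := hdim0.trans (ringKrullDim_quotient_le_of_pow_le hp₀ h2 hn)
      have : xs.length + 1 ≤ xs.length := by exact_mod_cast h3
      lia
    have := torsionBy_quotient_prime hp₀ hx
    rw [mult, mult_subsingleton xs (Submodule.torsionBy R (R ⧸ P₀) x), sub_zero]
    have hdim1 : (xs.length : WithBot ℕ∞) ≤ ringKrullDim (R ⧸ (P₀ ⊔ Ideal.span {x})) := by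
      have h1 := hdim0.trans (ringKrullDim_quotient_le_add_one P₀ (h.1 x (by simp)))
      rw [Nat.cast_add, Nat.cast_one] at h1
      exact ENat.WithBot.add_le_add_one_right_iff.1 h1
    obtain ⟨Q, hQ, hQle, hQdim⟩ := exists_prime_le_ringKrullDim hdim1
    refine ih _ h0.tail Q hQ (fun a ha => ?_) hQdim
    refine (hQ.isRadical ?_ : a ∈ Q)
    have := annihilator_quotSMulTop_le_radical x (R ⧸ P₀) ha
    rw [Ideal.annihilator_quotient] at this
    exact Ideal.radical_mono hQle this

theorem mult_singleton_pow (n : ℕ) (hn : n ≠ 0) {x : R} (X : Type u) [AddCommGroup X] [Module R X]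
    [Module.Finite R X] : Par [x] X → mult [x ^ n] X = n * mult [x] X := by
  intro h
  induction ‹Module.Finite R X› using IsNoetherianRing.induction_on_isQuotientEquivQuotientPrime R with
  | subsingleton N => rw [mult_subsingleton, mult_subsingleton, mul_zero]
  | quotient N p f =>
    have h' := h.of_surjective f.toLinearMap f.surjective
    have hp := h'.pow_head hn
    rw [mult_congr f h', mult_congr f hp]
    by_cases hx : x ∈ p.1
    · rw [mult_eq_zero_of_smul _ _ x (by simp) (smul_quotient_of_mem hx) h',
        mult_eq_zero_of_smul _ _ (x ^ n) (by simp)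
          (smul_quotient_of_mem (p.1.pow_mem_of_mem hx n (Nat.pos_of_ne_zero hn))) hp, mul_zero]
    · have hT (k : ℕ) : Subsingleton (Submodule.torsionBy R (R ⧸ p.1) (x ^ k)) :=
        torsionBy_quotient_prime p.2 fun h => hx (p.2.mem_of_pow_mem k h)
      have key (k : ℕ) (hk : k ≠ 0) : mult [x ^ k] (R ⧸ p.1) = len R (QuotSMulTop (x ^ k) (R ⧸ p.1)) := by
        have := hT k
        rw [mult, mult_subsingleton [] (Submodule.torsionBy R (R ⧸ p.1) (x ^ k)), sub_zero, mult]
      have key1 := key 1 one_ne_zero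
      rw [pow_one] at key1
      rw [key n hn, key1]
      clear hp
      have e01 : len R (QuotSMulTop (x ^ 1) (R ⧸ p.1)) = len R (QuotSMulTop x (R ⧸ p.1)) := by
        rw [pow_one]
      induction n with
      | zero => contradiction
      | succ n ih =>
        rcases Nat.eq_zero_or_pos n with rfl | hn0
        · simpa using e01
        · have ih := ih hn0.ne'
          let F : QuotSMulTop (x ^ n) (R ⧸ p.1) →ₗ[R] QuotSMulTop (x ^ (n + 1)) (R ⧸ p.1) :=
            Submodule.mapQ _ _ (LinearMap.lsmul R _ x) (by
              intro v hv
              obtain ⟨w, rfl⟩ := smul_mem_smul_top_iff.1 hv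
              exact smul_mem_smul_top_iff.2 ⟨w, by simp [smul_smul, pow_succ, mul_comm]⟩)
          let G : QuotSMulTop (x ^ (n + 1)) (R ⧸ p.1) →ₗ[R] QuotSMulTop x (R ⧸ p.1) :=
            Submodule.factor (by
              intro v hv
              obtain ⟨w, rfl⟩ := smul_mem_smul_top_iff.1 hv
              exact smul_mem_smul_top_iff.2 ⟨x ^ n • w, by simp [smul_smul, pow_succ']⟩)
          have hreg : ∀ v : R ⧸ p.1, x • v = 0 → v = 0 := fun v hv => by
            have := torsionBy_quotient_prime p.2 hx
            exact congrArg Subtype.val (Subsingleton.elim (⟨v, hv⟩ : Submodule.torsionBy R (R ⧸ p.1) x) 0)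
          rw [len_add (f := F) (g := G) ?_ ?_ ?_ (h'.pow_head (Nat.succ_ne_zero n)).tail.isFiniteLength]
          · push_cast
            rw [ih]; ring
          · rw [injective_iff_map_eq_zero]
            intro v hv
            obtain ⟨v, rfl⟩ := Submodule.mkQ_surjective _ v
            obtain ⟨w, hw⟩ := (mkQ_smul_top_eq_zero_iff _ _).1 (show (x ^ (n + 1) • ⊤ : Submodule R (R ⧸ p.1)).mkQ (x • v) = 0 from hv)
            refine (mkQ_smul_top_eq_zero_iff _ _).2 ⟨w, ?_⟩
            rw [← sub_eq_zero]
            apply hreg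
            rw [smul_sub, ← hw, smul_smul, ← pow_succ', sub_self]
          · exact Submodule.factor_surjective _
          · intro v
            obtain ⟨v, rfl⟩ := Submodule.mkQ_surjective _ v
            constructor
            · intro hv
              obtain ⟨w, hw⟩ := (mkQ_smul_top_eq_zero_iff _ _).1 (show (x • ⊤ : Submodule R (R ⧸ p.1)).mkQ v = 0 from hv)
              exact ⟨Submodule.mkQ _ w, by rw [← hw]; rfl⟩
            · rintro ⟨w, hw⟩
              obtain ⟨w, rfl⟩ := Submodule.mkQ_surjective _ w
              rw [← hw]
              exact (mkQ_smul_top_eq_zero_iff _ _).2 ⟨w, rfl⟩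
  | exact N₁ N₂ N₃ f g hf hg hfg h₁ h₃ =>
    rw [mult_add _ _ _ _ f g hf hg hfg h, mult_add _ _ _ _ f g hf hg hfg (h.pow_head hn),
      h₁ (h.of_injective f hf), h₃ (h.of_surjective g hg)]
    ring

theorem mult_append_pow (n : ℕ) (hn : n ≠ 0) {x : R} (ys : List R) : ∀ (X : Type u) [AddCommGroup X]
    [Module R X] [Module.Finite R X], Par (ys ++ [x]) X →
    mult (ys ++ [x ^ n]) X = n * mult (ys ++ [x]) X := by
  induction ys with
  | nil => exact fun X _ _ _ => mult_singleton_pow n hn X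
  | cons y ys ih =>
    intro X _ _ _ h
    change mult (y :: (ys ++ _)) X = n * mult (y :: (ys ++ _)) X
    rw [mult, mult, ih _ (Par.tail h), ih _ (Par.torsionBy h), mul_sub]

end Mult2

section HilbertBounds
variable {R : Type u} [CommRing R]

theorem len_le_add {X Y Z : Type u} [AddCommGroup X] [Module R X] [AddCommGroup Y] [Module R Y]
    [AddCommGroup Z] [Module R Z] {f : X →ₗ[R] Y} {g : Y →ₗ[R] Z}
    (hg : Function.Surjective g) (hfg : Function.Exact f g) (hX : IsFiniteLength R X)
    (hY : IsFiniteLength R Y) : len R Y ≤ len R X + len R Z := by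
  rw [len_add (f := (LinearMap.range f).subtype) (Submodule.subtype_injective _) hg
    (fun y => by rw [hfg y]; simp) hY]
  exact Nat.add_le_add_right (len_le_of_surjective f.surjective_rangeRestrict hX) _

theorem pow_smul_top_eq {M : Type u} [AddCommGroup M] [Module R M] {I J : Ideal R}
    (h : I • (⊤ : Submodule R M) = J • ⊤) (N : ℕ) :
    I ^ N • (⊤ : Submodule R M) = J ^ N • ⊤ := by
  induction N with
  | zero => simp
  | succ N ih =>
    rw [pow_succ, pow_succ, Submodule.mul_smul, h, ← Submodule.mul_smul, mul_comm,
      Submodule.mul_smul, ih, ← Submodule.mul_smul, mul_comm]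

theorem span_sup_smul_quotSMulTop {M : Type u} [AddCommGroup M] [Module R M] (x : R) (I : Ideal R) :
    (Ideal.span {x} ⊔ I) • (⊤ : Submodule R (QuotSMulTop x M)) = I • ⊤ := by
  rw [Submodule.sup_smul, sup_eq_right.2]
  refine Submodule.smul_le.2 fun r hr v _ => ?_
  obtain ⟨r, rfl⟩ := Ideal.mem_span_singleton'.1 hr
  obtain ⟨v, rfl⟩ := Submodule.mkQ_surjective _ v
  rw [← map_smul, (mkQ_smul_top_eq_zero_iff x _).2 ⟨r • v, by rw [smul_smul, mul_comm]⟩]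
  exact zero_mem _

/-- Iterated summation of a function on the natural numbers. -/
def sumIter : ℕ → (ℕ → ℤ) → ℕ → ℤ
  | 0, f, N => f N
  | k + 1, f, N => ∑ m ∈ Finset.range (N + 1), sumIter k f m

theorem sumIter_mono (k : ℕ) {f g : ℕ → ℤ} (h : ∀ m, f m ≤ g m) :
    ∀ N, sumIter k f N ≤ sumIter k g N := by
  induction k with
  | zero => exact h
  | succ k ih => exact fun N => Finset.sum_le_sum fun m _ => ih m

theorem sumIter_add (k : ℕ) (f g : ℕ → ℤ) :
    ∀ N, sumIter k (fun m => f m + g m) N = sumIter k f N + sumIter k g N := by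
  induction k with
  | zero => exact fun _ => rfl
  | succ k ih => intro N; simp_rw [sumIter, ih, Finset.sum_add_distrib]

theorem sumIter_mul (k : ℕ) (c : ℤ) (f : ℕ → ℤ) :
    ∀ N, sumIter k (fun m => c * f m) N = c * sumIter k f N := by
  induction k with
  | zero => exact fun _ => rfl
  | succ k ih => intro N; simp_rw [sumIter, ih, Finset.mul_sum]

theorem sumIter_choose (k j : ℕ) :
    ∀ N, sumIter k (fun m => ((m + j).choose j : ℤ)) N = ((N + (j + k)).choose (j + k) : ℤ) := by
  induction k with
  | zero => exact fun _ => rfl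
  | succ k ih =>
    intro N
    simp_rw [sumIter, ih]
    have := Nat.sum_range_add_choose N (j + k)
    rw [← add_assoc j k 1, ← add_assoc, ← this]
    push_cast; rfl

variable [IsLocalRing R]

theorem annihilator_sup_pow_le {M : Type u} [AddCommGroup M] [Module R M] (q : Ideal R) (N : ℕ) :
    Module.annihilator R M ⊔ q ^ N ≤
      Module.annihilator R (M ⧸ (q ^ N • (⊤ : Submodule R M))) := by
  refine sup_le (LinearMap.annihilator_le_of_surjective _ (Submodule.mkQ_surjective _)) ?_
  intro a ha
  rw [Module.mem_annihilator]
  intro v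
  obtain ⟨v, rfl⟩ := Submodule.mkQ_surjective _ v
  rw [← map_smul, Submodule.mkQ_apply, Submodule.Quotient.mk_eq_zero]
  exact Submodule.smul_mem_smul ha trivial

theorem Par.quotient_pow {M : Type u} [AddCommGroup M] [Module R M] [IsNoetherianRing R]
    {xs : List R} {q : Ideal R}
    {n : ℕ} (hxs : ∀ x ∈ xs, x ∈ maximalIdeal R)
    (h : maximalIdeal R ^ n ≤ Module.annihilator R M ⊔ (Ideal.ofList xs ⊔ q)) (N : ℕ) :
    Par xs (M ⧸ (q ^ N • (⊤ : Submodule R M))) := by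
  refine ⟨hxs, exists_pow_le_of_le_radical (n := n) (h.trans (sup_le ?_ (sup_le ?_ ?_)))⟩
  · exact le_sup_left.trans ((annihilator_sup_pow_le q N).trans (le_sup_left.trans Ideal.le_radical))
  · exact le_sup_right.trans Ideal.le_radical
  · intro a ha
    refine ⟨N, Ideal.mem_sup_left (annihilator_sup_pow_le q N (Ideal.mem_sup_right ?_))⟩
    exact Ideal.pow_mem_pow ha N

variable [IsNoetherianRing R]

theorem Par.isFiniteLength_quotient {M : Type u} [AddCommGroup M] [Module R M] [Module.Finite R M]
    {xs : List R} (h : Par xs M) (N : ℕ) :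
    IsFiniteLength R (M ⧸ ((Ideal.ofList xs) ^ N • (⊤ : Submodule R M))) := by
  obtain ⟨n, hn⟩ := h.2
  refine (Par.quotient_pow (xs := []) (n := n) (by simp) ?_ N).isFiniteLength
  simpa using hn

theorem len_quotient_pow_le_sum {M : Type u} [AddCommGroup M] [Module R M]
    {q : Ideal R} {x : R} (hx : x ∈ q)
    (hfl : ∀ N, IsFiniteLength R (M ⧸ (q ^ N • (⊤ : Submodule R M)))) (N : ℕ) :
    len R (M ⧸ (q ^ N • (⊤ : Submodule R M))) ≤ ∑ m ∈ Finset.range N,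
      len R (QuotSMulTop x M ⧸ (q ^ (m + 1) • (⊤ : Submodule R (QuotSMulTop x M)))) := by
  induction N with
  | zero =>
    have : Subsingleton (M ⧸ (q ^ 0 • (⊤ : Submodule R M))) := by
      rw [Submodule.Quotient.subsingleton_iff]; simp
    rw [len, Module.length_eq_zero]; simp
  | succ N ih =>
    rw [Finset.sum_range_succ]
    let F : (M ⧸ (q ^ N • (⊤ : Submodule R M))) →ₗ[R] M ⧸ (q ^ (N + 1) • (⊤ : Submodule R M)) :=
      Submodule.mapQ _ _ (LinearMap.lsmul R M x) (by
        intro v hv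
        change x • v ∈ q ^ (N + 1) • (⊤ : Submodule R M)
        rw [pow_succ', Submodule.mul_smul]
        exact Submodule.smul_mem_smul hx hv)
    have hmap : (q ^ (N + 1) • (⊤ : Submodule R M)).map (x • (⊤ : Submodule R M)).mkQ =
        q ^ (N + 1) • ⊤ := by
      rw [Submodule.map_smul'', Submodule.map_top, Submodule.range_mkQ]
    let G : (M ⧸ (q ^ (N + 1) • (⊤ : Submodule R M))) →ₗ[R]
        QuotSMulTop x M ⧸ (q ^ (N + 1) • (⊤ : Submodule R (QuotSMulTop x M))) :=
      Submodule.mapQ _ _ (x • (⊤ : Submodule R M)).mkQ (Submodule.map_le_iff_le_comap.1 hmap.le)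
    refine (len_le_add (f := F) (g := G) ?_ ?_ (hfl N) (hfl (N + 1))).trans
      (Nat.add_le_add_right ih _)
    · intro v
      obtain ⟨v, rfl⟩ := Submodule.mkQ_surjective _ v
      obtain ⟨v, rfl⟩ := Submodule.mkQ_surjective _ v
      exact ⟨Submodule.mkQ _ v, rfl⟩
    · intro v
      obtain ⟨v, rfl⟩ := Submodule.mkQ_surjective _ v
      constructor
      · intro hv
        have hv : (x • (⊤ : Submodule R M)).mkQ v ∈ q ^ (N + 1) • (⊤ : Submodule R (QuotSMulTop x M)) :=
          (Submodule.Quotient.mk_eq_zero _).1 hv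
        rw [← hmap] at hv
        obtain ⟨w, hw, hwv⟩ := hv
        have := (mkQ_smul_top_eq_zero_iff x (v - w)).1 (by rw [map_sub, hwv, sub_self])
        obtain ⟨u, hu⟩ := this
        refine ⟨Submodule.mkQ _ u, (Submodule.Quotient.eq _).2 ?_⟩
        change x • u - v ∈ _
        rw [hu, sub_sub_cancel_left]
        exact neg_mem hw
      · rintro ⟨w, hw⟩
        obtain ⟨w, rfl⟩ := Submodule.mkQ_surjective _ w
        rw [← hw]
        refine (Submodule.Quotient.mk_eq_zero _).2 ?_
        have : (x • (⊤ : Submodule R M)).mkQ (x • w) = 0 := (mkQ_smul_top_eq_zero_iff _ _).2 ⟨w, rfl⟩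
        exact this ▸ zero_mem _

theorem len_quotient_pow_le_sum_cons {M : Type u} [AddCommGroup M] [Module R M] [Module.Finite R M]
    {x : R} {xs : List R} (h : Par (x :: xs) M) (N : ℕ) :
    (len R (M ⧸ ((Ideal.ofList (x :: xs)) ^ (N + 1) • (⊤ : Submodule R M))) : ℤ) ≤
      ∑ m ∈ Finset.range (N + 1), (len R (QuotSMulTop x M ⧸
        ((Ideal.ofList xs) ^ (m + 1) • (⊤ : Submodule R (QuotSMulTop x M)))) : ℤ) := by
  have := len_quotient_pow_le_sum (x := x) (Ideal.subset_span (by simp)) h.isFiniteLength_quotient (N + 1)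
  have hq (m : ℕ) : (Ideal.ofList (x :: xs)) ^ m • (⊤ : Submodule R (QuotSMulTop x M)) =
      (Ideal.ofList xs) ^ m • ⊤ := by
    apply pow_smul_top_eq
    rw [Ideal.ofList_cons, span_sup_smul_quotSMulTop]
  refine (Int.ofNat_le.2 this).trans_eq ?_
  rw [Nat.cast_sum]
  exact Finset.sum_congr rfl fun m _ => by rw [hq]

/-- The colon modules of the list are torsion with respect to `w`. -/
def TorsionChain (w : R) : List R → ∀ (M : Type u) [AddCommGroup M] [Module R M], Prop
  | [], _, _, _ => True
  | x :: xs, M, _, _ => (∃ k, ∀ v : M, x • v = 0 → w ^ k • v = 0) ∧ TorsionChain w xs (QuotSMulTop x M)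

/-- The lengths of `0 : w ^ k` in `M / (xs) M` are bounded by `b`. -/
def TorsionBound (w : R) (b : ℕ) : List R → ∀ (M : Type u) [AddCommGroup M] [Module R M], Prop
  | [], M, _, _ => ∀ k, len R (Submodule.torsionBy R M (w ^ k)) ≤ b
  | x :: xs, M, _, _ => TorsionBound w b xs (QuotSMulTop x M)

theorem mult_append_singleton {w : R} {xs : List R} {x : R} {M : Type u} [AddCommGroup M] [Module R M]
    [Module.Finite R M] (h : Par (x :: (xs ++ [w])) M) (hw : ∃ k, ∀ v : M, x • v = 0 → w ^ k • v = 0) :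
    mult (x :: (xs ++ [w])) M = mult (xs ++ [w]) (QuotSMulTop x M) := by
  obtain ⟨k, hk⟩ := hw
  rw [mult, mult_eq_zero_of_pow_smul k (Submodule.torsionBy R M x) w (by simp) ?_ h.torsionBy, sub_zero]
  exact fun v => Subtype.ext (hk v.1 v.2)

theorem len_quotient_pow_le (w : R) (b : ℕ) (xs : List R) : ∀ (M : Type u) [AddCommGroup M]
    [Module R M] [Module.Finite R M], Par (xs ++ [w]) M → TorsionChain w xs M →
    TorsionBound w b xs M → ∀ N,
    (len R (M ⧸ ((Ideal.ofList (xs ++ [w])) ^ (N + 1) • (⊤ : Submodule R M))) : ℤ) ≤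
      mult (xs ++ [w]) M * (N + (xs.length + 1)).choose (xs.length + 1) +
        b * (N + xs.length).choose xs.length := by
  induction xs with
  | nil =>
    intro M _ _ _ hP _ hb N
    have hN := mult_singleton_pow (N + 1) (Nat.succ_ne_zero _) M hP
    rw [mult, mult, mult] at hN
    have h1 := hb (N + 1)
    have h2 : (Ideal.ofList ([] ++ [w])) ^ (N + 1) • (⊤ : Submodule R M) = w ^ (N + 1) • ⊤ := by
      rw [List.nil_append, Ideal.ofList_singleton, Ideal.span_singleton_pow,
        Submodule.ideal_span_singleton_smul]
    rw [h2]
    change (len R (QuotSMulTop (w ^ (N + 1)) M) : ℤ) ≤ mult [w] M * _ + _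
    simp only [List.length_nil, zero_add, add_zero, Nat.choose_one_right, Nat.choose_zero_right]
    push_cast at hN ⊢
    lia
  | cons x xs ih =>
    intro M _ _ _ hP hT hb N
    refine (len_quotient_pow_le_sum_cons hP N).trans ?_
    refine (Finset.sum_le_sum fun m _ => ih _ hP.tail hT.2 hb m).trans_eq ?_
    rw [← mult_append_singleton hP hT.1, Finset.sum_add_distrib, ← Finset.mul_sum, ← Finset.mul_sum]
    have h1 := Nat.sum_range_add_choose N (xs.length + 1)
    have h2 := Nat.sum_range_add_choose N xs.length
    simp only [List.length_cons, ← add_assoc] at h1 h2 ⊢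
    rw [← h1, ← h2]
    push_cast; rfl

theorem len_quotient_pow_le_choose (xs : List R) : ∀ (M : Type u) [AddCommGroup M]
    [Module R M] [Module.Finite R M], Par xs M → ∀ N,
    (len R (M ⧸ ((Ideal.ofList xs) ^ (N + 1) • (⊤ : Submodule R M))) : ℤ) ≤
      len R (M ⧸ (Ideal.ofList xs • (⊤ : Submodule R M))) * (N + xs.length).choose xs.length := by
  induction xs with
  | nil =>
    intro M _ _ _ hP N
    have h0 : (Ideal.ofList ([] : List R)) ^ (N + 1) = Ideal.ofList [] := by
      rw [Ideal.ofList_nil, ← Ideal.zero_eq_bot, zero_pow (Nat.succ_ne_zero N)]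
    rw [h0]
    simp
  | cons x xs ih =>
    intro M _ _ _ hP N
    refine (len_quotient_pow_le_sum_cons hP N).trans ?_
    refine (Finset.sum_le_sum fun m _ => ih _ hP.tail m).trans_eq ?_
    rw [← Finset.mul_sum, len_congr (Submodule.quotOfListConsSMulTopEquivQuotSMulTopInner M x xs)]
    have h2 := Nat.sum_range_add_choose N xs.length
    simp only [List.length_cons, ← add_assoc] at h2 ⊢
    rw [← h2]
    push_cast; rfl

end HilbertBounds

section LowerBounds
variable {R : Type u} [CommRing R]

theorem exists_colon_pow_stable [IsNoetherianRing R] {M : Type u} [AddCommGroup M] [Module R M]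
    [Module.Finite R M] (x : R) (A : Submodule R M) :
    ∃ T, ∀ s v, x ^ s • v ∈ A → x ^ T • v ∈ A := by
  have hmono : Monotone fun t => A.comap (LinearMap.lsmul R M (x ^ t)) := by
    intro s t hst v hv
    change x ^ t • v ∈ A
    obtain ⟨k, rfl⟩ := Nat.exists_eq_add_of_le hst
    rw [add_comm, pow_add, mul_smul]
    exact A.smul_mem _ hv
  obtain ⟨T, hT⟩ := monotone_stabilizes_iff_noetherian.2 (inferInstance : IsNoetherian R M)
    ⟨_, hmono⟩
  refine ⟨T, fun s v hv => ?_⟩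
  rcases le_total s T with h | h
  · exact hmono h hv
  · exact (SetLike.ext_iff.1 (hT s h) v).2 hv

variable [IsLocalRing R] [IsNoetherianRing R]

theorem sum_mult_le {M : Type u} [AddCommGroup M] [Module R M] [Module.Finite R M] {x : R}
    {xs : List R} {Z : Ideal R} (hxs : ∀ y ∈ x :: xs, y ∈ maximalIdeal R) {n : ℕ}
    (h : maximalIdeal R ^ n ≤ Module.annihilator R M ⊔ (Ideal.ofList (x :: xs) ⊔ Z)) (N : ℕ) :
    ∑ m ∈ Finset.range N, mult (x :: xs) (M ⧸ (Z ^ (m + 1) • (⊤ : Submodule R M))) ≤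
      mult xs (M ⧸ ((Ideal.span {x} ⊔ Z) ^ N • (⊤ : Submodule R M))) := by
  have hPZ (k : ℕ) : Par (x :: xs) (M ⧸ (Z ^ k • (⊤ : Submodule R M))) :=
    Par.quotient_pow hxs h k
  have hPq (k : ℕ) : Par xs (M ⧸ ((Ideal.span {x} ⊔ Z) ^ k • (⊤ : Submodule R M))) := by
    refine Par.quotient_pow (fun y hy => hxs y (by simp [hy])) (n := n) ?_ k
    rw [Ideal.ofList_cons] at h
    rwa [← sup_assoc (Ideal.ofList xs), sup_comm (Ideal.ofList xs)]
  choose T hT using fun k : ℕ => exists_colon_pow_stable x (Z ^ k • (⊤ : Submodule R M))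
  let W : ℕ → Submodule R M := fun k => (Z ^ k • (⊤ : Submodule R M)).comap (LinearMap.lsmul R M (x ^ T k))
  have hW (k v) : v ∈ W k ↔ ∃ s, x ^ s • v ∈ Z ^ k • (⊤ : Submodule R M) :=
    ⟨fun h => ⟨T k, h⟩, fun ⟨s, hs⟩ => hT k s v hs⟩
  have hZW (k) : Z ^ k • (⊤ : Submodule R M) ≤ W k := fun v hv => (hW k v).2 ⟨0, by simpa using hv⟩
  have hxW (k v) (hv : x • v ∈ W k) : v ∈ W k := by
    obtain ⟨s, hs⟩ := (hW k _).1 hv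
    exact (hW k v).2 ⟨s + 1, by rwa [pow_succ, mul_smul]⟩
  have hWanti (k) : W (k + 1) ≤ W k := by
    intro v hv
    obtain ⟨s, hs⟩ := (hW _ _).1 hv
    exact (hW k v).2 ⟨s, Submodule.smul_mono_left (Ideal.pow_le_pow_right k.le_succ) hs⟩
  have hZWs (k) : Z • W k ≤ W (k + 1) := by
    refine Submodule.smul_le.2 fun r hr v hv => ?_
    obtain ⟨s, hs⟩ := (hW _ _).1 hv
    refine (hW _ _).2 ⟨s, ?_⟩
    rw [smul_comm, pow_succ', Submodule.mul_smul]
    exact Submodule.smul_mem_smul hr hs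
  obtain ⟨Q, hQ0, hQs⟩ : ∃ Q : ℕ → Submodule R M, Q 0 = ⊤ ∧ ∀ k, Q (k + 1) = x • Q k ⊔ W (k + 1) :=
    ⟨fun k => Nat.rec ⊤ (fun k Qk => x • Qk ⊔ W (k + 1)) k, rfl, fun _ => rfl⟩
  have hWQ (k) : W k ≤ Q k := by
    cases k with
    | zero => rw [hQ0]; exact le_top
    | succ k => rw [hQs]; exact le_sup_right
  have hZQ (k) : Z • Q k ≤ Q (k + 1) := by
    induction k with
    | zero =>
      rw [hQs]
      refine le_trans ?_ le_sup_right
      have := hZW 1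
      rwa [pow_one, ← hQ0] at this
    | succ k ih =>
      nth_rewrite 1 [hQs]
      rw [hQs (k + 1), Submodule.smul_sup]
      refine sup_le_sup ?_ (hZWs _)
      refine Submodule.smul_le.2 fun r hr v hv => ?_
      obtain ⟨w, hw, rfl⟩ := hv
      change r • x • w ∈ _
      rw [smul_comm]
      exact Submodule.smul_mem_pointwise_smul _ _ _ (ih (Submodule.smul_mem_smul hr hw))
  have hqQ (k) : (Ideal.span {x} ⊔ Z) ^ k • (⊤ : Submodule R M) ≤ Q k := by
    induction k with
    | zero => rw [hQ0]; exact le_top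
    | succ k ih =>
      rw [pow_succ', Submodule.mul_smul]
      refine (Submodule.smul_mono le_rfl ih).trans ?_
      rw [Submodule.sup_smul, Submodule.ideal_span_singleton_smul]
      exact sup_le (by rw [hQs]; exact le_sup_left) (hZQ k)
  have hxQ (k v) (hv : x • v ∈ Q (k + 1)) : v ∈ Q k := by
    rw [hQs, Submodule.mem_sup] at hv
    obtain ⟨a, ha, w, hw, hvw⟩ := hv
    obtain ⟨a, ha, rfl⟩ := ha
    have : v - a ∈ W (k + 1) := hxW _ _ (by
      rw [smul_sub, ← hvw]
      change x • a + w - x • a ∈ _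
      simpa using hw)
    simpa using (Q k).add_mem (hWQ k (hWanti k this)) ha
  have hPQ (k : ℕ) : Par xs (M ⧸ Q k) := by
    have hs := Submodule.factor_surjective (hqQ k)
    exact (hPq k).of_surjective (Submodule.factor (hqQ k)) hs
  have hmW (k) : mult (x :: xs) (M ⧸ (Z ^ k • (⊤ : Submodule R M))) = mult xs (QuotSMulTop x (M ⧸ W k)) := by
    let g := Submodule.factor (hZW k)
    have hg : Function.Surjective g := Submodule.factor_surjective (hZW k)
    rw [mult_add _ _ _ _ (LinearMap.ker g).subtype g (Submodule.subtype_injective _) hg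
      (LinearMap.exact_subtype_ker_map g) (hPZ k), mult_eq_zero_of_pow_smul (T k) _ x (by simp) ?_
      ((hPZ k).of_injective _ (Submodule.subtype_injective _)), zero_add, mult]
    · have : Subsingleton (Submodule.torsionBy R (M ⧸ W k) x) := by
        refine subsingleton_of_forall_eq 0 fun ⟨v, hv⟩ => Subtype.ext ?_
        obtain ⟨v, rfl⟩ := Submodule.mkQ_surjective _ v
        exact (Submodule.Quotient.mk_eq_zero _).2 (hxW k v ((Submodule.Quotient.mk_eq_zero _).1 hv))
      rw [mult_subsingleton xs (Submodule.torsionBy R (M ⧸ W k) x), sub_zero]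
    · rintro ⟨v, hv⟩
      apply Subtype.ext
      obtain ⟨v, rfl⟩ := Submodule.mkQ_surjective _ v
      have hv : v ∈ W k := (Submodule.Quotient.mk_eq_zero _).1 hv
      exact (Submodule.Quotient.mk_eq_zero _).2 hv
  refine le_trans ?_ (mult_le_of_surjective (Submodule.factor (hqQ N))
    (Submodule.factor_surjective (hqQ N)) (hPq N))
  induction N with
  | zero => simpa using mult_nonneg xs _ (hPQ 0)
  | succ N ih =>
    rw [Finset.sum_range_succ]
    let F : (M ⧸ Q N) →ₗ[R] M ⧸ Q (N + 1) :=
      Submodule.mapQ _ _ (LinearMap.lsmul R M x) fun v hv =>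
        (hQs N).symm ▸ Submodule.mem_sup_left (Submodule.smul_mem_pointwise_smul _ _ _ hv)
    have hle : Q (N + 1) ≤ (x • (⊤ : Submodule R (M ⧸ W (N + 1)))).comap (W (N + 1)).mkQ := by
      rw [hQs]
      refine sup_le ?_ ?_
      · rintro _ ⟨w, -, rfl⟩
        exact smul_mem_smul_top_iff.2 ⟨(W (N + 1)).mkQ w, rfl⟩
      · intro w hw
        have : (W (N + 1)).mkQ w = 0 := (Submodule.Quotient.mk_eq_zero _).2 hw
        rw [Submodule.mem_comap, this]
        exact zero_mem _
    let G : (M ⧸ Q (N + 1)) →ₗ[R] QuotSMulTop x (M ⧸ W (N + 1)) := Submodule.mapQ _ _ _ hle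
    rw [mult_add xs _ _ _ F G ?_ ?_ ?_ (hPQ (N + 1)), ← hmW (N + 1)]
    · exact Int.add_le_add_right ih _
    · rw [injective_iff_map_eq_zero]
      intro v hv
      obtain ⟨v, rfl⟩ := Submodule.mkQ_surjective _ v
      exact (Submodule.Quotient.mk_eq_zero _).2 (hxQ N v ((Submodule.Quotient.mk_eq_zero _).1 hv))
    · intro v
      obtain ⟨v, rfl⟩ := Submodule.mkQ_surjective _ v
      obtain ⟨v, rfl⟩ := Submodule.mkQ_surjective _ v
      exact ⟨Submodule.mkQ _ v, rfl⟩
    · intro v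
      obtain ⟨v, rfl⟩ := Submodule.mkQ_surjective _ v
      constructor
      · intro hv
        have hv : (W (N + 1)).mkQ v ∈ x • (⊤ : Submodule R (M ⧸ W (N + 1))) :=
          (Submodule.Quotient.mk_eq_zero _).1 hv
        obtain ⟨w, hw⟩ := smul_mem_smul_top_iff.1 hv
        obtain ⟨w, rfl⟩ := Submodule.mkQ_surjective _ w
        refine ⟨Submodule.mkQ _ w, (Submodule.Quotient.eq _).2 ?_⟩
        refine hWQ (N + 1) ((Submodule.Quotient.eq _).1 ?_)
        exact hw
      · rintro ⟨w, hw⟩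
        obtain ⟨w, rfl⟩ := Submodule.mkQ_surjective _ w
        rw [← hw]
        exact (Submodule.Quotient.mk_eq_zero _).2 (smul_mem_smul_top_iff.2 ⟨Submodule.mkQ _ w, rfl⟩)

theorem sumIter_mult_le {M : Type u} [AddCommGroup M] [Module R M] [Module.Finite R M]
    {Z : Ideal R} {n : ℕ} (as : List R) : ∀ (xs : List R), (∀ y ∈ as ++ xs, y ∈ maximalIdeal R) →
    maximalIdeal R ^ n ≤ Module.annihilator R M ⊔ (Ideal.ofList (as ++ xs) ⊔ Z) → ∀ N : ℕ,
    sumIter as.length (fun m => mult (as.reverse ++ xs) (M ⧸ (Z ^ (m + 1) • (⊤ : Submodule R M)))) N ≤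
      mult xs (M ⧸ ((Ideal.ofList as ⊔ Z) ^ (N + 1) • (⊤ : Submodule R M))) := by
  induction as with
  | nil =>
    intro xs _ _ N
    rw [Ideal.ofList_nil, bot_sup_eq]
    exact le_rfl
  | cons a as ih =>
    intro xs hxs h N
    rw [Ideal.ofList_cons, sup_assoc]
    refine le_trans ?_ (sum_mult_le (x := a) (n := n) ?_ ?_ (N + 1))
    · rw [List.length_cons, sumIter]
      refine Finset.sum_le_sum fun m _ => ?_
      have := ih (a :: xs) (fun y hy => hxs y (by simp at hy ⊢; tauto)) (h.trans_eq (by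
        simp only [Ideal.ofList_cons, Ideal.ofList_append, List.cons_append]
        rw [sup_left_comm (Ideal.ofList as)])) m
      simpa using this
    · intro y hy; exact hxs y (by simp at hy ⊢; tauto)
    · refine h.trans_eq ?_
      simp only [Ideal.ofList_cons, Ideal.ofList_append, List.cons_append]
      ac_rfl

theorem mult_mul_choose_le {M : Type u} [AddCommGroup M] [Module R M] [Module.Finite R M]
    {as : List R} (h : Par as M) (N : ℕ) :
    mult as.reverse M * (N + as.length).choose as.length ≤
      len R (M ⧸ ((Ideal.ofList as) ^ (N + 1) • (⊤ : Submodule R M))) := by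
  obtain ⟨h1, n, hn⟩ := h
  have h2 := sumIter_mult_le (M := M) (Z := ⊥) (n := n) as [] (by simpa using h1) (by simpa using hn) N
  rw [mult, sup_bot_eq, List.append_nil] at h2
  refine le_trans (le_of_eq ?_) h2
  have h3 (m : ℕ) : mult as.reverse (M ⧸ ((⊥ : Ideal R) ^ (m + 1) • (⊤ : Submodule R M))) =
      mult as.reverse M := by
    refine (mult_congr (Submodule.quotEquivOfEqBot _ ?_).symm ?_).symm
    · rw [← Ideal.zero_eq_bot, zero_pow (Nat.succ_ne_zero m), Ideal.zero_eq_bot, Submodule.bot_smul]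
    · refine Par.quotient_pow (n := n) (by simpa using h1) ?_ _
      rw [sup_bot_eq]
      refine hn.trans_eq ?_
      rw [show Ideal.ofList as.reverse = Ideal.ofList as by simp [Ideal.ofList]]
  rw [show (fun m => mult (as.reverse) (M ⧸ ((⊥ : Ideal R) ^ (m + 1) • (⊤ : Submodule R M)))) =
    fun _ => mult as.reverse M from funext h3]
  have h4 := sumIter_choose as.length 0 N
  simp only [add_zero, Nat.choose_zero_right, Nat.cast_one, zero_add] at h4
  rw [← h4, ← sumIter_mul, mul_one]

/-- The isomorphism between `(X / xX) / y(X / xX)` and `(X / yX) / x(X / yX)`. -/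
noncomputable def quotSMulTopSwap (x y : R) (X : Type u) [AddCommGroup X] [Module R X] :
    QuotSMulTop y (QuotSMulTop x X) ≃ₗ[R] QuotSMulTop x (QuotSMulTop y X) :=
  have key (x y : R) : (y • (⊤ : Submodule R (QuotSMulTop x X))).comap (x • (⊤ : Submodule R X)).mkQ =
      x • (⊤ : Submodule R X) ⊔ y • (⊤ : Submodule R X) := by
    have : y • (⊤ : Submodule R (QuotSMulTop x X)) = (y • ⊤ : Submodule R X).map (x • ⊤ : Submodule R X).mkQ := by
      rw [Submodule.map_pointwise_smul, Submodule.map_top, Submodule.range_mkQ]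
    rw [this, Submodule.comap_map_eq, Submodule.ker_mkQ, sup_comm]
  have hk (x y : R) : LinearMap.ker ((y • (⊤ : Submodule R (QuotSMulTop x X))).mkQ ∘ₗ
      (x • (⊤ : Submodule R X)).mkQ) = x • (⊤ : Submodule R X) ⊔ y • (⊤ : Submodule R X) := by
    rw [LinearMap.ker_comp, Submodule.ker_mkQ, key]
  have hs (x y : R) : Function.Surjective ((y • (⊤ : Submodule R (QuotSMulTop x X))).mkQ ∘ₗ
      (x • (⊤ : Submodule R X)).mkQ) :=
    (Submodule.mkQ_surjective _).comp (Submodule.mkQ_surjective _)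
  (LinearMap.quotKerEquivOfSurjective _ (hs x y)).symm ≪≫ₗ
    Submodule.quotEquivOfEq _ _ ((hk x y).trans (sup_comm _ _ |>.trans (hk y x).symm)) ≪≫ₗ
      LinearMap.quotKerEquivOfSurjective _ (hs y x)

theorem mult_torsionBy_quotSMulTop {x y : R} {l : List R} {X : Type u} [AddCommGroup X] [Module R X]
    [Module.Finite R X] (h : Par (x :: y :: l) X) (h' : Par (y :: x :: l) X)
    (hx : ∀ v : X, x • v = 0 → v = 0) (hy : ∀ v : X, y • v = 0 → v = 0) :
    mult l (Submodule.torsionBy R (QuotSMulTop x X) y) =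
      mult l (Submodule.torsionBy R (QuotSMulTop y X) x) := by
  let S := QuotSMulTop (x * y) X
  have key (x y : R) (hP : Par l (Submodule.torsionBy R (QuotSMulTop x X) y))
      (hy : ∀ v : X, y • v = 0 → v = 0) (B : Submodule R X) (hB : B = (x * y) • (⊤ : Submodule R X)) :
      mult l (Submodule.torsionBy R (QuotSMulTop x X) y) =
        mult l ((x • ⊤ : Submodule R (X ⧸ B)) ⊓ y • ⊤ : Submodule R (X ⧸ B)) := by
    subst hB
    let F : QuotSMulTop x X →ₗ[R] QuotSMulTop (x * y) X :=
      Submodule.mapQ _ _ (LinearMap.lsmul R X y) (by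
        intro v hv
        obtain ⟨w, rfl⟩ := smul_mem_smul_top_iff.1 hv
        exact smul_mem_smul_top_iff.2 ⟨w, by simp [mul_smul, smul_comm x y]⟩)
    have hF : Function.Injective F := by
      rw [injective_iff_map_eq_zero]
      intro v hv
      obtain ⟨v, rfl⟩ := Submodule.mkQ_surjective _ v
      obtain ⟨w, hw⟩ := (mkQ_smul_top_eq_zero_iff (x * y) (y • v)).1 hv
      refine (mkQ_smul_top_eq_zero_iff _ _).2 ⟨w, ?_⟩
      rw [← sub_eq_zero]
      apply hy
      rw [smul_sub, ← hw, smul_smul, mul_comm, sub_self]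
    have hmap : (Submodule.torsionBy R (QuotSMulTop x X) y).map F = x • ⊤ ⊓ y • ⊤ := by
      ext v
      obtain ⟨v, rfl⟩ := Submodule.mkQ_surjective _ v
      rw [Submodule.mem_inf, smul_mem_smul_top_iff, smul_mem_smul_top_iff]
      constructor
      · rintro ⟨w, hw, hwv⟩
        obtain ⟨w, rfl⟩ := Submodule.mkQ_surjective _ w
        obtain ⟨t, ht⟩ := (mkQ_smul_top_eq_zero_iff x (y • w)).1 hw
        rw [← hwv]
        refine ⟨⟨Submodule.mkQ _ t, ?_⟩, ⟨Submodule.mkQ _ w, rfl⟩⟩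
        rw [← map_smul, ht]; rfl
      · rintro ⟨⟨t, ht⟩, w, hw⟩
        obtain ⟨w, rfl⟩ := Submodule.mkQ_surjective _ w
        obtain ⟨t, rfl⟩ := Submodule.mkQ_surjective _ t
        refine ⟨Submodule.mkQ _ w, ?_, hw⟩
        refine (mkQ_smul_top_eq_zero_iff x (y • w)).2 ?_
        have := (mkQ_smul_top_eq_zero_iff (x * y) (y • w - x • t)).1
          (by rw [map_sub, map_smul, map_smul, hw, ht, sub_self])
        obtain ⟨u, hu⟩ := this
        exact ⟨y • u + t, by rw [smul_add, smul_smul, hu]; abel⟩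
    let e := (Submodule.equivMapOfInjective F hF (Submodule.torsionBy R (QuotSMulTop x X) y)).trans
      (LinearEquiv.ofEq _ _ hmap)
    exact (mult_congr e.symm hP).symm
  rw [key x y h.tail.torsionBy hy _ rfl, key y x h'.tail.torsionBy hx _ (by rw [mul_comm]), inf_comm]

/-- Exchange of the first two elements. -/
theorem mult_swap (x y : R) (l : List R) (X : Type u) [AddCommGroup X] [Module R X]
    [Module.Finite R X] (h : Par (x :: y :: l) X) (h' : Par (y :: x :: l) X) :
    mult (x :: y :: l) X = mult (y :: x :: l) X := by
  induction ‹Module.Finite R X› using IsNoetherianRing.induction_on_isQuotientEquivQuotientPrime R with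
  | subsingleton N => rw [mult_subsingleton, mult_subsingleton]
  | exact N₁ N₂ N₃ f g hf hg hfg h₁ h₃ =>
    rw [mult_add _ _ _ _ f g hf hg hfg h, mult_add _ _ _ _ f g hf hg hfg h',
      h₁ (h.of_injective f hf) (h'.of_injective f hf), h₃ (h.of_surjective g hg) (h'.of_surjective g hg)]
  | quotient N p f =>
    have hp := h.of_surjective f.toLinearMap f.surjective
    have hp' := h'.of_surjective f.toLinearMap f.surjective
    rw [mult_congr f hp, mult_congr f hp']
    by_cases hx : x ∈ p.1
    · rw [mult_eq_zero_of_smul _ _ x (by simp) (smul_quotient_of_mem hx) hp,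
        mult_eq_zero_of_smul _ _ x (by simp) (smul_quotient_of_mem hx) hp']
    by_cases hy : y ∈ p.1
    · rw [mult_eq_zero_of_smul _ _ y (by simp) (smul_quotient_of_mem hy) hp,
        mult_eq_zero_of_smul _ _ y (by simp) (smul_quotient_of_mem hy) hp']
    have hsx := torsionBy_quotient_prime p.2 hx
    have hsy := torsionBy_quotient_prime p.2 hy
    have hreg {z : R} (hz : Subsingleton (Submodule.torsionBy R (R ⧸ p.1) z)) {v : R ⧸ p.1}
        (hv : z • v = 0) : v = 0 :=
      congrArg Subtype.val (Subsingleton.elim (⟨v, hv⟩ : Submodule.torsionBy R (R ⧸ p.1) z) 0)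
    rw [mult, mult_subsingleton (y :: l) (Submodule.torsionBy R (R ⧸ p.1) x), sub_zero, mult,
      mult, mult_subsingleton (x :: l) (Submodule.torsionBy R (R ⧸ p.1) y), sub_zero, mult]
    have e := mult_torsionBy_quotSMulTop hp hp' (fun v hv => hreg hsx hv) fun v hv => hreg hsy hv
    have e' := mult_congr (xs := l) (quotSMulTopSwap x y (R ⧸ p.1)) (Par.tail (Par.tail hp'))
    rw [e, e']

theorem Par.perm {xs ys : List R} (hp : xs.Perm ys) {X : Type u} [AddCommGroup X] [Module R X]
    (h : Par xs X) : Par ys X := by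
  obtain ⟨h1, n, hn⟩ := h
  refine ⟨fun y hy => h1 y (hp.mem_iff.2 hy), n, hn.trans_eq ?_⟩
  simp only [Ideal.ofList, hp.mem_iff]

theorem mult_perm {xs ys : List R} (hp : xs.Perm ys) : ∀ (X : Type u) [AddCommGroup X] [Module R X]
    [Module.Finite R X], Par xs X → mult xs X = mult ys X := by
  induction hp with
  | nil => intros; rfl
  | cons x _ ih => intro X _ _ _ h; rw [mult, mult, ih _ h.tail, ih _ h.torsionBy]
  | swap x y l => intro X _ _ _ h; exact mult_swap _ _ _ _ h (h.perm (List.Perm.swap x y l))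
  | trans h1 h2 ih1 ih2 => intro X _ _ _ h; rw [ih1 X h, ih2 X (h.perm h1)]

end LowerBounds

section Polynomials

/-- The functions that eventually agree with a polynomial of degree less than `j`. -/
def EvPoly : ℕ → (ℕ → ℤ) → Prop
  | 0, H => ∃ N, ∀ n ≥ N, H n = 0
  | j + 1, H => EvPoly j fun n => H (n + 1) - H n

theorem EvPoly.congr {j : ℕ} : ∀ {H H' : ℕ → ℤ}, EvPoly j H → (∃ N, ∀ n ≥ N, H n = H' n) →
    EvPoly j H' := by
  induction j with
  | zero =>
    rintro H H' ⟨N, hN⟩ ⟨N', hN'⟩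
    exact ⟨max N N', fun n hn => by rw [← hN' n (le_of_max_le_right hn), hN n (le_of_max_le_left hn)]⟩
  | succ j ih =>
    rintro H H' h ⟨N, hN⟩
    exact ih (H := fun n => H (n + 1) - H n) h
      ⟨N, fun n hn => by rw [hN n hn, hN _ (Nat.le_succ_of_le hn)]⟩

theorem EvPoly.sub {j : ℕ} : ∀ {H H' : ℕ → ℤ}, EvPoly j H → EvPoly j H' →
    EvPoly j (fun n => H n - H' n) := by
  induction j with
  | zero =>
    rintro H H' ⟨N, hN⟩ ⟨N', hN'⟩
    exact ⟨max N N', fun n hn => by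
      change H n - H' n = 0
      rw [hN' n (le_of_max_le_right hn), hN n (le_of_max_le_left hn), sub_zero]⟩
  | succ j ih =>
    intro H H' h h'
    exact (ih (H := fun n => H (n + 1) - H n) (H' := fun n => H' (n + 1) - H' n) h h').congr
      ⟨0, fun n _ => by ring⟩

theorem EvPoly.shift {j : ℕ} : ∀ {H : ℕ → ℤ}, EvPoly j H → EvPoly j (fun n => H (n + 1)) := by
  induction j with
  | zero => exact fun ⟨N, hN⟩ => ⟨N, fun n hn => hN _ (Nat.le_succ_of_le hn)⟩
  | succ j ih => exact fun h => ih (H := fun n => _) h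

theorem choose_succ_sub (n k : ℕ) : (((n + 1) + (k + 1)).choose (k + 1) : ℤ) =
    (n + (k + 1)).choose (k + 1) + ((n + 1) + k).choose k := by
  rw [show n + 1 + (k + 1) = (n + k + 1) + 1 by ring, Nat.choose_succ_succ,
    show n + (k + 1) = n + k + 1 by ring, show n + 1 + k = n + k + 1 by ring]
  push_cast; ring

theorem EvPoly.exists_sum {d : ℕ} : ∀ {H : ℕ → ℤ}, EvPoly (d + 1) H →
    ∃ c : ℕ → ℤ, ∃ N, ∀ n ≥ N, H n = ∑ k ∈ Finset.range (d + 1), c k * (n + k).choose k := by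
  induction d with
  | zero =>
    rintro H ⟨N, hN⟩
    refine ⟨fun _ => H N, N, fun n hn => ?_⟩
    simp only [zero_add, Finset.sum_range_one, add_zero, Nat.choose_zero_right, Nat.cast_one, mul_one]
    induction n, hn using Nat.le_induction with
    | base => rfl
    | succ n hn ih =>
      rw [← ih, ← sub_eq_zero]
      exact hN n hn
  | succ d ih =>
    intro H h
    obtain ⟨c, N, hN⟩ := ih (H := fun n => H (n + 1) - H n) h
    set b : ℕ → ℤ := fun k => c k - (if k = d then 0 else c (k + 1)) with hb
    have hshift (n : ℕ) : ∑ k ∈ Finset.range (d + 1), c k * ((n + k).choose k : ℤ) =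
        ∑ k ∈ Finset.range (d + 1), b k * ((n + 1) + k).choose k := by
      have e1 : ∑ k ∈ Finset.range (d + 1), b k * (((n + 1) + k).choose k : ℤ) =
          ∑ k ∈ Finset.range (d + 1), c k * (((n + 1) + k).choose k : ℤ) -
          ∑ k ∈ Finset.range d, c (k + 1) * (((n + 1) + k).choose k : ℤ) := by
        rw [Finset.sum_range_succ (fun k => b k * _), Finset.sum_range_succ (fun k => c k * _)]
        have : ∑ k ∈ Finset.range d, b k * (((n + 1) + k).choose k : ℤ) =
            ∑ k ∈ Finset.range d, (c k * (((n + 1) + k).choose k : ℤ) -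
              c (k + 1) * (((n + 1) + k).choose k : ℤ)) := by
          refine Finset.sum_congr rfl fun k hk => ?_
          rw [hb]; simp only [if_neg (Finset.mem_range.1 hk).ne]; ring
        rw [this, Finset.sum_sub_distrib, hb]
        simp only [if_true]; ring
      rw [e1, Finset.sum_range_succ' (fun k => c k * (((n + 1) + k).choose k : ℤ)),
        Finset.sum_range_succ' (fun k => c k * ((n + k).choose k : ℤ))]
      simp only [choose_succ_sub, mul_add, Finset.sum_add_distrib]
      simp only [Nat.choose_zero_right]
      ring
    let G : ℕ → ℤ := fun n => ∑ k ∈ Finset.range (d + 1), b k * (n + (k + 1)).choose (k + 1)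
    refine ⟨fun k => Nat.casesOn k (H N - G N) b, N, fun n hn => ?_⟩
    rw [Finset.sum_range_succ']
    simp only [add_zero, Nat.choose_zero_right, Nat.cast_one, mul_one]
    change H n = G n + (H N - G N)
    induction n, hn using Nat.le_induction with
    | base => ring
    | succ n hn ih =>
      have h1 : H (n + 1) - H n = G (n + 1) - G n := by
        have h2 := hN n hn
        change H (n + 1) - H n = _ at h2
        rw [h2, hshift, ← Finset.sum_sub_distrib]
        refine Finset.sum_congr rfl fun k _ => ?_
        rw [choose_succ_sub]; ring
      linarith

theorem EvPoly.exists_hilb {d : ℕ} {H : ℕ → ℤ} (h : EvPoly (d + 1) H) :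
    ∃ e : ℕ → ℤ, ∃ N, ∀ n ≥ N, H n =
      ∑ i ∈ Finset.range (d + 1), (-1) ^ i * e i * ((n + d - i).choose (d - i) : ℤ) := by
  obtain ⟨c, N, hN⟩ := h.exists_sum
  refine ⟨fun i => (-1) ^ i * c (d - i), N, fun n hn => ?_⟩
  rw [hN n hn, ← Finset.sum_range_reflect]
  refine Finset.sum_congr rfl fun i hi => ?_
  have hi' := Finset.mem_range.1 hi
  rw [← mul_assoc, ← mul_pow, show d + 1 - 1 - i = d - i by omega,
    show n + (d - i) = n + d - i by omega]
  simp

/-- The leading coefficient of an eventually nonnegative polynomial is nonnegative. -/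
theorem leading_nonneg {d : ℕ} {c : ℕ → ℤ} {N : ℕ}
    (h : ∀ n ≥ N, 0 ≤ ∑ i ∈ Finset.range (d + 1), c i * ((n + d - i).choose (d - i) : ℤ)) :
    0 ≤ c 0 := by
  rcases d with _ | d
  · simpa using h N le_rfl
  by_contra hc
  set C : ℤ := ∑ i ∈ Finset.range (d + 1), |c (i + 1)| with hC
  have hC0 : 0 ≤ C := Finset.sum_nonneg fun _ _ => abs_nonneg _
  obtain ⟨n, hn, hnC⟩ : ∃ n ≥ N, C * (d + 1) < n := by
    refine ⟨max N (C * (d + 1) + 1).toNat, le_max_left _ _, ?_⟩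
    have h1 : C * (d + 1) + 1 ≤ ((C * (d + 1) + 1).toNat : ℤ) := Int.self_le_toNat _
    have h2 : ((C * (d + 1) + 1).toNat : ℤ) ≤ (max N (C * (d + 1) + 1).toNat : ℕ) :=
      Int.ofNat_le.2 (le_max_right _ _)
    linarith
  have h1 := h n hn
  rw [Finset.sum_range_succ'] at h1
  have h2 : ∑ i ∈ Finset.range (d + 1), c (i + 1) * ((n + (d + 1) - (i + 1)).choose (d + 1 - (i + 1)) : ℤ)
      ≤ C * (n + d).choose d := by
    rw [hC, Finset.sum_mul]
    refine Finset.sum_le_sum fun i hi => ?_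
    have hi' := Finset.mem_range.1 hi
    refine (mul_le_mul_of_nonneg_right (le_abs_self _) (by positivity)).trans
      (mul_le_mul_of_nonneg_left (Int.ofNat_le.2 ?_) (abs_nonneg _))
    rw [show n + (d + 1) - (i + 1) = n + (d - i) by omega, show d + 1 - (i + 1) = d - i by omega,
      ← Nat.choose_symm_add, ← Nat.choose_symm_add (b := d)]
    exact Nat.choose_le_choose _ (by omega)
  have h3 : ((n + (d + 1)).choose (d + 1) : ℤ) * (d + 1) = (n + d + 1) * (n + d).choose d := by
    have := Nat.add_one_mul_choose_eq (n + d) d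
    rw [show n + (d + 1) = n + d + 1 by ring]
    exact_mod_cast this.symm
  have h4 : (0 : ℤ) < (n + d).choose d := by exact_mod_cast Nat.choose_pos (Nat.le_add_left d n)
  simp only [Nat.sub_zero] at h1
  have h5 : 0 ≤ C * (n + d).choose d - (n + (d + 1)).choose (d + 1) := by
    have : c 0 * ((n + (d + 1)).choose (d + 1) : ℤ) ≤ -1 * (n + (d + 1)).choose (d + 1) :=
      mul_le_mul_of_nonneg_right (by omega) (by positivity)
    linarith
  have h6 : 0 ≤ (C * (d + 1) - (n + d + 1)) * ((n + d).choose d : ℤ) := by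
    have := mul_nonneg h5 (by positivity : (0 : ℤ) ≤ d + 1)
    rw [sub_mul, h3] at this
    linarith
  have h7 := nonneg_of_mul_nonneg_left h6 h4
  have : (0 : ℤ) ≤ d := by positivity
  linarith

/-- The first two coefficients of an eventually nonnegative polynomial. -/
theorem second_nonneg {d : ℕ} {c : ℕ → ℤ} {N : ℕ}
    (h : ∀ n ≥ N, 0 ≤ ∑ i ∈ Finset.range (d + 1 + 1), c i * ((n + (d + 1) - i).choose (d + 1 - i) : ℤ))
    (hc : c 0 = 0) : 0 ≤ c 1 := by
  refine leading_nonneg (d := d) (c := fun i => c (i + 1)) (N := N) fun n hn => ?_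
  refine (h n hn).trans_eq ?_
  rw [Finset.sum_range_succ', hc, zero_mul, add_zero]
  refine Finset.sum_congr rfl fun i _ => ?_
  rw [show n + (d + 1) - (i + 1) = n + d - i by omega, show d + 1 - (i + 1) = d - i by omega]

end Polynomials

section Existence
variable {R : Type u} [CommRing R] {M : Type u} [AddCommGroup M] [Module R M]

theorem isFiniteLength_quotient_of_le {A B : Submodule R M} (h : A ≤ B)
    (hA : IsFiniteLength R (M ⧸ A)) : IsFiniteLength R (M ⧸ B) :=
  hA.of_surjective (Submodule.factor_surjective h)

theorem len_quotient_submodule {A B : Submodule R M} (h : A ≤ B) (hA : IsFiniteLength R (M ⧸ A)) :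
    len R (M ⧸ A) = len R (B.map A.mkQ) + len R (M ⧸ B) := by
  refine len_add (f := (B.map A.mkQ).subtype) (g := Submodule.factor h) (Submodule.subtype_injective _)
    (Submodule.factor_surjective h) ?_ hA
  rw [LinearMap.exact_iff, Submodule.range_subtype]
  ext v
  obtain ⟨v, rfl⟩ := A.mkQ_surjective v
  rw [LinearMap.mem_ker]
  constructor
  · intro hv
    exact ⟨v, (Submodule.Quotient.mk_eq_zero B).1 hv, rfl⟩
  · rintro ⟨w, hw, hwv⟩
    rw [← hwv]
    exact (Submodule.Quotient.mk_eq_zero B).2 hw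

theorem len_quotient_add_len_quotient (f : M →ₗ[R] M) {F G : Submodule R M}
    (hF : IsFiniteLength R (M ⧸ F)) (hG : IsFiniteLength R (M ⧸ G)) :
    IsFiniteLength R (M ⧸ (F ⊓ G.comap f)) ∧
    len R (M ⧸ G) + len R (M ⧸ F) = len R (M ⧸ (G ⊔ F.map f)) + len R (M ⧸ (F ⊓ G.comap f)) := by
  have hfl : IsFiniteLength R (M ⧸ (F ⊓ G.comap f)) := by
    let g : M →ₗ[R] (M ⧸ F) × (M ⧸ G) := F.mkQ.prod (G.mkQ ∘ₗ f)
    have hk : LinearMap.ker g = F ⊓ G.comap f := by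
      rw [LinearMap.ker_prod, Submodule.ker_mkQ, LinearMap.ker_comp, Submodule.ker_mkQ]
    rw [← hk]
    have hp : IsFiniteLength R ((M ⧸ F) × (M ⧸ G)) := by
      rw [isFiniteLength_iff_isNoetherian_isArtinian] at hF hG ⊢
      obtain ⟨_, _⟩ := hF
      obtain ⟨_, _⟩ := hG
      exact ⟨inferInstance, inferInstance⟩
    exact hp.of_injective (LinearMap.ker_eq_bot.1 (Submodule.ker_liftQ_eq_bot _ g le_rfl le_rfl))
  refine ⟨hfl, ?_⟩
  have h1 := len_quotient_submodule (A := F ⊓ G.comap f) inf_le_left hfl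
  have h2 := len_quotient_submodule (A := G) (B := G ⊔ F.map f) le_sup_left hG
  have e : F.map (F ⊓ G.comap f).mkQ ≃ₗ[R] (G ⊔ F.map f).map G.mkQ := by
    let g : (M ⧸ (F ⊓ G.comap f)) →ₗ[R] M ⧸ G := Submodule.mapQ _ _ f inf_le_right
    have hg : Submodule.map g (F.map (F ⊓ G.comap f).mkQ) = (G ⊔ F.map f).map G.mkQ := by
      rw [Submodule.map_sup, show Submodule.map G.mkQ G = ⊥ by simp, bot_sup_eq,
        ← Submodule.map_comp, ← Submodule.map_comp]
      rfl
    let g' : F.map (F ⊓ G.comap f).mkQ →ₗ[R] M ⧸ G := g.domRestrict _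
    have hinj : Function.Injective g' := by
      rw [injective_iff_map_eq_zero]
      rintro ⟨v, w, hw, rfl⟩ hv
      refine Subtype.ext ((Submodule.Quotient.mk_eq_zero _).2 ⟨hw, ?_⟩)
      exact (Submodule.Quotient.mk_eq_zero G).1 hv
    refine (LinearEquiv.ofInjective g' hinj).trans (LinearEquiv.ofEq _ _ ?_)
    rw [← hg, LinearMap.range_domRestrict]
  have h3 := len_congr e
  omega

theorem evPoly_len {q : Ideal R} [IsNoetherianRing R] [Module.Finite R M] (as : List R) (hq : q = Ideal.ofList as) :
    ∀ (j : ℕ) (F G : q.Filtration M), F.Stable → (∀ k, G.N k ≤ F.N k) →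
    (∀ k, IsFiniteLength R (M ⧸ G.N k)) → (∀ a ∈ as.drop j, ∀ k, ∀ v ∈ F.N k, a • v ∈ G.N (k + 1)) →
    EvPoly j fun k => (len R (M ⧸ G.N k) : ℤ) - len R (M ⧸ F.N k) := by
  intro j
  induction j with
  | zero =>
    intro F G hF hGF hG ha
    obtain ⟨n, hn⟩ := hF
    refine ⟨n + 1, fun k hk => ?_⟩
    obtain ⟨k, rfl⟩ := Nat.exists_eq_succ_of_ne_zero (by omega : k ≠ 0)
    have : G.N (k + 1) = F.N (k + 1) := by
      refine le_antisymm (hGF _) ?_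
      rw [← hn k (by omega), Submodule.smul_le]
      intro r hr v hv
      replace hr : r ∈ Ideal.span {x | x ∈ as} := by rwa [hq] at hr
      induction hr using Submodule.span_induction with
      | mem x h => exact ha x (by simpa using h) k v hv
      | zero => rw [zero_smul]; exact Submodule.zero_mem _
      | add x y _ _ hx hy => rw [add_smul]; exact Submodule.add_mem _ hx hy
      | smul a x _ hx => rw [smul_assoc]; exact Submodule.smul_mem _ _ hx
    change (len R (M ⧸ G.N (k + 1)) : ℤ) - len R (M ⧸ F.N (k + 1)) = 0
    rw [this, sub_self]
  | succ j ih =>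
    intro F G hFs hGF hG ha
    have hFfl (k) := isFiniteLength_quotient_of_le (hGF k) (hG k)
    by_cases hj : j < as.length
    swap
    · refine EvPoly.congr (j := j) ((ih F G hFs hGF hG ?_).shift.sub (ih F G hFs hGF hG ?_)) ⟨0, fun n _ => rfl⟩ <;>
      · intro a h
        rw [List.drop_eq_nil_of_le (by omega)] at h
        simp at h
    set a := as[j] with haj
    have haq : a ∈ q := hq ▸ Ideal.subset_span (List.getElem_mem hj)
    have hdrop : as.drop j = a :: as.drop (j + 1) := List.drop_eq_getElem_cons hj
    let f := LinearMap.lsmul R M a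
    let F' : q.Filtration M :=
      { N := fun k => F.N k ⊓ (G.N (k + 1)).comap f
        mono := fun k => inf_le_inf (F.mono k) (Submodule.comap_mono (G.mono (k + 1)))
        smul_le := fun k => by
          refine Submodule.smul_le.2 fun r hr v hv => ⟨?_, ?_⟩
          · exact F.smul_le k (Submodule.smul_mem_smul hr hv.1)
          · change a • r • v ∈ G.N (k + 1 + 1)
            rw [smul_comm]
            exact G.smul_le (k + 1) (Submodule.smul_mem_smul hr hv.2) }
    let G' : q.Filtration M :=
      { N := fun k => G.N k ⊔ (F.N (k - 1)).map f
        mono := fun k => sup_le_sup (G.mono _) (Submodule.map_mono (F.antitone (by omega)))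
        smul_le := fun k => by
          rw [Submodule.smul_sup, ← Submodule.map_smul'']
          refine sup_le_sup (G.smul_le _) (Submodule.map_mono ?_)
          cases k with
          | zero => exact Submodule.smul_le_right
          | succ k => exact F.smul_le k }
    have key (k) := len_quotient_add_len_quotient f (hFfl k) (hG (k + 1))
    have h1 : EvPoly j fun k => (len R (M ⧸ G'.N k) : ℤ) - len R (M ⧸ F.N k) := by
      refine ih F G' hFs (fun k => sup_le (hGF k) ?_)
        (fun k => isFiniteLength_quotient_of_le le_sup_left (hG k)) ?_
      · rintro _ ⟨v, hv, rfl⟩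
        cases k with
        | zero => exact Submodule.smul_mem _ _ hv
        | succ k => exact F.smul_le k (Submodule.smul_mem_smul haq hv)
      · intro y hy k v hv
        rw [hdrop, List.mem_cons] at hy
        rcases hy with rfl | hy
        · exact Submodule.mem_sup_right ⟨v, hv, rfl⟩
        · exact Submodule.mem_sup_left (ha y hy k v hv)
    have h2 : EvPoly j fun k => (len R (M ⧸ G.N k) : ℤ) - len R (M ⧸ F'.N k) := by
      refine ih F' G (hFs.of_le fun k => inf_le_left) (fun k v hv => ⟨hGF k hv, ?_⟩) hG ?_
      · exact G.smul_le k (Submodule.smul_mem_smul haq hv)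
      · intro y hy k v hv
        rw [hdrop, List.mem_cons] at hy
        rcases hy with rfl | hy
        · exact hv.2
        · exact ha y hy k v hv.1
    refine EvPoly.congr (j := j) (h1.shift.sub h2) ⟨0, fun k _ => ?_⟩
    have h3 := (key k).2
    change ((len R (M ⧸ (G.N (k + 1) ⊔ (F.N k).map f)) : ℤ) - len R (M ⧸ F.N (k + 1))) -
      (len R (M ⧸ G.N k) - len R (M ⧸ (F.N k ⊓ (G.N (k + 1)).comap f))) =
      ((len R (M ⧸ G.N (k + 1)) : ℤ) - len R (M ⧸ F.N (k + 1))) - (len R (M ⧸ G.N k) - len R (M ⧸ F.N k))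
    omega

/-- Existence of the Hilbert polynomial of an ideal that is integral over an ideal generated by
`as`. -/
theorem exists_hilb_of_pow_le [IsNoetherianRing R] (as : List R) {I : Ideal R}
    (hle : Ideal.ofList as ≤ I) (hI : ∀ k, I ^ (k + 1) ≤ Ideal.ofList as ^ k)
    (hfl : ∀ k, IsFiniteLength R (R ⧸ I ^ k)) :
    ∃ e : ℕ → ℤ, ∃ N, ∀ n ≥ N, (len R (R ⧸ I ^ (n + 1)) : ℤ) = ∑ i ∈ Finset.range (as.length + 1),
      (-1) ^ i * e i * ((n + as.length - i).choose (as.length - i) : ℤ) := by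
  set q := Ideal.ofList as with hq
  let S : q.Filtration R :=
    { N := fun k => q ^ (k - 1)
      mono := fun k => Ideal.pow_le_pow_right (by omega)
      smul_le := fun k => by
        rw [smul_eq_mul, ← pow_succ']
        exact Ideal.pow_le_pow_right (by omega) }
  have hS : S.Stable := ⟨1, fun n hn => by
    change q • q ^ (n - 1) = q ^ (n + 1 - 1)
    rw [smul_eq_mul, ← pow_succ']; congr 1; omega⟩
  let F : q.Filtration R :=
    { N := fun k => I ^ k
      mono := fun k => Ideal.pow_le_pow_right (by omega)
      smul_le := fun k => by
        rw [smul_eq_mul, pow_succ']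
        exact Ideal.mul_mono_left hle }
  let G : q.Filtration R :=
    { N := fun k => I ^ (k + 1)
      mono := fun k => Ideal.pow_le_pow_right (by omega)
      smul_le := fun k => by
        rw [smul_eq_mul, pow_succ' I (k + 1)]
        exact Ideal.mul_mono_left hle }
  have hF : F.Stable := hS.of_le fun k => by
    change I ^ k ≤ q ^ (k - 1)
    cases k with
    | zero => simp
    | succ k => exact hI k
  have h := evPoly_len as hq as.length F G hF (fun k => Ideal.pow_le_pow_right (by omega))
    (fun k => hfl _) (by simp)
  refine EvPoly.exists_hilb (H := fun n => (len R (R ⧸ I ^ (n + 1)) : ℤ)) ?_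
  exact EvPoly.congr (j := as.length) h.shift ⟨0, fun n _ => rfl⟩

end Existence

section ExtTools
variable {R : Type u} [CommRing R]

/-- `Ext` modules of two modules. -/
abbrev EExt (N X : Type u) [AddCommGroup N] [Module R N] [AddCommGroup X] [Module R X] (k : ℕ) :
    Type u :=
  Abelian.Ext.{u} (ModuleCat.of R N) (ModuleCat.of R X) k

variable {N N' N'' X Y Z : Type u} [AddCommGroup N] [Module R N] [AddCommGroup N'] [Module R N']
  [AddCommGroup N''] [Module R N''] [AddCommGroup X] [Module R X] [AddCommGroup Y] [Module R Y]
  [AddCommGroup Z] [Module R Z]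

/-- Covariant functoriality of `Ext`. -/
noncomputable def extPost (N : Type u) [AddCommGroup N] [Module R N] (g : X →ₗ[R] Y) (k : ℕ) :
    EExt (R := R) N X k →ₗ[R] EExt (R := R) N Y k where
  toFun α := α.comp (Abelian.Ext.mk₀ (ModuleCat.ofHom g)) (add_zero k)
  map_add' _ _ := Abelian.Ext.add_comp _ _ _ _
  map_smul' _ _ := Abelian.Ext.smul_comp _ _ _ _

/-- Contravariant functoriality of `Ext`. -/
noncomputable def extPre (X : Type u) [AddCommGroup X] [Module R X] (g : N →ₗ[R] N') (k : ℕ) :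
    EExt (R := R) N' X k →ₗ[R] EExt (R := R) N X k where
  toFun α := (Abelian.Ext.mk₀ (ModuleCat.ofHom g)).comp α (zero_add k)
  map_add' _ _ := Abelian.Ext.comp_add _ _ _ _
  map_smul' _ _ := Abelian.Ext.comp_smul _ _ _ _

theorem extPost_comp (f : X →ₗ[R] Y) (g : Y →ₗ[R] Z) (k : ℕ) (α : EExt (R := R) N X k) :
    extPost N g k (extPost N f k α) = extPost N (g ∘ₗ f) k α := by
  change (α.comp _ (add_zero k)).comp _ (add_zero k) = α.comp _ (add_zero k)
  rw [Abelian.Ext.comp_assoc_of_second_deg_zero, Abelian.Ext.mk₀_comp_mk₀]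
  rfl

theorem extPost_smul_id (r : R) (k : ℕ) (α : EExt (R := R) N X k) :
    extPost N (LinearMap.lsmul R X r) k α = r • α := by
  have : ModuleCat.ofHom (LinearMap.lsmul R X r) = r • 𝟙 (ModuleCat.of R X) := rfl
  change α.comp (Abelian.Ext.mk₀ (ModuleCat.ofHom (LinearMap.lsmul R X r))) (add_zero k) = _
  rw [this, Abelian.Ext.mk₀_smul, Abelian.Ext.comp_smul, Abelian.Ext.comp_mk₀_id]

theorem extPre_smul_id (r : R) (k : ℕ) (α : EExt (R := R) N X k) :
    extPre X (LinearMap.lsmul R N r) k α = r • α := by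
  have : ModuleCat.ofHom (LinearMap.lsmul R N r) = r • 𝟙 (ModuleCat.of R N) := rfl
  change (Abelian.Ext.mk₀ (ModuleCat.ofHom (LinearMap.lsmul R N r))).comp α (zero_add k) = _
  rw [this, Abelian.Ext.mk₀_smul, Abelian.Ext.smul_comp, Abelian.Ext.mk₀_id_comp]

/-- The covariant long exact sequence. -/
theorem exists_extPost_delta (N : Type u) [AddCommGroup N] [Module R N] {f : X →ₗ[R] Y} {g : Y →ₗ[R] Z}
    (hf : Function.Injective f) (hg : Function.Surjective g) (hfg : Function.Exact f g) (k : ℕ) :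
    ∃ δ : EExt (R := R) N Z k →ₗ[R] EExt (R := R) N X (k + 1),
      (∀ γ, δ γ = 0 → ∃ β, extPost N g k β = γ) ∧
      (∀ α, extPost N f (k + 1) α = 0 → ∃ γ, δ γ = α) ∧
      (∀ j β, extPost N g j β = 0 → ∃ α, extPost N f j α = β) ∧
      (∀ γ, extPost N f (k + 1) (δ γ) = 0) := by
  have hS := ModuleCat.shortComplex_shortExact (ModuleCat.shortComplexOfCompEqZero f g hfg.linearMap_comp_eq_zero) hfg hf hg
  refine ⟨{ toFun := fun γ => γ.comp hS.extClass rfl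
            map_add' := fun _ _ => Abelian.Ext.add_comp _ _ _ _
            map_smul' := fun _ _ => Abelian.Ext.smul_comp _ _ _ _ }, ?_, ?_, ?_, ?_⟩
  · exact fun γ h => Abelian.Ext.covariant_sequence_exact₃ _ hS γ rfl h
  · exact fun α h => Abelian.Ext.covariant_sequence_exact₁ _ hS α h rfl
  · exact fun j β h => Abelian.Ext.covariant_sequence_exact₂ _ hS β h
  · intro γ
    change (γ.comp hS.extClass rfl).comp (Abelian.Ext.mk₀ (ModuleCat.ofHom f)) (add_zero (k + 1)) = 0
    rw [Abelian.Ext.comp_assoc_of_third_deg_zero]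
    exact (congrArg (fun t => γ.comp t rfl) hS.extClass_comp).trans (Abelian.Ext.comp_zero _ _ _ _ _)

theorem extPost_zero_injective {f : X →ₗ[R] Y} (hf : Function.Injective f) (α : EExt (R := R) N X 0)
    (h : extPost N f 0 α = 0) : α = 0 := by
  obtain ⟨φ, rfl⟩ := (Abelian.Ext.mk₀_bijective _ _).2 α
  change (Abelian.Ext.mk₀ φ).comp (Abelian.Ext.mk₀ (ModuleCat.ofHom f)) (add_zero 0) = 0 at h
  rw [Abelian.Ext.mk₀_comp_mk₀, ← Abelian.Ext.mk₀_zero, (Abelian.Ext.mk₀_bijective _ _).1.eq_iff] at h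
  rw [← Abelian.Ext.mk₀_zero]
  congr 1
  ext v
  refine hf ?_
  rw [ModuleCat.hom_zero, LinearMap.zero_apply, map_zero]
  exact congrArg (fun t => t.hom v) h

/-- The contravariant long exact sequence. -/
theorem exists_extPre_delta (X : Type u) [AddCommGroup X] [Module R X] {f : N' →ₗ[R] N} {g : N →ₗ[R] N''}
    (hf : Function.Injective f) (hg : Function.Surjective g) (hfg : Function.Exact f g) (k : ℕ) :
    ∃ δ : EExt (R := R) N' X k →ₗ[R] EExt (R := R) N'' X (k + 1),
      (∀ γ, δ γ = 0 ↔ ∃ β, extPre X f k β = γ) ∧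
      (∀ α, extPre X g (k + 1) α = 0 → ∃ γ, δ γ = α) ∧
      (∀ j β, extPre X f j β = 0 → ∃ α, extPre X g j α = β) := by
  have hS := ModuleCat.shortComplex_shortExact (ModuleCat.shortComplexOfCompEqZero f g hfg.linearMap_comp_eq_zero) hfg hf hg
  refine ⟨{ toFun := fun γ => hS.extClass.comp γ (add_comm 1 k)
            map_add' := fun _ _ => Abelian.Ext.comp_add _ _ _ _
            map_smul' := fun _ _ => Abelian.Ext.comp_smul _ _ _ _ }, ?_, ?_, ?_⟩
  · refine fun γ => ⟨fun h => Abelian.Ext.contravariant_sequence_exact₁ hS _ γ (add_comm 1 k) h, ?_⟩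
    rintro ⟨β, rfl⟩
    change hS.extClass.comp ((Abelian.Ext.mk₀ (ModuleCat.ofHom f)).comp β (zero_add k)) (add_comm 1 k) = 0
    rw [← Abelian.Ext.comp_assoc_of_second_deg_zero]
    exact (congrArg (fun t => Abelian.Ext.comp t β (add_comm 1 k)) hS.extClass_comp).trans (Abelian.Ext.zero_comp _ _ _ _ _)
  · exact fun α h => Abelian.Ext.contravariant_sequence_exact₃ hS _ α h (add_comm 1 k)
  · exact fun j β h => Abelian.Ext.contravariant_sequence_exact₂ hS _ β h

/-- `c` kills `Ext^k(N, X)`. -/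
def EKill (c : R) (N X : Type u) [AddCommGroup N] [Module R N] [AddCommGroup X] [Module R X]
    (k : ℕ) : Prop := ∀ α : EExt (R := R) N X k, c • α = 0

theorem EKill.mul {c : R} {k : ℕ} (h : EKill c N X k) (a : R) : EKill (a * c) N X k := fun α => by
  rw [mul_smul, h, smul_zero]

theorem EKill.congr {c : R} {k : ℕ} (h : EKill c N X k) (e : X ≃ₗ[R] Y) : EKill c N Y k := fun α => by
  have h1 : extPost N e.toLinearMap k (extPost N e.symm.toLinearMap k α) = α := by
    rw [extPost_comp, show e.toLinearMap ∘ₗ e.symm.toLinearMap = LinearMap.lsmul R Y 1 by ext; simp,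
      extPost_smul_id, one_smul]
  rw [← h1, ← map_smul, ← map_smul, map_smul (extPost N e.symm.toLinearMap k), h, map_zero]

theorem EKill.of_smul_eq_zero {c : R} (h : ∀ v : X, c • v = 0) (k : ℕ) : EKill c N X k := fun α => by
  rw [← extPost_smul_id, show LinearMap.lsmul R X c = LinearMap.lsmul R X 0 by ext v; simp [h],
    extPost_smul_id, zero_smul]

theorem EKill.of_smul_eq_zero_left {c : R} (h : ∀ v : N, c • v = 0) (k : ℕ) : EKill c N X k := fun α => by
  rw [← extPre_smul_id, show LinearMap.lsmul R N c = LinearMap.lsmul R N 0 by ext v; simp [h],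
    extPre_smul_id, zero_smul]

section Sequence
variable {f : X →ₗ[R] Y} {g : Y →ₗ[R] Z} (hf : Function.Injective f) (hg : Function.Surjective g)
  (hfg : Function.Exact f g) {c c' : R} {k : ℕ}
include hf hg hfg

theorem EKill.mid (h : EKill c N X k) (h' : EKill c' N Z k) : EKill (c * c') N Y k := fun β => by
  obtain ⟨δ, -, -, h3, -⟩ := exists_extPost_delta N hf hg hfg k
  obtain ⟨α, hα⟩ := h3 k (c' • β) (by rw [map_smul, h'])
  rw [mul_smul, ← hα, ← map_smul, h, map_zero]

theorem EKill.left (h : EKill c N Z k) (h' : EKill c' N Y (k + 1)) : EKill (c * c') N X (k + 1) :=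
  fun α => by
  obtain ⟨δ, -, h2, -, -⟩ := exists_extPost_delta N hf hg hfg k
  obtain ⟨γ, hγ⟩ := h2 (c' • α) (by rw [map_smul, h'])
  rw [mul_smul, ← hγ, ← map_smul, h, map_zero]

theorem EKill.right (h : EKill c N Y k) (h' : EKill c' N X (k + 1)) : EKill (c * c') N Z k :=
  fun γ => by
  obtain ⟨δ, h1, -, -, -⟩ := exists_extPost_delta N hf hg hfg k
  obtain ⟨β, hβ⟩ := h1 (c' • γ) (by rw [map_smul, h'])
  rw [mul_smul, ← hβ, ← map_smul, h, map_zero]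

end Sequence

theorem EKill.left_zero {f : X →ₗ[R] Y} (hf : Function.Injective f) {c : R} (h : EKill c N Y 0) :
    EKill c N X 0 := fun α => extPost_zero_injective hf _ (by rw [map_smul, h])

end ExtTools

section ExtVanishing
variable {R : Type u} [CommRing R] {N : Type u} [AddCommGroup N] [Module R N]

theorem exact_smul_quotSMulTop (x : R) (X : Type u) [AddCommGroup X] [Module R X] :
    Function.Exact (LinearMap.lsmul R X x) (x • (⊤ : Submodule R X)).mkQ := fun v => by
  rw [mkQ_smul_top_eq_zero_iff]
  rfl

theorem ext_eq_zero_of_isWeaklyRegular (l : List R) (X : Type u) [AddCommGroup X] [Module R X]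
    (hl : RingTheory.Sequence.IsWeaklyRegular X l) (hN : ∀ a ∈ l, ∀ v : N, a • v = 0) (k : ℕ)
    (hk : k < l.length) : EKill (1 : R) N X k := by
  induction l generalizing X k with
  | nil => simp at hk
  | cons x l ih =>
    rw [RingTheory.Sequence.isWeaklyRegular_cons_iff] at hl
    have hinj : Function.Injective (LinearMap.lsmul R X x) := hl.1
    intro α
    rw [one_smul]
    have h0 : extPost N (LinearMap.lsmul R X x) k α = 0 := by
      rw [extPost_smul_id]
      exact EKill.of_smul_eq_zero_left (hN x (by simp)) k α
    rcases k with _ | k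
    · exact extPost_zero_injective hinj α h0
    · obtain ⟨δ, -, h2, -, -⟩ := exists_extPost_delta N hinj (Submodule.mkQ_surjective _)
        (exact_smul_quotSMulTop x X) k
      obtain ⟨γ, rfl⟩ := h2 α h0
      have := ih _ hl.2 (fun a ha => hN a (by simp [ha])) k (by simpa using hk) γ
      rw [one_smul] at this
      rw [this, map_zero]

theorem ext_quotient_eq_zero_of_isWeaklyRegular (zs : List R) (X : Type u) [AddCommGroup X] [Module R X]
    (hz : RingTheory.Sequence.IsWeaklyRegular X zs) (n : ℕ)
    (hn : ∀ k < n, EKill (1 : R) N X k) (k : ℕ) (hk : k + zs.length < n) :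
    EKill (1 : R) N (X ⧸ (Ideal.ofList zs • (⊤ : Submodule R X))) k := by
  induction zs generalizing X n with
  | nil =>
    refine (hn k (by simpa using hk)).congr (Submodule.quotEquivOfEqBot _ ?_).symm
    simp
  | cons x zs ih =>
    rw [RingTheory.Sequence.isWeaklyRegular_cons_iff] at hz
    have hinj : Function.Injective (LinearMap.lsmul R X x) := hz.1
    rw [List.length_cons] at hk
    refine EKill.congr ?_ (Submodule.quotOfListConsSMulTopEquivQuotSMulTopInner X x zs).symm
    refine ih (QuotSMulTop x X) hz.2 (n - 1) (fun j hj => ?_) (by omega)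
    rw [← one_mul (1 : R)]
    exact EKill.right hinj (Submodule.mkQ_surjective _) (exact_smul_quotSMulTop x X)
      (hn j (by omega)) (hn (j + 1) (by omega))

theorem exists_ekill_of_minimalPrimes [IsNoetherianRing R] [IsLocalRing R] {Z p : Ideal R} (hp : p ∈ Z.minimalPrimes)
    {S : Set (List R)} {i B : ℕ} (hB : ∀ l ∈ S, l.length ≤ B)
    (hS : ∀ l ∈ S, ∀ k, k + i < l.length → EKill (1 : R) (R ⧸ Ideal.ofList l) (R ⧸ Z) k)
    (X : Type u) [AddCommGroup X] [Module R X] [Module.Finite R X] (hX : Z ≤ Module.annihilator R X) :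
    ∃ c ∉ p, ∀ l ∈ S, ∀ k, k + i < l.length → EKill c (R ⧸ Ideal.ofList l) X k := by
  have hpp : p.IsPrime := hp.1.1
  suffices H : ∀ K, ∀ (X : Type u) [AddCommGroup X] [Module R X] [Module.Finite R X],
      Z ≤ Module.annihilator R X → ∃ c ∉ p, ∀ l ∈ S, ∀ k < K, k + i < l.length →
        EKill c (R ⧸ Ideal.ofList l) X k by
    obtain ⟨c, hc, h⟩ := H B X hX
    exact ⟨c, hc, fun l hl k hk => h l hl k (by have := hB l hl; omega) hk⟩
  clear hX
  intro K
  induction K with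
  | zero => exact fun X _ _ _ _ => ⟨1, p.ne_top_iff_one.1 hpp.ne_top, fun l hl k hk => by omega⟩
  | succ K ih =>
    intro X _ _ _ hX
    induction ‹Module.Finite R X› using IsNoetherianRing.induction_on_isQuotientEquivQuotientPrime R with
    | subsingleton N => exact ⟨1, p.ne_top_iff_one.1 hpp.ne_top, fun l hl k hk hi =>
        EKill.of_smul_eq_zero (fun v => Subsingleton.elim _ _) k⟩
    | quotient N P f =>
      rw [f.annihilator_eq, Ideal.annihilator_quotient] at hX
      by_cases hPp : P.1 = p
      · have hass : IsAssociatedPrime p (R ⧸ Z) := by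
          have : Module.Finite R (R ⧸ Z) := inferInstance
          refine Module.associatedPrimes.minimalPrimes_annihilator_subset_associatedPrimes R (R ⧸ Z) ?_
          rwa [Ideal.annihilator_quotient]
        obtain ⟨-, g, hg⟩ := (isAssociatedPrime_iff_exists_injective_linearMap _ _).1 hass
        obtain ⟨c, hc, h⟩ := ih ((R ⧸ Z) ⧸ LinearMap.range g) (by
          intro z hz
          rw [Module.mem_annihilator]
          intro v
          obtain ⟨v, rfl⟩ := Submodule.mkQ_surjective _ v
          rw [← map_smul]
          obtain ⟨v, rfl⟩ := Ideal.Quotient.mk_surjective v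
          rw [smul_quotient_of_mem hz, map_zero])
        refine ⟨c, hc, fun l hl k hk hi => ?_⟩
        have e : N ≃ₗ[R] (R ⧸ p) := f.trans (Submodule.quotEquivOfEq _ _ hPp)
        refine EKill.congr ?_ e.symm
        rcases k with _ | k
        · have := EKill.left_zero hg (hS l hl 0 hi)
          rw [← mul_one c]
          exact this.mul c
        · rw [← mul_one c]
          exact EKill.left hg (Submodule.mkQ_surjective _) (LinearMap.exact_map_mkQ_range g)
            (h l hl k (by omega) (by omega)) (hS l hl (k + 1) hi)
      · obtain ⟨c, hc, hcp⟩ : ∃ c ∈ P.1, c ∉ p := by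
          by_contra! hcon
          exact hPp (le_antisymm hcon (hp.2 ⟨P.2, hX⟩ hcon))
        refine ⟨c, hcp, fun l hl k hk hi => EKill.of_smul_eq_zero (fun v => ?_) k⟩
        apply f.injective
        rw [map_smul, map_zero]
        exact smul_quotient_of_mem hc _
    | exact N₁ N₂ N₃ f g hf hg hfg h₁ h₃ =>
      obtain ⟨c₁, hc₁, H₁⟩ := h₁ (hX.trans (f.annihilator_le_of_injective hf))
      obtain ⟨c₃, hc₃, H₃⟩ := h₃ (hX.trans (g.annihilator_le_of_surjective hg))
      exact ⟨c₁ * c₃, fun h => (hpp.mem_or_mem h).elim hc₁ hc₃, fun l hl k hk hi =>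
        EKill.mid hf hg hfg (H₁ l hl k hk hi) (H₃ l hl k hk hi)⟩

end ExtVanishing

section TopExt
variable {R : Type u} [CommRing R]

theorem exists_extPre_sequence {l : List R} {a : R} (hla : ∀ v : R, a * v ∈ Ideal.ofList l → v ∈ Ideal.ofList l)
    (X : Type u) [AddCommGroup X] [Module R X] (k : ℕ) :
    ∃ (g : EExt (R := R) (R ⧸ Ideal.ofList (l ++ [a])) X k →ₗ[R] EExt (R := R) (R ⧸ Ideal.ofList l) X k)
      (δ : EExt (R := R) (R ⧸ Ideal.ofList l) X k →ₗ[R]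
        EExt (R := R) (R ⧸ Ideal.ofList (l ++ [a])) X (k + 1)),
      (∀ β, a • β = 0 → ∃ α, g α = β) ∧ (∀ γ, δ γ = 0 ↔ ∃ β, a • β = γ) ∧
      ((∀ β : EExt (R := R) (R ⧸ Ideal.ofList l) X (k + 1), β = 0) → Function.Surjective δ) := by
  have hle : Ideal.ofList l ≤ Ideal.ofList (l ++ [a]) := by
    rw [Ideal.ofList_append]; exact le_sup_left
  let f : (R ⧸ Ideal.ofList l) →ₗ[R] (R ⧸ Ideal.ofList l) := LinearMap.lsmul R _ a
  let g : (R ⧸ Ideal.ofList l) →ₗ[R] (R ⧸ Ideal.ofList (l ++ [a])) := Submodule.factor hle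
  have hf : Function.Injective f := by
    refine (injective_iff_map_eq_zero f).2 fun v hv => ?_
    obtain ⟨v, rfl⟩ := Ideal.Quotient.mk_surjective v
    exact Ideal.Quotient.eq_zero_iff_mem.2 (hla v (Ideal.Quotient.eq_zero_iff_mem.1 hv))
  have hg : Function.Surjective g := Submodule.factor_surjective hle
  have hfg : Function.Exact f g := by
    intro v
    obtain ⟨v, rfl⟩ := Ideal.Quotient.mk_surjective v
    constructor
    · intro hv
      have hv : v ∈ Ideal.ofList (l ++ [a]) := Ideal.Quotient.eq_zero_iff_mem.1 hv
      rw [Ideal.ofList_append, Ideal.ofList_singleton] at hv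
      obtain ⟨u, hu, w, hw, rfl⟩ := Submodule.mem_sup.1 hv
      obtain ⟨w, rfl⟩ := Ideal.mem_span_singleton'.1 hw
      refine ⟨Ideal.Quotient.mk _ w, Ideal.Quotient.eq.2 ?_⟩
      have : a * w - (u + w * a) = - u := by ring
      change a * w - (u + w * a) ∈ _
      rw [this]
      exact neg_mem hu
    · rintro ⟨w, hw⟩
      obtain ⟨w, rfl⟩ := Ideal.Quotient.mk_surjective w
      have hw : a * w - v ∈ Ideal.ofList l := Ideal.Quotient.eq.1 hw
      refine Ideal.Quotient.eq_zero_iff_mem.2 ?_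
      have h2 : a * w ∈ Ideal.ofList (l ++ [a]) :=
        Ideal.mul_mem_right _ _ (Ideal.subset_span (by simp))
      have := sub_mem h2 (hle hw)
      simpa using this
  obtain ⟨δ, h1, h2, h3⟩ := exists_extPre_delta X hf hg hfg k
  refine ⟨extPre X g k, δ, fun β hβ => h3 k β ?_, fun γ => ?_, fun h α => h2 α (h _)⟩
  · rw [← hβ]; exact extPre_smul_id a k β
  · rw [h1]
    exact exists_congr fun β => by rw [← extPre_smul_id a k β]

theorem ofList_append_singleton_smul_top (l : List R) (a : R) (X : Type u) [AddCommGroup X] [Module R X]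
    (v : X) : v ∈ Ideal.ofList (l ++ [a]) • (⊤ : Submodule R X) ↔
      ∃ w, v - a • w ∈ Ideal.ofList l • (⊤ : Submodule R X) := by
  rw [Ideal.ofList_append, Ideal.ofList_singleton, Submodule.sup_smul, Submodule.ideal_span_singleton_smul,
    Submodule.mem_sup]
  constructor
  · rintro ⟨u, hu, w, hw, rfl⟩
    obtain ⟨w, rfl⟩ := smul_mem_smul_top_iff.1 hw
    exact ⟨w, by simpa using hu⟩
  · rintro ⟨w, hw⟩
    exact ⟨_, hw, a • w, smul_mem_smul_top_iff.2 ⟨w, rfl⟩, by simp⟩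

theorem ext_eq_zero_of_length_lt (l : List R)
    (hl : ∀ l' a, l' ++ [a] <+: l → ∀ v : R, a * v ∈ Ideal.ofList l' → v ∈ Ideal.ofList l')
    (X : Type u) [AddCommGroup X] [Module R X] (k : ℕ) (hk : l.length < k)
    (α : EExt (R := R) (R ⧸ Ideal.ofList l) X k) : α = 0 := by
  induction l using List.reverseRecOn generalizing k with
  | nil =>
    obtain ⟨k, rfl⟩ : ∃ j, k = j + 1 := ⟨k - 1, by simp at hk; omega⟩
    have e : (R ⧸ Ideal.ofList ([] : List R)) ≃ₗ[R] R := Submodule.quotEquivOfEqBot _ (by simp)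
    have : Module.Projective R (R ⧸ Ideal.ofList ([] : List R)) := Module.Projective.of_equiv e.symm
    have : CategoryTheory.Projective (ModuleCat.of R (R ⧸ Ideal.ofList ([] : List R))) :=
      (IsProjective.iff_projective _).1 this
    exact Abelian.Ext.eq_zero_of_projective α
  | append_singleton l a ih =>
    obtain ⟨k, rfl⟩ : ∃ j, k = j + 1 := ⟨k - 1, by omega⟩
    rw [List.length_append, List.length_singleton] at hk
    have ih' := ih (fun l' b hb => hl l' b (hb.trans (List.prefix_append _ _)))
    obtain ⟨g, δ, -, -, h3⟩ := exists_extPre_sequence (hl l a (List.prefix_refl _)) X k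
    obtain ⟨γ, rfl⟩ := h3 (ih' (k + 1) (by omega)) α
    rw [ih' k (by omega) γ, map_zero]

theorem exists_to_ext (l : List R)
    (hl : ∀ l' a, l' ++ [a] <+: l → ∀ v : R, a * v ∈ Ideal.ofList l' → v ∈ Ideal.ofList l')
    (X : Type u) [AddCommGroup X] [Module R X] :
    ∃ θ : X →ₗ[R] EExt (R := R) (R ⧸ Ideal.ofList l) X l.length, Function.Surjective θ ∧
      ∀ v, θ v = 0 ↔ v ∈ Ideal.ofList l • (⊤ : Submodule R X) := by
  induction l using List.reverseRecOn with
  | nil =>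
    have e : (R ⧸ Ideal.ofList ([] : List R)) ≃ₗ[R] R := Submodule.quotEquivOfEqBot _ (by simp)
    let F : X →ₗ[R] EExt (R := R) (R ⧸ Ideal.ofList ([] : List R)) X 0 :=
      { toFun := fun v => Abelian.Ext.mk₀ (ModuleCat.ofHom (LinearMap.toSpanSingleton R X v ∘ₗ e.toLinearMap))
        map_add' := fun v w => by
          rw [← Abelian.Ext.mk₀_add]
          congr 1
          refine ModuleCat.hom_ext (LinearMap.ext fun t => ?_)
          exact smul_add (e t) v w
        map_smul' := fun r v => by
          rw [RingHom.id_apply, ← Abelian.Ext.mk₀_smul]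
          congr 1
          refine ModuleCat.hom_ext (LinearMap.ext fun t => ?_)
          exact smul_comm (e t) r v }
    refine ⟨F, fun α => ?_, fun v => ?_⟩
    · obtain ⟨φ, rfl⟩ := (Abelian.Ext.mk₀_bijective _ _).2 α
      refine ⟨φ.hom (e.symm 1), ?_⟩
      change Abelian.Ext.mk₀ _ = _
      congr 1
      refine ModuleCat.hom_ext (LinearMap.ext fun t => ?_)
      change e t • φ.hom (e.symm 1) = φ.hom t
      rw [← map_smul, ← map_smul, smul_eq_mul, mul_one, e.symm_apply_apply]
    · have h0 : v ∈ Ideal.ofList ([] : List R) • (⊤ : Submodule R X) ↔ v = 0 := by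
        rw [Ideal.ofList_nil, Submodule.bot_smul, Submodule.mem_bot]
      refine Iff.trans ?_ h0.symm
      refine ⟨fun h => ?_, fun h => by rw [h, map_zero]⟩
      have h : Abelian.Ext.mk₀ (ModuleCat.ofHom (LinearMap.toSpanSingleton R X v ∘ₗ e.toLinearMap)) = 0 := h
      rw [← Abelian.Ext.mk₀_zero, (Abelian.Ext.mk₀_bijective _ _).1.eq_iff] at h
      have := congrArg (fun t => t.hom (e.symm 1)) h
      simpa using this
  | append_singleton l a ih =>
    have hl' : ∀ l' b, l' ++ [b] <+: l → ∀ v : R, b * v ∈ Ideal.ofList l' → v ∈ Ideal.ofList l' :=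
      fun l' b hb => hl l' b (hb.trans (List.prefix_append _ _))
    obtain ⟨θ, hs, hk⟩ := ih hl'
    obtain ⟨g, δ, -, h2, h3⟩ := exists_extPre_sequence (hl l a (List.prefix_refl _)) X l.length
    rw [List.length_append, List.length_singleton]
    refine ⟨δ ∘ₗ θ, (h3 (ext_eq_zero_of_length_lt l hl' X _ (Nat.lt_succ_self _))).comp hs, fun v => ?_⟩
    rw [LinearMap.comp_apply, h2, ofList_append_singleton_smul_top]
    constructor
    · rintro ⟨β, hβ⟩
      obtain ⟨w, rfl⟩ := hs β
      exact ⟨w, (hk _).1 (by rw [map_sub, map_smul, hβ, sub_self])⟩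
    · rintro ⟨w, hw⟩
      refine ⟨θ w, ?_⟩
      have := (hk _).2 hw
      rw [map_sub, map_smul, sub_eq_zero] at this
      exact this.symm

theorem smul_mem_of_ekill {l : List R} {a c : R}
    (hl : ∀ l' b, l' ++ [b] <+: l ++ [a] → ∀ v : R, b * v ∈ Ideal.ofList l' → v ∈ Ideal.ofList l')
    {X : Type u} [AddCommGroup X] [Module R X]
    (h : EKill c (R ⧸ Ideal.ofList (l ++ [a])) X l.length) {v : X}
    (hv : a • v ∈ Ideal.ofList l • (⊤ : Submodule R X)) : c • v ∈ Ideal.ofList l • (⊤ : Submodule R X) := by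
  obtain ⟨θ, hs, hk⟩ := exists_to_ext l (fun l' b hb => hl l' b (hb.trans (List.prefix_append _ _))) X
  obtain ⟨g, δ, h1, -, -⟩ := exists_extPre_sequence (hl l a (List.prefix_refl _)) X l.length
  obtain ⟨α, hα⟩ := h1 (θ v) (by rw [← map_smul]; exact (hk _).2 hv)
  rw [← hk, map_smul, ← hα, ← map_smul, h, map_zero]

end TopExt

section KillIdeal
variable {R : Type u} [CommRing R]

/-- The ideal of elements killing `Ext^k(R / l, X)` for all `l` in `S` and `k + i < l.length`. -/
def keIdeal (S : Set (List R)) (i : ℕ) (X : Type u) [AddCommGroup X] [Module R X] : Ideal R where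
  carrier := {c | ∀ l ∈ S, ∀ k, k + i < l.length → EKill c (R ⧸ Ideal.ofList l) X k}
  add_mem' ha hb l hl k hk α := by rw [add_smul, ha l hl k hk, hb l hl k hk, add_zero]
  zero_mem' l hl k hk α := zero_smul _ _
  smul_mem' c a ha l hl k hk := (ha l hl k hk).mul c

theorem mem_keIdeal {S : Set (List R)} {i : ℕ} {X : Type u} [AddCommGroup X] [Module R X] {c : R} :
    c ∈ keIdeal S i X ↔ ∀ l ∈ S, ∀ k, k + i < l.length → EKill c (R ⧸ Ideal.ofList l) X k := Iff.rfl

theorem exact_range_subtype_quotSMulTop (z : R) (X : Type u) [AddCommGroup X] [Module R X] :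
    Function.Exact (LinearMap.range (LinearMap.lsmul R X z)).subtype (z • (⊤ : Submodule R X)).mkQ := fun v => by
  rw [mkQ_smul_top_eq_zero_iff]
  constructor
  · rintro ⟨w, rfl⟩
    exact ⟨⟨_, w, rfl⟩, rfl⟩
  · rintro ⟨⟨_, w, rfl⟩, rfl⟩
    exact ⟨w, rfl⟩

theorem EKill.quotSMulTop {N X : Type u} [AddCommGroup N] [Module R N] [AddCommGroup X] [Module R X]
    {z a b c : R} (hK : ∀ v : X, z • v = 0 → a • v = 0) {k : ℕ} (hb : EKill b N X (k + 1))
    (hc : EKill c N X k) : EKill (c * (a * b)) N (QuotSMulTop z X) k := by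
  refine EKill.right (Submodule.subtype_injective _) (Submodule.mkQ_surjective _)
    (exact_range_subtype_quotSMulTop z X) hc ?_
  rw [mul_comm a b]
  refine EKill.right (c := b) (c' := a) (Submodule.subtype_injective _) (LinearMap.surjective_rangeRestrict _)
    (LinearMap.exact_subtype_ker_map (LinearMap.lsmul R X z).rangeRestrict) hb ?_
  refine EKill.of_smul_eq_zero ?_ _
  rintro ⟨v, hv⟩
  rw [LinearMap.ker_rangeRestrict] at hv
  exact Subtype.ext (hK v hv)

theorem EKill.of_quotSMulTop {N X : Type u} [AddCommGroup N] [Module R N] [AddCommGroup X] [Module R X]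
    {z f g : R} (hK : ∀ v : X, z • v = 0 → f • v = 0) {k : ℕ} (hz : EKill z N X k)
    (hg : ∀ j, j + 1 = k → EKill g N (QuotSMulTop z X) j) : EKill (f * g) N X k := by
  intro α
  set π := (LinearMap.lsmul R X z).rangeRestrict
  set ι := (LinearMap.range (LinearMap.lsmul R X z)).subtype
  have h1 : extPost N ι k (extPost N π k α) = 0 := by
    rw [extPost_comp]
    exact (extPost_smul_id z k α).trans (hz α)
  have h2 : g • extPost N π k α = 0 := by
    rcases k with _ | k
    · rw [extPost_zero_injective (Submodule.subtype_injective _) _ h1, smul_zero]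
    · obtain ⟨δ, -, h, -, -⟩ := exists_extPost_delta N (Submodule.subtype_injective _)
        (Submodule.mkQ_surjective _) (exact_range_subtype_quotSMulTop z X) k
      obtain ⟨γ, hγ⟩ := h _ h1
      rw [← hγ, ← map_smul, hg k rfl, map_zero]
  obtain ⟨-, -, -, h3, -⟩ := exists_extPost_delta N (Submodule.subtype_injective _)
    (LinearMap.surjective_rangeRestrict _) (LinearMap.exact_subtype_ker_map π) k
  obtain ⟨β, hβ⟩ := h3 k (g • α) (by rw [map_smul, h2])
  rw [mul_smul, ← hβ, ← map_smul]
  have : EKill f N (LinearMap.ker π) k := by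
    refine EKill.of_smul_eq_zero ?_ _
    rintro ⟨v, hv⟩
    rw [LinearMap.ker_rangeRestrict] at hv
    exact Subtype.ext (hK v hv)
  rw [this, map_zero]

theorem pow_le_keIdeal_quotSMulTop {S : Set (List R)} {i e : ℕ} {X : Type u} [AddCommGroup X] [Module R X]
    {𝔠 : Ideal R} (h : 𝔠 ^ e ≤ keIdeal S i X) {z : R} (hz : ∀ a ∈ 𝔠, ∀ v : X, z • v = 0 → a • v = 0) :
    𝔠 ^ (2 * e + 1) ≤ keIdeal S (i + 1) (QuotSMulTop z X) := by
  rw [show 2 * e + 1 = e + (1 + e) by ring, pow_add, pow_add, pow_one, Ideal.mul_le]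
  intro c hc d hd
  refine Submodule.mul_induction_on hd (fun a ha b hb => ?_) (fun x y hx hy => by
    rw [mul_add]; exact add_mem hx hy)
  exact fun l hl k hk => EKill.quotSMulTop (hz a ha) (h hb l hl (k + 1) (by omega))
    (h hc l hl k (by omega))

theorem exists_mem_keIdeal [IsNoetherianRing R] [IsLocalRing R] (S : Set (List R)) {𝔠 p : Ideal R}
    [p.IsPrime] {f : R} (hf : f ∉ p) (zs : List R) (X : Type u) [AddCommGroup X] [Module R X]
    [Module.Finite R X] (W : Ideal R) (hW : W ≤ Module.annihilator R X) (i e N : ℕ)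
    (he : 𝔠 ^ e ≤ keIdeal S i X) (hzs : ∀ z ∈ zs, z ∈ 𝔠 ^ N) (hN : (e + 1) * 2 ^ zs.length ≤ N + 1)
    (h𝔠 : ColonKilled 𝔠 zs X) (hk : ColonKilled (Ideal.span {f}) zs X)
    (hY : ∀ (Y : Type u) [AddCommGroup Y] [Module R Y] [Module.Finite R Y],
      W ⊔ Ideal.ofList zs ≤ Module.annihilator R Y → ∃ g ∉ p, g ∈ keIdeal S (i + zs.length) Y) :
    ∃ g ∉ p, g ∈ keIdeal S i X := by
  induction zs generalizing X W i e with
  | nil => exact hY X (by simpa using hW)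
  | cons z zs ih =>
    have hpow : 1 ≤ 2 ^ zs.length := Nat.one_le_two_pow
    rw [List.length_cons, pow_succ] at hN
    obtain ⟨g, hg, H⟩ := ih (QuotSMulTop z X) (W ⊔ Ideal.span {z})
      ((sup_le_sup_right hW _).trans (annihilator_sup_span_le_annihilator_quotSMulTop z X)) (i + 1) (2 * e + 1)
      (pow_le_keIdeal_quotSMulTop he h𝔠.1) (fun y hy => hzs y (by simp [hy]))
      (by nlinarith) h𝔠.2 hk.2 (fun Y _ _ _ h => by
        obtain ⟨g, hg, H⟩ := hY Y (by rw [Ideal.ofList_cons, ← sup_assoc]; exact h)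
        refine ⟨g, hg, ?_⟩
        rw [List.length_cons] at H
        rwa [add_assoc, add_comm 1])
    refine ⟨f * g, fun h => (Ideal.IsPrime.mem_or_mem ‹_› h).elim hf hg, fun l hl k hkl => ?_⟩
    refine EKill.of_quotSMulTop (fun v hv => hk.1 f (Ideal.mem_span_singleton_self f) v hv)
      (he (Ideal.pow_le_pow_right (by nlinarith) (hzs z (by simp))) l hl k hkl) ?_
    rintro j rfl
    exact H l hl j (by omega)

end KillIdeal

section ColonDescent
variable {R : Type u} [CommRing R] {T : Type u} [AddCommGroup T] [Module R T]

theorem smul_mem_of_colon_conditions {x y y' c : R}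
    (h1 : ∀ v w : T, y • v = x • w → ∃ w', y' • v = x • w')
    (h2 : ∀ u : T, x • u = 0 → y' • u = 0)
    (h3 : ∀ w a b : T, y' • y' • w = x • a + y • b → ∃ a b : T, y' • w = x • a + y • b)
    (hP : ∀ w a b : T, y' • w = x • a + y • b → ∃ h b : T, c • w = h + y • b ∧ ∃ u, y • h = x • u)
    (h4 : ∀ v u : T, y • y • v = x • x • u → ∃ u', y • v = x • x • u')
    (h5 : ∀ b u : T, x • x • b = y • u → ∃ u', x • b = y • u')
    (h6 : ∀ u : T, y • u = 0 → x • u = 0) {v w : T} (hv : y • v = x • w) :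
    ∃ b u : T, c • v = x • b + u ∧ x • u = 0 := by
  obtain ⟨w', hw'⟩ := h1 v w hv
  have e1 : x • (y' • w - y • w') = 0 := by
    rw [smul_sub, smul_comm x y' w, ← hv, smul_comm x y w', ← hw', smul_comm y y' v, sub_self]
  have e2 := h2 _ e1
  rw [smul_sub, sub_eq_zero] at e2
  obtain ⟨a, b, e3⟩ := h3 w 0 (y' • w') (by rw [e2, smul_zero, zero_add, smul_comm])
  obtain ⟨h, b, e4, h', e5⟩ := hP w a b e3
  have e6 : y • (c • v - x • b) = x • h := by
    rw [smul_sub, smul_comm y c v, hv, smul_comm c x w, e4, smul_add, smul_comm y x b, add_sub_cancel_right]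
  obtain ⟨b', e7⟩ := h4 (c • v - x • b) h' (by rw [e6, smul_comm y x h, e5])
  obtain ⟨b'', e8⟩ := h5 b' (c • v - x • b) e7.symm
  refine ⟨b + b'', c • v - x • b - x • b'', by rw [smul_add]; abel, h6 _ ?_⟩
  rw [smul_sub, e7, e8, smul_comm x y b'', sub_self]

end ColonDescent

section DimBound
variable {R : Type u} [CommRing R] [IsNoetherianRing R] [IsLocalRing R]

/-- `dim R / I ≤ k`. -/
def DLE (I : Ideal R) (k : ℕ) : Prop := ringKrullDim (R ⧸ I) ≤ k

theorem DLE.mono {I J : Ideal R} {k : ℕ} (h : DLE I k) (hIJ : I ≤ J) : DLE J k :=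
  (ringKrullDim_le_of_surjective _ (Ideal.Quotient.factor_surjective hIJ)).trans h

theorem natCast_succ_le_of_not_le {x : WithBot ℕ∞} {n : ℕ} (h : ¬ x ≤ n) : ((n + 1 : ℕ) : WithBot ℕ∞) ≤ x := by
  rw [Nat.cast_add, Nat.cast_one, ENat.WithBot.add_one_le_iff]
  exact not_le.1 h

theorem not_natCast_succ_le {x : WithBot ℕ∞} {n : ℕ} (h : x ≤ n) : ¬ ((n + 1 : ℕ) : WithBot ℕ∞) ≤ x := by
  rw [Nat.cast_add, Nat.cast_one, ENat.WithBot.add_one_le_iff, not_lt]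
  exact h

theorem dle_of_primes {I : Ideal R} {k : ℕ}
    (h : ∀ P : Ideal R, P.IsPrime → I ≤ P → ¬ ((k + 1 : ℕ) : WithBot ℕ∞) ≤ ringKrullDim (R ⧸ P)) : DLE I k := by
  by_contra hcon
  obtain ⟨P, hP, hle, hk⟩ := exists_prime_le_ringKrullDim (natCast_succ_le_of_not_le hcon)
  exact h P hP hle hk

theorem DLE.not_le {I P : Ideal R} {k : ℕ} (h : DLE I k) (hIP : I ≤ P) :
    ¬ ((k + 1 : ℕ) : WithBot ℕ∞) ≤ ringKrullDim (R ⧸ P) := not_natCast_succ_le (h.mono hIP)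

theorem DLE.of_sup {I : Ideal R} {x : R} (hx : x ∈ maximalIdeal R) {k : ℕ} (h : DLE (I ⊔ Ideal.span {x}) k) :
    DLE I (k + 1) := by
  refine (ringKrullDim_quotient_le_add_one I hx).trans ?_
  rw [Nat.cast_add, Nat.cast_one]
  exact ENat.WithBot.add_le_add_one_right_iff.2 h

theorem DLE.mem_minimalPrimes {I P : Ideal R} {k : ℕ} (h : DLE I k) (hP : P.IsPrime) (hIP : I ≤ P)
    (hk : (k : WithBot ℕ∞) ≤ ringKrullDim (R ⧸ P)) : P ∈ I.minimalPrimes := by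
  refine ⟨⟨hP, hIP⟩, fun Q hQ hQP x hx => ?_⟩
  by_contra hxQ
  exact h.not_le hQ.2 (succ_le_ringKrullDim_quotient hQ.1 hQP hx hxQ hk)

theorem DLE.exists_pow_le {I : Ideal R} (h : DLE I 0) : ∃ t, maximalIdeal R ^ t ≤ I := by
  refine exists_pow_le_of_le_radical (n := 1) ?_
  rw [pow_one, Ideal.radical_eq_sInf, le_sInf_iff]
  rintro P ⟨hIP, hP⟩ x hx
  by_contra hxP
  exact h.not_le hIP (one_le_ringKrullDim_quotient hP (by rintro rfl; exact hxP hx))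

theorem DLE.of_pow_le {I : Ideal R} {xs : List R} (hxs : ∀ x ∈ xs, x ∈ maximalIdeal R) {t : ℕ}
    (h : maximalIdeal R ^ t ≤ I ⊔ Ideal.ofList xs) : DLE I xs.length :=
  dle_of_primes fun _ hP hIP hk => not_natCast_succ_le
    (ringKrullDim_quotient_le_of_pow_le hP hxs (h.trans (sup_le_sup_right hIP _))) hk

/-- Prime avoidance in a coset. -/
theorem exists_add_dle {Z K : Ideal R} {y : R} {i : ℕ} (hZ : DLE Z (i + 1))
    (h : ∀ P : Ideal R, P.IsPrime → Z ≤ P → ((i + 1 : ℕ) : WithBot ℕ∞) ≤ ringKrullDim (R ⧸ P) →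
      y ∈ P → ¬ K ≤ P) : ∃ k ∈ K, DLE (Z ⊔ Ideal.span {y + k}) i := by
  obtain ⟨S, hSdef⟩ : ∃ S : Set (Ideal R), ∀ P, P ∈ S ↔ P ∈ Z.minimalPrimes ∧
      ((i + 1 : ℕ) : WithBot ℕ∞) ≤ ringKrullDim (R ⧸ P) := ⟨{P | _}, fun _ => Iff.rfl⟩
  have hS : S.Finite := (Ideal.finite_minimalPrimes_of_isNoetherianRing R Z).subset
    fun P hP => ((hSdef P).1 hP).1
  have hprime (P : Ideal R) (hP : P ∈ S) : P.IsPrime := ((hSdef P).1 hP).1.1.1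
  obtain ⟨Q, hQ1, hQ2⟩ : ∃ Q : Ideal R, (∀ P ∈ S, y ∉ P → Q ≤ P) ∧ ∀ P ∈ S, y ∈ P → ¬ Q ≤ P := by
    obtain ⟨t, ht⟩ : ∃ t : Finset (Ideal R), ∀ P, P ∈ t ↔ P ∈ S ∧ y ∉ P :=
      ⟨(hS.subset (fun P hP => hP.1 : {P | P ∈ S ∧ y ∉ P} ⊆ S)).toFinset, fun P => by simp⟩
    refine ⟨t.prod id, fun P hP hy => ?_, fun P hP hy hle => ?_⟩
    · have := hprime P hP
      exact (Ideal.IsPrime.prod_le this).2 ⟨P, (ht P).2 ⟨hP, hy⟩, le_rfl⟩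
    · obtain ⟨P', hP', hle'⟩ := (Ideal.IsPrime.prod_le (hprime P hP)).1 hle
      rw [ht] at hP'
      exact hP'.2 (((hSdef P).1 hP).1.2 ((hSdef P').1 hP'.1).1.1 hle' hy)
  obtain ⟨t, ht⟩ : ∃ t : Set (Ideal R), ∀ P, P ∈ t ↔ P ∈ S ∧ y ∈ P := ⟨{P | _}, fun _ => Iff.rfl⟩
  have htS : t.Finite := hS.subset fun P hP => ((ht P).1 hP).1
  obtain ⟨k, hk, hkP⟩ : ∃ k ∈ K * Q, ∀ P ∈ t, k ∉ P := by
    by_contra hcon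
    push Not at hcon
    have hsub : ((K * Q : Ideal R) : Set R) ⊆ ⋃ P ∈ t, ((id P : Ideal R) : Set R) := by
      intro k hk
      obtain ⟨P, hP, hkP⟩ := hcon k hk
      exact Set.mem_biUnion hP hkP
    rw [Ideal.subset_union_prime_finite htS (f := id) ⊤ ⊤
      fun P hP _ _ => hprime P ((ht P).1 hP).1] at hsub
    obtain ⟨P, hPt, hle⟩ := hsub
    obtain ⟨hPS, hyP⟩ := (ht P).1 hPt
    rcases (hprime P hPS).mul_le.1 hle with hle | hle
    · exact h P (hprime P hPS) ((hSdef P).1 hPS).1.1.2 ((hSdef P).1 hPS).2 hyP hle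
    · exact hQ2 P hPS hyP hle
  refine ⟨k, (Ideal.mul_le_inf hk).1, dle_of_primes fun P hP hle hdim => ?_⟩
  obtain ⟨P₀, hP₀, hP₀P⟩ := Ideal.exists_minimalPrimes_le (le_sup_left.trans hle)
  have hyk : y + k ∈ P := hle (Ideal.mem_sup_right (Ideal.mem_span_singleton_self _))
  have hyk0 : y + k ∉ P₀ := by
    have hS0 : P₀ ∈ S := (hSdef _).2
      ⟨hP₀, hdim.trans (ringKrullDim_le_of_surjective _ (Ideal.Quotient.factor_surjective hP₀P))⟩
    intro hmem
    by_cases hy : y ∈ P₀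
    · exact hkP P₀ ((ht P₀).2 ⟨hS0, hy⟩) (by simpa using sub_mem hmem hy)
    · have : k ∈ P₀ := hQ1 P₀ hS0 hy (Ideal.mul_le_inf hk).2
      exact hy (by simpa using sub_mem hmem this)
  exact hZ.not_le hP₀.1.2 (succ_le_ringKrullDim_quotient hP₀.1.1 hP₀P hyk hyk0 hdim)

theorem exists_mem_dle {Z J : Ideal R} {i : ℕ} (hZ : DLE Z (i + 1))
    (h : ∀ P : Ideal R, P.IsPrime → Z ≤ P → ((i + 1 : ℕ) : WithBot ℕ∞) ≤ ringKrullDim (R ⧸ P) →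
      ¬ J ≤ P) : ∃ x ∈ J, DLE (Z ⊔ Ideal.span {x}) i := by
  obtain ⟨k, hk, h⟩ := exists_add_dle (y := 0) hZ fun P hP hle hdim _ => h P hP hle hdim
  exact ⟨k, hk, by rwa [zero_add] at h⟩

/-- Parts of systems of parameters of a ring of dimension `n`. -/
def PSL (n : ℕ) (l : List R) : Prop :=
  (∀ x ∈ l, x ∈ maximalIdeal R) ∧ ∃ k, k + l.length = n ∧ DLE (Ideal.ofList l) k

theorem ofList_perm {l l' : List R} (h : l.Perm l') : Ideal.ofList l = Ideal.ofList l' :=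
  congrArg Ideal.span (Set.ext fun _ => h.mem_iff)

theorem PSL.perm {n : ℕ} {l l' : List R} (h : PSL n l) (hp : l.Perm l') : PSL n l' := by
  obtain ⟨h1, k, hk, h2⟩ := h
  exact ⟨fun x hx => h1 x (hp.mem_iff.2 hx), k, by rw [← hp.length_eq, hk], by rwa [← ofList_perm hp]⟩

theorem PSL.tail {n : ℕ} {x : R} {l : List R} (h : PSL n (x :: l)) : PSL n l := by
  obtain ⟨h1, k, hk, h2⟩ := h
  refine ⟨fun y hy => h1 y (by simp [hy]), k + 1, by simp at hk; omega, ?_⟩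
  rw [Ideal.ofList_cons, sup_comm] at h2
  exact h2.of_sup (h1 x (by simp))

theorem PSL.sublist {n : ℕ} {l l' : List R} (h : PSL n l) (hp : l'.Sublist l) : PSL n l' := by
  induction hp with
  | slnil => exact h
  | cons a _ ih => exact ih h.tail
  | @cons_cons l₁ l₂ a hs ih =>
    -- move `a` to the end, remove, and put it back
    clear ih
    suffices H : ∀ l₁ l₂ r : List R, l₁.Sublist l₂ → PSL n (l₂ ++ r) → PSL n (l₁ ++ r) by
      exact ((H l₁ l₂ [a] hs (h.perm (List.perm_append_singleton a l₂).symm))).perm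
        (List.perm_append_singleton a l₁)
    clear h hs
    intro l₁ l₂ r hs
    induction hs generalizing r with
    | slnil => exact id
    | cons b _ ih => exact fun h => ih r h.tail
    | cons_cons b _ ih =>
      intro h
      exact (ih (b :: r) (h.perm List.perm_middle.symm)).perm List.perm_middle

theorem PSL.pow_head {n : ℕ} {x : R} {l : List R} (h : PSL n (x :: l)) {e : ℕ} (he : e ≠ 0) :
    PSL n (x ^ e :: l) := by
  obtain ⟨h1, k, hk, h2⟩ := h
  refine ⟨?_, k, by simpa using hk, dle_of_primes fun P hP hle => h2.not_le ?_⟩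
  · intro y hy
    rcases List.mem_cons.1 hy with rfl | hy
    · exact Ideal.pow_mem_of_mem _ (h1 x (by simp)) e (Nat.pos_of_ne_zero he)
    · exact h1 y (by simp [hy])
  · rw [Ideal.ofList_cons, sup_le_iff] at hle ⊢
    exact ⟨(Ideal.span_singleton_le_iff_mem _).2
      (hP.mem_of_pow_mem e ((Ideal.span_singleton_le_iff_mem _).1 hle.1)), hle.2⟩

theorem PSL.exists_par {n : ℕ} {l : List R} (h : PSL n l) :
    ∃ l', (l ++ l').length = n ∧ Par (l ++ l') R := by
  obtain ⟨h1, k, hk, h2⟩ := h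
  induction k generalizing l with
  | zero =>
    obtain ⟨t, ht⟩ := h2.exists_pow_le
    exact ⟨[], by simpa using hk, by simpa using h1, t, by simpa using ht.trans le_sup_right⟩
  | succ k ih =>
    obtain ⟨x, hx, hd⟩ := exists_mem_dle (J := maximalIdeal R) h2 fun P hP _ hdim hle => by
      have : P = maximalIdeal R := le_antisymm (le_maximalIdeal hP.ne_top) hle
      subst this
      let _ : Field (R ⧸ maximalIdeal R) := Ideal.Quotient.field _
      have h0 : ringKrullDim (R ⧸ maximalIdeal R) = 0 := ringKrullDim_eq_zero_of_field _
      rw [h0] at hdim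
      have := (Nat.cast_le (α := WithBot ℕ∞) (m := k + 1) (n := 0)).1 (by simp at hdim)
      omega
    obtain ⟨l', hl', hpar⟩ := ih (l := l ++ [x]) (by
        intro y hy
        rcases List.mem_append.1 hy with hy | hy
        · exact h1 y hy
        · rw [List.mem_singleton.1 hy]; exact hx) (by simp; omega)
      (by rwa [Ideal.ofList_append, Ideal.ofList_singleton])
    exact ⟨x :: l', by simpa using hl', by simpa using hpar⟩

end DimBound

section ColonList
variable {R : Type u} [CommRing R]

theorem mkQ_mem_smul_top_iff {M : Type u} [AddCommGroup M] [Module R M] (N : Submodule R M) (I : Ideal R) (v : M) :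
    N.mkQ v ∈ I • (⊤ : Submodule R (M ⧸ N)) ↔ v ∈ I • (⊤ : Submodule R M) ⊔ N := by
  have h : I • (⊤ : Submodule R (M ⧸ N)) = (I • (⊤ : Submodule R M)).map N.mkQ := by
    rw [Submodule.map_smul'', Submodule.map_top, Submodule.range_mkQ]
  rw [h, ← Submodule.mem_comap, Submodule.comap_map_mkQ, sup_comm]

theorem colonKilled_iff (𝔞 : Ideal R) (zs : List R) (M : Type u) [AddCommGroup M] [Module R M] :
    ColonKilled 𝔞 zs M ↔ ∀ l a r, zs = l ++ a :: r → ∀ f ∈ 𝔞, ∀ v : M,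
      a • v ∈ Ideal.ofList l • (⊤ : Submodule R M) → f • v ∈ Ideal.ofList l • (⊤ : Submodule R M) := by
  induction zs generalizing M with
  | nil => simp [ColonKilled]
  | cons x xs ih =>
    have key (l : List R) (v : M) : (x • (⊤ : Submodule R M)).mkQ v ∈
        Ideal.ofList l • (⊤ : Submodule R (QuotSMulTop x M)) ↔ v ∈ Ideal.ofList (x :: l) • (⊤ : Submodule R M) := by
      rw [Ideal.ofList_cons, Submodule.sup_smul, Submodule.ideal_span_singleton_smul, sup_comm]
      exact mkQ_mem_smul_top_iff _ _ v
    rw [ColonKilled, ih]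
    constructor
    · rintro ⟨h1, h2⟩ l a r h f hf v hv
      rcases l with _ | ⟨y, l⟩
      · obtain ⟨rfl, rfl⟩ : x = a ∧ xs = r := by simpa using h
        simp only [Ideal.ofList_nil, Submodule.bot_smul, Submodule.mem_bot] at hv ⊢
        exact h1 f hf v hv
      · obtain ⟨rfl, h'⟩ : x = y ∧ xs = l ++ a :: r := by simpa using h
        rw [← key, map_smul] at hv ⊢
        exact h2 l a r h' f hf _ hv
    · intro h
      refine ⟨fun f hf v hv => ?_, fun l a r hxs f hf v hv => ?_⟩
      · have := h [] x xs rfl f hf v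
        simp only [Ideal.ofList_nil, Submodule.bot_smul, Submodule.mem_bot] at this
        exact this hv
      · obtain ⟨v, rfl⟩ := Submodule.mkQ_surjective _ v
        rw [← map_smul, key] at hv ⊢
        exact h (x :: l) a r (by simp [hxs]) f hf v hv

variable [IsLocalRing R]

/-- The elements killing all colon modules `((l, z) : a) / (l, z)`, where `l, a, z` is part of a
system of parameters of the `d`-dimensional ring `R`. -/
def bCol (d : ℕ) (z : List R) : Ideal R where
  carrier := {c | ∀ l a, PSL d (l ++ a :: z) → ∀ v, a * v ∈ Ideal.ofList (l ++ z) → c * v ∈ Ideal.ofList (l ++ z)}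
  add_mem' ha hb l a hl v hv := by rw [add_mul]; exact add_mem (ha l a hl v hv) (hb l a hl v hv)
  zero_mem' l a hl v hv := by rw [zero_mul]; exact zero_mem _
  smul_mem' c a ha l b hl v hv := by
    rw [smul_eq_mul, mul_assoc]
    exact Ideal.mul_mem_left _ _ (ha l b hl v hv)

/-- Lists whose entries lie in the cubes of the colon killing ideals modulo the later entries. -/
def CList (d : ℕ) : List R → Prop
  | [] => True
  | x :: z => x ∈ bCol d z ^ 3 ∧ CList d z

end ColonList

section Lift
variable {A R : Type u} [CommRing A] [CommRing R] [IsNoetherianRing A] [IsNoetherianRing R]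
  [IsLocalRing A] [IsLocalRing R] [Algebra A R]

theorem ofList_map (l : List A) : Ideal.ofList (l.map (algebraMap A R)) = (Ideal.ofList l).map (algebraMap A R) := by
  rw [Ideal.map_ofList]

theorem smul_mem_ofList_smul_top_iff (l : List A) (a : A) (v : R) :
    a • v ∈ Ideal.ofList l • (⊤ : Submodule A R) ↔
      algebraMap A R a * v ∈ Ideal.ofList (l.map (algebraMap A R)) := by
  rw [Ideal.smul_top_eq_map, Submodule.restrictScalars_mem, ofList_map, Algebra.smul_def]

theorem mem_maximalIdeal_of_map {a : A}
    (ha : algebraMap A R a ∈ maximalIdeal R) : a ∈ maximalIdeal A := by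
  rw [mem_maximalIdeal, mem_nonunits_iff] at *
  exact fun h => ha (h.map _)

theorem map_mem_maximalIdeal (hs : Function.Surjective (algebraMap A R)) {a : A}
    (ha : a ∈ maximalIdeal A) : algebraMap A R a ∈ maximalIdeal R := by
  have := IsLocalHom.of_surjective (algebraMap A R) hs
  rw [mem_maximalIdeal, mem_nonunits_iff] at *
  exact fun h => ha (isUnit_of_map_unit _ _ h)

theorem ringKrullDim_quotient_comap (hs : Function.Surjective (algebraMap A R)) (I : Ideal R) :
    ringKrullDim (A ⧸ I.comap (algebraMap A R)) = ringKrullDim (R ⧸ I) :=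
  ringKrullDim_eq_of_ringEquiv (RingEquiv.ofBijective (Ideal.quotientMap I (algebraMap A R) le_rfl)
    ⟨Ideal.quotientMap_injective, Ideal.quotientMap_surjective hs⟩)

theorem exists_lift_psl (hs : Function.Surjective (algebraMap A R)) {n d : ℕ} {ws : List A}
    (hn : d + ws.length = n) (z : List A) (hz : PSL n (ws ++ z)) (ys : List R)
    (hys : PSL d (ys ++ z.map (algebraMap A R))) :
    ∃ l : List A, l.map (algebraMap A R) = ys ∧ PSL n (ws ++ (l ++ z)) := by
  induction ys with
  | nil => exact ⟨[], rfl, hz⟩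
  | cons y ys ih =>
    obtain ⟨l, rfl, h1, k, hk, h2⟩ := ih hys.tail
    obtain ⟨h3, k', hk', h4⟩ := hys
    obtain ⟨a, rfl⟩ := hs y
    obtain rfl : k = k' + 1 := by
      simp only [List.cons_append, List.length_cons, List.length_append, List.length_map] at hk hk'
      omega
    obtain ⟨b, hb, hd⟩ := exists_add_dle (y := a) (K := RingHom.ker (algebraMap A R)) h2
      fun P hP hle hdim haP hK => by
        have hPm : (P.map (algebraMap A R)).comap (algebraMap A R) = P := by
          rw [Ideal.comap_map_of_surjective _ hs]
          exact sup_eq_left.2 hK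
        rw [← hPm, ringKrullDim_quotient_comap hs] at hdim
        refine h4.not_le ?_ hdim
        rw [List.cons_append, Ideal.ofList_cons, sup_le_iff, ← List.map_append, ofList_map]
        exact ⟨(Ideal.span_singleton_le_iff_mem _).2 (Ideal.mem_map_of_mem _ haP), Ideal.map_mono
          ((le_sup_right.trans (Ideal.ofList_append ws (l ++ z)).ge).trans hle)⟩
    have hb' : algebraMap A R (a + b) = algebraMap A R a := by rw [map_add, (RingHom.mem_ker).1 hb, add_zero]
    refine ⟨(a + b) :: l, by simp [hb'], PSL.perm (l := (a + b) :: (ws ++ (l ++ z))) ⟨?_, k', ?_, ?_⟩ ?_⟩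
    · intro x hx
      rcases List.mem_cons.1 hx with rfl | hx
      · exact mem_maximalIdeal_of_map (by rw [hb']; exact h3 _ (by simp))
      · exact h1 x hx
    · simp only [List.length_cons] at hk ⊢
      omega
    · rwa [Ideal.ofList_cons, sup_comm]
    · rw [List.cons_append]
      exact List.perm_middle.symm

theorem PSL.of_lift (hs : Function.Surjective (algebraMap A R)) {n d : ℕ} {ws l : List A}
    (hn : d + ws.length = n) (hws : ∀ w ∈ ws, algebraMap A R w = 0) (h : PSL n (ws ++ l)) :
    PSL d (l.map (algebraMap A R)) := by
  obtain ⟨h1, k, hk, h2⟩ := h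
  refine ⟨fun x hx => ?_, k, by simp only [List.length_append, List.length_map] at *; omega, ?_⟩
  · obtain ⟨a, ha, rfl⟩ := List.mem_map.1 hx
    exact map_mem_maximalIdeal hs (h1 a (by simp [ha]))
  · rw [DLE, ← ringKrullDim_quotient_comap hs]
    refine h2.mono ?_
    rw [Ideal.ofList, Ideal.span_le]
    intro x hx
    rcases List.mem_append.1 (show x ∈ ws ++ l from hx) with hx | hx
    · rw [SetLike.mem_coe, Ideal.mem_comap, hws x hx]; exact zero_mem _
    · exact Ideal.subset_span (List.mem_map_of_mem hx)

/-- The ideal killing the `Ext` modules controlling colons modulo `z`. -/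
def bKe (n : ℕ) (ws z : List A) (R : Type u) [CommRing R] [Algebra A R] : Ideal A :=
  keIdeal {l | PSL n (ws ++ (l ++ z))} 0 (R ⧸ (Ideal.ofList z • (⊤ : Submodule A R)))

theorem mem_ofList_of_isWeaklyRegular {n : ℕ} (hA : ∀ l : List A, PSL n l → RingTheory.Sequence.IsWeaklyRegular A l)
    {L : List A} (hL : PSL n L) (l : List A) (b : A) (hl : l ++ [b] <+: L) (v : A)
    (hv : b * v ∈ Ideal.ofList l) : v ∈ Ideal.ofList l := by
  have h := hA _ (hL.sublist hl.sublist)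
  rw [RingTheory.Sequence.isWeaklyRegular_append_iff, RingTheory.Sequence.isWeaklyRegular_cons_iff] at h
  have h1 := isSMulRegular_iff_right_eq_zero_of_smul.1 h.2.1
    (Submodule.Quotient.mk v)
  rw [← Submodule.Quotient.mk_smul, Submodule.Quotient.mk_eq_zero, Submodule.Quotient.mk_eq_zero,
    smul_eq_mul, smul_eq_mul, Ideal.mul_top] at h1
  exact h1 hv

theorem smul_mem_of_mem_bKe {n : ℕ} (hA : ∀ l : List A, PSL n l → RingTheory.Sequence.IsWeaklyRegular A l)
    {ws z l : List A} {a c : A} (hc : c ∈ bKe n ws z R) (hl : PSL n (ws ++ ((l ++ [a]) ++ z))) {v : R}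
    (hv : algebraMap A R a * v ∈ Ideal.ofList ((l ++ z).map (algebraMap A R))) :
    algebraMap A R c * v ∈ Ideal.ofList ((l ++ z).map (algebraMap A R)) := by
  have h1 := smul_mem_of_ekill (l := l) (a := a) (c := c)
    (fun l' b hlb => mem_ofList_of_isWeaklyRegular hA (hl.sublist
      ((List.sublist_append_left _ _).trans (List.sublist_append_right _ _))) l' b hlb)
    (hc (l ++ [a]) hl l.length (by simp)) (v := Submodule.mkQ _ v)
  have h2 (w : R) : (Ideal.ofList z • (⊤ : Submodule A R)).mkQ w ∈ Ideal.ofList l • (⊤ : Submodule A _) ↔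
      w ∈ Ideal.ofList (l ++ z) • (⊤ : Submodule A R) := by
    rw [mkQ_mem_smul_top_iff, Ideal.ofList_append, Submodule.sup_smul]
  rw [← map_smul, ← map_smul, h2, h2, smul_mem_ofList_smul_top_iff, smul_mem_ofList_smul_top_iff] at h1
  exact h1 hv

theorem map_bKe_le_bCol (hs : Function.Surjective (algebraMap A R)) {n d : ℕ} {ws : List A}
    (hn : d + ws.length = n) (hA : ∀ l : List A, PSL n l → RingTheory.Sequence.IsWeaklyRegular A l)
    {z : List A} (hz : PSL n (ws ++ z)) :
    (bKe n ws z R).map (algebraMap A R) ≤ bCol d (z.map (algebraMap A R)) := by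
  rw [Ideal.map_le_iff_le_comap]
  intro c hc l a hl v hv
  obtain ⟨L, hL, hp⟩ := exists_lift_psl hs hn z hz (l ++ [a]) (by simpa using hl)
  obtain ⟨l', L', rfl, rfl, hL'⟩ := List.map_eq_append_iff.1 hL
  obtain ⟨a', t, rfl, rfl, ht⟩ := List.map_eq_cons_iff.1 hL'
  obtain rfl := List.map_eq_nil_iff.1 ht
  rw [← List.map_append] at hv ⊢
  exact smul_mem_of_mem_bKe hA hc hp hv

end Lift

section Select

theorem not_maximalIdeal_le {R : Type u} [CommRing R] [IsLocalRing R] {P : Ideal R} (hP : P.IsPrime) {k : ℕ}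
    (hdim : ((k + 1 : ℕ) : WithBot ℕ∞) ≤ ringKrullDim (R ⧸ P)) : ¬ maximalIdeal R ≤ P := fun hle => by
  have : P = maximalIdeal R := le_antisymm (le_maximalIdeal hP.ne_top) hle
  subst this
  let _ : Field (R ⧸ maximalIdeal R) := Ideal.Quotient.field _
  have h0 : ringKrullDim (R ⧸ maximalIdeal R) = 0 := ringKrullDim_eq_zero_of_field _
  rw [h0] at hdim
  have := (Nat.cast_le (α := WithBot ℕ∞) (m := k + 1) (n := 0)).1 (by simp at hdim)
  omega

theorem PSL.par {R : Type u} [CommRing R] [IsLocalRing R] [IsNoetherianRing R] {n : ℕ} {l : List R}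
    (h : PSL n l) (hl : l.length = n) : Par l R := by
  obtain ⟨h1, k, hk, h2⟩ := h
  obtain rfl : k = 0 := by omega
  obtain ⟨t, ht⟩ := h2.exists_pow_le
  exact ⟨h1, t, ht.trans le_sup_right⟩

variable {A R : Type u} [CommRing A] [CommRing R] [IsNoetherianRing A] [IsNoetherianRing R]
  [IsLocalRing A] [IsLocalRing R] [Algebra A R]

theorem isWeaklyRegular_quotient {n : ℕ} (hA : ∀ l : List A, PSL n l → RingTheory.Sequence.IsWeaklyRegular A l)
    {L l : List A} (h : PSL n (L ++ l)) : RingTheory.Sequence.IsWeaklyRegular (A ⧸ Ideal.ofList L) l := by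
  have h1 := ((RingTheory.Sequence.isWeaklyRegular_append_iff _ _ _).1 (hA _ h)).2
  have h2 : (Ideal.ofList L • ⊤ : Ideal A) = Ideal.ofList L := by rw [smul_eq_mul, Ideal.mul_top]
  rwa [h2] at h1

theorem smul_quotient_ofList_eq_zero (l : List A) : ∀ a ∈ l, ∀ v : A ⧸ Ideal.ofList l, a • v = 0 := by
  intro a ha v
  obtain ⟨v, rfl⟩ := Ideal.Quotient.mk_surjective v
  exact Ideal.Quotient.eq_zero_iff_mem.2 (Ideal.mul_mem_right _ _ (Ideal.subset_span ha))

theorem bKe_not_le (hs : Function.Surjective (algebraMap A R)) {n : ℕ}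
    (hA : ∀ l : List A, PSL n l → RingTheory.Sequence.IsWeaklyRegular A l) {ws z : List A}
    (hws : ∀ w ∈ ws, algebraMap A R w = 0) {p : Ideal A} (hp : p ∈ (Ideal.ofList (ws ++ z)).minimalPrimes) :
    ¬ bKe n ws z R ≤ p := by
  have : Module.Finite A R := Module.Finite.of_surjective (Algebra.linearMap A R) hs
  obtain ⟨c, hc, h⟩ := exists_ekill_of_minimalPrimes hp (S := {l | PSL n (ws ++ (l ++ z))}) (i := 0) (B := n)
    (fun l hl => by
      obtain ⟨_, k, hk, -⟩ := hl
      simp only [List.length_append] at hk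
      omega)
    (fun l hl k hk => ext_eq_zero_of_isWeaklyRegular l _ (isWeaklyRegular_quotient hA (PSL.perm hl (by
      rw [List.append_assoc]
      exact List.perm_append_comm.append_left _))) (smul_quotient_ofList_eq_zero l) k hk)
    (R ⧸ (Ideal.ofList z • (⊤ : Submodule A R))) (by
      rw [Ideal.ofList_append, sup_le_iff]
      constructor
      · refine Ideal.span_le.2 fun w hw => Module.mem_annihilator.2 fun v => ?_
        obtain ⟨v, rfl⟩ := Submodule.mkQ_surjective _ v
        have hw0 : w • v = 0 := by rw [Algebra.smul_def, hws w hw, zero_mul]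
        rw [← map_smul, hw0, map_zero]
      · refine fun w hw => Module.mem_annihilator.2 fun v => ?_
        obtain ⟨v, rfl⟩ := Submodule.mkQ_surjective _ v
        rw [← map_smul]
        exact (Submodule.Quotient.mk_eq_zero _).2 (Submodule.smul_mem_smul hw trivial))
  exact fun hle => hc (hle h)

theorem exists_cons_cList (hs : Function.Surjective (algebraMap A R)) {n d : ℕ}
    (hA : ∀ l : List A, PSL n l → RingTheory.Sequence.IsWeaklyRegular A l) {ws L : List A}
    (hn : d + ws.length = n) (hws : ∀ w ∈ ws, algebraMap A R w = 0) {i : ℕ} (hi : i + 1 + L.length = d)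
    (hL : PSL n (ws ++ L)) {J : Ideal A}
    (hJ : ∀ P : Ideal A, P.IsPrime → ((i + 1 : ℕ) : WithBot ℕ∞) ≤ ringKrullDim (A ⧸ P) → ¬ J ≤ P)
    (hC : CList d (L.map (algebraMap A R))) :
    ∃ x ∈ J, x ∈ maximalIdeal A ^ 2 ∧ PSL n (ws ++ (x :: L)) ∧ CList d ((x :: L).map (algebraMap A R)) := by
  obtain ⟨h1, k, hk, h2⟩ := id hL
  obtain rfl : k = i + 1 := by
    simp only [List.length_append] at hk
    omega
  obtain ⟨x, hx, hd⟩ := exists_mem_dle (J := J * (maximalIdeal A ^ 2 * bKe n ws L R ^ 3)) h2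
    fun P hP hle hdim hle' => by
      rcases hP.mul_le.1 hle' with h | h
      · exact hJ P hP hdim h
      rcases hP.mul_le.1 h with h | h
      · exact not_maximalIdeal_le hP hdim (hP.le_of_pow_le h)
      · exact bKe_not_le hs hA hws (h2.mem_minimalPrimes hP hle hdim) (hP.le_of_pow_le h)
  have hx1 := (Ideal.mul_le_inf hx).1
  have hx2 := (Ideal.mul_le_inf (Ideal.mul_le_inf hx).2)
  refine ⟨x, hx1, hx2.1, PSL.perm (l := x :: (ws ++ L)) ⟨?_, i, ?_, ?_⟩ List.perm_middle.symm, ?_, hC⟩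
  · intro y hy
    rcases List.mem_cons.1 hy with rfl | hy
    · exact Ideal.pow_le_self two_ne_zero hx2.1
    · exact h1 y hy
  · simp only [List.length_cons]
    omega
  · rwa [Ideal.ofList_cons, sup_comm]
  · have h3 := Ideal.mem_map_of_mem (algebraMap A R) hx2.2
    rw [Ideal.map_pow] at h3
    exact Ideal.pow_right_mono (map_bKe_le_bCol hs hn hA hL) 3 h3

theorem exists_list_cList (hs : Function.Surjective (algebraMap A R)) {n d : ℕ}
    (hA : ∀ l : List A, PSL n l → RingTheory.Sequence.IsWeaklyRegular A l) {ws L : List A}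
    (hn : d + ws.length = n) (hws : ∀ w ∈ ws, algebraMap A R w = 0) {s : ℕ} (j : ℕ) (hi : s + j + L.length = d)
    (hL : PSL n (ws ++ L)) {J : Ideal A}
    (hJ : ∀ P : Ideal A, P.IsPrime → ((s + 1 : ℕ) : WithBot ℕ∞) ≤ ringKrullDim (A ⧸ P) → ¬ J ≤ P)
    (hC : CList d (L.map (algebraMap A R))) :
    ∃ l : List A, l.length = j ∧ (∀ x ∈ l, x ∈ J ∧ x ∈ maximalIdeal A ^ 2) ∧ PSL n (ws ++ (l ++ L)) ∧
      CList d ((l ++ L).map (algebraMap A R)) := by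
  induction j generalizing s with
  | zero => exact ⟨[], rfl, by simp, hL, hC⟩
  | succ j ih =>
    have hJ' : ∀ P : Ideal A, P.IsPrime → ((s + 1 + 1 : ℕ) : WithBot ℕ∞) ≤ ringKrullDim (A ⧸ P) → ¬ J ≤ P :=
      fun P hP h => hJ P hP (le_trans (by exact_mod_cast Nat.le_succ _) h)
    obtain ⟨l, rfl, h1, h2, h3⟩ := ih (s := s + 1) (by omega) hJ'
    obtain ⟨x, hx, hx2, h4, h5⟩ := exists_cons_cList hs hA hn hws (i := s) (L := l ++ L)
      (by simp only [List.length_append]; omega) h2 hJ h3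
    refine ⟨x :: l, by simp, ?_, h4, h5⟩
    intro y hy
    rcases List.mem_cons.1 hy with rfl | hy
    · exact ⟨hx, hx2⟩
    · exact h1 y hy

theorem bKe_nil (n : ℕ) (ws : List A) : bKe n ws [] R = keIdeal {l | PSL n (ws ++ l)} 0 R := by
  have e : (R ⧸ (Ideal.ofList ([] : List A) • (⊤ : Submodule A R))) ≃ₗ[A] R :=
    Submodule.quotEquivOfEqBot (Ideal.ofList ([] : List A) • (⊤ : Submodule A R))
      (by rw [Ideal.ofList_nil]; exact Submodule.bot_smul (R := A) _)
  ext c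
  simp only [bKe, mem_keIdeal, List.append_nil, Set.mem_ofPred_eq]
  exact ⟨fun h l hl k hk => (h l hl k hk).congr e, fun h l hl k hk => (h l hl k hk).congr e.symm⟩

theorem ekill_quotient_ofList {n : ℕ} (hA : ∀ l : List A, PSL n l → RingTheory.Sequence.IsWeaklyRegular A l)
    {ws zs l : List A} (hz : PSL n (ws ++ zs)) (hl : PSL n (ws ++ l)) {k : ℕ} (hk : k + zs.length < l.length) :
    EKill (1 : A) (A ⧸ Ideal.ofList l) (A ⧸ (Ideal.ofList ws ⊔ Ideal.ofList zs)) k := by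
  have h := ext_quotient_eq_zero_of_isWeaklyRegular (N := A ⧸ Ideal.ofList l) zs (A ⧸ Ideal.ofList ws)
    (isWeaklyRegular_quotient hA hz) l.length (fun k hk => ext_eq_zero_of_isWeaklyRegular l _
      (isWeaklyRegular_quotient hA hl) (smul_quotient_ofList_eq_zero l) k hk) k hk
  have h2 : (Ideal.ofList zs • ⊤ : Submodule A (A ⧸ Ideal.ofList ws)) =
      Submodule.map (Submodule.mkQ (Ideal.ofList ws)) (Ideal.ofList zs) := by
    rw [← Submodule.range_mkQ, ← Submodule.map_top, ← Submodule.map_smul'', smul_eq_mul, Ideal.mul_top]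
  exact h.congr ((Submodule.quotEquivOfEq _ _ h2).trans (Submodule.quotientQuotientEquivQuotientSup _ _))

/-- If no power of the maximal ideal kills all colon modules of `R`, a homomorphic image of a
Cohen–Macaulay ring, there are a system of parameters `xs ++ zs` as in the definition of C-systems
and a prime `p` of dimension `xs.length` at which the colon modules of `zs` do not all vanish. -/
theorem exists_bad_list (hs : Function.Surjective (algebraMap A R)) {n d : ℕ}
    (hn : ∀ l : List A, PSL n l → RingTheory.Sequence.IsWeaklyRegular A l)
    (hA : DLE (⊥ : Ideal A) n) (hR : DLE (⊥ : Ideal R) d) (hdn : d ≤ n)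
    (hnot : ∀ t, ¬ maximalIdeal R ^ t ≤ bCol d ([] : List R)) :
    ∃ (xs zs : List R) (p : Ideal R), p.IsPrime ∧ xs ≠ [] ∧ xs.length + zs.length = d ∧ Par (xs ++ zs) R ∧
      CList d (xs ++ zs) ∧ (∀ x ∈ xs ++ zs, x ∈ maximalIdeal R ^ 2) ∧ (∀ z ∈ zs, z ∈ bCol d ([] : List R)) ∧
      (xs.length : WithBot ℕ∞) ≤ ringKrullDim (R ⧸ p) ∧
      ∀ f ∉ p, ¬ ColonKilled (Ideal.span {f}) zs R := by
  have : Module.Finite A R := Module.Finite.of_surjective (Algebra.linearMap A R) hs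
  have hcm (P : Ideal A) (hP : RingHom.ker (algebraMap A R) ≤ P) :
      (P.map (algebraMap A R)).comap (algebraMap A R) = P := by
    rw [Ideal.comap_map_of_surjective _ hs]
    exact sup_eq_left.2 hP
  obtain ⟨ws, hwn, hws, hwP⟩ : ∃ ws : List A, d + ws.length = n ∧ (∀ w ∈ ws, algebraMap A R w = 0) ∧
      PSL n ws := by
    suffices H : ∀ j, d + j ≤ n → ∃ ws : List A, ws.length = j ∧ (∀ w ∈ ws, algebraMap A R w = 0) ∧
        PSL n ws by
      obtain ⟨ws, h1, h2, h3⟩ := H (n - d) (by omega)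
      exact ⟨ws, by omega, h2, h3⟩
    intro j
    induction j with
    | zero => exact fun _ => ⟨[], rfl, by simp, by simp, n, rfl, by rwa [Ideal.ofList_nil]⟩
    | succ j ih =>
      intro hj
      obtain ⟨ws, rfl, h1, h2, k, hk, h3⟩ := ih (by omega)
      obtain ⟨k, rfl⟩ : ∃ k', k = k' + 1 := ⟨k - 1, by omega⟩
      obtain ⟨w, hw, h4⟩ := exists_mem_dle (J := RingHom.ker (algebraMap A R)) h3 fun P hP _ hdim hle => by
        rw [← hcm P hle, ringKrullDim_quotient_comap hs] at hdim
        exact (hR.mono bot_le).not_le (I := P.map (algebraMap A R)) le_rfl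
          (le_trans (by exact_mod_cast (by omega : d + 1 ≤ k + 1)) hdim)
      refine ⟨w :: ws, rfl, ?_, ?_, k, by simp only [List.length_cons]; omega, ?_⟩
      · intro y hy
        rcases List.mem_cons.1 hy with rfl | hy
        · exact hw
        · exact h1 y hy
      · intro y hy
        rcases List.mem_cons.1 hy with rfl | hy
        · exact mem_maximalIdeal_of_map (by rw [(RingHom.mem_ker).1 hw]; exact zero_mem _)
        · exact h2 y hy
      · rwa [Ideal.ofList_cons, sup_comm]
  have hwP' : PSL n (ws ++ []) := by rwa [List.append_nil]
  obtain ⟨𝔠, h𝔠⟩ : ∃ 𝔠, 𝔠 = bKe n ws [] R := ⟨_, rfl⟩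
  have hker : RingHom.ker (algebraMap A R) ≤ 𝔠 := by
    rw [h𝔠, bKe_nil]
    exact fun a ha l _ k _ => EKill.of_smul_eq_zero (fun v => by
      rw [Algebra.smul_def, (RingHom.mem_ker).1 ha, zero_mul]) k
  have hmap : 𝔠.map (algebraMap A R) ≤ bCol d ([] : List R) := by
    rw [h𝔠]
    exact map_bKe_le_bCol hs hwn hn hwP'
  obtain ⟨s, hs1, hs2⟩ : ∃ s, DLE 𝔠 (s + 1) ∧ ¬ DLE 𝔠 s := by
    by_contra hcon
    push Not at hcon
    have h0 : DLE 𝔠 0 := by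
      suffices H : ∀ k, DLE 𝔠 k → DLE 𝔠 0 from H _ (hA.mono bot_le)
      intro k
      induction k with
      | zero => exact id
      | succ k ih => exact fun h => ih (hcon k h)
    obtain ⟨t, ht⟩ := h0.exists_pow_le
    refine hnot t (le_trans ?_ hmap)
    have h1 : maximalIdeal R ≤ (maximalIdeal A).map (algebraMap A R) := by
      intro x hx
      obtain ⟨a, rfl⟩ := hs x
      exact Ideal.mem_map_of_mem _ (mem_maximalIdeal_of_map hx)
    exact (Ideal.pow_right_mono h1 t).trans (by rw [← Ideal.map_pow]; exact Ideal.map_mono ht)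
  obtain ⟨p, hp, h𝔠p, hpdim⟩ := exists_prime_le_ringKrullDim (natCast_succ_le_of_not_le hs2)
  have hpm := hcm p (hker.trans h𝔠p)
  have hsd : s + 1 ≤ d := by
    by_contra hcon
    rw [← hpm, ringKrullDim_quotient_comap hs] at hpdim
    exact (hR.mono bot_le).not_le (I := p.map (algebraMap A R)) le_rfl
      (le_trans (by exact_mod_cast (by omega : d + 1 ≤ s + 1)) hpdim)
  obtain ⟨D, rfl⟩ : ∃ D, d = s + 1 + D := ⟨d - (s + 1), by omega⟩
  obtain ⟨zs, hzl, hz1, hz2, hz3⟩ := exists_list_cList hs hn hwn hws (s := s + 1) (L := []) D (by simp)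
    hwP' (J := 𝔠 ^ 2 ^ (D + 1)) (fun P hP hdim hle => hs1.not_le (hP.le_of_pow_le hle) hdim) trivial
  rw [List.append_nil] at hz2 hz3
  obtain ⟨xs, hxl, hx1, hx2, hx3⟩ := exists_list_cList hs hn hwn hws (s := 0) (L := zs) (s + 1) (by omega)
    hz2 (J := ⊤) (fun P hP hdim hle => hP.ne_top (top_le_iff.1 hle)) hz3
  have hz𝔠 : ∀ z ∈ zs, z ∈ 𝔠 := fun z hz => Ideal.pow_le_self (by positivity) (hz1 z hz).1
  rw [List.map_append] at hx3
  refine ⟨xs.map (algebraMap A R), zs.map (algebraMap A R), p.map (algebraMap A R),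
    Ideal.map_isPrime_of_surjective hs (hker.trans h𝔠p), ?_, by simp [hxl, hzl], ?_, hx3, ?_, ?_, ?_, ?_⟩
  · rintro h
    rw [List.map_eq_nil_iff.1 h] at hxl
    simp at hxl
  · rw [← List.map_append]
    exact (PSL.of_lift hs hwn hws hx2).par (by simp [hxl, hzl])
  · rw [← List.map_append]
    intro y hy
    obtain ⟨a, ha, rfl⟩ := List.mem_map.1 hy
    have ha2 : a ∈ maximalIdeal A ^ 2 := by
      rcases List.mem_append.1 ha with ha | ha
      · exact (hx1 a ha).2
      · exact (hz1 a ha).2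
    have h := Ideal.mem_map_of_mem (algebraMap A R) ha2
    rw [Ideal.map_pow] at h
    exact Ideal.pow_right_mono (Ideal.map_le_iff_le_comap.2 fun _ => map_mem_maximalIdeal hs) 2 h
  · intro z hz
    obtain ⟨a, ha, rfl⟩ := List.mem_map.1 hz
    exact hmap (Ideal.mem_map_of_mem _ (hz𝔠 a ha))
  · rw [List.length_map, hxl, ← ringKrullDim_quotient_comap hs, hpm]
    exact hpdim
  · intro f hf hk
    obtain ⟨f, rfl⟩ := hs f
    have hf' : f ∉ p := fun h => hf (Ideal.mem_map_of_mem _ h)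
    rw [colonKilled_iff] at hk
    obtain ⟨g, hg, hg'⟩ := exists_mem_keIdeal {l : List A | PSL n (ws ++ l)} (𝔠 := 𝔠) hf' zs R (Ideal.ofList ws)
      (Ideal.span_le.2 fun w hw => Module.mem_annihilator.2 fun v => by
        rw [Algebra.smul_def, hws w hw, zero_mul]) 0 1 (2 ^ (D + 1))
      (by rw [pow_one, h𝔠, bKe_nil]) (fun z hz => (hz1 z hz).1) (by rw [hzl, pow_succ]; omega)
      (by
        rw [colonKilled_iff]
        rintro l a r rfl c hc v hv
        rw [smul_mem_ofList_smul_top_iff] at hv ⊢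
        have h := smul_mem_of_mem_bKe hn (ws := ws) (z := []) (l := l) (a := a) (h𝔠 ▸ hc)
          (hz2.sublist (by simp)) (v := v)
        rw [List.append_nil] at h
        exact h hv)
      (by
        rw [colonKilled_iff]
        rintro l a r rfl c hc v hv
        obtain ⟨c, rfl⟩ := Ideal.mem_span_singleton'.1 hc
        rw [smul_mem_ofList_smul_top_iff] at hv ⊢
        have h := hk (l.map (algebraMap A R)) (algebraMap A R a) (r.map (algebraMap A R)) (by simp)
          (algebraMap A R f) (Ideal.mem_span_singleton_self _) v
        simp only [smul_eq_mul, Ideal.mul_top] at h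
        rw [map_mul, mul_assoc]
        exact Ideal.mul_mem_left _ _ (h hv))
      (fun Y _ _ _ hY => exists_ekill_of_minimalPrimes (B := n)
        (by
          obtain ⟨_, k, hk, h2⟩ := hz2
          rw [Ideal.ofList_append] at h2
          refine h2.mem_minimalPrimes hp ?_ ?_
          · refine sup_le ?_ ?_
            · exact (Ideal.span_le.2 fun w hw => hws w hw).trans (hker.trans h𝔠p)
            · exact (Ideal.span_le.2 fun z hz => hz𝔠 z hz).trans h𝔠p
          · refine le_trans ?_ hpdim
            simp only [List.length_append] at hk
            exact_mod_cast (by omega : k ≤ s + 1))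
        (fun l hl => by
          obtain ⟨_, k, hk, -⟩ := hl
          simp only [List.length_append] at hk
          omega)
        (fun l hl k hk => ekill_quotient_ofList hn hz2 hl (by omega)) Y hY)
    rw [← bKe_nil, ← h𝔠] at hg'
    exact hg (h𝔠p hg')

end Select

section Descent
variable {R : Type u} [CommRing R]

/-- `c` kills `((l, x)M : y) / ((l, x)M + (lM : x))`. -/
def EndKilled (c : R) (l : List R) (x y : R) (M : Type u) [AddCommGroup M] [Module R M] : Prop :=
  ∀ v : M, y • v ∈ Ideal.ofList (l ++ [x]) • (⊤ : Submodule R M) →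
    ∃ u : M, c • v - u ∈ Ideal.ofList (l ++ [x]) • (⊤ : Submodule R M) ∧ x • u ∈ Ideal.ofList l • (⊤ : Submodule R M)

theorem mem_ofList_append_singleton {l : List R} {x v : R} :
    v ∈ Ideal.ofList (l ++ [x]) ↔ ∃ w, v - x * w ∈ Ideal.ofList l := by
  simpa using ofList_append_singleton_smul_top l x R v

theorem mem_ofList_append_pair {l : List R} {x y v : R} :
    v ∈ Ideal.ofList (l ++ [x, y]) ↔ ∃ a b, v - (x * a + y * b) ∈ Ideal.ofList l := by
  rw [show l ++ [x, y] = (l ++ [x]) ++ [y] by simp, mem_ofList_append_singleton]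
  simp only [mem_ofList_append_singleton]
  constructor
  · rintro ⟨b, a, h⟩
    exact ⟨a, b, by rwa [sub_sub, add_comm] at h⟩
  · rintro ⟨a, b, h⟩
    exact ⟨b, a, by rwa [sub_sub, add_comm]⟩

variable [IsLocalRing R] [IsNoetherianRing R]

theorem mul_mem_of_mem_bCol {d : ℕ} {c : R} (hc : c ∈ bCol d ([] : List R)) {l : List R} {a v : R}
    (hl : PSL d (l ++ [a])) (hv : a * v ∈ Ideal.ofList l) : c * v ∈ Ideal.ofList l := by
  have := hc l a hl v
  rw [List.append_nil] at this
  exact this hv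

theorem PSL.sq {d : ℕ} {l r : List R} {a : R} (h : PSL d (l ++ a :: r)) : PSL d (l ++ a * a :: r) := by
  rw [← pow_two]
  exact ((h.perm List.perm_middle).pow_head two_ne_zero).perm List.perm_middle.symm

theorem EndKilled.descent {d : ℕ} {c x y y' : R} {l r : List R} (hz : PSL d (l ++ x :: y :: y' :: r))
    (hx : x ∈ bCol d ([] : List R)) (hy : y ∈ bCol d ([] : List R)) (hy' : y' ∈ bCol d ([] : List R))
    (h : EndKilled c (l ++ [x]) y y' R) : EndKilled c l x y R := by
  unfold EndKilled at *
  simp only [smul_eq_mul, Ideal.mul_top] at *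
  intro v hv
  obtain ⟨w, hw⟩ := mem_ofList_append_singleton.1 hv
  have mk (a b : R) : (Ideal.Quotient.mk (Ideal.ofList l) a : R ⧸ Ideal.ofList l) =
      Ideal.Quotient.mk (Ideal.ofList l) b ↔ a - b ∈ Ideal.ofList l := Ideal.Quotient.eq
  have sm (a b : R) : a • (Ideal.Quotient.mk (Ideal.ofList l) b) = Ideal.Quotient.mk (Ideal.ofList l) (a * b) := rfl
  have mk0 (a : R) : (Ideal.Quotient.mk (Ideal.ofList l) a : R ⧸ Ideal.ofList l) = 0 ↔ a ∈ Ideal.ofList l :=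
    Ideal.Quotient.eq_zero_iff_mem
  have hsur := Ideal.Quotient.mk_surjective (I := Ideal.ofList l)
  have pxy : PSL d (l ++ [x, y]) := hz.sublist (by simp)
  have px : PSL d (l ++ [x]) := hz.sublist (by simp)
  have py : PSL d (l ++ [y]) := hz.sublist (by simp)
  have pxyy : PSL d (l ++ [x, y, y']) := hz.sublist (by simp)
  suffices hh : ∃ b u : R ⧸ Ideal.ofList l, c • Ideal.Quotient.mk (Ideal.ofList l) v = x • b + u ∧ x • u = 0 by
    obtain ⟨b, u, h1, h2⟩ := hh
    obtain ⟨b, rfl⟩ := hsur b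
    obtain ⟨u, rfl⟩ := hsur u
    rw [sm, sm, ← map_add, mk] at h1
    rw [sm, mk0] at h2
    exact ⟨u, mem_ofList_append_singleton.2 ⟨b, by convert h1 using 1; ring⟩, h2⟩
  refine smul_mem_of_colon_conditions (y := y) (y' := y') (w := Ideal.Quotient.mk _ w) ?_ ?_ ?_ ?_ ?_ ?_ ?_ ((mk _ _).2 hw)
  · intro v w h
    obtain ⟨v, rfl⟩ := hsur v
    obtain ⟨w, rfl⟩ := hsur w
    rw [sm, sm, mk] at h
    obtain ⟨w', h'⟩ := mem_ofList_append_singleton.1 (mul_mem_of_mem_bCol hy' (l := l ++ [x]) (a := y) (by simpa using pxy)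
      (mem_ofList_append_singleton.2 ⟨w, h⟩))
    exact ⟨Ideal.Quotient.mk _ w', (mk _ _).2 h'⟩
  · intro u h
    obtain ⟨u, rfl⟩ := hsur u
    rw [sm, mk0] at h ⊢
    exact mul_mem_of_mem_bCol hy' px h
  · intro w a b h
    obtain ⟨w, rfl⟩ := hsur w
    obtain ⟨a, rfl⟩ := hsur a
    obtain ⟨b, rfl⟩ := hsur b
    rw [sm, sm, sm, sm, ← map_add, mk, ← mul_assoc] at h
    obtain ⟨a', b', h'⟩ := mem_ofList_append_pair.1 (mul_mem_of_mem_bCol hy' (l := l ++ [x, y]) (a := y' * y')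
      (PSL.sq (by simpa using pxyy)) (mem_ofList_append_pair.2 ⟨a, b, h⟩))
    exact ⟨Ideal.Quotient.mk _ a', Ideal.Quotient.mk _ b', (mk _ _).2 h'⟩
  · intro w a b hw
    obtain ⟨w, rfl⟩ := hsur w
    obtain ⟨a, rfl⟩ := hsur a
    obtain ⟨b, rfl⟩ := hsur b
    rw [sm, sm, sm, ← map_add, mk] at hw
    obtain ⟨u, h1, h2⟩ := h w (by
      rw [show l ++ [x] ++ [y] = l ++ [x, y] by simp]
      exact mem_ofList_append_pair.2 ⟨a, b, hw⟩)
    rw [show l ++ [x] ++ [y] = l ++ [x, y] by simp] at h1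
    obtain ⟨a', b', h1⟩ := mem_ofList_append_pair.1 h1
    obtain ⟨u', h2⟩ := mem_ofList_append_singleton.1 h2
    refine ⟨Ideal.Quotient.mk _ (u + x * a'), Ideal.Quotient.mk _ b', ?_, Ideal.Quotient.mk _ (u' + y * a'), ?_⟩
    · rw [sm, sm, ← map_add, mk]
      convert h1 using 1; ring
    · rw [sm, sm, mk]
      convert h2 using 1; ring
  · intro v u h
    obtain ⟨v, rfl⟩ := hsur v
    obtain ⟨u, rfl⟩ := hsur u
    rw [sm, sm, sm, sm, mk, ← mul_assoc, ← mul_assoc] at h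
    obtain ⟨w', h'⟩ := mem_ofList_append_singleton.1 (mul_mem_of_mem_bCol hy (l := l ++ [x * x]) (a := y * y)
      (PSL.sq (by simpa using pxy.sq)) (mem_ofList_append_singleton.2 ⟨u, h⟩))
    exact ⟨Ideal.Quotient.mk _ w', (mk _ _).2 (by rw [mul_assoc] at h'; exact h')⟩
  · intro b u h
    obtain ⟨b, rfl⟩ := hsur b
    obtain ⟨u, rfl⟩ := hsur u
    rw [sm, sm, sm, mk, ← mul_assoc] at h
    obtain ⟨w', h'⟩ := mem_ofList_append_singleton.1 (mul_mem_of_mem_bCol hx (l := l ++ [y]) (a := x * x)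
      (PSL.sq (by simpa using pxy.perm (l' := l ++ [y, x]) (List.Perm.append_left _ (List.Perm.swap _ _ _))))
      (mem_ofList_append_singleton.2 ⟨u, h⟩))
    exact ⟨Ideal.Quotient.mk _ w', (mk _ _).2 h'⟩
  · intro u h
    obtain ⟨u, rfl⟩ := hsur u
    rw [sm, mk0] at h ⊢
    exact mul_mem_of_mem_bCol hx py h

theorem EndKilled.of_last {d : ℕ} {c : R} {zs : List R} (hz : PSL d zs) (hb : ∀ z ∈ zs, z ∈ bCol d ([] : List R))
    (h : ∀ l x y, zs = l ++ [x, y] → EndKilled c l x y R) (r : List R) :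
    ∀ l x y, zs = l ++ x :: y :: r → EndKilled c l x y R := by
  induction r with
  | nil => exact h
  | cons y' r ih =>
    intro l x y hzs
    subst hzs
    exact EndKilled.descent hz (hb x (by simp)) (hb y (by simp)) (hb y' (by simp))
      (ih (l ++ [x]) y y' (by simp))

/-- If `c` kills the last of the modules in `EndKilled`, a power of `c` kills all colon modules. -/
theorem colonKilled_of_endKilled {d : ℕ} {c : R} {zs : List R} (hz : PSL d zs)
    (hb : ∀ z ∈ zs, z ∈ bCol d ([] : List R)) (hreg : ∀ z ∈ zs, ∀ v : R, z * v = 0 → v = 0)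
    (h : ∀ l x y, zs = l ++ [x, y] → EndKilled c l x y R) :
    ColonKilled (Ideal.span {c ^ zs.length}) zs R := by
  have key : ∀ l a r, zs = l ++ a :: r → ∀ v, a * v ∈ Ideal.ofList l → c ^ l.length * v ∈ Ideal.ofList l := by
    intro l
    induction l using List.reverseRecOn with
    | nil =>
      rintro a r rfl v hv
      rw [Ideal.ofList_nil] at hv ⊢
      rw [hreg a (by simp) v hv, mul_zero]
      exact zero_mem _
    | append_singleton l x ih =>
      intro a r hzs v hv
      have hzs' : zs = l ++ x :: a :: r := by simpa using hzs
      have h1 := EndKilled.of_last hz hb h r l x a hzs' v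
      simp only [smul_eq_mul, Ideal.mul_top] at h1
      obtain ⟨u, h2, h3⟩ := h1 hv
      have h4 := ih x (a :: r) hzs' u h3
      have h5 : Ideal.ofList l ≤ Ideal.ofList (l ++ [x]) := Ideal.span_mono fun y hy => List.mem_append_left _ hy
      have h6 := add_mem (Ideal.mul_mem_left _ (c ^ l.length) h2) (h5 h4)
      rw [List.length_append, List.length_singleton]
      convert h6 using 1; ring
  rw [colonKilled_iff]
  intro l a r hzs f hf v hv
  obtain ⟨g, rfl⟩ := Ideal.mem_span_singleton'.1 hf
  simp only [smul_eq_mul, Ideal.mul_top] at *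
  have hlen : zs.length = (r.length + 1) + l.length := by rw [hzs]; simp; omega
  rw [hlen, pow_add, mul_assoc, mul_assoc]
  exact Ideal.mul_mem_left _ _ (Ideal.mul_mem_left _ _ (key l a r hzs v hv))

end Descent

section LowerBound
variable {R : Type u} [CommRing R]

theorem mkQ_mem_ofList_smul_top_iff {M : Type u} [AddCommGroup M] [Module R M] (x : R) (l : List R) (v : M) :
    (x • (⊤ : Submodule R M)).mkQ v ∈ Ideal.ofList l • (⊤ : Submodule R (QuotSMulTop x M)) ↔
      v ∈ Ideal.ofList (x :: l) • (⊤ : Submodule R M) := by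
  rw [Ideal.ofList_cons, Submodule.sup_smul, Submodule.ideal_span_singleton_smul, sup_comm]
  exact mkQ_mem_smul_top_iff _ _ v

/-- A strong form of the condition defining `d`-sequences. -/
def IsDSeq (zs : List R) (M : Type u) [AddCommGroup M] [Module R M] : Prop :=
  ∀ l a r, zs = l ++ a :: r → ∀ k ∈ a :: r, ∀ v : M, a • a • v ∈ Ideal.ofList l • (⊤ : Submodule R M) →
    k • v ∈ Ideal.ofList l • (⊤ : Submodule R M)

variable {M : Type u} [AddCommGroup M] [Module R M]

theorem IsDSeq.tail {x : R} {zs : List R} (h : IsDSeq (x :: zs) M) : IsDSeq zs (QuotSMulTop x M) := by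
  rintro l a r rfl k hk v hv
  obtain ⟨v, rfl⟩ := Submodule.mkQ_surjective _ v
  rw [← map_smul, ← map_smul, mkQ_mem_ofList_smul_top_iff] at hv
  rw [← map_smul, mkQ_mem_ofList_smul_top_iff]
  exact h (x :: l) a r (by simp) k hk v hv

theorem IsDSeq.colon_inf_le {zs : List R} (h : IsDSeq zs M) {l r : List R} {a : R} (hz : zs = l ++ a :: r) {v : M}
    (hv : a • v ∈ Ideal.ofList l • (⊤ : Submodule R M)) (hv' : v ∈ Ideal.ofList zs • (⊤ : Submodule R M)) :
    v ∈ Ideal.ofList l • (⊤ : Submodule R M) := by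
  have key : ∀ r1 r2, a :: r = r1 ++ r2 → v ∈ Ideal.ofList (l ++ r1) • (⊤ : Submodule R M) →
      v ∈ Ideal.ofList l • (⊤ : Submodule R M) := by
    intro r1
    induction r1 using List.reverseRecOn with
    | nil => intro r2 _ h; simpa using h
    | append_singleton r1 k ih =>
      intro r2 hr hv'
      refine ih (k :: r2) (by simpa using hr) ?_
      rw [← List.append_assoc, ofList_append_singleton_smul_top] at hv'
      obtain ⟨b, hb⟩ := hv'
      have hle : Ideal.ofList l • (⊤ : Submodule R M) ≤ Ideal.ofList (l ++ r1) • (⊤ : Submodule R M) :=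
        Submodule.smul_mono_left (Ideal.span_mono fun y hy => List.mem_append_left _ hy)
      have hk : k ∈ a :: r := by rw [hr]; simp
      have h1 : k • v ∈ Ideal.ofList l • (⊤ : Submodule R M) :=
        h l a r hz k hk v (Submodule.smul_mem _ _ hv)
      have h2 : k • k • b ∈ Ideal.ofList (l ++ r1) • (⊤ : Submodule R M) := by
        have := sub_mem (hle h1) (Submodule.smul_mem _ k hb)
        rwa [smul_sub, sub_sub_cancel] at this
      have h3 := h (l ++ r1) k r2 (by rw [hz, hr]; simp) k (by simp) b h2
      have := add_mem hb h3
      rwa [sub_add_cancel] at this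
  exact key (a :: r) [] (by simp) (hz ▸ hv')

theorem IsDSeq.pow_inf_le {zs : List R} (h : IsDSeq zs M) (n : ℕ) : ∀ l r : List R, zs = l ++ r → ∀ v : M,
    v ∈ Ideal.ofList zs ^ (n + 1) • (⊤ : Submodule R M) → v ∈ Ideal.ofList l • (⊤ : Submodule R M) →
    v ∈ Ideal.ofList l • (Ideal.ofList zs ^ n • (⊤ : Submodule R M)) := by
  induction n with
  | zero =>
    intro l r _ v _ hv
    rwa [pow_zero, Ideal.one_eq_top, Submodule.top_smul]
  | succ n ihn =>
    intro l r
    induction r generalizing l with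
    | nil =>
      intro hz v hv _
      rw [List.append_nil] at hz
      rw [← hz, ← Submodule.mul_smul, ← pow_succ']
      exact hv
    | cons a r ih =>
      intro hz v hv hv'
      have h1 := ih (l ++ [a]) (by simpa using hz) v hv (by
        rw [ofList_append_singleton_smul_top]
        exact ⟨0, by simpa using hv'⟩)
      rw [Ideal.ofList_append, Ideal.ofList_singleton, Submodule.sup_smul, Submodule.mem_sup] at h1
      obtain ⟨u, hu, w', hw', rfl⟩ := h1
      rw [Submodule.ideal_span_singleton_smul] at hw'
      obtain ⟨w, hw, rfl⟩ := hw'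
      have hle : Ideal.ofList l • (Ideal.ofList zs ^ (n + 1) • (⊤ : Submodule R M)) ≤
        Ideal.ofList l • (⊤ : Submodule R M) := Submodule.smul_mono le_rfl le_top
      have haw : a • w ∈ Ideal.ofList l • (⊤ : Submodule R M) := by
        have := sub_mem hv' (hle hu)
        rwa [add_sub_cancel_left] at this
      have hw1 : w ∈ Ideal.ofList l • (⊤ : Submodule R M) := by
        refine h.colon_inf_le hz haw ?_
        refine Submodule.smul_mono_left ?_ hw
        exact Ideal.pow_le_self (Nat.succ_ne_zero n)
      have hw2 := ihn l (a :: r) hz w hw hw1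
      refine add_mem hu ?_
      have hw3 := Submodule.smul_mem_smul (Ideal.subset_span (show a ∈ {x | x ∈ zs} by simp [hz]) : a ∈ Ideal.ofList zs) hw2
      rw [← Submodule.mul_smul, mul_comm, Submodule.mul_smul, ← Submodule.mul_smul (Ideal.ofList zs), ← pow_succ'] at hw3
      exact hw3

theorem IsDSeq.exists_sub_mem {x : R} {zs : List R} (h : IsDSeq (x :: zs) M) {n : ℕ} {v : M}
    (hv : x • v ∈ Ideal.ofList (x :: zs) ^ (n + 1) • (⊤ : Submodule R M)) :
    ∃ w, x • w = 0 ∧ v - w ∈ Ideal.ofList (x :: zs) ^ n • (⊤ : Submodule R M) := by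
  have h1 := h.pow_inf_le n [x] zs rfl _ hv (by
    rw [Ideal.ofList_singleton, Submodule.ideal_span_singleton_smul]
    exact Submodule.smul_mem_pointwise_smul _ _ _ trivial)
  rw [Ideal.ofList_singleton, Submodule.ideal_span_singleton_smul] at h1
  obtain ⟨w, hw, hw'⟩ := h1
  refine ⟨v - w, ?_, by simpa using hw⟩
  rw [smul_sub, sub_eq_zero]
  exact hw'.symm

variable [IsLocalRing R] [IsNoetherianRing R] [Module.Finite R M]

theorem Par.quotient_ofList_pow {zs xs : List R} (h : Par (zs ++ xs) M) (N : ℕ) :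
    Par xs (M ⧸ Ideal.ofList zs ^ N • (⊤ : Submodule R M)) := by
  obtain ⟨h1, n, hn⟩ := h
  rw [Ideal.ofList_append, sup_comm (Ideal.ofList zs)] at hn
  exact Par.quotient_pow (fun x hx => h1 x (List.mem_append_right _ hx)) hn N

theorem mult_ker_add_range {xs : List R} {X Y : Type u} [AddCommGroup X] [Module R X] [AddCommGroup Y] [Module R Y]
    [Module.Finite R X] (f : X →ₗ[R] Y) (h : Par xs X) :
    mult xs X = mult xs (LinearMap.ker f) + mult xs (LinearMap.range f) :=
  mult_add xs _ X _ (LinearMap.ker f).subtype f.rangeRestrict (Submodule.subtype_injective _)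
    f.surjective_rangeRestrict (fun v => by simp [Subtype.ext_iff]) h

theorem IsDSeq.par_torsionBy {x : R} {zs xs : List R} (h : IsDSeq (x :: zs) M)
    (hP : Par (x :: zs ++ xs) M) : Par xs (Submodule.torsionBy R M x) := by
  obtain ⟨h1, n, hn⟩ := hP
  refine ⟨fun y hy => h1 y (List.mem_append_right _ hy), n, hn.trans ?_⟩
  rw [Ideal.ofList_append, ← sup_assoc]
  refine sup_le_sup_right (sup_le (LinearMap.annihilator_le_of_injective _
    (Submodule.subtype_injective _)) (Ideal.span_le.2 fun k hk => ?_)) _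
  refine Module.mem_annihilator.2 fun v => Subtype.ext ?_
  have hv : x • (v : M) = 0 := (Submodule.mem_torsionBy_iff x (v : M)).1 v.2
  have := h [] x zs rfl k hk (v : M) (by rw [hv, smul_zero]; exact zero_mem _)
  simpa using this

theorem IsDSeq.mult_quotient_pow_succ {x : R} {zs xs : List R} (h : IsDSeq (x :: zs) M)
    (hP : Par (x :: zs ++ xs) M) (N : ℕ) :
    mult xs (M ⧸ Ideal.ofList (x :: zs) ^ N • (⊤ : Submodule R M)) +
      mult xs (QuotSMulTop x M ⧸ Ideal.ofList zs ^ (N + 1) • (⊤ : Submodule R (QuotSMulTop x M))) ≤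
    mult xs (M ⧸ Ideal.ofList (x :: zs) ^ (N + 1) • (⊤ : Submodule R M)) + mult xs (Submodule.torsionBy R M x) := by
  set q := Ideal.ofList (x :: zs) with hq
  have hxq : x ∈ q := Ideal.subset_span (by simp)
  let f : (M ⧸ q ^ N • (⊤ : Submodule R M)) →ₗ[R] (M ⧸ q ^ (N + 1) • (⊤ : Submodule R M)) :=
    Submodule.mapQ _ _ (LinearMap.lsmul R M x) (fun v hv => by
      rw [pow_succ', Submodule.mul_smul]
      exact Submodule.smul_mem_smul hxq hv)
  have hg : Ideal.ofList zs ^ (N + 1) • (⊤ : Submodule R (QuotSMulTop x M)) =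
      (q ^ (N + 1) • (⊤ : Submodule R M)).map (x • (⊤ : Submodule R M)).mkQ := by
    rw [Submodule.map_smul'', Submodule.map_top, Submodule.range_mkQ]
    refine (pow_smul_top_eq ?_ _).symm
    rw [hq, Ideal.ofList_cons, span_sup_smul_quotSMulTop]
  let g : (M ⧸ q ^ (N + 1) • (⊤ : Submodule R M)) →ₗ[R]
      (QuotSMulTop x M ⧸ Ideal.ofList zs ^ (N + 1) • (⊤ : Submodule R (QuotSMulTop x M))) :=
    Submodule.mapQ _ _ (x • (⊤ : Submodule R M)).mkQ (by rw [hg]; exact Submodule.le_comap_map _ _)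
  have hgs : Function.Surjective g := by
    intro v
    obtain ⟨v, rfl⟩ := Submodule.mkQ_surjective _ v
    obtain ⟨v, rfl⟩ := Submodule.mkQ_surjective _ v
    exact ⟨Submodule.Quotient.mk v, rfl⟩
  have p0 := hP.quotient_ofList_pow (N + 1)
  have e1 := mult_ker_add_range f (hP.quotient_ofList_pow N)
  have e2 := mult_add xs (LinearMap.ker g) _ _ (LinearMap.ker g).subtype g (Submodule.subtype_injective _)
    hgs (LinearMap.exact_subtype_ker_map g) p0
  have hle : LinearMap.range f ≤ LinearMap.ker g := by
    rintro _ ⟨v, rfl⟩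
    obtain ⟨v, rfl⟩ := Submodule.mkQ_surjective _ v
    change Submodule.Quotient.mk ((x • (⊤ : Submodule R M)).mkQ (x • v)) = _
    rw [(mkQ_smul_top_eq_zero_iff x _).2 ⟨v, rfl⟩]
    rfl
  have e3 : mult xs (LinearMap.range f) ≤ mult xs (LinearMap.ker g) :=
    mult_le_of_injective (Submodule.inclusion hle) (Submodule.inclusion_injective hle)
      (p0.of_injective _ (Submodule.subtype_injective _))
  let k : Submodule.torsionBy R M x →ₗ[R] LinearMap.ker f :=
    LinearMap.codRestrict _ ((Submodule.mkQ _).comp (Submodule.subtype _)) (fun v => by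
      have hv : x • (v : M) = 0 := (Submodule.mem_torsionBy_iff x (v : M)).1 v.2
      change Submodule.Quotient.mk (x • (v : M)) = _
      rw [hv]; rfl)
  have hk : Function.Surjective k := by
    rintro ⟨v, hv⟩
    obtain ⟨v, rfl⟩ := Submodule.mkQ_surjective _ v
    obtain ⟨w, hw, hw'⟩ := h.exists_sub_mem (n := N) (v := v) ((Submodule.Quotient.mk_eq_zero _).1 hv)
    refine ⟨⟨w, (Submodule.mem_torsionBy_iff x w).2 hw⟩, Subtype.ext ?_⟩
    exact ((Submodule.Quotient.eq _).2 hw').symm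
  have px := h.par_torsionBy hP
  have e4 := mult_le_of_surjective k hk px
  lia

theorem EndKilled.of_quotSMulTop {c x₀ x y : R} {l : List R} (h : EndKilled c l x y (QuotSMulTop x₀ M)) :
    EndKilled c (x₀ :: l) x y M := by
  intro v hv
  obtain ⟨u, h1, h2⟩ := h ((x₀ • (⊤ : Submodule R M)).mkQ v)
    (by rw [← map_smul, mkQ_mem_ofList_smul_top_iff]; exact hv)
  obtain ⟨u, rfl⟩ := Submodule.mkQ_surjective _ u
  rw [← map_smul, ← map_sub, mkQ_mem_ofList_smul_top_iff] at h1
  rw [← map_smul, mkQ_mem_ofList_smul_top_iff] at h2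
  exact ⟨u, h1, h2⟩

theorem mult_cons_append_le {x : R} {ys : List R} (hP : Par (x :: ys) M) :
    mult (x :: ys) M ≤ mult ys (QuotSMulTop x M) := by
  rw [mult]
  have := mult_nonneg ys _ hP.torsionBy
  lia

theorem mul_mult_add_le {y : R} {xs : List R} (h : Par (y :: xs) M) (N : ℕ) :
    (N + 1) * mult (y :: xs) M + mult xs (Submodule.torsionBy R M y) ≤
      mult xs (M ⧸ Ideal.ofList [y] ^ (N + 1) • (⊤ : Submodule R M)) := by
  have hN : N + 1 ≠ 0 := Nat.succ_ne_zero N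
  have hq : Ideal.ofList [y] ^ (N + 1) • (⊤ : Submodule R M) = y ^ (N + 1) • (⊤ : Submodule R M) := by
    rw [Ideal.ofList_singleton, Ideal.span_singleton_pow, Submodule.ideal_span_singleton_smul]
  have hp : (y :: xs).Perm (xs ++ [y]) := (List.perm_append_singleton y xs).symm
  have hp' : (y ^ (N + 1) :: xs).Perm (xs ++ [y ^ (N + 1)]) := (List.perm_append_singleton _ xs).symm
  have h' : Par (y ^ (N + 1) :: xs) M := Par.pow_head h hN
  have e1 := mult_append_pow (N + 1) hN xs M (Par.perm hp h)
  rw [mult_perm hp.symm M (Par.perm hp h), mult_perm hp'.symm M (Par.perm hp' h'), mult] at e1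
  have hle : Submodule.torsionBy R M y ≤ Submodule.torsionBy R M (y ^ (N + 1)) := by
    intro v hv
    rw [Submodule.mem_torsionBy_iff] at hv ⊢
    rw [pow_succ, mul_smul, hv, smul_zero]
  have e2 : mult xs (Submodule.torsionBy R M y) ≤ mult xs (Submodule.torsionBy R M (y ^ (N + 1))) :=
    mult_le_of_injective (Submodule.inclusion hle) (Submodule.inclusion_injective hle) h'.torsionBy
  rw [hq]
  push_cast at e1
  lia

theorem IsDSeq.mult_torsionBy_add_one_le {x y : R} {xs : List R} {p : Ideal R} (hp : p.IsPrime)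
    (hxs : (xs.length : WithBot ℕ∞) ≤ ringKrullDim (R ⧸ p)) (h : IsDSeq [x, y] M) (hP : Par ([x, y] ++ xs) M)
    (hE : ∀ c ∉ p, ¬ EndKilled c [] x y M) :
    mult xs (Submodule.torsionBy R M x) + 1 ≤ mult xs (Submodule.torsionBy R (QuotSMulTop x M) y) := by
  have kill {v : M} (hv : x • x • v = 0) (k : R) (hk : k ∈ [x, y]) : k • v = 0 := by
    simpa using h [] x [y] rfl k hk v (by rw [hv]; exact zero_mem _)
  have hT : Par xs (Submodule.torsionBy R (QuotSMulTop x M) y) := Par.torsionBy (Par.tail hP)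
  let f : Submodule.torsionBy R M x →ₗ[R] Submodule.torsionBy R (QuotSMulTop x M) y :=
    LinearMap.codRestrict _ ((x • (⊤ : Submodule R M)).mkQ.comp (Submodule.subtype _)) (fun v => by
      have hv : x • (v : M) = 0 := (Submodule.mem_torsionBy_iff x (v : M)).1 v.2
      rw [Submodule.mem_torsionBy_iff, LinearMap.comp_apply, ← map_smul, Submodule.subtype_apply,
        kill (by rw [hv, smul_zero]) y (by simp), map_zero])
  have hf : Function.Injective f := by
    rw [← LinearMap.ker_eq_bot, LinearMap.ker_eq_bot']
    rintro ⟨v, hv⟩ h0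
    rw [Submodule.mem_torsionBy_iff] at hv
    obtain ⟨u, rfl⟩ := (mkQ_smul_top_eq_zero_iff x v).1 (congrArg Subtype.val h0)
    exact Subtype.ext (kill hv x (by simp))
  rw [mult_add xs _ _ _ f (LinearMap.range f).mkQ hf (Submodule.mkQ_surjective _)
    (LinearMap.exact_map_mkQ_range f) hT]
  have := one_le_mult xs _ (hT.of_surjective _ (LinearMap.range f).mkQ_surjective) p hp (fun c hc => by
    by_contra hcp
    refine hE c hcp fun v hv => ?_
    rw [List.nil_append, Ideal.ofList_singleton, Submodule.ideal_span_singleton_smul] at hv ⊢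
    have hv' : (x • (⊤ : Submodule R M)).mkQ v ∈ Submodule.torsionBy R (QuotSMulTop x M) y := by
      rw [Submodule.mem_torsionBy_iff, ← map_smul]
      exact (Submodule.Quotient.mk_eq_zero _).2 hv
    have h1 := Module.mem_annihilator.1 hc ((LinearMap.range f).mkQ ⟨_, hv'⟩)
    rw [← map_smul] at h1
    obtain ⟨u, hu⟩ := (Submodule.Quotient.mk_eq_zero _).1 h1
    refine ⟨u, ?_, ?_⟩
    · refine (Submodule.Quotient.eq _).1 ?_
      exact (congrArg Subtype.val hu).symm
    · rw [(Submodule.mem_torsionBy_iff x (u : M)).1 u.2]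
      exact zero_mem _) hxs
  lia

/-- The lower bound for multiplicities along powers of the ideal of a `d`-sequence whose last module is not
killed outside `p`. -/
theorem IsDSeq.exists_le_mult {x y : R} {xs : List R} {p : Ideal R} (hp : p.IsPrime)
    (hxs : (xs.length : WithBot ℕ∞) ≤ ringKrullDim (R ⧸ p)) (l : List R) :
    ∀ (M : Type u) [AddCommGroup M] [Module R M] [Module.Finite R M], IsDSeq (l ++ [x, y]) M →
      Par (l ++ [x, y] ++ xs) M → (∀ c ∉ p, ¬ EndKilled c l x y M) →
      ∃ C : ℤ, 0 ≤ C ∧ ∀ N : ℕ, mult (l ++ [x, y] ++ xs) M * (N + (l.length + 2)).choose (l.length + 2) +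
          (N + (l.length + 1)).choose (l.length + 1) - C * (N + l.length).choose l.length ≤
        mult xs (M ⧸ Ideal.ofList (l ++ [x, y]) ^ (N + 1) • (⊤ : Submodule R M)) := by
  induction l with
  | nil =>
    intro M _ _ _ h hP hE
    refine ⟨0, le_rfl, fun N => ?_⟩
    have e1 := h.mult_torsionBy_add_one_le hp hxs hP hE
    have hPt : Par (y :: xs) (QuotSMulTop x M) := Par.tail hP
    have e2 (N : ℕ) := mul_mult_add_le hPt N
    have e3 (N : ℕ) := h.mult_quotient_pow_succ hP N
    have e4 : mult ([] ++ [x, y] ++ xs) M ≤ mult (y :: xs) (QuotSMulTop x M) := mult_cons_append_le hP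
    rw [List.length_nil, zero_mul, sub_zero, List.nil_append]
    rw [List.nil_append] at e4
    have e5 (N : ℕ) : mult xs (M ⧸ Ideal.ofList [x, y] ^ N • (⊤ : Submodule R M)) +
        ((N + 1) * mult ([x, y] ++ xs) M + 1) ≤
        mult xs (M ⧸ Ideal.ofList [x, y] ^ (N + 1) • (⊤ : Submodule R M)) := by
      have e6 := mul_le_mul_of_nonneg_left e4 (by positivity : (0 : ℤ) ≤ N + 1)
      have := e2 N
      have := e3 N
      lia
    induction N with
    | zero =>
      have := e5 0
      have := mult_nonneg xs _ (hP.quotient_ofList_pow 0)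
      simp at *
      linarith
    | succ N ih =>
      have e6 := e5 (N + 1)
      have e7 : (N + 1 + (0 + 2)).choose (0 + 2) = (N + 2) + (N + (0 + 2)).choose (0 + 2) := by
        rw [show N + 1 + (0 + 2) = (N + (0 + 2)) + 1 by ring, Nat.choose_succ_succ' _ 1, Nat.choose_one_right]
      simp only [zero_add, Nat.choose_one_right] at *
      rw [e7]
      push_cast at *
      linarith
  | cons x₀ l ih =>
    intro M _ _ _ h hP hE
    obtain ⟨C, hC, ih⟩ := ih (QuotSMulTop x₀ M) h.tail (Par.tail hP) fun c hc hc' => hE c hc hc'.of_quotSMulTop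
    have p0 : 0 ≤ mult xs (Submodule.torsionBy R M x₀) := mult_nonneg xs _ (h.par_torsionBy hP)
    have e4 : mult (x₀ :: l ++ [x, y] ++ xs) M ≤ mult (l ++ [x, y] ++ xs) (QuotSMulTop x₀ M) := mult_cons_append_le hP
    have h' : IsDSeq (x₀ :: (l ++ [x, y])) M := h
    have hP' : Par (x₀ :: (l ++ [x, y]) ++ xs) M := hP
    have e3 (N : ℕ) := h'.mult_quotient_pow_succ hP' N
    have e5 (N : ℕ) := mul_le_mul_of_nonneg_right e4
      (by positivity : (0 : ℤ) ≤ (N + (l.length + 2)).choose (l.length + 2))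
    refine ⟨C + mult xs (Submodule.torsionBy R M x₀), by lia, fun N => ?_⟩
    rw [List.length_cons]
    induction N with
    | zero =>
      have := e3 0
      have := ih 0
      have := e5 0
      have := mult_nonneg xs _ (hP.quotient_ofList_pow 0)
      simp only [zero_add, Nat.choose_self, List.cons_append] at *
      push_cast at *
      linarith
    | succ N ihN =>
      have e6 := e3 (N + 1)
      have e7 := ih (N + 1)
      have e8 := e5 (N + 1)
      have pas (k : ℕ) : ((N + 1 + (k + 1)).choose (k + 1) : ℤ) = (N + 1 + k).choose k + (N + (k + 1)).choose (k + 1) := by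
        rw [show N + 1 + (k + 1) = (N + 1 + k) + 1 by ring, Nat.choose_succ_succ', show N + 1 + k = N + (k + 1) by ring]
        push_cast; ring
      have e9 : (1 : ℤ) ≤ (N + 1 + l.length).choose l.length := by
        exact_mod_cast Nat.choose_pos (by lia)
      have e10 := mul_le_mul_of_nonneg_left e9 p0
      have q1 := pas (l.length + 2)
      have q2 := pas (l.length + 1)
      have q3 := pas l.length
      rw [show l.length + 1 + 2 = l.length + 2 + 1 by ring] at *
      rw [show l.length + 1 + 1 = l.length + 2 by ring] at *
      rw [q1, q2, q3]
      rw [q2, q3] at e8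
      rw [q2, q3] at e7
      simp only [List.cons_append] at *
      linarith

end LowerBound

section ColonIdeal
variable {R : Type u} [CommRing R] [IsLocalRing R]

theorem exists_unit_coefficient (L : List R) {v : R} (hv : v ∈ Ideal.ofList L)
    (hv' : v ∉ maximalIdeal R * Ideal.ofList L) :
    ∃ l₁ w l₂ e, L = l₁ ++ w :: l₂ ∧ IsUnit e ∧ v - e * w ∈ Ideal.ofList (l₁ ++ l₂) := by
  induction L generalizing v with
  | nil => simp_all
  | cons x L ih =>
    rw [Ideal.ofList_cons] at hv hv'
    obtain ⟨y, hy, z, hz, rfl⟩ := Submodule.mem_sup.1 hv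
    obtain ⟨c, rfl⟩ := Ideal.mem_span_singleton'.1 hy
    by_cases hc : IsUnit c
    · exact ⟨[], x, L, c, rfl, hc, by simpa using hz⟩
    · have hc' : c * x ∈ maximalIdeal R * (Ideal.span {x} ⊔ Ideal.ofList L) :=
        Ideal.mul_mem_mul hc (le_sup_left (α := Ideal R) (Ideal.mem_span_singleton_self x))
      obtain ⟨l₁, w, l₂, e, rfl, he, h⟩ := ih hz fun h =>
        hv' (add_mem hc' (Ideal.mul_mono_right le_sup_right h))
      refine ⟨x :: l₁, w, l₂, e, rfl, he, ?_⟩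
      rw [List.cons_append, Ideal.ofList_cons, show c * x + z - e * w = c * x + (z - e * w) by ring]
      exact add_mem (le_sup_left (α := Ideal R) (Ideal.mul_mem_left _ _ (Ideal.mem_span_singleton_self x)))
        (le_sup_right (α := Ideal R) h)

theorem le_span_sup_colon {J P : Ideal R} {w y a e : R} (hP : ∀ v, v ∈ P ↔ w * v ∈ J)
    (ha : ∀ u ∈ maximalIdeal R, a * u ∈ J ⊔ Ideal.span {w}) (hw : w - e * y * a ∈ J) :
    maximalIdeal R ≤ Ideal.span {y} ⊔ P := by
  intro u hu
  obtain ⟨j, hj, z, hz, h⟩ := Submodule.mem_sup.1 (ha u hu)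
  obtain ⟨b, rfl⟩ := Ideal.mem_span_singleton'.1 hz
  have hmem : u - b * e * y ∈ P := by
    rw [hP]
    have : w * (u - b * e * y) = (w - e * y * a) * (u - b * e * y) + e * y * (a * u - b * w) + e * y * b * (w - e * y * a) := by
      ring
    rw [this, ← h, add_sub_cancel_right]
    exact add_mem (add_mem (J.mul_mem_right _ hw) (J.mul_mem_left _ hj)) (J.mul_mem_left _ hw)
  rw [← add_sub_cancel (b * e * y) u]
  exact add_mem (le_sup_left (α := Ideal R) (Ideal.mul_mem_left _ _ (Ideal.mem_span_singleton_self y)))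
    (le_sup_right (α := Ideal R) hmem)

theorem not_mem_sq_of_colon [IsNoetherianRing R] {J₀ : Ideal R} {w x y a e : R}
    (ha : ∀ u ∈ maximalIdeal R, a * u ∈ (J₀ ⊔ Ideal.span {x}) ⊔ Ideal.span {w})
    (hy : y ∈ maximalIdeal R)
    (hw : w - e * y * a ∈ J₀ ⊔ Ideal.span {x})
    (h1 : ∀ v, w * (w * v) ∈ J₀ ⊔ Ideal.span {x} → w * v ∈ J₀ ⊔ Ideal.span {x})
    (h2 : ∀ u v, w * u ∈ J₀ ⊔ Ideal.span {x} → w * v ∈ J₀ ⊔ Ideal.span {x} →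
      ∃ t, w * t ∈ J₀ ⊔ Ideal.span {x} ∧ w * w * (u * v - x * t) ∈ J₀)
    (h3 : w * w * (x * x) ∉ J₀) : x ∉ maximalIdeal R ^ 2 := by
  intro hx
  have hxm : x ∈ maximalIdeal R := Ideal.pow_le_self two_ne_zero hx
  have hJ : ∃ J, J = J₀ ⊔ Ideal.span {x} := ⟨_, rfl⟩
  obtain ⟨J, hJ⟩ := hJ
  rw [← hJ] at ha hw
  simp only [← hJ] at h1 h2
  obtain ⟨P, hP⟩ : ∃ P : Ideal R, ∀ v, v ∈ P ↔ w * v ∈ J := ⟨Submodule.comap (LinearMap.lsmul R R w) J, fun v => Iff.rfl⟩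
  obtain ⟨H, hH⟩ : ∃ H : Ideal R, ∀ v, v ∈ H ↔ w * w * v ∈ J₀ :=
    ⟨Submodule.comap (LinearMap.lsmul R R (w * w)) J₀, fun v => Iff.rfl⟩
  have hle := le_span_sup_colon hP ha hw
  have hxP : x ∈ P := (hP x).2 (by
    rw [hJ]
    exact le_sup_right (α := Ideal R) (Ideal.mul_mem_left _ _ (Ideal.mem_span_singleton_self x)))
  have hPm : P ≤ maximalIdeal R := by
    refine le_maximalIdeal fun htop => ?_
    have h11 : w * 1 ∈ J := (hP 1).1 (htop ▸ Submodule.mem_top)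
    obtain ⟨t, -, ht⟩ := h2 1 1 h11 h11
    have hu : IsUnit (1 * 1 - x * t) := by
      by_contra hu
      refine (maximalIdeal R).ne_top_iff_one.1 (maximalIdeal.isMaximal R).ne_top ?_
      have := add_mem ((mem_maximalIdeal _).2 hu) ((maximalIdeal R).mul_mem_right t hxm)
      simp at this
    exact h3 (J₀.mul_mem_right _ ((J₀.mul_unit_mem_iff_mem hu).1 ht))
  have hPP : P * P ≤ Ideal.span {x} * P ⊔ H := by
    rw [Ideal.mul_le]
    intro u hu v hv
    obtain ⟨t, ht, h⟩ := h2 u v ((hP u).1 hu) ((hP v).1 hv)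
    rw [← add_sub_cancel (x * t) (u * v)]
    exact add_mem (le_sup_left (α := Ideal R) (Ideal.mul_mem_mul (Ideal.mem_span_singleton_self x) ((hP t).2 ht)))
      (le_sup_right (α := Ideal R) ((hH _).2 h))
  have hxy : x ∈ Ideal.span {y} * P ⊔ P * P := by
    have hx2 : x ∈ Ideal.span {y} * Ideal.span {y} ⊔ (Ideal.span {y} * P ⊔ P * P) := by
      refine (le_trans (Ideal.pow_right_mono hle 2) ?_) hx
      rw [pow_two, Ideal.sup_mul, Ideal.mul_sup, Ideal.mul_sup, mul_comm P (Ideal.span {y})]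
      exact sup_le (sup_le le_sup_left (le_sup_left.trans le_sup_right)) le_sup_right
    obtain ⟨z, hz, p, hp, h⟩ := Submodule.mem_sup.1 hx2
    rw [Ideal.span_singleton_mul_span_singleton] at hz
    obtain ⟨c, rfl⟩ := Ideal.mem_span_singleton'.1 hz
    have reg (v : R) (hv : y * v ∈ P) : v ∈ P := by
      rw [hP] at hv ⊢
      refine h1 _ ?_
      rw [show w * (w * v) = w * v * (w - e * y * a) + e * a * (w * (y * v)) by ring]
      exact add_mem (J.mul_mem_left _ hw) (J.mul_mem_left _ hv)
    have hpP : p ∈ P := (sup_le Ideal.mul_le_right Ideal.mul_le_right : Ideal.span {y} * P ⊔ P * P ≤ P) hp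
    have hc : c ∈ P := by
      refine reg _ (reg _ ?_)
      rw [show y * (y * c) = x - p by rw [← h]; ring]
      exact sub_mem hxP hpP
    rw [← h]
    refine add_mem (le_sup_left (α := Ideal R) ?_) hp
    rw [show c * (y * y) = y * (c * y) by ring]
    exact Ideal.mul_mem_mul (Ideal.mem_span_singleton_self y) (P.mul_mem_right _ hc)
  have hN : Ideal.span {x} * P ≤ H := by
    refine Submodule.le_of_le_smul_of_le_jacobson_bot (I := maximalIdeal R) (IsNoetherian.noetherian _)
      (maximalIdeal_le_jacobson _) ?_
    have hxle : Ideal.span {x} ≤ maximalIdeal R * P ⊔ H := by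
      rw [Ideal.span_singleton_le_iff_mem]
      refine (sup_le ?_ ?_ : Ideal.span {y} * P ⊔ P * P ≤ _) hxy
      · exact (Ideal.mul_mono_left ((Ideal.span_singleton_le_iff_mem _).2 hy)).trans le_sup_left
      · exact (Ideal.mul_mono_left hPm).trans le_sup_left
    have hxle' : Ideal.span {x} ≤ Ideal.span {y} * P ⊔ (Ideal.span {x} * P ⊔ H) := by
      rw [Ideal.span_singleton_le_iff_mem]
      exact (sup_le_sup_left hPP _) hxy
    calc Ideal.span {x} * P ≤ (Ideal.span {y} * P ⊔ (Ideal.span {x} * P ⊔ H)) * P := Ideal.mul_mono_left hxle'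
      _ ≤ H ⊔ maximalIdeal R • (Ideal.span {x} * P) := by
        rw [Ideal.sup_mul, Ideal.sup_mul, mul_assoc, smul_eq_mul]
        refine sup_le ?_ (sup_le ?_ ((Ideal.mul_le_left : H * P ≤ H).trans le_sup_left))
        · refine (Ideal.mul_mono ((Ideal.span_singleton_le_iff_mem _).2 hy) hPP).trans ?_
          rw [Ideal.mul_sup, sup_comm]
          exact sup_le_sup (Ideal.mul_le_right : maximalIdeal R * H ≤ H) le_rfl
        · rw [mul_comm]
          exact (Ideal.mul_mono_left hPm : P * (Ideal.span {x} * P) ≤ maximalIdeal R * (Ideal.span {x} * P)).trans le_sup_right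
  exact h3 ((hH _).1 (hN (Ideal.mul_mem_mul (Ideal.mem_span_singleton_self x) hxP)))

end ColonIdeal

section ColonIdeal
variable {R : Type u} [CommRing R]

theorem isWeaklyRegular_of_colon (rs : List R)
    (h : ∀ l a r, rs = l ++ a :: r → ∀ v : R, a * v ∈ Ideal.ofList l → v ∈ Ideal.ofList l) :
    RingTheory.Sequence.IsWeaklyRegular R rs := by
  refine ⟨fun i hi => ?_⟩
  rw [isSMulRegular_iff_right_eq_zero_of_smul]
  intro v hv
  obtain ⟨v, rfl⟩ := Submodule.mkQ_surjective _ v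
  rw [← map_smul, Submodule.mkQ_apply, Submodule.Quotient.mk_eq_zero, smul_eq_mul, smul_eq_mul, Ideal.mul_top] at hv
  rw [Submodule.mkQ_apply, Submodule.Quotient.mk_eq_zero, smul_eq_mul, Ideal.mul_top]
  exact h (rs.take i) rs[i] (rs.drop (i + 1)) (by simp) v hv

theorem mem_ofList_of_isWeaklyRegular_append {l : List R} {w v : R}
    (h : RingTheory.Sequence.IsWeaklyRegular R (l ++ [w])) (hv : w * v ∈ Ideal.ofList l) : v ∈ Ideal.ofList l := by
  rw [RingTheory.Sequence.isWeaklyRegular_append_iff, RingTheory.Sequence.isWeaklyRegular_singleton_iff] at h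
  have h2 := h.2
  rw [isSMulRegular_iff_right_eq_zero_of_smul] at h2
  have := h2 (Submodule.mkQ _ v) (by
    rw [← map_smul, Submodule.mkQ_apply, Submodule.Quotient.mk_eq_zero, smul_eq_mul, smul_eq_mul, Ideal.mul_top]
    exact hv)
  rwa [Submodule.mkQ_apply, Submodule.Quotient.mk_eq_zero, smul_eq_mul, Ideal.mul_top] at this

variable [IsLocalRing R]

theorem CList.mem {d : ℕ} {l r : List R} {a : R} (h : CList d (l ++ a :: r)) : a ∈ bCol d r ^ 3 := by
  induction l with
  | nil => exact h.1
  | cons x l ih => exact ih h.2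

theorem one_mem_of_pow_not_le {b : Ideal R} {x : R} (hx : x ∈ b ^ 3) (hx2 : x ∉ maximalIdeal R ^ 2) : (1 : R) ∈ b := by
  by_contra h
  exact hx2 (Ideal.pow_le_pow_right (by norm_num) (Ideal.pow_right_mono
    (le_maximalIdeal ((Ideal.ne_top_iff_one b).2 h)) 3 hx))

variable [IsNoetherianRing R]

theorem not_mul_mem_of_psl {d : ℕ} (hnp : ∀ l : List R, l.length < d → ¬ Par l R) {l : List R} {x w : R}
    (h : PSL d (l ++ [x, w])) (hl : l.length + 2 = d) : w * w * (x * x) ∉ Ideal.ofList l := by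
  intro hx
  refine hnp (l ++ [x + w]) (by simp; omega) ⟨fun y hy => ?_, ?_⟩
  · rcases List.mem_append.1 hy with hy | hy
    · exact h.1 y (by simp [hy])
    · rw [List.mem_singleton.1 hy]
      exact add_mem (h.1 x (by simp)) (h.1 w (by simp))
  · obtain ⟨-, n, hn⟩ := h.par (by simp; omega)
    obtain ⟨k, hk⟩ : ∃ k, maximalIdeal R ^ k ≤ Ideal.ofList (l ++ [x + w]) := by
      refine exists_pow_le_of_le_radical (n := n) (hn.trans (sup_le ?_ ?_))
      · have : Module.annihilator R R = ⊥ := by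
          rw [Module.annihilator_eq_bot]; infer_instance
        rw [this]; exact bot_le
      · have hl : Ideal.ofList l ≤ Ideal.ofList (l ++ [x + w]) := by
          rw [Ideal.ofList_append]; exact le_sup_left
        have hs : x + w ∈ Ideal.ofList (l ++ [x + w]) := Ideal.subset_span (by simp)
        have hwx : w * x ∈ (Ideal.ofList (l ++ [x + w])).radical :=
          ⟨2, by rw [pow_two]; exact hl (by convert hx using 1; ring)⟩
        have hx : x ∈ (Ideal.ofList (l ++ [x + w])).radical := by
          refine (Ideal.radical_isRadical _) ⟨2, ?_⟩
          rw [show x ^ 2 = x * (x + w) - w * x by ring]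
          exact sub_mem (Ideal.mul_mem_left _ _ (Ideal.le_radical hs)) hwx
        have hw : w ∈ (Ideal.ofList (l ++ [x + w])).radical := by
          have := sub_mem (Ideal.le_radical hs) hx
          rwa [add_sub_cancel_left] at this
        rw [Ideal.ofList_append]
        refine sup_le (hl.trans Ideal.le_radical) (Ideal.span_le.2 ?_)
        intro y hy
        rcases (by simpa using hy : y = x ∨ y = w) with rfl | rfl <;> assumption
    exact ⟨k, hk.trans le_sup_right⟩

/-- If a socle element of `R / q` is not integral over `q` in the obvious way, then `q` contains
a parameter that is regular modulo the other generators, which generate a regular-type ideal. -/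
theorem exists_regular_of_not_mul_le {d : ℕ} {L : List R} (hL : PSL d L) (hLd : L.length = d) (hd : 2 ≤ d)
    (hC : CList d L) (hreg : ∀ x : R, PSL d [x] → ∀ v, x * v = 0 → v = 0)
    (hnp : ∀ l : List R, l.length < d → ¬ Par l R) {I : Ideal R}
    (hI : ∀ a ∈ I, ∀ u ∈ maximalIdeal R, a * u ∈ Ideal.ofList L)
    (hnot : ¬ maximalIdeal R * I ≤ maximalIdeal R * Ideal.ofList L) :
    (∃ x ∈ L, x ∉ maximalIdeal R ^ 2) ∧ ∃ w l y, L.Perm (w :: l) ∧ y ∈ maximalIdeal R ∧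
      maximalIdeal R ≤ Ideal.span {y} ⊔ Ideal.ofList l ∧ ∀ v, w * v ∈ Ideal.ofList l → v ∈ Ideal.ofList l := by
  rw [Ideal.mul_le] at hnot
  push Not at hnot
  obtain ⟨y, hy, a, ha, hya⟩ := hnot
  obtain ⟨l₁, w, l₂, e, rfl, he, hw⟩ := exists_unit_coefficient L (mul_comm a y ▸ hI a ha y hy) hya
  obtain ⟨e, rfl⟩ := he
  have hw' : w - (↑e⁻¹ : R) * y * a ∈ Ideal.ofList (l₁ ++ l₂) := by
    rw [show w - (↑e⁻¹ : R) * y * a = -(↑e⁻¹ * (y * a - e * w)) - ((↑e⁻¹ * e : R) - 1) * w by ring, Units.inv_mul,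
      sub_self, zero_mul, sub_zero]
    exact neg_mem (Ideal.mul_mem_left _ _ hw)
  have hperm : (l₁ ++ w :: l₂).Perm (w :: (l₁ ++ l₂)) := List.perm_middle
  have ha' (u : R) (hu : u ∈ maximalIdeal R) : a * u ∈ Ideal.ofList (l₁ ++ l₂) ⊔ Ideal.span {w} := by
    have := hI a ha u hu
    rwa [ofList_perm hperm, Ideal.ofList_cons, sup_comm] at this
  have hwb := CList.mem hC
  suffices H : ∃ x ∈ l₁ ++ l₂, x ∉ maximalIdeal R ^ 2 ∧ ∀ v, w * v ∈ Ideal.ofList (l₁ ++ l₂) → v ∈ Ideal.ofList (l₁ ++ l₂) by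
    obtain ⟨x, hx, hx2, hwv⟩ := H
    refine ⟨⟨x, by simp at hx ⊢; tauto, hx2⟩, w, l₁ ++ l₂, y, hperm, hy, ?_, hwv⟩
    exact le_span_sup_colon (P := Ideal.ofList (l₁ ++ l₂)) (fun v => ⟨fun h => Ideal.mul_mem_left _ _ h, hwv v⟩) ha' hw'
  rcases List.eq_nil_or_concat l₂ with rfl | ⟨l₂, x, rfl⟩
  · obtain ⟨l₁, x, rfl⟩ : ∃ l x, l₁ = l ++ [x] := by
      rcases List.eq_nil_or_concat l₁ with rfl | ⟨l, x, rfl⟩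
      · simp at hLd; omega
      · exact ⟨l, x, by simp⟩
    have hLx : PSL d (l₁ ++ [x, w]) := by simpa using hL
    have hx3 : x ∈ bCol d [w] ^ 3 := CList.mem (l := l₁) (r := [w]) (by simpa using hC)
    have hxb := Ideal.pow_le_self three_ne_zero hx3
    have hwb := Ideal.pow_le_self three_ne_zero hwb
    rw [List.append_nil] at *
    have h1 (v : R) (hv : w * (w * v) ∈ Ideal.ofList (l₁ ++ [x])) : w * v ∈ Ideal.ofList (l₁ ++ [x]) :=
      mul_mem_of_mem_bCol hwb hL.sq (by rwa [mul_assoc])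
    have hx2 : x ∉ maximalIdeal R ^ 2 := by
      have e1 : Ideal.ofList (l₁ ++ [x]) = Ideal.ofList l₁ ⊔ Ideal.span {x} := by simp
      rw [e1] at ha' hw'
      refine not_mem_sq_of_colon ha' hy hw' (fun v => by rw [← e1]; exact h1 v) (fun u v hu hv => ?_)
        (not_mul_mem_of_psl hnp hLx (by simp at hLd; omega))
      rw [← e1, mem_ofList_append_singleton] at hu hv
      obtain ⟨a', ha'⟩ := hu
      obtain ⟨b', hb'⟩ := hv
      obtain ⟨t, ht⟩ := mem_ofList_append_singleton.1 (mul_mem_of_mem_bCol hwb (l := l₁ ++ [x * x]) (a := w * w) (v := u * v)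
        (by simpa using PSL.sq (l := l₁ ++ [x * x]) (r := []) (by simpa using PSL.sq hLx))
        (mem_ofList_append_singleton.2 ⟨a' * b', by
          rw [show w * w * (u * v) - x * x * (a' * b') = (w * u - x * a') * (w * v) + x * a' * (w * v - x * b') by ring]
          exact add_mem (Ideal.mul_mem_right _ _ ha') (Ideal.mul_mem_left _ _ hb')⟩))
      obtain ⟨t', ht'⟩ := mem_ofList_append_singleton.1 (hxb l₁ (x * x) hLx.sq t (mem_ofList_append_singleton.2 ⟨u * v, by
        rw [← neg_mem_iff]; convert ht using 1; ring⟩))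
      refine ⟨t', ?_, ?_⟩
      · rw [← e1, mem_ofList_append_singleton]
        exact ⟨t, by rw [← neg_mem_iff]; convert ht' using 1; ring⟩
      · rw [show w * w * (u * v - x * t') = w * ((w * (u * v) - x * x * t) + x * (x * t - w * t')) by ring]
        exact Ideal.mul_mem_left _ _ (add_mem ht (Ideal.mul_mem_left _ _ ht'))
    refine ⟨x, by simp, hx2, fun v => mem_ofList_of_isWeaklyRegular_append ?_⟩
    have h1b := one_mem_of_pow_not_le hx3 hx2
    refine isWeaklyRegular_of_perm_of_subset_maximalIdeal (rs := w :: (l₁ ++ [x])) ?_ hperm.symm fun r hr =>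
      hL.1 r (hperm.symm.subset hr)
    refine isWeaklyRegular_of_colon _ fun l a r h v hv => ?_
    rcases l with _ | ⟨w', l⟩
    · obtain ⟨rfl, -⟩ : w = a ∧ l₁ ++ [x] = r := by simpa using h
      simp only [Ideal.ofList_nil, Submodule.mem_bot] at hv ⊢
      exact hreg _ (hL.sublist (by simp)) _ hv
    · obtain ⟨rfl, h2⟩ : w = w' ∧ l₁ ++ [x] = l ++ a :: r := by simpa using h
      have e2 : Ideal.ofList (w :: l) = Ideal.ofList (l ++ [w]) := ofList_perm (List.perm_append_singleton w l).symm
      rw [e2] at hv ⊢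
      simpa using h1b l a ((h2 ▸ hL : PSL d ((l ++ a :: r) ++ [w])).sublist (by simp)) v hv
  · rw [List.concat_eq_append] at *
    have hLx : PSL d ((l₁ ++ l₂) ++ [x, w]) := hL.perm (by
      rw [List.append_assoc]
      refine List.Perm.append_left _ ?_
      rw [← List.cons_append, show l₂ ++ [x, w] = (l₂ ++ [x]) ++ [w] by simp]
      exact (List.perm_append_singleton w (l₂ ++ [x])).symm)
    have hLw : PSL d ((l₁ ++ l₂) ++ [w, x]) := hLx.perm (List.Perm.append_left _ (List.Perm.swap _ _ _))
    have hx3 : x ∈ bCol d ([] : List R) ^ 3 := CList.mem (l := l₁ ++ w :: l₂) (r := []) (by simpa using hC)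
    have hxb := Ideal.pow_le_self three_ne_zero hx3
    have hwb := Ideal.pow_le_self three_ne_zero hwb
    have h1 (v : R) (hv : w * (w * v) ∈ Ideal.ofList (l₁ ++ (l₂ ++ [x]))) : w * v ∈ Ideal.ofList (l₁ ++ (l₂ ++ [x])) :=
      hwb l₁ (w * w) hL.sq v (by rwa [mul_assoc])
    have hx2 : x ∉ maximalIdeal R ^ 2 := by
      have e1 : Ideal.ofList (l₁ ++ (l₂ ++ [x])) = Ideal.ofList (l₁ ++ l₂) ⊔ Ideal.span {x} := by
        rw [← List.append_assoc, Ideal.ofList_append _ [x], Ideal.ofList_singleton]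
      rw [e1] at ha' hw'
      refine not_mem_sq_of_colon ha' hy hw' (fun v => by rw [← e1]; exact h1 v) (fun u v hu hv => ?_)
        (not_mul_mem_of_psl hnp hLx (by simp at hLd ⊢; omega))
      rw [← e1, ← List.append_assoc, mem_ofList_append_singleton] at hu hv
      obtain ⟨a', ha'⟩ := hu
      obtain ⟨b', hb'⟩ := hv
      obtain ⟨t, ht⟩ := mem_ofList_append_singleton.1 (mul_mem_of_mem_bCol hxb (l := (l₁ ++ l₂) ++ [w * w]) (a := x * x)
        (v := a' * b')
        (by simpa using PSL.sq (l := (l₁ ++ l₂) ++ [w * w]) (r := []) (by simpa using PSL.sq hLw))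
        (mem_ofList_append_singleton.2 ⟨u * v, by
          rw [show x * x * (a' * b') - w * w * (u * v) = -((w * u - x * a') * (w * v) + x * a' * (w * v - x * b')) by ring]
          exact neg_mem (add_mem (Ideal.mul_mem_right _ _ ha') (Ideal.mul_mem_left _ _ hb'))⟩))
      refine ⟨t, ?_, ?_⟩
      · rw [← e1]
        refine h1 _ ?_
        rw [← List.append_assoc, mem_ofList_append_singleton]
        exact ⟨a' * b', by rw [← neg_mem_iff]; convert ht using 1; ring⟩
      · rw [show w * w * (u * v - x * t) = (w * u - x * a') * (w * v) + x * a' * (w * v - x * b') +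
          x * (x * (a' * b') - w * w * t) by ring]
        exact add_mem (add_mem (Ideal.mul_mem_right _ _ ha') (Ideal.mul_mem_left _ _ hb')) (Ideal.mul_mem_left _ _ ht)
    refine ⟨x, by simp, hx2, fun v hv => ?_⟩
    simpa using mul_mem_of_mem_bCol (one_mem_of_pow_not_le hx3 hx2)
      (hL.perm (hperm.trans (List.perm_append_singleton w _).symm)) hv

end ColonIdeal

section ColonIdeal
variable {R : Type u} [CommRing R] [IsLocalRing R] [IsNoetherianRing R]

theorem exists_unit_mul_pow_sub_mem {J : Ideal R} {w y : R} (hJ : J ≤ maximalIdeal R) (hw : w ∈ maximalIdeal R)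
    (hwJ : w ∉ J) (hy : y ∈ maximalIdeal R) (h : maximalIdeal R ≤ Ideal.span {y} ⊔ J) :
    ∃ n c, IsUnit c ∧ w - c * y ^ (n + 1) ∈ J := by
  have hex : ∃ n, w ∉ J ⊔ Ideal.span {y ^ n} := by
    by_contra hc
    push Not at hc
    have hmem : Submodule.Quotient.mk w ∈ (⨅ n : ℕ, maximalIdeal R ^ n • ⊤ : Submodule R (R ⧸ J)) := by
      rw [Submodule.mem_iInf]
      intro n
      have := (mkQ_mem_smul_top_iff J (maximalIdeal R ^ n) w).2 (by
        rw [smul_eq_mul, Ideal.mul_top, sup_comm]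
        exact sup_le_sup_left ((Ideal.span_singleton_le_iff_mem _).2 (Ideal.pow_mem_pow hy n)) J (hc n))
      exact this
    rw [Ideal.iInf_pow_smul_eq_bot_of_isLocalRing _ (maximalIdeal.isMaximal R).ne_top, Submodule.mem_bot,
      Submodule.Quotient.mk_eq_zero] at hmem
    exact hwJ hmem
  classical
  obtain ⟨n, hn, hmin⟩ : ∃ n, w ∉ J ⊔ Ideal.span {y ^ n} ∧ ∀ m < n, w ∈ J ⊔ Ideal.span {y ^ m} :=
    ⟨Nat.find hex, Nat.find_spec hex, fun m hm => not_not.1 (Nat.find_min hex hm)⟩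
  rcases n with _ | n
  · simp at hn
  obtain ⟨j, hj, z, hz, hjz⟩ := Submodule.mem_sup.1 (hmin n (Nat.lt_succ_self n))
  obtain ⟨c, rfl⟩ := Ideal.mem_span_singleton'.1 hz
  have hc : IsUnit c := by
    by_contra hc
    obtain ⟨b, hb, j', hj', hbj⟩ := Submodule.mem_sup.1 (h ((mem_maximalIdeal c).2 hc))
    obtain ⟨b, rfl⟩ := Ideal.mem_span_singleton'.1 hb
    refine hn ?_
    rw [← hjz, ← hbj, show j + (b * y + j') * y ^ n = (j + j' * y ^ n) + b * y ^ (n + 1) by ring]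
    exact add_mem (le_sup_left (α := Ideal R) (add_mem hj (J.mul_mem_right _ hj')))
      (le_sup_right (α := Ideal R) (Ideal.mul_mem_left _ _ (Ideal.mem_span_singleton_self _)))
  rcases n with _ | n
  · exact absurd (show c ∈ maximalIdeal R by
      rw [show c = w - j by rw [← hjz]; ring]
      exact sub_mem hw (hJ hj)) (by rwa [mem_maximalIdeal, mem_nonunits_iff, not_not])
  · exact ⟨n, c, hc, by rwa [← hjz, add_sub_cancel_right]⟩

theorem eq_top_or_exists_par_of_colon {d : ℕ} {L : List R} (hL : PSL d L) (hLd : L.length = d) {I : Ideal R}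
    (hI : ∀ v, v ∈ I ↔ ∀ u ∈ maximalIdeal R, u * v ∈ Ideal.ofList L)
    {w y : R} {l : List R} (hp : L.Perm (w :: l)) (hy : y ∈ maximalIdeal R)
    (hm : maximalIdeal R ≤ Ideal.span {y} ⊔ Ideal.ofList l) (hw : ∀ v, w * v ∈ Ideal.ofList l → v ∈ Ideal.ofList l) :
    I = ⊤ ∨ ∃ L' : List R, L'.length = d ∧ Par L' R ∧ I = Ideal.ofList L' := by
  have hl : Ideal.ofList l ≤ maximalIdeal R := Ideal.span_le.2 fun x hx =>
    hL.1 x (hp.symm.subset (List.mem_cons_of_mem _ hx))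
  have hwl : w ∉ Ideal.ofList l := fun h => (maximalIdeal R).ne_top_iff_one.1 (maximalIdeal.isMaximal R).ne_top
    (hl (hw 1 (by simpa using h)))
  obtain ⟨n, c, ⟨c, rfl⟩, hc⟩ := exists_unit_mul_pow_sub_mem hl (hL.1 w (hp.symm.subset (by simp))) hwl hy hm
  have hq : Ideal.ofList L = Ideal.ofList (y ^ (n + 1) :: l) := by
    rw [ofList_perm hp, Ideal.ofList_cons, Ideal.ofList_cons]
    refine le_antisymm (sup_le ?_ le_sup_right) (sup_le ?_ le_sup_right)
    · rw [Ideal.span_singleton_le_iff_mem, ← sub_add_cancel w (c * y ^ (n + 1))]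
      exact add_mem (le_sup_right (α := Ideal R) hc)
        (le_sup_left (α := Ideal R) (Ideal.mul_mem_left _ _ (Ideal.mem_span_singleton_self _)))
    · rw [Ideal.span_singleton_le_iff_mem]
      rw [show y ^ (n + 1) = (↑c⁻¹ * c : R) * y ^ (n + 1) by simp,
        show (↑c⁻¹ * c : R) * y ^ (n + 1) = ↑c⁻¹ * w - ↑c⁻¹ * (w - c * y ^ (n + 1)) by ring]
      exact sub_mem (le_sup_left (α := Ideal R) (Ideal.mul_mem_left _ _ (Ideal.mem_span_singleton_self _)))
        (le_sup_right (α := Ideal R) (Ideal.mul_mem_left _ _ hc))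
  have hyreg (v : R) (hv : y * v ∈ Ideal.ofList l) : v ∈ Ideal.ofList l := by
    refine hw v ?_
    rw [show w * v = (w - c * y ^ (n + 1)) * v + c * y ^ n * (y * v) by ring]
    exact add_mem (Ideal.mul_mem_right _ _ hc) (Ideal.mul_mem_left _ _ hv)
  have hIle : Ideal.ofList (y ^ n :: l) ≤ I := by
    rw [Ideal.ofList_cons]
    refine sup_le ((Ideal.span_singleton_le_iff_mem _).2 ((hI _).2 fun u hu => ?_)) fun v hv => (hI v).2 fun u hu => ?_
    · obtain ⟨b, hb, j, hj, rfl⟩ := Submodule.mem_sup.1 (hm hu)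
      obtain ⟨b, rfl⟩ := Ideal.mem_span_singleton'.1 hb
      rw [hq, Ideal.ofList_cons, show (b * y + j) * y ^ n = b * y ^ (n + 1) + j * y ^ n by ring]
      exact add_mem (le_sup_left (α := Ideal R) (Ideal.mul_mem_left _ _ (Ideal.mem_span_singleton_self _)))
        (le_sup_right (α := Ideal R) (Ideal.mul_mem_right _ _ hj))
    · rw [hq, Ideal.ofList_cons]
      exact le_sup_right (α := Ideal R) (Ideal.mul_mem_left _ _ hv)
  rcases n with _ | n
  · refine Or.inl (top_le_iff.1 (le_trans ?_ hIle))
    simp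
  refine Or.inr ⟨y ^ (n + 1) :: l, by rw [← hLd, hp.length_eq]; rfl, ?_, le_antisymm (fun v hv => ?_) hIle⟩
  · obtain ⟨-, k, hk⟩ := hL.par hLd
    refine ⟨List.forall_mem_cons.2 ⟨Ideal.pow_mem_of_mem _ hy _ (Nat.succ_pos n), fun x hx =>
      hL.1 x (hp.symm.subset (List.mem_cons_of_mem _ hx))⟩, k, hk.trans (sup_le_sup_left ?_ _)⟩
    rw [hq, Ideal.ofList_cons, Ideal.ofList_cons]
    exact sup_le_sup_right ((Ideal.span_singleton_le_span_singleton).2 (pow_dvd_pow _ (Nat.le_succ _))) _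
  · have h := (hI v).1 hv y hy
    rw [hq, Ideal.ofList_cons] at h
    obtain ⟨b, hb, j, hj, hbj⟩ := Submodule.mem_sup.1 h
    obtain ⟨b, rfl⟩ := Ideal.mem_span_singleton'.1 hb
    have := hyreg (v - b * y ^ (n + 1)) (by
      rw [show y * (v - b * y ^ (n + 1)) = y * v - b * y ^ (n + 1 + 1) by ring, ← hbj, add_sub_cancel_left]
      exact hj)
    rw [Ideal.ofList_cons, ← add_sub_cancel (b * y ^ (n + 1)) v]
    exact add_mem (le_sup_left (α := Ideal R) (Ideal.mul_mem_left _ _ (Ideal.mem_span_singleton_self _)))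
      (le_sup_right (α := Ideal R) this)

end ColonIdeal

section CompleteNoetherian

variable {R S : Type*} [CommRing R] [CommRing S] [Algebra R S]

lemma exists_sub_mem_map_pow (I : Ideal R)
    (hd : ∀ s : S, ∃ r : R, s - algebraMap R S r ∈ I.map (algebraMap R S)) (k : ℕ) {s : S}
    (hs : s ∈ I.map (algebraMap R S) ^ k) :
    ∃ r ∈ I ^ k, s - algebraMap R S r ∈ I.map (algebraMap R S) ^ (k + 1) := by
  rw [← Ideal.map_pow] at hs
  refine Submodule.span_induction ?_ ⟨0, zero_mem _, by simp⟩ ?_ ?_ hs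
  · rintro _ ⟨a, ha, rfl⟩
    exact ⟨a, ha, by simp⟩
  · rintro x y - - ⟨a, ha, ha'⟩ ⟨b, hb, hb'⟩
    refine ⟨a + b, add_mem ha hb, ?_⟩
    rw [map_add, add_sub_add_comm]
    exact add_mem ha' hb'
  · rintro c x - ⟨a, ha, ha'⟩
    obtain ⟨c', hc'⟩ := hd c
    refine ⟨c' * a, Ideal.mul_mem_left _ _ ha, ?_⟩
    have e : c • x - algebraMap R S (c' * a) =
        c * (x - algebraMap R S a) + (c - algebraMap R S c') * algebraMap R S a := by
      simp only [smul_eq_mul, map_mul]; ring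
    rw [e]
    refine add_mem (Ideal.mul_mem_left _ _ ha') ?_
    rw [pow_succ']
    refine Ideal.mul_mem_mul hc' ?_
    rw [← Ideal.map_pow]
    exact Ideal.mem_map_of_mem _ ha

/-- The filtration of `R` by initial forms of elements of the ideal `𝔟` of `S`. -/
def initialFiltration (I : Ideal R) (𝔟 : Ideal S) : I.Filtration R where
  N k :=
    { carrier := {r | r ∈ I ^ k ∧
        ∃ b ∈ 𝔟, algebraMap R S r - b ∈ I.map (algebraMap R S) ^ (k + 1)}
      add_mem' := by
        rintro x y ⟨hx, b, hb, hxb⟩ ⟨hy, c, hc, hyc⟩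
        refine ⟨add_mem hx hy, b + c, add_mem hb hc, ?_⟩
        rw [map_add, add_sub_add_comm]
        exact add_mem hxb hyc
      zero_mem' := ⟨zero_mem _, 0, zero_mem _, by simp⟩
      smul_mem' := by
        rintro a x ⟨hx, b, hb, hxb⟩
        refine ⟨Ideal.mul_mem_left _ _ hx, algebraMap R S a * b, Ideal.mul_mem_left _ _ hb, ?_⟩
        rw [smul_eq_mul, map_mul, ← mul_sub]
        exact Ideal.mul_mem_left _ _ hxb }
  mono k := by
    rintro x ⟨hx, -⟩
    refine ⟨Ideal.pow_le_pow_right k.le_succ hx, 0, zero_mem _, ?_⟩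
    rw [sub_zero, ← Ideal.map_pow]
    exact Ideal.mem_map_of_mem _ hx
  smul_le k := by
    refine Submodule.smul_le.2 ?_
    rintro a ha x ⟨hx, b, hb, hxb⟩
    refine ⟨?_, algebraMap R S a * b, Ideal.mul_mem_left _ _ hb, ?_⟩
    · rw [pow_succ']
      exact Ideal.mul_mem_mul ha hx
    · rw [smul_eq_mul, map_mul, ← mul_sub, pow_succ']
      exact Ideal.mul_mem_mul (Ideal.mem_map_of_mem _ ha) hxb

lemma exists_fg_initial [IsNoetherianRing R] (I : Ideal R) (𝔟 : Ideal S)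
    (hd : ∀ s : S, ∃ r : R, s - algebraMap R S r ∈ I.map (algebraMap R S)) :
    ∃ (𝔠 : Ideal S) (K : ℕ), 𝔠.FG ∧ 𝔠 ≤ 𝔟 ∧
      ∀ k, ∀ β ∈ 𝔟, β ∈ I.map (algebraMap R S) ^ k →
        ∃ γ ∈ I.map (algebraMap R S) ^ (k - K) • 𝔠,
          β - γ ∈ I.map (algebraMap R S) ^ (k + 1) := by
  set J := I.map (algebraMap R S) with hJ
  have hst : (initialFiltration I 𝔟).Stable := by
    refine (I.stableFiltration_stable (⊤ : Submodule R R)).of_le ?_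
    rintro k x ⟨hx, -⟩
    simpa using hx
  obtain ⟨K, hK⟩ := hst.exists_pow_smul_eq_of_ge
  have hfg : ∀ j, ∃ 𝔠 : Ideal S, 𝔠.FG ∧ 𝔠 ≤ 𝔟 ∧ ∀ n ∈ (initialFiltration I 𝔟).N j,
      ∃ γ ∈ 𝔠, algebraMap R S n - γ ∈ J ^ (j + 1) := by
    intro j
    obtain ⟨t, ht⟩ := IsNoetherian.noetherian ((initialFiltration I 𝔟).N j)
    have hb : ∀ n : R, ∃ b ∈ 𝔟, n ∈ (initialFiltration I 𝔟).N j →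
        algebraMap R S n - b ∈ J ^ (j + 1) := by
      intro n
      by_cases h : n ∈ (initialFiltration I 𝔟).N j
      · obtain ⟨-, b, hb, hb'⟩ := h
        exact ⟨b, hb, fun _ => hb'⟩
      · exact ⟨0, zero_mem _, fun h' => absurd h' h⟩
    choose b hb hb' using hb
    classical
    refine ⟨Ideal.span (t.image b), ⟨_, rfl⟩, Ideal.span_le.2 ?_, ?_⟩
    · intro z hz
      obtain ⟨n, -, rfl⟩ := Finset.mem_image.1 hz
      exact hb n
    · intro n hn
      rw [← ht] at hn
      refine Submodule.span_induction ?_ ⟨0, zero_mem _, by simp⟩ ?_ ?_ hn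
      · intro x hx
        exact ⟨b x, Ideal.subset_span (Finset.mem_image_of_mem b hx),
          hb' x (ht ▸ Submodule.subset_span hx)⟩
      · rintro x y - - ⟨c, hc, hxc⟩ ⟨e, he, hye⟩
        refine ⟨c + e, add_mem hc he, ?_⟩
        rw [map_add, add_sub_add_comm]
        exact add_mem hxc hye
      · rintro a x - ⟨c, hc, hxc⟩
        refine ⟨algebraMap R S a * c, Ideal.mul_mem_left _ _ hc, ?_⟩
        rw [smul_eq_mul, map_mul, ← mul_sub]
        exact Ideal.mul_mem_left _ _ hxc
  choose 𝔠 hc1 hc2 hc3 using hfg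
  refine ⟨⨆ j : Fin (K + 1), 𝔠 j, K, Submodule.fg_iSup _ fun j => hc1 j,
    iSup_le fun j => hc2 j, fun k β hβ hβk => ?_⟩
  have hle : ∀ j ≤ K, 𝔠 j ≤ ⨆ j : Fin (K + 1), 𝔠 j := fun j hj =>
    le_iSup (fun j : Fin (K + 1) => 𝔠 j) ⟨j, Nat.lt_succ_of_le hj⟩
  obtain ⟨r, hr, hβr⟩ := exists_sub_mem_map_pow I hd k hβk
  have hrN : r ∈ (initialFiltration I 𝔟).N k :=
    ⟨hr, β, hβ, by rw [← neg_sub]; exact neg_mem hβr⟩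
  suffices h : ∃ γ ∈ J ^ (k - K) • ⨆ j : Fin (K + 1), 𝔠 j,
      algebraMap R S r - γ ∈ J ^ (k + 1) by
    obtain ⟨γ, hγ, h⟩ := h
    refine ⟨γ, hγ, ?_⟩
    have := add_mem hβr h
    rwa [sub_add_sub_cancel] at this
  rcases le_total k K with h | h
  · obtain ⟨γ, hγ, h'⟩ := hc3 k r hrN
    refine ⟨γ, ?_, h'⟩
    rw [Nat.sub_eq_zero_of_le h, pow_zero, Ideal.one_eq_top, Submodule.top_smul]
    exact hle k h hγ
  · rw [hK k h] at hrN
    refine Submodule.smul_induction_on hrN ?_ ?_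
    · intro a ha n hn
      obtain ⟨γ, hγ, h'⟩ := hc3 K n hn
      have haJ : algebraMap R S a ∈ J ^ (k - K) := by
        rw [hJ, ← Ideal.map_pow]
        exact Ideal.mem_map_of_mem _ ha
      refine ⟨algebraMap R S a • γ, Submodule.smul_mem_smul haJ (hle K le_rfl hγ), ?_⟩
      rw [smul_eq_mul, smul_eq_mul, map_mul, ← mul_sub,
        show k + 1 = (k - K) + (K + 1) by lia, pow_add]
      exact Ideal.mul_mem_mul haJ h'
    · rintro x y ⟨c, hc, hxc⟩ ⟨e, he, hye⟩
      refine ⟨c + e, add_mem hc he, ?_⟩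
      rw [map_add, add_sub_add_comm]
      exact add_mem hxc hye

theorem isNoetherianRing_of_isAdicComplete [IsNoetherianRing R] (I : Ideal R)
    [IsAdicComplete (I.map (algebraMap R S)) S]
    (hd : ∀ s : S, ∃ r : R, s - algebraMap R S r ∈ I.map (algebraMap R S)) :
    IsNoetherianRing S := by
  refine (isNoetherianRing_iff_ideal_fg S).2 fun 𝔟 => ?_
  obtain ⟨𝔠, K, ⟨t, rfl⟩, hle, hstep⟩ := exists_fg_initial I 𝔟 hd
  set J := I.map (algebraMap R S) with hJ
  suffices h : 𝔟 ≤ Ideal.span (t : Set S) from le_antisymm h hle ▸ ⟨t, rfl⟩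
  intro β hβ
  have hγ : ∀ k, ∀ β : S, ∃ γ : S, β ∈ 𝔟 → β ∈ J ^ k →
      γ ∈ J ^ (k - K) • Ideal.span (t : Set S) ∧ β - γ ∈ J ^ (k + 1) := by
    intro k β
    by_cases h : β ∈ 𝔟 ∧ β ∈ J ^ k
    · obtain ⟨γ, h1, h2⟩ := hstep k β h.1 h.2
      exact ⟨γ, fun _ _ => ⟨h1, h2⟩⟩
    · exact ⟨0, fun h1 h2 => absurd ⟨h1, h2⟩ h⟩
  choose γ hγ using hγ
  let B : ℕ → S := fun k => Nat.rec β (fun k b => b - γ k b) k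
  have hB : ∀ k, B k ∈ 𝔟 ∧ B k ∈ J ^ k := by
    intro k
    induction k with
    | zero => exact ⟨hβ, by simp⟩
    | succ k ih =>
      obtain ⟨h1, h2⟩ := hγ k (B k) ih.1 ih.2
      exact ⟨sub_mem ih.1 (hle (Ideal.mul_le_left (I := Ideal.span (t : Set S)) (by
        rw [mul_comm]; exact h1))), h2⟩
  have hc : ∀ k, ∃ c : t → S, (∀ i, c i ∈ J ^ (k - K)) ∧ γ k (B k) = ∑ i, c i * i := by
    intro k
    have h1 := (hγ k (B k) (hB k).1 (hB k).2).1
    have hr : (t : Set S) = Set.range ((↑) : t → S) := by simp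
    rw [hr] at h1
    obtain ⟨c, hc, h⟩ := (Submodule.mem_ideal_smul_span_iff_exists_sum _ _ _).1 h1
    refine ⟨c, hc, ?_⟩
    rw [← h, Finsupp.sum_fintype _ _ (by simp)]
    rfl
  choose c hc hc' using hc
  have hsum : ∀ n, β - ∑ k ∈ Finset.range n, γ k (B k) = B n := by
    intro n
    induction n with
    | zero => simp [B]
    | succ n ih => rw [Finset.sum_range_succ, ← sub_sub, ih]
  have hlim : ∀ i : t, ∃ L, ∀ n, (∑ k ∈ Finset.range (n + K), c k i) ≡ L
      [SMOD (J ^ n • ⊤ : Submodule S S)] := by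
    intro i
    refine IsPrecomplete.prec' (I := J) (fun n => ∑ k ∈ Finset.range (n + K), c k i) ?_
    intro m n hmn
    refine (SModEq.sub_mem.2 ?_).symm
    rw [← Finset.sum_Ico_eq_sub _ (show m + K ≤ n + K by lia)]
    refine sum_mem fun k hk => ?_
    rw [Finset.mem_Ico] at hk
    have := Ideal.pow_le_pow_right (show m ≤ k - K by lia) (hc k i)
    simpa using this
  choose L hL using hlim
  have hβL : β = ∑ i, L i * i := by
    rw [← sub_eq_zero]
    refine IsHausdorff.haus' (I := J) _ fun n => ?_
    rw [SModEq.zero]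
    have h1 : (∑ i : t, (∑ k ∈ Finset.range (n + K), c k i) * i) - ∑ i, L i * i ∈ J ^ n := by
      rw [← Finset.sum_sub_distrib]
      refine sum_mem fun i _ => ?_
      rw [← sub_mul]
      refine Ideal.mul_mem_right _ _ ?_
      simpa using SModEq.sub_mem.1 (hL i n)
    have h2 : β - (∑ i : t, (∑ k ∈ Finset.range (n + K), c k i) * i) ∈ J ^ n := by
      have e : (∑ i : t, (∑ k ∈ Finset.range (n + K), c k i) * (i : S)) =
          ∑ k ∈ Finset.range (n + K), γ k (B k) := by
        simp_rw [hc', Finset.sum_mul]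
        exact Finset.sum_comm
      rw [e, hsum]
      exact Ideal.pow_le_pow_right (Nat.le_add_right n K) (hB _).2
    have := add_mem h2 h1
    rw [sub_add_sub_cancel] at this
    simpa using this
  rw [hβL]
  exact sum_mem fun i _ => Ideal.mul_mem_left _ _ (Ideal.subset_span i.2)

end CompleteNoetherian

section CompletionDim

variable {R : Type u} [CommRing R] [IsLocalRing R] [IsNoetherianRing R]

instance isNoetherianRing_adicCompletion : IsNoetherianRing (AdicCompletion (maximalIdeal R) R) := by
  have : IsAdicComplete ((maximalIdeal R).map (algebraMap R (AdicCompletion (maximalIdeal R) R))) (AdicCompletion (maximalIdeal R) R) := by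
    rw [← AdicCompletion.maximalIdeal_eq_map]
    infer_instance
  refine isNoetherianRing_of_isAdicComplete (maximalIdeal R) fun s => ?_
  rw [← AdicCompletion.maximalIdeal_eq_map]
  obtain ⟨y, hy⟩ := (AdicCompletion.residueField_map_bijective (R := R)).2 (residue _ s)
  obtain ⟨r, rfl⟩ := residue_surjective y
  refine ⟨r, ?_⟩
  rw [← residue_eq_zero_iff, map_sub, sub_eq_zero, ← hy]
  rfl

lemma ringKrullDim_le_adicCompletion : ringKrullDim R ≤ ringKrullDim (AdicCompletion (maximalIdeal R) R) := by
  have : (maximalIdeal (AdicCompletion (maximalIdeal R) R)).LiesOver (maximalIdeal R) :=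
    ⟨(IsLocalRing.maximalIdeal_comap (algebraMap R (AdicCompletion (maximalIdeal R) R))).symm⟩
  rw [← maximalIdeal_height_eq_ringKrullDim, ← maximalIdeal_height_eq_ringKrullDim,
    Ideal.height_eq_height_add_of_liesOver_of_hasGoingDown (maximalIdeal R) (maximalIdeal (AdicCompletion (maximalIdeal R) R))]
  exact_mod_cast le_self_add

end CompletionDim

section UnmixedRing

variable {R : Type u} [CommRing R] [IsLocalRing R] [IsNoetherianRing R]

lemma exists_ofList_dle {I : Ideal R} (s : ℕ) (h : DLE I s) :
    ∃ xs : List R, xs.length = s ∧ (∀ x ∈ xs, x ∈ maximalIdeal R) ∧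
      ∃ n, maximalIdeal R ^ n ≤ I ⊔ Ideal.ofList xs := by
  induction s generalizing I with
  | zero => exact ⟨[], rfl, by simp, by simpa using h.exists_pow_le⟩
  | succ s ih =>
    obtain ⟨x, hx, hxI⟩ := exists_mem_dle (J := maximalIdeal R) h
      fun P hP _ hd hle => not_maximalIdeal_le hP hd hle
    obtain ⟨xs, rfl, hxs, n, hn⟩ := ih hxI
    refine ⟨x :: xs, rfl, List.forall_mem_cons.2 ⟨hx, hxs⟩, n, ?_⟩
    rwa [Ideal.ofList_cons, ← sup_assoc]

theorem le_ringKrullDim_of_isUnmixedRing (hum : IsUnmixedRing R) {p : Ideal R}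
    (hp : IsAssociatedPrime p R) {d : ℕ} (hd : ringKrullDim R = d) :
    (d : WithBot ℕ∞) ≤ ringKrullDim (R ⧸ p) := by
  by_contra hlt
  have := hp.isPrime
  obtain ⟨v, hv, hpv⟩ := exists_eq_colon_of_isAssociatedPrime hp
  obtain ⟨k, hk, hkd⟩ : ∃ k : ℕ, DLE p k ∧ k < d := by
    rcases Nat.eq_zero_or_pos d with rfl | hd0
    · exact absurd (by simpa using ringKrullDim_nonneg_of_nontrivial (R := R ⧸ p)) hlt
    · obtain ⟨e, rfl⟩ := Nat.exists_eq_succ_of_ne_zero hd0.ne'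
      refine ⟨e, ?_, by lia⟩
      by_contra h
      exact hlt (natCast_succ_le_of_not_le h)
  obtain ⟨xs, rfl, hxs, n, hn⟩ := exists_ofList_dle k hk
  have hv' : algebraMap R (AdicCompletion (maximalIdeal R) R) v ≠ 0 := by
    rw [Ne, ← map_zero (algebraMap R (AdicCompletion (maximalIdeal R) R))]
    exact fun h => hv (AdicCompletion.of_injective (maximalIdeal R) R h)
  obtain ⟨P, hP, hvP⟩ := exists_le_isAssociatedPrime_of_isNoetherianRing (AdicCompletion (maximalIdeal R) R) _ hv'
  have hpP : p.map (algebraMap R (AdicCompletion (maximalIdeal R) R)) ≤ P := by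
    refine Ideal.map_le_iff_le_comap.2 fun a ha => hvP ?_
    rw [Submodule.mem_colon_singleton, smul_eq_mul, ← map_mul, ← smul_eq_mul, (hpv a).1 ha, map_zero]
    exact zero_mem _
  have hm := Ideal.map_mono (f := algebraMap R (AdicCompletion (maximalIdeal R) R)) hn
  rw [Ideal.map_pow, ← AdicCompletion.maximalIdeal_eq_map, Ideal.map_sup, Ideal.map_ofList] at hm
  have h1 := ringKrullDim_quotient_le_of_pow_le hP.isPrime (xs := xs.map (algebraMap R (AdicCompletion (maximalIdeal R) R)))
    (by
      intro y hy
      obtain ⟨x, hx, rfl⟩ := List.mem_map.1 hy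
      rw [AdicCompletion.maximalIdeal_eq_map]
      exact Ideal.mem_map_of_mem _ (hxs x hx)) (hm.trans (sup_le_sup_right hpP _))
  rw [hum P hP, List.length_map] at h1
  have h2 := hd.symm.le.trans (ringKrullDim_le_adicCompletion.trans h1)
  have : d ≤ xs.length := by exact_mod_cast h2
  lia

theorem eq_zero_of_isUnmixedRing (hum : IsUnmixedRing R) {d : ℕ} (hd : ringKrullDim R = d)
    {x : R} (hx : PSL d [x]) {v : R} (hv : x * v = 0) : v = 0 := by
  by_contra h0
  obtain ⟨P, hP, hvP⟩ := exists_le_isAssociatedPrime_of_isNoetherianRing R v h0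
  have hxP : x ∈ P := hvP (by
    rw [Submodule.mem_colon_singleton, smul_eq_mul, hv]; exact zero_mem _)
  obtain ⟨-, k, hk, hx⟩ := hx
  have h1 := le_ringKrullDim_of_isUnmixedRing hum hP hd
  have h2 : DLE P k := hx.mono (by simpa using (Ideal.span_singleton_le_iff_mem _).2 hxP)
  have h3 : d ≤ k := by exact_mod_cast h1.trans h2
  simp at hk
  lia

end UnmixedRing

section Length

variable {R : Type u} [CommRing R]
variable {X Y Z : Type u} [AddCommGroup X] [Module R X] [AddCommGroup Y] [Module R Y]
  [AddCommGroup Z] [Module R Z]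

lemma length_le_add (f : X →ₗ[R] Y) (g : Y →ₗ[R] Z) (h : ∀ y, g y = 0 → ∃ x, f x = y) :
    Module.length R Y ≤ Module.length R X + Module.length R Z := by
  rw [Module.length_eq_add_of_exact (LinearMap.ker g).subtype g.rangeRestrict
    (Submodule.subtype_injective _) g.surjective_rangeRestrict (by
      rw [LinearMap.exact_iff, LinearMap.ker_rangeRestrict, Submodule.range_subtype])]
  refine add_le_add ?_ (Module.length_le_of_injective _ (Submodule.subtype_injective _))
  refine (Module.length_le_of_injective (Submodule.inclusion (fun y hy => ?_))
    (Submodule.inclusion_injective _)).trans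
    (Module.length_le_of_surjective f.rangeRestrict f.surjective_rangeRestrict)
  obtain ⟨x, rfl⟩ := h y hy
  exact ⟨x, rfl⟩

lemma length_mono {A B : Submodule R X} (h : A ≤ B) : Module.length R A ≤ Module.length R B :=
  Module.length_le_of_injective _ (Submodule.inclusion_injective h)

lemma length_map_le (A : Submodule R X) (f : X →ₗ[R] Y) :
    Module.length R (A.map f) ≤ Module.length R A :=
  Module.length_le_of_surjective (f.submoduleMap A) (f.submoduleMap_surjective A)

lemma length_torsionBySet_le (S : Set R) {f : X →ₗ[R] Y} (hf : Function.Injective f) :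
    Module.length R (Submodule.torsionBySet R X S) ≤
      Module.length R (Submodule.torsionBySet R Y S) := by
  refine Module.length_le_of_injective (f.restrict fun x hx => ?_) fun x y h => ?_
  · rw [Submodule.mem_torsionBySet_iff] at hx ⊢
    intro a
    rw [← map_smul, hx, map_zero]
  · exact Subtype.ext (hf (congrArg Subtype.val h))

/-- Elements multiplied into `K` by an ideal with `n` generators. -/
lemma length_le_torsionBySet_add {I : Ideal R} {n : ℕ} (a : Fin n → R)
    (ha : I = Ideal.span (Set.range a)) {W K : Submodule R X} (h : ∀ r ∈ I, ∀ w ∈ W, r • w ∈ K) :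
    Module.length R W ≤
      Module.length R (Submodule.torsionBySet R X (I : Set R)) + n * Module.length R K := by
  have haI : ∀ i, a i ∈ I := fun i => ha ▸ Ideal.subset_span ⟨i, rfl⟩
  let g : W →ₗ[R] (Fin n → K) := LinearMap.pi fun i =>
    ((LinearMap.lsmul R X (a i)).restrict fun w hw => h _ (haI i) w hw)
  let T := Submodule.torsionBySet R X (I : Set R) ⊓ W
  refine (length_le_add (Submodule.inclusion (inf_le_right : T ≤ W)) g fun w hw => ?_).trans ?_
  · refine ⟨⟨w, ?_, w.2⟩, rfl⟩
    have h0 : ∀ i, a i • (w : X) = 0 := fun i => congrArg Subtype.val (congrFun hw i)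
    rw [SetLike.mem_coe, Submodule.mem_torsionBySet_iff]
    rintro ⟨r, hr⟩
    have : I ≤ (LinearMap.toSpanSingleton R X (w : X)).ker := by
      rw [ha, Ideal.span_le]
      rintro _ ⟨i, rfl⟩
      exact h0 i
    exact this hr
  · rw [Module.length_pi_of_fintype]
    refine add_le_add (length_mono inf_le_left) ?_
    simp

end Length

section LCBound

variable {R : Type u} [CommRing R] [IsLocalRing R] [IsNoetherianRing R]

/-- Bounds on the lengths of the local cohomology modules below degree `k` and on the socle
in degree `k`. -/
def LCBound (k b : ℕ) (M : Type u) [AddCommGroup M] [Module R M] : Prop :=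
  (∀ i < k, Module.length R (LCo (maximalIdeal R) M i) ≤ b) ∧
    Module.length R (Submodule.torsionBySet R (LCo (maximalIdeal R) M k) ((maximalIdeal R) : Set R)) ≤ b

lemma lcKilled_of_length {M : Type u} [AddCommGroup M] [Module R M] {k : ℕ}
    (h : ∀ i < k, Module.length R (LCo (maximalIdeal R) M i) ≠ ⊤) : LCKilled (R := R) M k := by
  intro i hi
  have := (isFiniteLength_iff_isNoetherian_isArtinian.1 (Module.length_ne_top_iff.1 (h i hi))).1
  obtain ⟨t, ht⟩ := exists_pow_smul_uniform (J := (maximalIdeal R)) (⊤ : Submodule R (LCo (maximalIdeal R) M i))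
    fun v _ => exists_pow_smul_lc_eq_zero v
  exact ⟨t, fun a ha y => ht a ha y trivial⟩

variable {M : Type u} [AddCommGroup M] [Module R M]

lemma LCBound.lcKilled {k b : ℕ} (h : LCBound (R := R) k b M) : LCKilled (R := R) M k :=
  lcKilled_of_length fun i hi => ((h.1 i hi).trans_lt (ENat.natCast_lt_top b)).ne

lemma Par.exists_pow_smul [Module.Finite R M] {x : R} {xs : List R} (h : Par (x :: xs) M)
    (hM : LCKilled (R := R) M (xs.length + 1)) (k : ℕ) :
    ∃ n, ∀ a ∈ (maximalIdeal R) ^ n, ∀ v : M, x ^ k • v = 0 → a • v = 0 := by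
  obtain ⟨n, hn⟩ := exists_pow_smul_uniform (J := (maximalIdeal R)) (Submodule.torsionBy R M (x ^ k))
    fun v hv => exists_pow_smul_of_avoids (fun P hP hx =>
      h.eq_maximalIdeal_of_mem hM hP (hP.isPrime.mem_of_pow_mem k hx)) (x := x ^ k) hv
  exact ⟨n, hn⟩

lemma LCBound.quotSMulTop [Module.Finite R M] {b : ℕ} {x : R} {xs : List R}
    (h : LCBound (R := R) (xs.length + 1) b M) (hp : Par (x :: xs) M) :
    LCBound (R := R) xs.length (2 * b) (QuotSMulTop x M) := by
  obtain ⟨n, hn⟩ := hp.exists_pow_smul h.lcKilled 1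
  rw [pow_one] at hn
  have hδ := exists_lcDelta_smul (J := (maximalIdeal R)) x hn (Submodule.mkQ_surjective _)
    (mkQ_smul_top_eq_zero_iff x)
  have e : ((2 * b : ℕ) : ℕ∞) = b + b := by push_cast; ring
  constructor
  · intro i hi
    obtain ⟨δ, h1, -⟩ := hδ i
    rw [e]
    exact (length_le_add _ δ fun y hy => (h1 y).1 hy).trans
      (add_le_add (h.1 i (by lia)) (h.1 (i + 1) (by lia)))
  · obtain ⟨δ, h1, -⟩ := hδ xs.length
    set S := Submodule.torsionBySet R (LCo (maximalIdeal R) (QuotSMulTop x M) xs.length) ((maximalIdeal R) : Set R) with hS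
    let δ' : S →ₗ[R] Submodule.torsionBySet R (LCo (maximalIdeal R) M (xs.length + 1)) ((maximalIdeal R) : Set R) :=
      δ.restrict fun y hy => by
        rw [Submodule.mem_torsionBySet_iff] at hy ⊢
        intro a
        rw [← map_smul, hy, map_zero]
    let g := lcMap (maximalIdeal R) ((x • (⊤ : Submodule R M)).mkQ) xs.length
    refine (length_le_add (g.restrict (p := S.comap g) (q := S) fun y hy => hy) δ'
      fun y hy => ?_).trans ((add_le_add ?_ h.2).trans_eq e.symm)
    · obtain ⟨z, hz⟩ := (h1 y).1 (congrArg Subtype.val hy)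
      refine ⟨⟨z, ?_⟩, Subtype.ext hz⟩
      have hy' := y.2
      rw [← hz] at hy'
      exact hy'
    · exact (Module.length_le_of_injective _ (Submodule.subtype_injective _)).trans
        (h.1 _ (by lia))

lemma exists_lcBound (xs : List R) : ∀ (M : Type u) [AddCommGroup M] [Module R M]
    [Module.Finite R M], Par xs M → (∀ i < xs.length, Module.length R (LCo (maximalIdeal R) M i) ≠ ⊤) →
      ∃ b, LCBound (R := R) xs.length b M := by
  have key : ∀ (M : Type u) [AddCommGroup M] [Module R M] (k : ℕ),
      (∀ i < k, Module.length R (LCo (maximalIdeal R) M i) ≠ ⊤) →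
      Module.length R (Submodule.torsionBySet R (LCo (maximalIdeal R) M k) ((maximalIdeal R) : Set R)) ≠ ⊤ →
      ∃ b, LCBound (R := R) k b M := by
    intro M _ _ k h1 h2
    have h3 : ∑ i ∈ Finset.range k, Module.length R (LCo (maximalIdeal R) M i) ≠ ⊤ :=
      WithTop.sum_ne_top.2 fun i hi => h1 i (Finset.mem_range.1 hi)
    have h4 : (∑ i ∈ Finset.range k, Module.length R (LCo (maximalIdeal R) M i)) +
        Module.length R (Submodule.torsionBySet R (LCo (maximalIdeal R) M k) ((maximalIdeal R) : Set R)) ≠ ⊤ :=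
      WithTop.add_ne_top.2 ⟨h3, h2⟩
    obtain ⟨b, hb⟩ := ENat.ne_top_iff_exists.1 h4
    refine ⟨b, fun i hi => ?_, ?_⟩
    · rw [hb]
      exact (Finset.single_le_sum (f := fun i => Module.length R (LCo (maximalIdeal R) M i))
        (fun _ _ => bot_le) (Finset.mem_range.2 hi)).trans le_self_add
    · rw [hb]
      exact le_add_self
  induction xs with
  | nil =>
    intro M _ _ _ hp _
    refine key M 0 (by simp) (ne_top_of_le_ne_top
      (Module.length_ne_top_iff.2 hp.isFiniteLength) ?_)
    exact (Module.length_le_of_injective _ (Submodule.subtype_injective _)).trans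
      (Module.length_le_of_injective _ lcGamma_injective)
  | cons x xs ih =>
    intro M _ _ _ hp hM
    refine key M _ hM ?_
    obtain ⟨n, hn⟩ := hp.exists_pow_smul (lcKilled_of_length hM) 1
    rw [pow_one] at hn
    have hδ := exists_lcDelta_smul (J := (maximalIdeal R)) x hn (Submodule.mkQ_surjective _)
      (mkQ_smul_top_eq_zero_iff x)
    obtain ⟨b, -, hb⟩ := ih (QuotSMulTop x M) hp.tail fun i hi => by
      obtain ⟨δ, h1, -⟩ := hδ i
      exact ne_top_of_le_ne_top (WithTop.add_ne_top.2 ⟨hM i (by simp; lia),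
        hM (i + 1) (by simpa using hi)⟩) (length_le_add _ δ fun y hy => (h1 y).1 hy)
    obtain ⟨δ, h1, h2⟩ := hδ xs.length
    set S := Submodule.torsionBySet R (LCo (maximalIdeal R) M (xs.length + 1)) ((maximalIdeal R) : Set R) with hS
    have hK : Module.length R (LinearMap.ker δ) ≠ ⊤ := by
      refine ne_top_of_le_ne_top (hM xs.length (by simp)) ?_
      have : LinearMap.ker δ = LinearMap.range (lcMap (maximalIdeal R) (x • (⊤ : Submodule R M)).mkQ xs.length) :=
        Submodule.ext fun y => h1 y
      rw [this]
      exact Module.length_le_of_surjective _ (LinearMap.surjective_rangeRestrict _)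
    obtain ⟨t, a, ha⟩ := Submodule.fg_iff_exists_fin_generating_family.1
      (maximalIdeal R).fg_of_isNoetherianRing
    have hW := length_le_torsionBySet_add a ha.symm (W := S.comap δ) (K := LinearMap.ker δ)
      fun r hr w hw => by
        rw [LinearMap.mem_ker, map_smul]
        exact (Submodule.mem_torsionBySet_iff _ _).1 hw ⟨r, hr⟩
    have hSle : S ≤ (S.comap δ).map δ := by
      intro y hy
      obtain ⟨z, rfl⟩ := (h2 y).1 ((Submodule.mem_torsionBySet_iff _ _).1 hy ⟨x, hp.1 x (by simp)⟩)
      exact ⟨z, hy, rfl⟩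
    refine ne_top_of_le_ne_top (WithTop.add_ne_top.2 ⟨ne_top_of_le_ne_top (ENat.natCast_ne_top b) hb,
      WithTop.mul_ne_top (ENat.natCast_ne_top t) hK⟩) (((length_mono hSle).trans
        (length_map_le _ _)).trans hW)

end LCBound

section LengthBounds

variable {R : Type u} [CommRing R] [IsLocalRing R] [IsNoetherianRing R]

lemma length_torsionBySet_quotient_le (S : Set R) (r : List R)
    (base : ∀ (M : Type u) [AddCommGroup M] [Module R M] [Module.Finite R M] (b : ℕ), Par r M →
      LCBound (R := R) r.length b M → Module.length R (Submodule.torsionBySet R M S) ≤ b)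
    (l : List R) : ∀ (M : Type u) [AddCommGroup M] [Module R M] [Module.Finite R M] (b : ℕ),
      Par (l ++ r) M → LCBound (R := R) (l ++ r).length b M →
        Module.length R (Submodule.torsionBySet R (M ⧸ (Ideal.ofList l • ⊤ : Submodule R M)) S) ≤
          ((2 ^ l.length * b : ℕ) : ℕ∞) := by
  induction l with
  | nil =>
    intro M _ _ _ b hp hb
    refine (length_torsionBySet_le S (f := (Submodule.quotEquivOfEqBot _ (by simp)).toLinearMap)
      (LinearEquiv.injective _)).trans ?_
    simpa using base M b hp hb
  | cons x l ih =>
    intro M _ _ _ b hp hb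
    refine (length_torsionBySet_le S
      (f := (Submodule.quotOfListConsSMulTopEquivQuotSMulTopInner M x l).toLinearMap)
      (LinearEquiv.injective _)).trans
        ((ih _ (2 * b) hp.tail (hb.quotSMulTop (xs := l ++ r) hp)).trans_eq ?_)
    rw [List.length_cons, pow_succ]
    ring_nf

lemma length_socle_le {M : Type u} [AddCommGroup M] [Module R M] {b : ℕ}
    (h : LCBound (R := R) 0 b M) :
    Module.length R (Submodule.torsionBySet R M ((maximalIdeal R) : Set R)) ≤ b := by
  refine (length_mono (B := (Submodule.torsionBySet R (LCo (maximalIdeal R) M 0) ((maximalIdeal R) : Set R)).map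
    (lcGamma (maximalIdeal R) M)) fun v hv => ?_).trans ((length_map_le _ _).trans h.2)
  rw [Submodule.mem_torsionBySet_iff] at hv
  obtain ⟨x, rfl⟩ := (exists_lcGamma_eq_iff (J := (maximalIdeal R)) v).2
    ⟨1, fun a ha => hv ⟨a, pow_one (maximalIdeal R) ▸ ha⟩⟩
  refine ⟨x, ?_, rfl⟩
  rw [SetLike.mem_coe, Submodule.mem_torsionBySet_iff]
  intro a
  refine lcGamma_injective ?_
  rw [map_smul, hv, map_zero]

lemma length_torsion_pow_le {M : Type u} [AddCommGroup M] [Module R M] [Module.Finite R M] {b : ℕ}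
    {w : R} (hp : Par [w] M) (h : LCBound (R := R) 1 b M) (k : ℕ) :
    Module.length R (Submodule.torsionBy R M (w ^ k)) ≤ b := by
  refine (length_mono (B := (LinearMap.range (lcGamma (maximalIdeal R) M))) fun v hv => ?_).trans
    ((Module.length_le_of_surjective _ (LinearMap.surjective_rangeRestrict _)).trans
      (h.1 0 one_pos))
  obtain ⟨n, hn⟩ := hp.exists_pow_smul h.lcKilled k
  exact (exists_lcGamma_eq_iff v).2 ⟨n, fun a ha => hn a ha v hv⟩

lemma torsionChain_and_bound (w : R) (xs : List R) : ∀ (M : Type u) [AddCommGroup M] [Module R M]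
    [Module.Finite R M] (b : ℕ), Par (xs ++ [w]) M → LCBound (R := R) (xs.length + 1) b M →
      TorsionChain w xs M ∧ TorsionBound w (2 ^ xs.length * b) xs M := by
  induction xs with
  | nil =>
    refine fun M _ _ _ b hp hb => ⟨trivial, fun k => ?_⟩
    simpa [len] using ENat.toNat_le_of_le_natCast (length_torsion_pow_le hp hb k)
  | cons x xs ih =>
    intro M _ _ _ b hp hb
    have hl : (xs ++ [w]).length = xs.length + 1 := by simp
    have hb' : LCBound (R := R) ((xs ++ [w]).length + 1) b M := by rwa [hl]
    obtain ⟨h1, h2⟩ := ih _ (2 * b) hp.tail (hl ▸ hb'.quotSMulTop hp)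
    obtain ⟨n, hn⟩ := Par.exists_pow_smul (xs := xs ++ [w]) hp hb'.lcKilled 1
    refine ⟨⟨⟨n, fun v hv => hn _ (Ideal.pow_mem_pow (hp.1 w (by simp)) n) v (by simpa using hv)⟩,
      h1⟩, ?_⟩
    rw [List.length_cons, pow_succ, mul_assoc]
    exact h2

theorem le_len_quotient_pow {L : List R} (hp : Par L R) (N : ℕ) :
    mult L R * (N + L.length).choose L.length ≤ (len R (R ⧸ Ideal.ofList L ^ (N + 1)) : ℤ) := by
  have h := mult_mul_choose_le hp N
  rw [mult_perm L.reverse_perm _ (hp.perm L.reverse_perm.symm), smul_eq_mul, Ideal.mul_top] at h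
  exact h

theorem len_quotient_pow_le_of_lcBound {d b : ℕ} {L : List R} (hp : Par L R)
    (hL : L.length = d + 1) (hb : LCBound (R := R) (d + 1) b R) (N : ℕ) :
    (len R (R ⧸ Ideal.ofList L ^ (N + 1)) : ℤ) ≤
      mult L R * (N + (d + 1)).choose (d + 1) + (2 ^ d * b : ℕ) * (N + d).choose d := by
  obtain rfl | ⟨xs, w, rfl⟩ := L.eq_nil_or_concat
  · simp at hL
  rw [List.concat_eq_append] at *
  obtain rfl : xs.length = d := by simpa using hL
  obtain ⟨h1, h2⟩ := torsionChain_and_bound w xs R b hp hb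
  have h := len_quotient_pow_le w _ xs R hp h1 h2 N
  rwa [smul_eq_mul, Ideal.mul_top] at h

end LengthBounds

section Generators

variable {R : Type u} [CommRing R]

lemma sup_pow_succ_eq (A J : Ideal R) (N : ℕ) :
    (A ⊔ J) ^ (N + 1) = A * (A ⊔ J) ^ N ⊔ J ^ (N + 1) := by
  refine le_antisymm ?_ (sup_le ?_ (Ideal.pow_right_mono le_sup_right _))
  · induction N with
    | zero => simp
    | succ N ih =>
      rw [pow_succ', Ideal.sup_mul]
      refine sup_le le_sup_left ?_
      refine (Ideal.mul_mono_right ih).trans ?_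
      rw [Ideal.mul_sup, ← pow_succ']
      refine sup_le_sup ?_ le_rfl
      rw [mul_left_comm]
      refine Ideal.mul_mono_right ?_
      rw [pow_succ' (A ⊔ J)]
      exact Ideal.mul_mono_left le_sup_right
  · rw [pow_succ']
    exact Ideal.mul_mono_left le_sup_left

lemma ofList_map_mul (x : R) (G : List R) :
    Ideal.ofList (G.map (x * ·)) = Ideal.span {x} * Ideal.ofList G := by
  induction G with
  | nil => simp
  | cons g G ih =>
    rw [List.map_cons, Ideal.ofList_cons, ih, Ideal.ofList_cons, Ideal.mul_sup,
      Ideal.span_singleton_mul_span_singleton]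

lemma exists_ofList_eq_pow (L : List R) (N : ℕ) :
    ∃ G : List R, Ideal.ofList G = Ideal.ofList L ^ N ∧ G.length = L.length.multichoose N := by
  induction L generalizing N with
  | nil =>
    rcases N with _ | N
    · exact ⟨[1], by simp, by simp⟩
    · exact ⟨[], by simp [pow_succ], by simp⟩
  | cons x L ih =>
    induction N with
    | zero => exact ⟨[1], by simp, by simp⟩
    | succ N ihN =>
      obtain ⟨G₁, h1, h1'⟩ := ih (N + 1)
      obtain ⟨G₂, h2, h2'⟩ := ihN
      refine ⟨G₂.map (x * ·) ++ G₁, ?_, ?_⟩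
      · rw [Ideal.ofList_append, ofList_map_mul, h1, h2, Ideal.ofList_cons, sup_pow_succ_eq]
      · rw [List.length_append, List.length_map, h1', h2', List.length_cons,
          Nat.multichoose_succ_succ, add_comm]

lemma length_sup_le {X : Type u} [AddCommGroup X] [Module R X] (A B : Submodule R X) :
    Module.length R (A ⊔ B : Submodule R X) ≤ Module.length R A + Module.length R B := by
  refine (length_le_add (Submodule.inclusion (le_sup_left : A ≤ A ⊔ B))
    ((A.mkQ.submoduleMap (A ⊔ B))) fun y hy => ?_).trans (add_le_add le_rfl ?_)
  · have : A.mkQ y = 0 := congrArg Subtype.val hy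
    exact ⟨⟨y, by simpa using this⟩, rfl⟩
  · rw [Submodule.map_sup, Submodule.mkQ_map_self, bot_sup_eq]
    exact length_map_le _ _

lemma length_iSup_le {X : Type u} [AddCommGroup X] [Module R X] {n : ℕ} (A : Fin n → Submodule R X)
    {c : ℕ∞} (h : ∀ i, Module.length R (A i) ≤ c) :
    Module.length R (⨆ i, A i : Submodule R X) ≤ n * c := by
  have key : ∀ s : Finset (Fin n), Module.length R (s.sup A : Submodule R X) ≤ s.card * c := by
    intro s
    induction s using Finset.induction_on with
    | empty => rw [Finset.sup_empty, Module.length_bot]; exact bot_le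
    | insert i s hi ih =>
      rw [Finset.sup_insert, Finset.card_insert_of_notMem hi]
      refine (length_sup_le _ _).trans ((add_le_add (h i) ih).trans_eq ?_)
      push_cast
      ring
  have := key Finset.univ
  rwa [Finset.sup_univ_eq_iSup, Finset.card_univ, Fintype.card_fin] at this

lemma length_map_ofList_mul_le {V W : Ideal R} (G : List R) :
    Module.length R (Submodule.map (Submodule.mkQ (Ideal.ofList G * V)) (Ideal.ofList G * W)) ≤
      G.length * Module.length R (Submodule.map (Submodule.mkQ V) W) := by
  induction G with
  | nil =>
    rw [Ideal.ofList_nil, Submodule.bot_mul, Submodule.bot_mul, Submodule.map_bot, Module.length_bot]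
    exact bot_le
  | cons g G ih =>
    have h1 : Ideal.span {g} * V ≤ Ideal.ofList (g :: G) * V := by
      rw [Ideal.ofList_cons]; exact Ideal.mul_mono_left le_sup_left
    have h2 : Ideal.ofList G * V ≤ Ideal.ofList (g :: G) * V := by
      rw [Ideal.ofList_cons]; exact Ideal.mul_mono_left le_sup_right
    have e1 : Submodule.map (Submodule.mkQ (Ideal.ofList (g :: G) * V)) (Ideal.span {g} * W) ≤
        Submodule.map (Submodule.mapQ V (Ideal.ofList (g :: G) * V) (LinearMap.lsmul R R g)
          fun v hv => h1 (Ideal.mul_mem_mul (Ideal.mem_span_singleton_self g) hv))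
          (Submodule.map (Submodule.mkQ V) W) := by
      rintro _ ⟨y, hy, rfl⟩
      obtain ⟨w, hw, rfl⟩ := Ideal.mem_span_singleton_mul.1 hy
      exact ⟨_, ⟨w, hw, rfl⟩, rfl⟩
    have e2 : Submodule.map (Submodule.mkQ (Ideal.ofList (g :: G) * V)) (Ideal.ofList G * W) ≤
        Submodule.map (Submodule.factor h2)
          (Submodule.map (Submodule.mkQ (Ideal.ofList G * V)) (Ideal.ofList G * W)) := by
      rintro _ ⟨y, hy, rfl⟩
      exact ⟨_, ⟨y, hy, rfl⟩, rfl⟩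
    have e3 : Ideal.ofList (g :: G) * W = Ideal.span {g} * W ⊔ Ideal.ofList G * W := by
      rw [Ideal.ofList_cons, Ideal.sup_mul]
    rw [e3, Submodule.map_sup]
    refine (length_sup_le _ _).trans ((add_le_add ((length_mono e1).trans (length_map_le _ _))
      (((length_mono e2).trans (length_map_le _ _)).trans ih)).trans_eq ?_)
    rw [List.length_cons]
    push_cast
    ring

end Generators

section ColonBounds

variable {R : Type u} [CommRing R] [IsLocalRing R] [IsNoetherianRing R]

/-- The ideal `(x_j : j ≠ i) : x_i`. -/
def colonErase (L : List R) (i : Fin L.length) : Ideal R :=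
  Submodule.comap (LinearMap.lsmul R R L[i]) (Ideal.ofList (L.eraseIdx i))

lemma mem_colonErase_of_sum {L : List R} {c : Fin L.length → R} (h : ∑ j, c j * L[j] = 0)
    (i : Fin L.length) : c i ∈ colonErase L i := by
  change L[i] * c i ∈ Ideal.ofList (L.eraseIdx i)
  rw [← Finset.add_sum_erase _ _ (Finset.mem_univ i)] at h
  rw [mul_comm, eq_neg_of_add_eq_zero_left h]
  refine neg_mem (sum_mem fun j hj => Ideal.mul_mem_left _ _ (Ideal.subset_span ?_))
  have hij : (j : ℕ) ≠ i := fun h => (Finset.mem_erase.1 hj).1 (Fin.ext h)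
  exact List.mem_eraseIdx_iff_getElem.2 ⟨j, j.2, hij, rfl⟩

lemma mem_mul_ofList_iff {J : Ideal R} {L : List R} {v : R} :
    v ∈ J * Ideal.ofList L ↔ ∃ c : Fin L.length → R, (∀ i, c i ∈ J) ∧ ∑ i, c i * L[i] = v := by
  have h : Ideal.ofList L = Ideal.span (Set.range fun i : Fin L.length => L[i]) := by
    rw [Ideal.ofList]
    congr 1
    ext x
    simp [List.mem_iff_get]
  rw [h, ← smul_eq_mul J]
  refine (Submodule.mem_ideal_smul_span_iff_exists_sum _ _ _).trans ⟨?_, ?_⟩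
  · rintro ⟨c, hc, h⟩
    refine ⟨c, hc, ?_⟩
    rw [← h, Finsupp.sum_fintype _ _ (by simp)]
    rfl
  · rintro ⟨c, hc, h⟩
    refine ⟨Finsupp.equivFunOnFinite.symm c, hc, ?_⟩
    rw [← h, Finsupp.sum_fintype _ _ (by simp)]
    rfl

lemma length_map_colonErase_le {d b : ℕ} {L : List R} (hp : Par L R) (hL : L.length = d + 1)
    (hb : LCBound (R := R) (d + 1) b R) (i : Fin L.length) :
    Module.length R (Submodule.map (Submodule.mkQ (Ideal.ofList L)) (colonErase L i)) ≤
      ((2 ^ d * b : ℕ) : ℕ∞) := by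
  set l := L.eraseIdx i with hl
  have hperm : L.Perm (l ++ [L[i]]) :=
    (List.getElem_cons_eraseIdx_perm i.2).symm.trans (List.perm_append_singleton _ _).symm
  have hld : l.length = d := by simpa [hL] using hperm.length_eq.symm
  have hlen := length_torsionBySet_quotient_le {L[i]} [L[i]] (fun M _ _ _ b hp hb => by
    have := length_torsion_pow_le hp hb 1
    rwa [pow_one, ← Submodule.torsionBySet_singleton_eq] at this) l R b (hp.perm hperm)
      (by rwa [List.length_append, hld])
  rw [hld] at hlen
  have hle : (Ideal.ofList l • ⊤ : Submodule R R) ≤ Ideal.ofList L := by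
    rw [smul_eq_mul, Ideal.mul_top, ofList_perm hperm, Ideal.ofList_append]
    exact le_sup_left
  refine (length_mono (B := Submodule.map (Submodule.factor hle) (Submodule.torsionBySet R _ {L[i]}))
    ?_).trans ((length_map_le _ _).trans hlen)
  rintro _ ⟨v, hv, rfl⟩
  refine ⟨Submodule.Quotient.mk v, ?_, rfl⟩
  rw [Submodule.torsionBySet_singleton_eq]
  change L[i] • (Submodule.Quotient.mk v : R ⧸ (Ideal.ofList l • ⊤ : Submodule R R)) = 0
  rw [← Submodule.Quotient.mk_smul, Submodule.Quotient.mk_eq_zero, smul_eq_mul, smul_eq_mul,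
    Ideal.mul_top]
  exact hv

theorem len_quotient_pow_le_len_colon {d b t : ℕ} {a : Fin t → R}
    (ha : (maximalIdeal R) = Ideal.span (Set.range a)) {L : List R} (hp : Par L R) (hL : L.length = d + 1)
    (hb : LCBound (R := R) (d + 1) b R) {I : Ideal R} (hI : ∀ v ∈ I, ∀ u ∈ (maximalIdeal R), u * v ∈ Ideal.ofList L)
    (hIm : I ≤ (maximalIdeal R)) (hqI : Ideal.ofList L ≤ I) (hmI : (maximalIdeal R) * I ≤ (maximalIdeal R) * Ideal.ofList L) (N : ℕ) :
    (len R (R ⧸ Ideal.ofList L ^ (N + 1)) : ℤ) ≤ len R (R ⧸ I ^ (N + 1)) +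
      (2 ^ (d + 1) * b + t * ((d + 1) * (2 ^ d * b)) : ℕ) * (N + d).choose d := by
  set q := Ideal.ofList L with hq
  set C := 2 ^ (d + 1) * b + t * ((d + 1) * (2 ^ d * b)) with hC
  set U : Ideal R := ⨆ i, colonErase L i with hU
  obtain ⟨W, hW⟩ : ∃ W : Ideal R, ∀ v, v ∈ W ↔ v ∈ (maximalIdeal R) ∧ ∀ u ∈ (maximalIdeal R), u * v ∈ q ⊔ U := by
    refine ⟨{ carrier := {v | v ∈ (maximalIdeal R) ∧ ∀ u ∈ (maximalIdeal R), u * v ∈ q ⊔ U}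
              add_mem' := ?_, zero_mem' := ?_, smul_mem' := ?_ }, fun v => Iff.rfl⟩
    · rintro v w ⟨h1, h2⟩ ⟨h3, h4⟩
      exact ⟨add_mem h1 h3, fun u hu => by rw [mul_add]; exact add_mem (h2 u hu) (h4 u hu)⟩
    · exact ⟨zero_mem _, fun u _ => by rw [mul_zero]; exact zero_mem _⟩
    · rintro r v ⟨h1, h2⟩
      exact ⟨Ideal.mul_mem_left _ _ h1, fun u hu => by
        rw [smul_eq_mul, mul_left_comm]; exact Ideal.mul_mem_left _ _ (h2 u hu)⟩
  have hIW : I ≤ W := fun v hv =>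
    (hW v).2 ⟨hIm hv, fun u hu => le_sup_left (α := Ideal R) (hI v hv u hu)⟩
  have hlenU : Module.length R (Submodule.map (Submodule.mkQ q) U) ≤
      (((d + 1) * (2 ^ d * b) : ℕ) : ℕ∞) := by
    rw [hU, Submodule.map_iSup]
    refine (length_iSup_le _ fun i => length_map_colonErase_le hp hL hb i).trans_eq ?_
    rw [hL]
    push_cast
    ring
  have hsoc : Module.length R (Submodule.torsionBySet R (R ⧸ q) ((maximalIdeal R) : Set R)) ≤
      ((2 ^ (d + 1) * b : ℕ) : ℕ∞) := by
    have h := length_torsionBySet_quotient_le ((maximalIdeal R) : Set R) [] (fun M _ _ _ b _ hb =>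
      length_socle_le hb) L R b (by rwa [List.append_nil]) (by rwa [List.append_nil, hL])
    rw [hL] at h
    exact (length_torsionBySet_le ((maximalIdeal R) : Set R) (f := (Submodule.quotEquivOfEq q _
      (by rw [smul_eq_mul, Ideal.mul_top])).toLinearMap) (LinearEquiv.injective _)).trans h
  have hlenW : Module.length R (Submodule.map (Submodule.mkQ q) W) ≤ (C : ℕ∞) := by
    refine (length_le_torsionBySet_add a ha (K := Submodule.map (Submodule.mkQ q) U) ?_).trans
      ((add_le_add hsoc (mul_le_mul' le_rfl hlenU)).trans_eq (by rw [hC]; push_cast; ring))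
    rintro u hu _ ⟨v, hv, rfl⟩
    obtain ⟨x, hx, y, hy, h⟩ := Submodule.mem_sup.1 (((hW v).1 hv).2 u hu)
    refine ⟨y, hy, ?_⟩
    have hx0 : Submodule.mkQ q x = 0 := (Submodule.Quotient.mk_eq_zero q).2 hx
    rw [← map_smul, smul_eq_mul, ← h, map_add, hx0, zero_add]
  have hIqW : I * W ≤ q * W := by
    refine Ideal.mul_le.2 fun v hv w hw => ?_
    obtain ⟨hwm, hw'⟩ := (hW w).1 hw
    obtain ⟨c, hc, hcv⟩ := mem_mul_ofList_iff.1 (hmI (Ideal.mul_mem_mul hwm hv))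
    rw [mul_comm q, mul_comm v]
    refine mem_mul_ofList_iff.2 ⟨c, fun i => (hW _).2 ⟨hc i, fun u hu => ?_⟩, hcv⟩
    obtain ⟨e, he, hev⟩ := mem_mul_ofList_iff.1 (hmI (Ideal.mul_mem_mul hu hv))
    have hz : ∑ j, (u * c j - e j * w) * L[j] = 0 := by
      have : ∑ j, (u * c j - e j * w) * L[j] = u * ∑ j, c j * L[j] - w * ∑ j, e j * L[j] := by
        rw [Finset.mul_sum, Finset.mul_sum, ← Finset.sum_sub_distrib]
        exact Finset.sum_congr rfl fun j _ => by ring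
      rw [this, hcv, hev]
      ring
    have h1 : u * c i - e i * w ∈ q ⊔ U := le_sup_right (α := Ideal R)
      (le_iSup (colonErase L) i (mem_colonErase_of_sum hz i))
    have := add_mem h1 (hw' (e i) (he i))
    rwa [sub_add_cancel] at this
  have hpow : ∀ n, I ^ (n + 1) ≤ q ^ n * W := by
    intro n
    induction n with
    | zero => simpa using hIW
    | succ n ih =>
      rw [pow_succ']
      refine (Ideal.mul_mono_right ih).trans ?_
      rw [mul_left_comm, pow_succ, mul_assoc]
      exact Ideal.mul_mono_right hIqW
  obtain ⟨G, hG, hGl⟩ := exists_ofList_eq_pow L N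
  have hlen := length_map_ofList_mul_le (V := q) (W := W) G
  rw [hG, hGl, hL, Nat.multichoose_eq, ← pow_succ] at hlen
  have hfin : IsFiniteLength R (R ⧸ q ^ (N + 1)) := by
    have := hp.isFiniteLength_quotient (N + 1)
    rwa [smul_eq_mul, Ideal.mul_top] at this
  have h1 : q ^ (N + 1) ≤ q ^ N * W := by
    rw [pow_succ]
    exact Ideal.mul_mono_right (hqI.trans hIW)
  have h2 : len R (R ⧸ q ^ N * W) ≤ len R (R ⧸ I ^ (N + 1)) :=
    len_le_of_surjective (Submodule.factor_surjective (hpow N))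
      (isFiniteLength_quotient_of_le (Ideal.pow_right_mono hqI _) hfin)
  have h3 := len_quotient_submodule h1 hfin
  have h4 : len R (Submodule.map (Submodule.mkQ (q ^ (N + 1))) (q ^ N * W)) ≤
      C * (N + d).choose d := by
    refine ENat.toNat_le_of_le_natCast (hlen.trans ((mul_le_mul' le_rfl hlenW).trans_eq ?_))
    rw [show d + 1 + N - 1 = N + d by lia, Nat.choose_symm_add, mul_comm]
    push_cast
    rfl
  rw [h3]
  push_cast
  have h4' : (len R (Submodule.map (Submodule.mkQ (q ^ (N + 1))) (q ^ N * W)) : ℤ) ≤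
      C * (N + d).choose d := by exact_mod_cast h4
  have h2' : (len R (R ⧸ q ^ N * W) : ℤ) ≤ len R (R ⧸ I ^ (N + 1)) := by exact_mod_cast h2
  linarith

end ColonBounds

section ChernBound

lemma coeff_le_of_sum_le {d N : ℕ} {f g : ℕ → ℤ}
    (h : ∀ n ≥ N, ∑ i ∈ Finset.range (d + 1 + 1), f i * ((n + (d + 1) - i).choose (d + 1 - i) : ℤ) ≤
      ∑ i ∈ Finset.range (d + 1 + 1), g i * ((n + (d + 1) - i).choose (d + 1 - i) : ℤ)) :
    f 0 ≤ g 0 ∧ (f 0 = g 0 → f 1 ≤ g 1) := by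
  have h' : ∀ n ≥ N, 0 ≤ ∑ i ∈ Finset.range (d + 1 + 1),
      (g i - f i) * ((n + (d + 1) - i).choose (d + 1 - i) : ℤ) := fun n hn => by
    simp_rw [sub_mul]
    rw [Finset.sum_sub_distrib]
    exact sub_nonneg.2 (h n hn)
  have h0 := leading_nonneg (c := fun i => g i - f i) h'
  refine ⟨sub_nonneg.1 h0, fun h1 => sub_nonneg.1 ?_⟩
  exact second_nonneg (c := fun i => g i - f i) h' (sub_eq_zero.2 h1.symm)

lemma sum_range_three (d n : ℕ) (E B C : ℤ) :
    ∑ i ∈ Finset.range (d + 1 + 1 + 1), (if i = 0 then E else if i = 1 then B else if i = 2 then C else 0) *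
      ((n + (d + 1 + 1) - i).choose (d + 1 + 1 - i) : ℤ) =
      E * (n + (d + 2)).choose (d + 2) + B * (n + (d + 1)).choose (d + 1) + C * (n + d).choose d := by
  rw [Finset.sum_range_succ', Finset.sum_range_succ', Finset.sum_range_succ',
    Finset.sum_eq_zero fun i _ => by simp]
  simp only [zero_add, show n + (d + 1 + 1) - 1 = n + (d + 1) by lia, show d + 1 + 1 - 1 = d + 1 by lia,
    show n + (d + 1 + 1) - (1 + 1) = n + d by lia, show d + 1 + 1 - (1 + 1) = d by lia, Nat.sub_zero]
  simp
  ring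

/-- Two-sided estimates of a Hilbert function with the same leading term bound the Chern number. -/
theorem hilb_coeff_one_bounds {d : ℕ} {H : ℕ → ℤ} {e : ℕ → ℤ} {E B B' C : ℤ}
    (he : ∃ N, ∀ n ≥ N, H n = ∑ i ∈ Finset.range (d + 1 + 1 + 1),
      (-1) ^ i * e i * ((n + (d + 1 + 1) - i).choose (d + 1 + 1 - i) : ℤ))
    (hlow : ∀ n : ℕ, E * (n + (d + 2)).choose (d + 2) + B * (n + (d + 1)).choose (d + 1) +
      C * (n + d).choose d ≤ H n)
    (hup : ∀ n : ℕ, H n ≤ E * (n + (d + 2)).choose (d + 2) + B' * (n + (d + 1)).choose (d + 1)) :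
    -B' ≤ e 1 ∧ e 1 ≤ -B := by
  obtain ⟨N, hN⟩ := he
  obtain ⟨h1, h2⟩ := coeff_le_of_sum_le (d := d + 1) (N := N)
    (f := fun i => if i = 0 then E else if i = 1 then B else if i = 2 then C else 0)
    (g := fun i => (-1) ^ i * e i) (fun n hn => by
    rw [← hN n hn, sum_range_three d n E B C]
    exact hlow n)
  obtain ⟨h3, h4⟩ := coeff_le_of_sum_le (d := d + 1) (N := N) (f := fun i => (-1) ^ i * e i)
    (g := fun i => if i = 0 then E else if i = 1 then B' else if i = 2 then 0 else 0) (fun n hn => by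
    rw [← hN n hn, sum_range_three d n E B' 0, zero_mul, add_zero]
    exact hup n)
  simp only [pow_zero, pow_one, if_true, one_mul, one_ne_zero, if_false] at h1 h2 h3 h4
  have h5 := h2 (le_antisymm h1 h3)
  have h6 := h4 (le_antisymm h3 h1)
  constructor <;> linarith

variable {R : Type u} [CommRing R] [IsLocalRing R] [IsNoetherianRing R]

/-- If the local cohomology in degrees below the dimension has finite length, then the Chern numbers
of the socle ideals of the parameter ideals generated by `CList`s are bounded. -/
theorem exists_chern_bound {d : ℕ} {L₀ : List R} (hL₀ : Par L₀ R) (hd₀ : L₀.length = d + 1 + 1)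
    (hlc : ∀ i < d + 1 + 1, Module.length R (LCo (maximalIdeal R) R i) ≠ ⊤)
    (hreg : ∀ x : R, PSL (d + 1 + 1) [x] → ∀ v, x * v = 0 → v = 0)
    (hnp : ∀ l : List R, l.length < d + 1 + 1 → ¬ Par l R) :
    ∃ B : ℤ, ∀ (L : List R) (I : Ideal R) (e : ℕ → ℤ), PSL (d + 1 + 1) L → L.length = d + 1 + 1 →
      CList (d + 1 + 1) L → (∀ v, v ∈ I ↔ ∀ u ∈ maximalIdeal R, u * v ∈ Ideal.ofList L) →
      (∃ N, ∀ n ≥ N, (len R (R ⧸ I ^ (n + 1)) : ℤ) = ∑ i ∈ Finset.range (d + 1 + 1 + 1),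
        (-1) ^ i * e i * ((n + (d + 1 + 1) - i).choose (d + 1 + 1 - i) : ℤ)) → -B ≤ e 1 ∧ e 1 ≤ B := by
  obtain ⟨b, hb⟩ := exists_lcBound L₀ R hL₀ (by rwa [hd₀])
  rw [hd₀] at hb
  obtain ⟨t, a, ha⟩ := Submodule.fg_iff_exists_fin_generating_family.1
    (maximalIdeal R).fg_of_isNoetherianRing
  set b₁ := 2 ^ (d + 1) * b with hb₁
  set b₂ := 2 ^ (d + 1 + 1) * b + t * ((d + 1 + 1) * b₁) with hb₂
  refine ⟨(b₁ + b₂ : ℕ), fun L I e hL hLd hC hI he => ?_⟩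
  suffices h : ∃ E : ℤ, (∀ n : ℕ, E * (n + (d + 2)).choose (d + 2) - b₂ * (n + (d + 1)).choose (d + 1)
      ≤ len R (R ⧸ I ^ (n + 1))) ∧ ∀ n : ℕ, (len R (R ⧸ I ^ (n + 1)) : ℤ) ≤
      E * (n + (d + 2)).choose (d + 2) + b₁ * (n + (d + 1)).choose (d + 1) by
    obtain ⟨E, h1, h2⟩ := h
    obtain ⟨h3, h4⟩ := hilb_coeff_one_bounds (E := E) (B := -b₂) (B' := b₁) (C := 0) he
      (fun n => by have := h1 n; linarith) h2
    push_cast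
    constructor <;> linarith
  have htop : I = ⊤ → ∃ E : ℤ, (∀ n : ℕ, E * (n + (d + 2)).choose (d + 2) -
      b₂ * (n + (d + 1)).choose (d + 1) ≤ len R (R ⧸ I ^ (n + 1))) ∧
      ∀ n : ℕ, (len R (R ⧸ I ^ (n + 1)) : ℤ) ≤
      E * (n + (d + 2)).choose (d + 2) + b₁ * (n + (d + 1)).choose (d + 1) := by
    rintro rfl
    have h0 : ∀ n, len R (R ⧸ (⊤ : Ideal R) ^ (n + 1)) = 0 := fun n => by
      have : Subsingleton (R ⧸ (⊤ : Ideal R) ^ (n + 1)) := by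
        rw [Ideal.Quotient.subsingleton_iff, ← Ideal.one_eq_top, one_pow]
      rw [len, Module.length_eq_zero]
      rfl
    refine ⟨0, fun n => ?_, fun n => ?_⟩ <;> rw [h0] <;> simp <;> positivity
  by_cases hmI : maximalIdeal R * I ≤ maximalIdeal R * Ideal.ofList L
  · by_cases hItop : I = ⊤
    · exact htop hItop
    have hp := hL.par hLd
    have hqI : Ideal.ofList L ≤ I := fun v hv => (hI v).2 fun u _ => Ideal.mul_mem_left _ _ hv
    refine ⟨mult L R, fun n => ?_, fun n => ?_⟩
    · have h1 := le_len_quotient_pow hp n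
      have h2 := len_quotient_pow_le_len_colon ha.symm hp hLd hb (fun v hv => (hI v).1 hv)
        (le_maximalIdeal hItop) hqI hmI n
      rw [hLd] at h1
      rw [sub_le_iff_le_add]
      exact h1.trans h2
    · refine le_trans ?_ (len_quotient_pow_le_of_lcBound hp hLd hb n)
      have hfin := hp.isFiniteLength_quotient (n + 1)
      rw [smul_eq_mul, Ideal.mul_top] at hfin
      exact_mod_cast len_le_of_surjective
        (Submodule.factor_surjective (Ideal.pow_right_mono hqI (n + 1))) hfin
  · obtain ⟨-, w, l, y, hperm, hy, hm, hw⟩ := exists_regular_of_not_mul_le hL hLd (by lia) hC hreg hnp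
      (fun v hv u hu => by rw [mul_comm]; exact (hI v).1 hv u hu) hmI
    rcases eq_top_or_exists_par_of_colon hL hLd hI hperm hy hm hw with h | ⟨L', hL', hp, rfl⟩
    · exact htop h
    · refine ⟨mult L' R, fun n => ?_, len_quotient_pow_le_of_lcBound hp hL' hb⟩
      have h1 := le_len_quotient_pow hp n
      rw [hL'] at h1
      exact (sub_le_self _ (by positivity)).trans h1

end ChernBound

variable {R : Type u} [CommRing R] [IsLocalRing R] [IsNoetherianRing R]

lemma Par.psl {L : List R} (h : Par L R) : PSL L.length L := by
  obtain ⟨h1, n, hn⟩ := h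
  refine ⟨h1, 0, zero_add _, DLE.of_pow_le (xs := []) (t := n) (by simp) ?_⟩
  refine hn.trans (sup_le (fun a ha => ?_) le_sup_left)
  have : a * 1 = 0 := Module.mem_annihilator.1 ha 1
  rw [mul_one] at this
  rw [this]
  exact zero_mem _

lemma TorsionChain.of_colonKilled {w : R} (xs : List R) : ∀ (M : Type u) [AddCommGroup M] [Module R M],
    ColonKilled (Ideal.span {w}) xs M → TorsionChain w xs M := by
  induction xs with
  | nil => exact fun _ _ _ _ => trivial
  | cons x xs ih => exact fun M _ _ h =>
      ⟨⟨1, by rw [pow_one]; exact h.1 w (Ideal.mem_span_singleton_self w)⟩, ih _ h.2⟩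

lemma exists_torsionBound {w : R} (xs : List R) : ∀ (M : Type u) [AddCommGroup M] [Module R M]
    [Module.Finite R M], Par (xs ++ [w]) M → ∃ b, TorsionBound w b xs M := by
  induction xs with
  | cons x xs ih => exact fun M _ _ _ h => ih _ h.tail
  | nil =>
    intro M _ _ _ h
    obtain ⟨K, hK⟩ := monotone_stabilizes_iff_noetherian.2 (inferInstance : IsNoetherian R M)
      ⟨fun k => Submodule.torsionBy R M (w ^ k), fun i j hij v hv => by
        obtain ⟨t, rfl⟩ := Nat.exists_eq_add_of_le hij
        rw [Submodule.mem_torsionBy_iff] at hv ⊢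
        rw [pow_add, mul_comm, mul_smul, hv, smul_zero]⟩
    have hfin : IsFiniteLength R (Submodule.torsionBy R M (w ^ (K + 1))) :=
      (Par.torsionBy (xs := []) (h.pow_head (Nat.succ_ne_zero K))).isFiniteLength
    refine ⟨len R (Submodule.torsionBy R M (w ^ (K + 1))), fun k => ?_⟩
    have hle : Submodule.torsionBy R M (w ^ k) ≤ Submodule.torsionBy R M (w ^ (K + 1)) := by
      have h1 : ∀ m ≥ K, Submodule.torsionBy R M (w ^ K) = Submodule.torsionBy R M (w ^ m) := hK
      rw [← h1 (K + 1) (Nat.le_succ K), h1 (max K k) (le_max_left _ _)]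
      intro v hv
      obtain ⟨t, ht⟩ := Nat.exists_eq_add_of_le (le_max_right K k)
      rw [Submodule.mem_torsionBy_iff] at hv ⊢
      rw [ht, pow_add, mul_comm, mul_smul, hv, smul_zero]
    exact len_le_of_injective (Submodule.inclusion_injective hle) hfin

lemma colonKilled_of_mem_bCol {d : ℕ} {w : R} (hw : w ∈ bCol d ([] : List R)) {ys : List R}
    (h : PSL d ys) : ColonKilled (Ideal.span {w}) ys R := by
  rw [colonKilled_iff]
  rintro l a r rfl f hf v hv
  obtain ⟨g, rfl⟩ := Ideal.mem_span_singleton'.1 hf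
  simp only [smul_eq_mul, Ideal.mul_top] at hv ⊢
  rw [mul_assoc]
  exact Ideal.mul_mem_left _ _ (mul_mem_of_mem_bCol hw (h.sublist (by simp)) hv)

lemma isDSeq_of_mem_bCol {d : ℕ} {zs : List R} (h : PSL d zs) (hb : ∀ z ∈ zs, z ∈ bCol d ([] : List R)) :
    IsDSeq zs R := by
  rintro l a r rfl k hk v hv
  simp only [smul_eq_mul, Ideal.mul_top] at hv ⊢
  rw [← mul_assoc] at hv
  exact mul_mem_of_mem_bCol (hb k (List.mem_append_right _ hk)) (h.sq.sublist (by simp)) hv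

lemma maximalIdeal_mul_pow_le {q I : Ideal R} (h : maximalIdeal R * I ≤ maximalIdeal R * q) (k : ℕ) :
    maximalIdeal R * I ^ k ≤ maximalIdeal R * q ^ k := by
  induction k with
  | zero => simp
  | succ k ih =>
    rw [pow_succ, pow_succ, ← mul_assoc, ← mul_assoc]
    refine (Ideal.mul_mono_left ih).trans ?_
    rw [mul_right_comm, mul_right_comm _ _ q]
    exact Ideal.mul_mono_left h

lemma len_quotient_pow_le_add_len {q I : Ideal R} {x : R} (hx : x ∈ maximalIdeal R)
    (h : maximalIdeal R * I ≤ maximalIdeal R * q) {k : ℕ} (hq : IsFiniteLength R (R ⧸ q ^ k))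
    (hI : IsFiniteLength R (R ⧸ I ^ k)) :
    len R (R ⧸ q ^ k) ≤ len R (R ⧸ I ^ k) + len R (R ⧸ q ^ k ⊔ Ideal.span {x}) := by
  have htop : IsFiniteLength R (R ⧸ (⊤ : Ideal R)) := isFiniteLength_quotient_of_le le_top hq
  have h1 := (len_quotient_add_len_quotient (LinearMap.lsmul R R x) htop hq).2
  have h0 : len R (R ⧸ (⊤ : Ideal R)) = 0 := by
    have : Subsingleton (R ⧸ (⊤ : Ideal R)) := Ideal.Quotient.subsingleton_iff.2 rfl
    rw [len, Module.length_eq_zero, ENat.toNat_zero]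
  have h2 : Submodule.map (LinearMap.lsmul R R x) ⊤ = Ideal.span {x} := by
    ext v
    simp [Ideal.mem_span_singleton', mul_comm]
  have h3 : (I ^ k : Ideal R) ≤ ⊤ ⊓ Submodule.comap (LinearMap.lsmul R R x) (q ^ k : Ideal R) := by
    intro v hv
    have hle : maximalIdeal R * I ^ k ≤ q ^ k := (maximalIdeal_mul_pow_le h k).trans Ideal.mul_le_right
    have hv' : x * v ∈ q ^ k := hle (Ideal.mul_mem_mul hx hv)
    exact ⟨Submodule.mem_top, hv'⟩
  have h4 := len_le_of_surjective (Submodule.factor_surjective h3) hI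
  rw [h2] at h1
  rw [h0, add_zero] at h1
  lia

lemma len_quotient_sup_span_le {x : R} {L : List R} {q : Ideal R} (hp : Par (x :: L) R)
    (hq : Ideal.ofList L ≤ q) (N : ℕ) : (len R (R ⧸ q ^ (N + 1) ⊔ Ideal.span {x}) : ℤ) ≤
      len R (QuotSMulTop x R ⧸ (Ideal.ofList L • (⊤ : Submodule R (QuotSMulTop x R)))) *
        (N + L.length).choose L.length := by
  refine le_trans ?_ (len_quotient_pow_le_choose L (QuotSMulTop x R) hp.tail N)
  have hle : (x • ⊤ : Submodule R R) ≤ q ^ (N + 1) ⊔ Ideal.span {x} := by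
    rintro _ ⟨v, -, rfl⟩
    exact le_sup_right (α := Ideal R) (Ideal.mem_span_singleton'.2 ⟨v, mul_comm _ _⟩)
  have hker : (Ideal.ofList L ^ (N + 1) • (⊤ : Submodule R (QuotSMulTop x R))) ≤
      LinearMap.ker (Submodule.factor hle) := by
    refine Submodule.smul_le.2 fun a ha v _ => ?_
    obtain ⟨v, rfl⟩ := Submodule.mkQ_surjective _ v
    rw [LinearMap.mem_ker, ← map_smul]
    refine (Submodule.Quotient.mk_eq_zero _).2 ?_
    exact le_sup_left (α := Ideal R) (Ideal.mul_mem_right _ _ (Ideal.pow_right_mono hq _ ha))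
  have hsurj : Function.Surjective (Submodule.liftQ _ _ hker) := fun y => by
    obtain ⟨v, rfl⟩ := Submodule.factor_surjective hle y
    exact ⟨Submodule.Quotient.mk v, rfl⟩
  exact_mod_cast len_le_of_surjective hsurj (hp.tail.isFiniteLength_quotient (N + 1))

section ChernUnbounded

variable {R : Type u} [CommRing R] [IsLocalRing R] [IsNoetherianRing R]

/-- Raising the first entry of a suitable `CList` to high powers makes the Chern number of the socle
ideal arbitrarily negative. -/
theorem exists_chern_lt {d : ℕ} {x u v : R} {xs l : List R} {p : Ideal R} (hpp : p.IsPrime)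
    (hd : xs.length + l.length + 1 = d) (hpar : Par (x :: xs ++ (l ++ [u, v])) R)
    (hC : CList (d + 1 + 1) (x :: xs ++ (l ++ [u, v])))
    (hm2 : ∀ y ∈ x :: xs ++ (l ++ [u, v]), y ∈ maximalIdeal R ^ 2)
    (hb : ∀ z ∈ l ++ [u, v], z ∈ bCol (d + 1 + 1) ([] : List R))
    (hdim : ((x :: xs).length : WithBot ℕ∞) ≤ ringKrullDim (R ⧸ p))
    (hE : ∀ c ∉ p, ¬ EndKilled c l u v R)
    (hreg : ∀ x : R, PSL (d + 1 + 1) [x] → ∀ v, x * v = 0 → v = 0)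
    (hnp : ∀ l : List R, l.length < d + 1 + 1 → ¬ Par l R) (B : ℤ) :
    ∃ L : List R, PSL (d + 1 + 1) L ∧ L.length = d + 1 + 1 ∧ CList (d + 1 + 1) L ∧ ∀ I : Ideal R,
      (∀ v, v ∈ I ↔ ∀ u ∈ maximalIdeal R, u * v ∈ Ideal.ofList L) → ∃ e : ℕ → ℤ,
      (∃ N, ∀ n ≥ N, (len R (R ⧸ I ^ (n + 1)) : ℤ) = ∑ i ∈ Finset.range (d + 1 + 1 + 1),
        (-1) ^ i * e i * ((n + (d + 1 + 1) - i).choose (d + 1 + 1 - i) : ℤ)) ∧ e 1 < B := by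
  have hlen : (x :: xs ++ (l ++ [u, v])).length = d + 1 + 1 := by simp; lia
  have hpsl := hpar.psl
  rw [hlen] at hpsl
  obtain ⟨C, -, hlow⟩ := IsDSeq.exists_le_mult hpp hdim l R
    (isDSeq_of_mem_bCol (hpsl.sublist (List.sublist_append_right _ _)) hb)
    (hpar.perm List.perm_append_comm) hE
  set E := mult (l ++ [u, v] ++ (x :: xs)) R with hEdef
  set c := len R (QuotSMulTop x R ⧸ (Ideal.ofList (xs ++ (l ++ [u, v])) •
    (⊤ : Submodule R (QuotSMulTop x R)))) with hc
  obtain ⟨n, hn0, hn⟩ : ∃ n : ℕ, n ≠ 0 ∧ (c : ℤ) - B < n := ⟨((c : ℤ) - B).toNat + 1, by lia, by lia⟩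
  set L := x ^ n :: xs ++ (l ++ [u, v]) with hL
  have hLlen : L.length = d + 1 + 1 := hlen
  have hLpar : Par L R := hpar.pow_head hn0
  have hLpsl : PSL (d + 1 + 1) L := hpsl.pow_head hn0
  have hLC : CList (d + 1 + 1) L := ⟨Ideal.pow_mem_of_mem _ hC.1 n (Nat.pos_of_ne_zero hn0), hC.2⟩
  refine ⟨L, hLpsl, hLlen, hLC, fun I hI => ?_⟩
  set q := Ideal.ofList L with hq
  have hLm2 : ∀ y ∈ L, y ∈ maximalIdeal R ^ 2 := by
    intro y hy
    rcases List.mem_cons.1 hy with rfl | hy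
    · exact Ideal.pow_mem_of_mem _ (hm2 x (by simp)) n (Nat.pos_of_ne_zero hn0)
    · exact hm2 y (List.mem_cons_of_mem _ hy)
  have hqI : q ≤ I := fun v hv => (hI v).2 fun u _ => Ideal.mul_mem_left _ _ hv
  have hmI : maximalIdeal R * I ≤ maximalIdeal R * q := by
    by_contra hcon
    obtain ⟨⟨y, hy, hy2⟩, -⟩ := exists_regular_of_not_mul_le hLpsl hLlen (by lia) hLC hreg hnp
      (fun v hv u hu => by rw [mul_comm]; exact (hI v).1 hv u hu) hcon
    exact hy2 (hLm2 y hy)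
  have hItop : I ≠ ⊤ := by
    rintro rfl
    have h1 : maximalIdeal R ≤ maximalIdeal R • maximalIdeal R := fun y hy => by
      have h2 := (hI 1).1 trivial y hy
      rw [mul_one] at h2
      rw [smul_eq_mul, ← pow_two]
      exact Ideal.span_le.2 hLm2 h2
    have h0 := Submodule.eq_bot_of_le_smul_of_le_jacobson_bot _ _
      (maximalIdeal R).fg_of_isNoetherianRing h1 (maximalIdeal_le_jacobson _)
    refine hnp [] (by simp) ⟨by simp, 1, ?_⟩
    rw [pow_one, h0]
    exact bot_le
  have hqfin : ∀ k, IsFiniteLength R (R ⧸ q ^ k) := fun k => by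
    have := hLpar.isFiniteLength_quotient k
    rwa [smul_eq_mul, Ideal.mul_top] at this
  have hIfin : ∀ k, IsFiniteLength R (R ⧸ I ^ k) := fun k =>
    isFiniteLength_quotient_of_le (Ideal.pow_right_mono hqI k) (hqfin k)
  obtain ⟨e, he⟩ := exists_hilb_of_pow_le L hqI (fun k => by
    rw [pow_succ']
    exact ((Ideal.mul_mono_left (le_maximalIdeal hItop)).trans (maximalIdeal_mul_pow_le hmI k)).trans
      Ideal.mul_le_right) hIfin
  rw [hLlen] at he
  refine ⟨e, he, ?_⟩
  have hmult : mult L R = n * E := by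
    have h1 : (x :: xs ++ (l ++ [u, v])).Perm ((xs ++ (l ++ [u, v])) ++ [x]) :=
      (List.perm_append_singleton _ _).symm
    have h2 : L.Perm ((xs ++ (l ++ [u, v])) ++ [x ^ n]) := (List.perm_append_singleton _ _).symm
    rw [mult_perm h2 R hLpar, mult_append_pow n hn0 _ R (hpar.perm h1), ← mult_perm h1 R hpar,
      mult_perm List.perm_append_comm R hpar]
  obtain ⟨b, hup⟩ : ∃ b : ℕ, ∀ N : ℕ, (len R (R ⧸ q ^ (N + 1)) : ℤ) ≤
      n * E * (N + (d + 2)).choose (d + 2) + b * (N + (d + 1)).choose (d + 1) := by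
    have hLv : L = (x ^ n :: xs ++ (l ++ [u])) ++ [v] := by simp [hL]
    have hlv : (x ^ n :: xs ++ (l ++ [u])).length = d + 1 := by simp; lia
    have hp := hLpar
    rw [hLv] at hp
    obtain ⟨b, hb'⟩ := exists_torsionBound _ R hp
    refine ⟨b, fun N => ?_⟩
    have hps := hLpsl
    rw [hLv] at hps
    have h := len_quotient_pow_le v b _ R hp (.of_colonKilled _ R (colonKilled_of_mem_bCol
      (hb v (by simp)) (hps.sublist (List.sublist_append_left _ _)))) hb' N
    rwa [← hLv, hmult, hlv, smul_eq_mul, Ideal.mul_top] at h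
  have hlowq : ∀ N : ℕ, n * E * (N + (d + 2)).choose (d + 2) + n * (N + (d + 1)).choose (d + 1) +
      (-(n * C)) * (N + d).choose d ≤ (len R (R ⧸ q ^ (N + 1)) : ℤ) := by
    intro N
    obtain ⟨hmem, t, ht⟩ := hLpar
    have h1 := sumIter_mult_le (M := R) (Z := Ideal.ofList (l ++ [u, v])) (n := t) (x ^ n :: xs) []
      (fun y hy => hmem y (List.mem_append_left _ (by simpa using hy)))
      (by rwa [List.append_nil, ← Ideal.ofList_append]) N
    rw [mult, ← Ideal.ofList_append, smul_eq_mul, Ideal.mul_top] at h1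
    refine le_trans ?_ h1
    have h2 : ∀ m : ℕ, n * E * ((m + (l.length + 2)).choose (l.length + 2) : ℤ) +
        (n * (m + (l.length + 1)).choose (l.length + 1) + (-(n * C)) * (m + l.length).choose l.length) ≤
        mult ((x ^ n :: xs).reverse ++ []) (R ⧸ (Ideal.ofList (l ++ [u, v]) ^ (m + 1) •
          (⊤ : Submodule R R))) := by
      intro m
      have hY : Par (x :: xs) (R ⧸ (Ideal.ofList (l ++ [u, v]) ^ (m + 1) • (⊤ : Submodule R R))) := by
        obtain ⟨hmem', t', ht'⟩ := hpar
        exact Par.quotient_pow (fun y hy => hmem' y (List.mem_append_left _ hy))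
          (by rwa [← Ideal.ofList_append]) (m + 1)
      have h3 : (x :: xs).Perm (xs ++ [x]) := (List.perm_append_singleton _ _).symm
      have h4 : (x ^ n :: xs).Perm (xs ++ [x ^ n]) := (List.perm_append_singleton _ _).symm
      rw [List.append_nil, mult_perm ((List.reverse_perm _).trans h4) _
        ((hY.pow_head hn0).perm (List.reverse_perm _).symm),
        mult_append_pow n hn0 _ _ (hY.perm h3), ← mult_perm h3 _ hY]
      have h5 := mul_le_mul_of_nonneg_left (hlow m) (Nat.cast_nonneg (α := ℤ) n)
      linarith
    refine le_trans (le_of_eq ?_) (sumIter_mono _ h2 N)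
    rw [sumIter_add, sumIter_add, sumIter_mul, sumIter_mul, sumIter_mul, sumIter_choose, sumIter_choose,
      sumIter_choose, List.length_cons, show l.length + 2 + (xs.length + 1) = d + 2 by lia,
      show l.length + 1 + (xs.length + 1) = d + 1 by lia, show l.length + (xs.length + 1) = d by lia]
    ring
  have hx : x ∈ maximalIdeal R := hpar.1 x (by simp)
  have hfin := hilb_coeff_one_bounds (E := n * E) (B := n - c) (B' := b) (C := -(n * C)) he
    (fun N => by
      have h1 := hlowq N
      have h2 := len_quotient_pow_le_add_len hx hmI (hqfin (N + 1)) (hIfin (N + 1))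
      have h3 := len_quotient_sup_span_le (q := q) (L := xs ++ (l ++ [u, v])) hpar
        (Ideal.span_mono fun y hy => List.mem_cons_of_mem _ hy) N
      rw [← hc, show (xs ++ (l ++ [u, v])).length = d + 1 by simp; lia] at h3
      have h2' : (len R (R ⧸ q ^ (N + 1)) : ℤ) ≤ len R (R ⧸ I ^ (N + 1)) +
        len R (R ⧸ q ^ (N + 1) ⊔ Ideal.span {x}) := by exact_mod_cast h2
      linarith)
    (fun N => by
      have h1 := len_le_of_surjective
        (Submodule.factor_surjective (Ideal.pow_right_mono hqI (N + 1))) (hqfin (N + 1))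
      have h1' : (len R (R ⧸ I ^ (N + 1)) : ℤ) ≤ len R (R ⧸ q ^ (N + 1)) := by exact_mod_cast h1
      exact h1'.trans (hup N))
  linarith [hfin.2]

end ChernUnbounded

section Bridge

section Lists
variable {R : Type u} [CommRing R] {s : ℕ} (x : Fin s → R)

theorem span_range_eq_ofList : Ideal.span (Set.range x) = Ideal.ofList (List.ofFn x) :=
  congrArg Ideal.span (Set.ext fun _ => (List.mem_ofFn' _ _).symm)

theorem ofFn_eq_append (i : Fin s) :
    List.ofFn x = (List.ofFn x).take i ++ x i :: (List.ofFn x).drop (i + 1) := by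
  conv_lhs => rw [← List.take_append_drop i (List.ofFn x)]
  rw [List.drop_eq_getElem_cons (by simp), List.getElem_ofFn]

theorem span_image_lt (i : Fin s) :
    Ideal.span (x '' {j | j < i}) = Ideal.ofList ((List.ofFn x).take i) := by
  refine congrArg Ideal.span (Set.ext fun y => ?_)
  simp only [Set.mem_image, Set.mem_ofPred_eq, List.mem_take_iff_getElem, List.getElem_ofFn]
  constructor
  · rintro ⟨j, hj, rfl⟩
    exact ⟨j, by simp; omega, rfl⟩
  · rintro ⟨j, hj, rfl⟩
    rw [lt_min_iff, List.length_ofFn] at hj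
    exact ⟨⟨j, hj.2⟩, hj.1, rfl⟩

theorem span_image_gt (i : Fin s) :
    Ideal.span (x '' {j | i < j}) = Ideal.ofList ((List.ofFn x).drop (i + 1)) := by
  refine congrArg Ideal.span (Set.ext fun y => ?_)
  simp only [Set.mem_image, Set.mem_ofPred_eq, List.mem_drop_iff_getElem, List.getElem_ofFn]
  constructor
  · rintro ⟨j, hj, rfl⟩
    have : (i : ℕ) < j := hj
    exact ⟨j - (i + 1), by simp; omega, by congr 1; ext; simp; omega⟩
  · rintro ⟨j, hj, rfl⟩
    exact ⟨⟨i + 1 + j, by simpa [add_comm] using hj⟩, by rw [Fin.lt_def]; simp; omega, by congr 1⟩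

end Lists

variable {R : Type u} [CommRing R] [IsNoetherianRing R] [IsLocalRing R]

theorem isFiniteLength_iff_exists_pow (M : Type u) [AddCommGroup M] [Module R M] [Module.Finite R M] :
    IsFiniteLength R M ↔ ∃ t, ∀ a ∈ maximalIdeal R ^ t, ∀ v : M, a • v = 0 := by
  refine ⟨fun h => ?_, fun ⟨t, ht⟩ => isFiniteLength_of_pow_smul_eq_zero ht⟩
  obtain ⟨_, _⟩ := isFiniteLength_iff_isNoetherian_isArtinian.1 h
  obtain ⟨n, hn⟩ := IsArtinian.monotone_stabilizes (R := R) (M := M)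
    ⟨fun n => OrderDual.toDual (maximalIdeal R ^ n • (⊤ : Submodule R M)), fun a b hab =>
      Submodule.smul_mono_left (Ideal.pow_le_pow_right hab)⟩
  have h1 : maximalIdeal R ^ n • (⊤ : Submodule R M) = maximalIdeal R ^ (n + 1) • ⊤ := hn _ n.le_succ
  have h2 : maximalIdeal R ^ n • (⊤ : Submodule R M) = ⊥ := by
    refine Submodule.eq_bot_of_le_smul_of_le_jacobson_bot (maximalIdeal R) _ (IsNoetherian.noetherian _) ?_
      (maximalIdeal_le_jacobson _)
    rw [← Submodule.mul_smul, ← pow_succ', ← h1]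
  refine ⟨n, fun a ha v => ?_⟩
  rw [← Submodule.mem_bot R, ← h2]
  exact Submodule.smul_mem_smul ha trivial

variable {d : ℕ}

theorem PSL.exists_ringKrullDim_eq (hd : ringKrullDim R = d) {z : List R} (h : PSL d z) :
    ∃ k : ℕ, k + z.length = d ∧ ringKrullDim (R ⧸ Ideal.ofList z) = k := by
  obtain ⟨hm, k, hk, h1⟩ := h
  refine ⟨k, hk, le_antisymm h1 ?_⟩
  have hle : Ideal.ofList z ≤ maximalIdeal R := Ideal.span_le.2 hm
  rcases k with _ | k
  · have : Nontrivial (R ⧸ Ideal.ofList z) :=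
      Ideal.Quotient.nontrivial_iff.2 fun h => (maximalIdeal.isMaximal R).ne_top (top_le_iff.1 (h ▸ hle))
    exact_mod_cast ringKrullDim_nonneg_of_nontrivial
  · by_contra hcon
    have h2 : DLE (Ideal.ofList z) k := by
      by_contra h3
      exact hcon (natCast_succ_le_of_not_le h3)
    obtain ⟨-, k', hk', h4⟩ := PSL.sublist (l' := []) ⟨hm, k, rfl, h2⟩ (List.nil_sublist _)
    have h5 : ringKrullDim R ≤ k' := by
      rw [← ringKrullDim_eq_of_ringEquiv (RingEquiv.quotientBot R), ← Ideal.ofList_nil]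
      exact h4
    rw [hd] at h5
    have : d ≤ k' := by exact_mod_cast h5
    simp at hk'
    omega

theorem isSOP_iff (hd : ringKrullDim R = d) {z : List R} (hz : PSL d z) {M : Type u} [AddCommGroup M]
    [Module R M] [Module.Finite R M] (hM : Module.annihilator R M = Ideal.ofList z)
    (hI : ∀ (I : Ideal R) c, (∀ v : M, c • v ∈ I • (⊤ : Submodule R M)) ↔ c ∈ I ⊔ Ideal.ofList z)
    {s : ℕ} (x : Fin s → R) :
    IsSOP R M x ↔ s + z.length = d ∧ PSL d (List.ofFn x ++ z) := by
  obtain ⟨k, hk, hdim⟩ := hz.exists_ringKrullDim_eq hd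
  have h1 : moduleDim R M = k := by rw [moduleDim, hM, hdim]
  have h2 : IsFiniteLength R (M ⧸ (Ideal.span (Set.range x) • (⊤ : Submodule R M))) ↔
      ∃ t, maximalIdeal R ^ t ≤ Ideal.ofList (List.ofFn x ++ z) := by
    rw [isFiniteLength_iff_exists_pow]
    refine exists_congr fun t => forall_congr' fun a => forall_congr' fun ha => ?_
    rw [Ideal.ofList_append, ← span_range_eq_ofList, ← hI]
    refine ⟨fun h v => ?_, fun h v => ?_⟩
    · rw [← Submodule.Quotient.mk_eq_zero]
      exact h (Submodule.Quotient.mk v)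
    · obtain ⟨v, rfl⟩ := Submodule.Quotient.mk_surjective _ v
      rw [← Submodule.Quotient.mk_smul, Submodule.Quotient.mk_eq_zero]
      exact h v
  rw [IsSOP, h1, h2, Nat.cast_inj]
  constructor
  · rintro ⟨rfl, hx, t, ht⟩
    refine ⟨hk, fun y hy => ?_, 0, by simp [← hk], ?_⟩
    · rcases List.mem_append.1 hy with hy | hy
      · obtain ⟨i, rfl⟩ := (List.mem_ofFn' _ _).1 hy
        exact hx i
      · exact hz.1 y hy
    · exact DLE.of_pow_le (xs := []) (by simp) (by simpa using ht)
  · rintro ⟨h3, h4⟩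
    refine ⟨by omega, fun i => h4.1 _ (List.mem_append_left _ ((List.mem_ofFn' _ _).2 ⟨i, rfl⟩)), ?_⟩
    obtain ⟨-, t, ht⟩ := h4.par (by simpa using h3)
    have hbot : Module.annihilator R R = ⊥ := Module.annihilator_eq_bot.2 inferInstance
    exact ⟨t, by rwa [hbot, bot_sup_eq] at ht⟩

theorem isSOP_quotient_iff (hd : ringKrullDim R = d) {z : List R} (hz : PSL d z) {s : ℕ} (x : Fin s → R) :
    IsSOP R (R ⧸ (Ideal.ofList z : Submodule R R)) x ↔ s + z.length = d ∧ PSL d (List.ofFn x ++ z) := by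
  refine isSOP_iff hd hz Ideal.annihilator_quotient (fun I c => ?_) x
  have h1 : I ⊔ Ideal.ofList z = I • (⊤ : Submodule R R) ⊔ Ideal.ofList z := by
    rw [smul_eq_mul, Ideal.mul_top]
  rw [h1]
  constructor
  · intro h
    rw [← mkQ_mem_smul_top_iff]
    have h2 := h (Submodule.mkQ _ 1)
    rwa [← map_smul, smul_eq_mul, mul_one] at h2
  · intro h v
    obtain ⟨v, rfl⟩ := Submodule.mkQ_surjective _ v
    rw [← map_smul, mkQ_mem_smul_top_iff, smul_eq_mul c, mul_comm]
    exact Submodule.smul_mem _ v h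

theorem isSOP_self_iff (hd : ringKrullDim R = d) {s : ℕ} (x : Fin s → R) :
    IsSOP R R x ↔ s = d ∧ PSL d (List.ofFn x) := by
  have hz : PSL d ([] : List R) := ⟨by simp, d, rfl, by
    rw [Ideal.ofList_nil, DLE, ← hd]
    exact ringKrullDim_quotient_le _⟩
  have h := isSOP_iff (M := R) hd hz (by rw [Ideal.ofList_nil]; exact Module.annihilator_eq_bot.2 inferInstance) (fun I c => by
    simp only [smul_eq_mul, Ideal.mul_top, Ideal.ofList_nil, sup_bot_eq]
    exact ⟨fun h => by simpa using h 1, fun h v => Ideal.mul_mem_right _ _ h⟩) x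
  simpa using h

theorem bIdeal_eq_bCol (hd : ringKrullDim R = d) {z : List R} (hz : PSL d z) :
    bIdeal R (R ⧸ (Ideal.ofList z : Submodule R R)) = bCol d z := by
  have key (I : Ideal R) (a c : R) : c ∈ (Submodule.torsionBy R
      ((R ⧸ (Ideal.ofList z : Submodule R R)) ⧸ (I • (⊤ : Submodule R (R ⧸ (Ideal.ofList z : Submodule R R))))) a).annihilator ↔
      ∀ v, a * v ∈ I ⊔ Ideal.ofList z → c * v ∈ I ⊔ Ideal.ofList z := by
    have h (b v : R) : b • (Submodule.mkQ (I • (⊤ : Submodule R (R ⧸ (Ideal.ofList z : Submodule R R)))))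
        (Submodule.mkQ _ v) = 0 ↔ b * v ∈ I ⊔ Ideal.ofList z := by
      rw [← map_smul, ← map_smul, Submodule.mkQ_apply, Submodule.Quotient.mk_eq_zero, mkQ_mem_smul_top_iff,
        smul_eq_mul, smul_eq_mul, Ideal.mul_top]
    rw [Submodule.mem_annihilator]
    constructor
    · intro hc v hv
      rw [← h] at hv ⊢
      exact hc _ ((Submodule.mem_torsionBy_iff _ _).2 hv)
    · intro hc w hw
      obtain ⟨w, rfl⟩ := Submodule.mkQ_surjective _ w
      obtain ⟨w, rfl⟩ := Submodule.mkQ_surjective _ w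
      rw [Submodule.mem_torsionBy_iff, h] at hw
      rw [h]
      exact hc _ hw
  ext c
  simp only [bIdeal, Submodule.mem_iInf, key, span_image_lt, ← Ideal.ofList_append]
  constructor
  · intro h l a hla
    obtain ⟨l', hlen, hpar⟩ := hla.exists_par
    have hp := hpar.psl
    rw [hlen] at hp
    have hperm : ((l ++ a :: z) ++ l').Perm ((l ++ a :: l') ++ z) := by
      rw [List.append_assoc, List.append_assoc]
      refine List.Perm.append_left _ ?_
      simpa using List.perm_append_comm
    have := h _ (l ++ a :: l').get
      ((isSOP_quotient_iff hd hz _).2 ⟨by simp at hlen ⊢; omega, by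
        rw [List.ofFn_get]; exact hp.perm hperm⟩) ⟨l.length, by simp⟩
    rw [List.ofFn_get] at this
    simpa only [List.take_left', List.get_eq_getElem, List.getElem_append_right le_rfl, Nat.sub_self,
      List.getElem_cons_zero] using this
  · intro h s x hx i
    refine h _ _ (((isSOP_quotient_iff hd hz x).1 hx).2.sublist ?_)
    conv_rhs => rw [ofFn_eq_append x i, List.append_assoc]
    exact List.Sublist.append_left (by simp) _

theorem cList_iff (L : List R) :
    CList d L ↔ ∀ l a r, L = l ++ a :: r → a ∈ bCol d r ^ 3 := by
  induction L with
  | nil => simp [CList]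
  | cons x L ih =>
    rw [CList, ih]
    constructor
    · rintro ⟨h1, h2⟩ l a r h
      rcases l with _ | ⟨y, l⟩
      · obtain ⟨rfl, rfl⟩ : x = a ∧ L = r := by simpa using h
        exact h1
      · obtain ⟨rfl, h'⟩ : x = y ∧ L = l ++ a :: r := by simpa using h
        exact h2 l a r h'
    · exact fun h => ⟨h [] x L rfl, fun l a r hL => h (x :: l) a r (by simp [hL])⟩

theorem isCSOP_iff (hd : ringKrullDim R = d) {s : ℕ} (x : Fin s → R) :
    IsCSOP R R x ↔ s = d ∧ PSL d (List.ofFn x) ∧ CList d (List.ofFn x) := by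
  rw [IsCSOP, isSOP_self_iff hd, and_assoc]
  refine and_congr_right fun _ => and_congr_right fun hx => ?_
  have h (i : Fin s) : bIdeal R (R ⧸ (Ideal.span (x '' {j | i < j}) • (⊤ : Submodule R R))) =
      bCol d ((List.ofFn x).drop (i + 1)) := by
    rw [← bIdeal_eq_bCol hd (hx.sublist (List.drop_sublist _ _))]
    have hN : Ideal.span (x '' {j | i < j}) • (⊤ : Submodule R R) = Ideal.ofList ((List.ofFn x).drop (i + 1)) := by
      rw [smul_eq_mul, Ideal.mul_top, span_image_gt]
    rw [hN]
  simp only [h, cList_iff]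
  constructor
  · intro hC l a r hL
    have hlen : l.length < s := by
      have := congrArg List.length hL
      simp at this
      omega
    have h1 := hC ⟨l.length, hlen⟩
    have h2 : x ⟨l.length, hlen⟩ = a := by
      rw [← List.getElem_ofFn (f := x) (by simpa using hlen)]
      simp [hL]
    simpa [h2, hL] using h1
  · exact fun hC i => hC _ _ _ (ofFn_eq_append x i)

theorem isCParamIdeal_iff (hd : ringKrullDim R = d) (q : Ideal R) :
    IsCParamIdeal R q ↔ ∃ L, PSL d L ∧ L.length = d ∧ CList d L ∧ q = Ideal.ofList L := by
  constructor
  · rintro ⟨s, x, hx, rfl⟩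
    obtain ⟨rfl, h1, h2⟩ := (isCSOP_iff hd x).1 hx
    exact ⟨_, h1, by simp, h2, span_range_eq_ofList x⟩
  · rintro ⟨L, h1, h2, h3, rfl⟩
    refine ⟨L.length, L.get, (isCSOP_iff hd _).2 ⟨h2, ?_⟩, ?_⟩
    · rw [List.ofFn_get]
      exact ⟨h1, h3⟩
    · rw [span_range_eq_ofList, List.ofFn_get]

end Bridge

section Main
variable {R : Type u} [CommRing R] [IsLocalRing R] [IsNoetherianRing R] {d : ℕ}

theorem isHilbCoeff_iff {I : Ideal R} (hI : ∀ n, IsFiniteLength R (R ⧸ I ^ n)) (e : ℕ → ℤ) :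
    IsHilbCoeff R I d e ↔ ∃ N, ∀ n ≥ N, (len R (R ⧸ I ^ (n + 1)) : ℤ) = ∑ i ∈ Finset.range (d + 1),
      (-1) ^ i * e i * ((n + d - i).choose (d - i) : ℤ) := by
  have h (n : ℕ) : moduleLength R (R ⧸ (I ^ n • (⊤ : Submodule R R))) = (len R (R ⧸ I ^ n) : WithBot ℕ∞) := by
    have h1 : I ^ n • (⊤ : Submodule R R) = I ^ n := by rw [smul_eq_mul, Ideal.mul_top]
    rw [h1, moduleLength, ← Module.coe_length, ← len_coe (hI n)]
    rfl
  refine exists_congr fun N => forall_congr' fun n => forall_congr' fun _ => ?_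
  simp only [h, Nat.cast_inj]
  exact ⟨fun ⟨L, h1, h2⟩ => h1 ▸ h2, fun h => ⟨_, rfl, h⟩⟩

theorem mem_colonIdeal_iff (q : Ideal R) (v : R) :
    v ∈ colonIdeal R q ↔ ∀ u ∈ maximalIdeal R, u * v ∈ q := Iff.rfl

theorem Par.isFiniteLength_quotient_colonIdeal_pow {L : List R} (hL : Par L R) (n : ℕ) :
    IsFiniteLength R (R ⧸ colonIdeal R (Ideal.ofList L) ^ n) := by
  have hle : Ideal.ofList L ^ n • (⊤ : Submodule R R) ≤ colonIdeal R (Ideal.ofList L) ^ n := by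
    rw [smul_eq_mul, Ideal.mul_top]
    have h : Ideal.ofList L ≤ colonIdeal R (Ideal.ofList L) := fun v hv u _ => Ideal.mul_mem_left _ u hv
    exact Ideal.pow_right_mono h n
  exact (hL.isFiniteLength_quotient n).of_surjective (Submodule.factor_surjective hle)

theorem dle_bot (hd : ringKrullDim R = d) : DLE (⊥ : Ideal R) d := by
  rw [DLE, ← hd]
  exact ringKrullDim_quotient_le _

theorem length_le_of_par (hd : ringKrullDim R = d) {l : List R} (hl : Par l R) : d ≤ l.length := by
  obtain ⟨P, hP, -, h⟩ := exists_prime_le_ringKrullDim (R := R) (I := ⊥) (k := d) (by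
    rw [ringKrullDim_eq_of_ringEquiv (RingEquiv.quotientBot R), hd])
  obtain ⟨hm, n, hn⟩ := hl
  rw [Module.annihilator_eq_bot.2 (inferInstance : FaithfulSMul R R), bot_sup_eq] at hn
  exact_mod_cast h.trans (ringKrullDim_quotient_le_of_pow_le hP hm (hn.trans le_sup_right))

theorem isWeaklyRegular_of_isCMLocal (hR : IsCMLocal R) (hd : ringKrullDim R = d) {l : List R} (hl : PSL d l) :
    RingTheory.Sequence.IsWeaklyRegular R l := by
  obtain ⟨l', hlen, hpar⟩ := hl.exists_par
  refine ((RingTheory.Sequence.isWeaklyRegular_append_iff R l l').1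
    (isWeaklyRegular_of_lc_eq_zero _ R (fun i hi y => ?_) hpar)).1
  have : Subsingleton (LCo (maximalIdeal R) R i) := hR i (by rw [hd]; exact_mod_cast hlen ▸ hi)
  exact Subsingleton.elim _ _

theorem isGeneralizedCM_of_pow_le_bCol (hd : ringKrullDim R = d) {t : ℕ}
    (ht : maximalIdeal R ^ t ≤ bCol d ([] : List R)) : IsGeneralizedCM R := by
  obtain ⟨L, hL, hpar⟩ := PSL.exists_par (R := R) (n := d) (l := []) ⟨by simp, d, rfl, by
    rw [Ideal.ofList_nil]; exact dle_bot hd⟩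
  intro i hi
  rw [hd] at hi
  refine (lc_finite_of_colonKilled (t := t) i d R ⟨_, hL, hpar⟩ (fun xs hxs hp => ?_) (by exact_mod_cast hi)).2
  rw [colonKilled_iff]
  rintro l a r rfl f hf v hv
  have h1 := hp.psl
  rw [hxs] at h1
  rw [smul_eq_mul, smul_eq_mul, Ideal.mul_top] at hv ⊢
  have h2 : PSL d (l ++ a :: []) := h1.sublist (List.Sublist.append_left (by simp) l)
  have := ht hf l a h2 v (by simpa using hv)
  simpa using this

theorem exists_two_le_of_not_colonKilled {zs : List R} {p : Ideal R} (hp : p.IsPrime)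
    (hz : PSL d zs) (hb : ∀ z ∈ zs, z ∈ bCol d ([] : List R)) (hreg : ∀ z ∈ zs, ∀ v : R, z * v = 0 → v = 0)
    (h : ∀ f ∉ p, ¬ ColonKilled (Ideal.span {f}) zs R) :
    ∃ l u v, zs = l ++ [u, v] ∧ ∀ c ∉ p, ¬ EndKilled c l u v R := by
  by_cases hzs : ∃ l u v, zs = l ++ [u, v]
  · obtain ⟨l, u, v, rfl⟩ := hzs
    refine ⟨l, u, v, rfl, fun c hc hE => h (c ^ (l ++ [u, v]).length) (fun h => hc (hp.mem_of_pow_mem _ h))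
      (colonKilled_of_endKilled hz hb hreg fun l' x y hl => ?_)⟩
    obtain ⟨rfl, h1⟩ := List.append_inj' hl rfl
    obtain ⟨rfl, rfl⟩ : u = x ∧ v = y := by simpa using h1
    exact hE
  · refine absurd (colonKilled_of_endKilled (c := 1) hz hb hreg fun l x y hl => absurd ⟨l, x, y, hl⟩ hzs) (h _ ?_)
    rw [one_pow]
    exact fun h => hp.ne_top ((Ideal.eq_top_iff_one _).2 h)

end Main

end LocCoh

open LocCoh
/-- For `R` unmixed of dimension `d ≥ 2`, `R` is generalized Cohen-Macaulay
iff `Ξ_1(R) = {e_1(q :_R m, R) : q a C-parameter ideal of R}` is finite. -/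
theorem statement_12 {R : Type u} [CommRing R] [IsLocalRing R] [IsNoetherianRing R]
    (hres : IsHomImageOfCM R)
    (d : ℕ) (hd : 2 ≤ d) (hdim : ringKrullDim R = (d : WithBot ℕ∞))
    (hum : IsUnmixedRing R) :
    IsGeneralizedCM R ↔
      {z : ℤ | ∃ q : Ideal R, IsCParamIdeal R q ∧
        ∃ e : ℕ → ℤ, IsHilbCoeff R (colonIdeal R q) d e ∧ z = e 1}.Finite := by
  have hreg (x : R) (hx : PSL d [x]) (v : R) (hv : x * v = 0) : v = 0 := eq_zero_of_isUnmixedRing hum hdim hx hv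
  have hnp (l : List R) (hl : l.length < d) : ¬ Par l R := fun h => (length_le_of_par hdim h).not_gt hl
  obtain ⟨d, rfl⟩ : ∃ d', d = d' + 1 + 1 := ⟨d - 2, by omega⟩
  constructor
  · intro hR
    obtain ⟨L₀, hL₀, hpar⟩ := PSL.exists_par (R := R) (n := d + 1 + 1) (l := []) ⟨by simp, _, rfl, by
      rw [Ideal.ofList_nil]; exact dle_bot hdim⟩
    obtain ⟨B, hB⟩ := exists_chern_bound hpar hL₀ (fun i hi => Module.length_ne_top_iff.2
      (hR i (by rw [hdim]; exact_mod_cast hi))) hreg hnp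
    refine (Set.finite_Icc (-B) B).subset ?_
    rintro z ⟨q, hq, e, he, rfl⟩
    obtain ⟨L, h1, h2, h3, rfl⟩ := (isCParamIdeal_iff hdim q).1 hq
    exact hB L _ e h1 h2 h3 (mem_colonIdeal_iff _)
      ((isHilbCoeff_iff (h1.par h2).isFiniteLength_quotient_colonIdeal_pow e).1 he)
  · intro hfin
    by_contra hR
    obtain ⟨A, _, _, _, hA, f, hf⟩ := hres
    algebraize [f]
    obtain ⟨n, hn⟩ : ∃ n : ℕ, ringKrullDim A = n := by
      have h1 : ringKrullDim A ≠ ⊤ := ringKrullDim_ne_top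
      have h2 : ringKrullDim A ≠ ⊥ := ringKrullDim_ne_bot
      lift ringKrullDim A to ℕ∞ using h2 with k
      lift k to ℕ using by simpa using h1
      exact ⟨k, rfl⟩
    have hdn : d + 1 + 1 ≤ n := by
      have := ringKrullDim_le_of_surjective f hf
      rw [hdim, hn] at this
      exact_mod_cast this
    obtain ⟨xs, zs, p, hp, hxs, hlen, hpar, hC, hm2, hb, hpdim, hbad⟩ := exists_bad_list (A := A) (R := R) hf
      (fun l hl => isWeaklyRegular_of_isCMLocal hA hn hl) (dle_bot hn) (dle_bot hdim) hdn
      fun t ht => hR (isGeneralizedCM_of_pow_le_bCol hdim ht)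
    have hpsl := hpar.psl
    rw [List.length_append, hlen] at hpsl
    have hz := hpsl.sublist (List.sublist_append_right xs zs)
    obtain ⟨l, u, v, rfl, hE⟩ := exists_two_le_of_not_colonKilled hp hz hb
      (fun z h => hreg z (hz.sublist (List.singleton_sublist.2 h))) hbad
    obtain ⟨x, xs, rfl⟩ := List.exists_cons_of_ne_nil hxs
    obtain ⟨B, hB⟩ := hfin.bddBelow
    obtain ⟨L, h1, h2, h3, h4⟩ := exists_chern_lt hp (by simp at hlen; omega) hpar hC hm2 hb hpdim hE hreg hnp B
    obtain ⟨e, he, heB⟩ := h4 (colonIdeal R (Ideal.ofList L)) (mem_colonIdeal_iff _)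
    exact heB.not_ge (hB ⟨_, (isCParamIdeal_iff hdim _).2 ⟨L, h1, h2, h3, rfl⟩, e,
      (isHilbCoeff_iff (h1.par h2).isFiniteLength_quotient_colonIdeal_pow e).2 he, rfl⟩)
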